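/- For all integers r and s with r/2 ≤ s < r there exists a constant C > 0 such that the following holds. Let n be divisible by r, let G be an n-vertex graph with minimum degree at least (1 − s/r)·n, and let p = C·p_s(n). Then with high probability (as n → ∞) the randomly perturbed graph G^p = G ∪ G_{n,p} contains a K_r-factor. -/

import Mathlib

open Finset
open scoped Classical

/-- The degree of a vertex (number of neighbours). -/
noncomputable def degR {V : Type*} (G : SimpleGraph V) (v : V) : ℕ :=
  Nat.card (G.neighborSet v)

/-- The number of edges of a graph on `Fin n`. -/
noncomputable def edgeCount {n : ℕ} (H : SimpleGraph (Fin n)) : ℕ := Nat.card H.edgeSet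

/-- The probability that the binomial random graph `G_{n,p}` satisfies the property `P`. -/
noncomputable def Pr (n : ℕ) (p : ℝ) (P : SimpleGraph (Fin n) → Prop) : ℝ :=
  ∑ H : SimpleGraph (Fin n),
    if P H then p ^ edgeCount H * (1 - p) ^ (n.choose 2 - edgeCount H) else 0

/-- `G` has a `K_r`-factor: a partition of the vertex set into `r`-cliques. -/
def HasCliqueFactor {n : ℕ} (G : SimpleGraph (Fin n)) (r : ℕ) : Prop :=
  ∃ P : Finpartition (Finset.univ : Finset (Fin n)), ∀ c ∈ P.parts, G.IsNClique r c

/-- The threshold function `p_s(n)`: `log n / n` if `s = 2` and `n^{-φ(s)}` with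
`φ(s) = 2s/((s-1)(s+2))` if `s ≥ 3`. -/
noncomputable def pThr (s n : ℕ) : ℝ :=
  if s = 2 then Real.log n / n
  else (n : ℝ) ^ (-(2 * (s : ℝ)) / (((s : ℝ) - 1) * ((s : ℝ) + 2)))

/-- The number of edges of `G` within the vertex set `S`. -/
noncomputable def edgesIn {V : Type*} (G : SimpleGraph V) (S : Set V) : ℕ :=
  Nat.card {e : Sym2 V // e ∈ G.edgeSet ∧ ∀ v ∈ e, v ∈ S}

/-- The number of ordered adjacent pairs between `S` and `T`. -/
noncomputable def edgesBtw {V : Type*} (G : SimpleGraph V) (S T : Set V) : ℕ :=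
  Nat.card {p : V × V // p.1 ∈ S ∧ p.2 ∈ T ∧ G.Adj p.1 p.2}

/-- The edge density of the pair `(S, T)` in `G`. -/
noncomputable def density {V : Type*} (G : SimpleGraph V) (S T : Set V) : ℝ :=
  (edgesBtw G S T : ℝ) / ((S.ncard : ℝ) * (T.ncard : ℝ))

/-- The pair `(S, T)` is `(ε, d)`-regular in `G`. -/
def IsRegularPair {V : Type*} (G : SimpleGraph V) (S T : Set V) (ε d : ℝ) : Prop :=
  ∀ X ⊆ S, ∀ Y ⊆ T, ε * S.ncard ≤ (X.ncard : ℝ) → ε * T.ncard ≤ (Y.ncard : ℝ) →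
    |density G X Y - d| < ε

/-- The pair `(S, T)` is `(ε, d, ϑ)`-super-regular in `G`. -/
def IsSuperRegularPair {V : Type*} (G : SimpleGraph V) (S T : Set V) (ε d ϑ : ℝ) : Prop :=
  IsRegularPair G S T ε d ∧
  (∀ v ∈ S, ϑ * T.ncard ≤ ((T ∩ G.neighborSet v).ncard : ℝ)) ∧
  (∀ v ∈ T, ϑ * S.ncard ≤ ((S ∩ G.neighborSet v).ncard : ℝ))



/-! ## Part 1 : binomial random subsets -/

/-- Expectation of `f` over the `p`-random subset of `E`. -/
noncomputable def BE {α : Type*} [DecidableEq α] (E : Finset α) (p : ℝ) (f : Finset α → ℝ) : ℝ :=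
  ∑ W ∈ E.powerset, p ^ (#W) * (1 - p) ^ (#E - #W) * f W

section BE
variable {α : Type*} [DecidableEq α]

theorem BE_empty (p : ℝ) (f : Finset α → ℝ) : BE ∅ p f = f ∅ := by
  simp [BE]

theorem BE_insert {E : Finset α} {a : α} (ha : a ∉ E) (p : ℝ) (f : Finset α → ℝ) :
    BE (insert a E) p f = (1 - p) * BE E p f + p * BE E p (fun W => f (insert a W)) := by
  unfold BE
  rw [Finset.sum_powerset_insert ha, Finset.mul_sum, Finset.mul_sum]
  congr 1
  · apply Finset.sum_congr rfl
    intro W hW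
    have h1 : #W ≤ #E := Finset.card_le_card (Finset.mem_powerset.1 hW)
    rw [Finset.card_insert_of_notMem ha, Nat.succ_sub h1, pow_succ]
    ring
  · apply Finset.sum_congr rfl
    intro W hW
    have h2 : a ∉ W := fun h => ha (Finset.mem_powerset.1 hW h)
    rw [Finset.card_insert_of_notMem ha, Finset.card_insert_of_notMem h2, pow_succ]
    rw [show #E + 1 - (#W + 1) = #E - #W by omega]
    ring

theorem BE_const (E : Finset α) (p c : ℝ) : BE E p (fun _ => c) = c := by
  induction E using Finset.induction_on with
  | empty => simp [BE_empty]
  | insert a s ha ih => rw [BE_insert ha, ih]; ring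

theorem BE_add (E : Finset α) (p : ℝ) (f g : Finset α → ℝ) :
    BE E p (fun W => f W + g W) = BE E p f + BE E p g := by
  unfold BE
  rw [← Finset.sum_add_distrib]
  exact Finset.sum_congr rfl fun _ _ => by ring

theorem BE_smul (E : Finset α) (p c : ℝ) (f : Finset α → ℝ) :
    BE E p (fun W => c * f W) = c * BE E p f := by
  unfold BE
  rw [Finset.mul_sum]
  exact Finset.sum_congr rfl fun _ _ => by ring

theorem BE_sum {ι : Type*} (t : Finset ι) (E : Finset α) (p : ℝ) (f : ι → Finset α → ℝ) :
    BE E p (fun W => ∑ i ∈ t, f i W) = ∑ i ∈ t, BE E p (f i) := by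
  unfold BE
  rw [Finset.sum_comm]
  exact Finset.sum_congr rfl fun _ _ => by rw [Finset.mul_sum]

theorem BE_mono {E : Finset α} {p : ℝ} (h0 : 0 ≤ p) (h1 : p ≤ 1) {f g : Finset α → ℝ}
    (h : ∀ W ⊆ E, f W ≤ g W) : BE E p f ≤ BE E p g := by
  unfold BE
  apply Finset.sum_le_sum
  intro W hW
  have : 0 ≤ 1 - p := by linarith
  exact mul_le_mul_of_nonneg_left (h W (Finset.mem_powerset.1 hW)) (by positivity)

theorem BE_union (E : Finset α) (p₁ p₂ : ℝ) (f : Finset α → ℝ) :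
    BE E p₁ (fun W₁ => BE E p₂ (fun W₂ => f (W₁ ∪ W₂))) = BE E (p₁ + p₂ - p₁ * p₂) f := by
  induction E using Finset.induction_on generalizing f with
  | empty => simp [BE_empty]
  | insert a s ha ih =>
    simp only [BE_insert ha]
    rw [BE_add, BE_add, BE_smul, BE_smul, BE_smul, BE_smul, ← ih, ← ih]
    simp only [Finset.insert_union, Finset.union_insert, Finset.insert_idem]
    ring

/-- Probability of an event for a `p`-random subset of `E`. -/
noncomputable def PB (E : Finset α) (p : ℝ) (A : Finset α → Prop) : ℝ :=
  BE E p (fun W => if A W then 1 else 0)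

theorem PB_nonneg {E : Finset α} {p : ℝ} (h0 : 0 ≤ p) (h1 : p ≤ 1) (A : Finset α → Prop) :
    0 ≤ PB E p A := by
  have := BE_mono (E := E) h0 h1 (f := fun _ => 0) (g := fun W => if A W then 1 else 0)
    (fun W _ => by split_ifs <;> norm_num)
  rwa [BE_const] at this

theorem PB_le_one {E : Finset α} {p : ℝ} (h0 : 0 ≤ p) (h1 : p ≤ 1) (A : Finset α → Prop) :
    PB E p A ≤ 1 := by
  have := BE_mono (E := E) h0 h1 (g := fun _ => 1) (f := fun W => if A W then 1 else 0)
    (fun W _ => by split_ifs <;> norm_num)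
  rwa [BE_const] at this

theorem PB_mono {E : Finset α} {p : ℝ} (h0 : 0 ≤ p) (h1 : p ≤ 1) {A B : Finset α → Prop}
    (h : ∀ W ⊆ E, A W → B W) : PB E p A ≤ PB E p B := by
  apply BE_mono h0 h1
  intro W hW
  by_cases hA : A W
  · simp [hA, h W hW hA]
  · simp only [hA, if_false]; split_ifs <;> norm_num

theorem PB_compl (E : Finset α) (p : ℝ) (A : Finset α → Prop) :
    PB E p (fun W => ¬ A W) = 1 - PB E p A := by
  simp only [PB]
  rw [eq_sub_iff_add_eq, ← BE_add]
  calc _ = BE E p (fun _ => 1) := by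
        congr 1; funext W; by_cases h : A W <;> simp [h]
    _ = 1 := BE_const _ _ _

theorem PB_anti_p {E : Finset α} {p p' : ℝ} (h0 : 0 ≤ p) (hpp : p ≤ p') (h1 : p' ≤ 1)
    {A : Finset α → Prop} (hA : ∀ W W', W ⊆ W' → A W' → A W) :
    PB E p' A ≤ PB E p A := by
  rcases eq_or_lt_of_le (le_trans hpp h1) with hp1 | hp1
  · have : p' = p := by linarith
    rw [this]
  · have hpos : 0 < 1 - p := by linarith
    set t := (p' - p) / (1 - p) with ht
    have ht0 : 0 ≤ t := div_nonneg (by linarith) hpos.le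
    have ht1 : t ≤ 1 := by rw [ht, div_le_one hpos]; linarith
    have he : p' = p + t - p * t := by
      have : t * (1 - p) = p' - p := by rw [ht]; field_simp
      linarith
    unfold PB
    rw [he, ← BE_union]
    apply BE_mono h0 hp1.le
    intro W hW
    have := BE_mono (E := E) ht0 ht1 (f := fun W₂ => if A (W ∪ W₂) then (1:ℝ) else 0)
      (g := fun _ => if A W then (1:ℝ) else 0) (fun W₂ _ => by
        by_cases hh : A (W ∪ W₂)
        · simp [hh, hA W (W ∪ W₂) subset_union_left hh]
        · simp only [hh, if_false]; split_ifs <;> norm_num)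
    rwa [BE_const] at this

/-! ### fragments -/

/-- `μ` is a sub-probability on subsets of `E`, `q`-spread, with supports of size at most `ℓ`. -/
structure SubSpread (E : Finset α) (q : ℝ) (ℓ : ℕ) (μ : Finset α → ℝ) : Prop where
  nonneg : ∀ S, 0 ≤ μ S
  supp : ∀ S, μ S ≠ 0 → S ⊆ E ∧ #S ≤ ℓ
  spread : ∀ D, ∑ S ∈ E.powerset with D ⊆ S, μ S ≤ q ^ #D

/-- the failure event -/
def FragFail (μ : Finset α → ℝ) (L : ℕ) (W : Finset α) : Prop :=
  ¬ ∃ S, μ S ≠ 0 ∧ #(S \ W) ≤ L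

theorem frag_exists (μ : Finset α → ℝ) (W S : Finset α) (hS : μ S ≠ 0) :
    ∃ S', μ S' ≠ 0 ∧ S' ⊆ W ∪ S ∧ ∀ S'', μ S'' ≠ 0 → S'' ⊆ W ∪ S → #(S' \ W) ≤ #(S'' \ W) := by
  have h : ∃ k, ∃ S', μ S' ≠ 0 ∧ S' ⊆ W ∪ S ∧ #(S' \ W) = k := ⟨_, S, hS, subset_union_right, rfl⟩
  obtain ⟨S', h1, h2, h3⟩ := Nat.find_spec h
  refine ⟨S', h1, h2, fun S'' h4 h5 => ?_⟩
  rw [h3]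
  exact Nat.find_min' h ⟨S'', h4, h5, rfl⟩

/-- the minimum fragment -/
noncomputable def frag (μ : Finset α → ℝ) (W S : Finset α) : Finset α :=
  if hS : μ S ≠ 0 then (frag_exists μ W S hS).choose \ W else ∅

theorem frag_spec (μ : Finset α → ℝ) (W S : Finset α) (hS : μ S ≠ 0) :
    frag μ W S ⊆ S ∧ Disjoint W (frag μ W S) ∧ (∃ S', μ S' ≠ 0 ∧ S' ⊆ W ∪ frag μ W S) ∧
      ∀ S'', μ S'' ≠ 0 → S'' ⊆ W ∪ frag μ W S → frag μ W S ⊆ S'' := by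
  obtain ⟨h1, h2, h3⟩ := (frag_exists μ W S hS).choose_spec
  have hf : frag μ W S = (frag_exists μ W S hS).choose \ W := by rw [frag, dif_pos hS]
  set S' := (frag_exists μ W S hS).choose
  rw [hf]
  have hsub : S' \ W ⊆ S := by
    intro x hx
    rw [mem_sdiff] at hx
    rcases mem_union.1 (h2 hx.1) with h | h
    · exact absurd h hx.2
    · exact h
  refine ⟨hsub, disjoint_sdiff, ⟨S', h1, by
    intro x hx; by_cases hxW : x ∈ W <;> simp [hx, hxW]⟩, ?_⟩
  intro S'' h4 h5
  have h6 : S'' \ W ⊆ S' \ W := by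
    intro x hx
    rw [mem_sdiff] at hx
    rcases mem_union.1 (h5 hx.1) with h | h
    · exact absurd h hx.2
    · exact h
  have h7 := h3 S'' h4 (h5.trans (union_subset_union_right hsub))
  have h8 := Finset.eq_of_subset_of_card_le h6 h7
  rw [← h8]
  exact sdiff_subset

theorem frag_count {E : Finset α} {q p : ℝ} {ℓ : ℕ} {μ : Finset α → ℝ} (hμ : SubSpread E q ℓ μ)
    (hq : 0 ≤ q) (hp0 : 0 < p) (hp1 : p ≤ 1) (t : ℕ) :
    BE E p (fun W => ∑ S ∈ E.powerset with (μ S ≠ 0 ∧ #(frag μ W S) = t), μ S)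
      ≤ (ℓ.choose t : ℝ) * (q / p) ^ t := by
  have hp' : 0 ≤ 1 - p := by linarith
  -- canonical member
  let can : Finset α → Finset α := fun Z => if h : ∃ S, μ S ≠ 0 ∧ S ⊆ Z then h.choose else ∅
  have hcan : ∀ Z, #(can Z) ≤ ℓ := by
    intro Z
    by_cases h : ∃ S, μ S ≠ 0 ∧ S ⊆ Z
    · simp only [can, dif_pos h]
      exact (hμ.supp _ h.choose_spec.1).2
    · simp [can, dif_neg h]
  have key : BE E p (fun W => ∑ S ∈ E.powerset with (μ S ≠ 0 ∧ #(frag μ W S) = t), p ^ t * μ S)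
      ≤ ∑ Z ∈ E.powerset, p ^ #Z * (1 - p) ^ (#E - #Z) *
          (∑ χ ∈ (can Z).powersetCard t, ∑ S ∈ E.powerset with χ ⊆ S, μ S) := by
    have hL : BE E p (fun W => ∑ S ∈ E.powerset with (μ S ≠ 0 ∧ #(frag μ W S) = t), p ^ t * μ S)
      ≤ ∑ x ∈ (E.powerset ×ˢ E.powerset).filter
          (fun x => μ x.2 ≠ 0 ∧ #(frag μ x.1 x.2) = t),
          p ^ #(x.1 ∪ frag μ x.1 x.2) * (1 - p) ^ (#E - #(x.1 ∪ frag μ x.1 x.2)) * μ x.2 := by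
      unfold BE
      rw [Finset.sum_filter, Finset.sum_product]
      apply Finset.sum_le_sum
      intro W hW
      dsimp only
      rw [Finset.sum_filter, Finset.mul_sum]
      apply Finset.sum_le_sum
      intro S hS
      split_ifs with h
      · obtain ⟨h1, h2, -, -⟩ := frag_spec μ W S h.1
        have hc : #(W ∪ frag μ W S) = #W + t := by rw [card_union_of_disjoint h2, h.2]
        have hle : #W + t ≤ #E := by
          rw [← hc]
          exact card_le_card (union_subset (mem_powerset.1 hW) (h1.trans (mem_powerset.1 hS)))
        rw [hc, pow_add]
        have : (1 - p) ^ (#E - #W) ≤ (1 - p) ^ (#E - (#W + t)) :=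
          pow_le_pow_of_le_one hp' (by linarith) (by omega)
        have h3 := hμ.nonneg S
        calc p ^ #W * (1 - p) ^ (#E - #W) * (p ^ t * μ S)
            = p ^ #W * p ^ t * μ S * (1 - p) ^ (#E - #W) := by ring
          _ ≤ p ^ #W * p ^ t * μ S * (1 - p) ^ (#E - (#W + t)) := by
              apply mul_le_mul_of_nonneg_left this; positivity
          _ = _ := by ring
      · simp
    refine hL.trans ?_
    have hR : ∑ Z ∈ E.powerset, p ^ #Z * (1 - p) ^ (#E - #Z) *
          (∑ χ ∈ (can Z).powersetCard t, ∑ S ∈ E.powerset with χ ⊆ S, μ S)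
        = ∑ y ∈ E.powerset.sigma (fun Z => ((can Z).powersetCard t).sigma
            (fun χ => E.powerset.filter (fun S => χ ⊆ S))),
            p ^ #y.1 * (1 - p) ^ (#E - #y.1) * μ y.2.2 := by
      rw [Finset.sum_sigma]
      apply Finset.sum_congr rfl
      intro Z _
      rw [Finset.sum_sigma, Finset.mul_sum]
      apply Finset.sum_congr rfl
      intro χ _
      rw [Finset.mul_sum]
    rw [hR]
    let emb : Finset α × Finset α → (Σ _ : Finset α, Σ _ : Finset α, Finset α) :=
      fun x => ⟨x.1 ∪ frag μ x.1 x.2, frag μ x.1 x.2, x.2⟩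
    have hinj : Set.InjOn emb ((E.powerset ×ˢ E.powerset).filter
          (fun x => μ x.2 ≠ 0 ∧ #(frag μ x.1 x.2) = t)) := by
      rintro ⟨W, S⟩ hx ⟨W', S'⟩ hx' hxx
      simp only [coe_filter, mem_product, Set.mem_ofPred_eq] at hx hx'
      simp only [emb, Sigma.mk.injEq, heq_eq_eq] at hxx
      obtain ⟨h1, h2, h3⟩ := hxx
      obtain ⟨-, d1, -, -⟩ := frag_spec μ W S hx.2.1
      obtain ⟨-, d2, -, -⟩ := frag_spec μ W' S' hx'.2.1
      subst h3
      have : W = W' := by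
        have e1 : (W ∪ frag μ W S) \ frag μ W S = W := by
          rw [union_sdiff_right]; exact sdiff_eq_self_of_disjoint d1
        have e2 : (W' ∪ frag μ W' S) \ frag μ W' S = W' := by
          rw [union_sdiff_right]; exact sdiff_eq_self_of_disjoint d2
        rw [← e1, ← e2, h1, h2]
      rw [this]
    calc _ = ∑ x ∈ (E.powerset ×ˢ E.powerset).filter
          (fun x => μ x.2 ≠ 0 ∧ #(frag μ x.1 x.2) = t),
          (fun y : (Σ _ : Finset α, Σ _ : Finset α, Finset α) =>
            p ^ #y.1 * (1 - p) ^ (#E - #y.1) * μ y.2.2) (emb x) := rfl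
      _ = ∑ y ∈ ((E.powerset ×ˢ E.powerset).filter
          (fun x => μ x.2 ≠ 0 ∧ #(frag μ x.1 x.2) = t)).image emb,
            p ^ #y.1 * (1 - p) ^ (#E - #y.1) * μ y.2.2 := by rw [Finset.sum_image hinj]
      _ ≤ _ := by
        apply Finset.sum_le_sum_of_subset_of_nonneg
        · intro y hy
          obtain ⟨⟨W, S⟩, hx, rfl⟩ := mem_image.1 hy
          simp only [mem_filter, mem_product, mem_powerset] at hx
          obtain ⟨⟨hW, hS⟩, hne, hc⟩ := hx
          obtain ⟨h1, h2, h3, h4⟩ := frag_spec μ W S hne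
          simp only [emb, mem_sigma, mem_powerset, mem_powersetCard, mem_filter]
          refine ⟨union_subset hW (h1.trans hS), ⟨?_, hc⟩, hS, h1⟩
          simp only [can, dif_pos h3]
          exact h4 _ h3.choose_spec.1 h3.choose_spec.2
        · intro y _ _
          have := hμ.nonneg y.2.2
          positivity
  have hB : ∑ Z ∈ E.powerset, p ^ #Z * (1 - p) ^ (#E - #Z) *
          (∑ χ ∈ (can Z).powersetCard t, ∑ S ∈ E.powerset with χ ⊆ S, μ S)
      ≤ BE E p (fun _ => (ℓ.choose t : ℝ) * q ^ t) := by
    apply BE_mono hp0.le hp1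
    intro Z _
    calc ∑ χ ∈ (can Z).powersetCard t, ∑ S ∈ E.powerset with χ ⊆ S, μ S
        ≤ ∑ χ ∈ (can Z).powersetCard t, q ^ t := by
          apply Finset.sum_le_sum
          intro χ hχ
          have := hμ.spread χ
          rwa [(mem_powersetCard.1 hχ).2] at this
      _ = ((#(can Z)).choose t : ℝ) * q ^ t := by
          rw [sum_const, card_powersetCard, nsmul_eq_mul]
      _ ≤ _ := by
          gcongr
          exact hcan Z
  rw [BE_const] at hB
  have h := key.trans hB
  have e : BE E p (fun W => ∑ S ∈ E.powerset with (μ S ≠ 0 ∧ #(frag μ W S) = t), p ^ t * μ S)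
      = p ^ t * BE E p (fun W => ∑ S ∈ E.powerset with (μ S ≠ 0 ∧ #(frag μ W S) = t), μ S) := by
    rw [← BE_smul]
    congr 1; funext W; rw [mul_sum]
  rw [e] at h
  rw [div_pow, mul_div_assoc', le_div_iff₀ (by positivity)]
  linarith

/-- the statement that the failure probability is at most `ε` for all sub-spread measures -/
def FragGood (E : Finset α) (q p : ℝ) (ℓ L : ℕ) (ε : ℝ) : Prop :=
  ∀ μ, SubSpread E q ℓ μ → (∑ S ∈ E.powerset, μ S) * PB E p (FragFail μ L) ≤ ε

theorem FragGood.base (E : Finset α) (q p : ℝ) (L : ℕ) : FragGood E q p L L 0 := by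
  intro μ hμ
  by_cases h : ∃ S, μ S ≠ 0
  · have : PB E p (FragFail μ L) = 0 := by
      have h2 : (fun W => if FragFail μ L W then (1:ℝ) else 0) = fun _ => 0 := by
        funext W
        rw [if_neg]
        obtain ⟨S, hS⟩ := h
        exact fun hf => hf ⟨S, hS, (card_le_card sdiff_subset).trans (hμ.supp S hS).2⟩
      unfold PB
      rw [h2, BE_const]
    rw [this, mul_zero]
  · push Not at h
    rw [sum_eq_zero (fun S _ => h S), zero_mul]

theorem FragGood.step {E : Finset α} {q p₁ p₂ : ℝ} {ℓ ℓ' L : ℕ} {ε ε' : ℝ} (hq : 0 ≤ q)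
    (h1 : 0 < p₁) (h1' : p₁ ≤ 1) (h2 : 0 ≤ p₂) (h2' : p₂ ≤ 1)
    (h : FragGood E q p₂ ℓ' L ε)
    (he : ∑ t ∈ Finset.Ioc ℓ' ℓ, (ℓ.choose t : ℝ) * (q / p₁) ^ t ≤ ε') :
    FragGood E q (p₁ + p₂ - p₁ * p₂) ℓ L (ε + ε') := by
  intro μ hμ
  set bad : Finset α → ℝ := fun W => ∑ t ∈ Finset.Ioc ℓ' ℓ,
    ∑ S ∈ E.powerset with (μ S ≠ 0 ∧ #(frag μ W S) = t), μ S with hbad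
  have hbadE : BE E p₁ bad ≤ ε' := by
    rw [hbad, BE_sum]
    exact (Finset.sum_le_sum fun t _ => frag_count hμ hq h1 h1' t).trans he
  unfold PB
  rw [← BE_union, ← BE_smul]
  have : BE E p₁ (fun W => ε + bad W) ≤ ε + ε' := by
    rw [BE_add, BE_const]; linarith
  refine le_trans (BE_mono h1.le h1' ?_) this
  intro W hW
  -- pushforward
  set μ' : Finset α → ℝ := fun χ => ∑ S ∈ E.powerset with
    ((μ S ≠ 0 ∧ #(frag μ W S) ≤ ℓ') ∧ frag μ W S = χ), μ S with hμ'
  have hμ's : SubSpread E q ℓ' μ' := by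
    refine ⟨fun χ => sum_nonneg fun S _ => hμ.nonneg S, ?_, ?_⟩
    · intro χ hχ
      obtain ⟨S, hS, -⟩ := exists_ne_zero_of_sum_ne_zero hχ
      simp only [mem_filter, mem_powerset] at hS
      obtain ⟨hSE, ⟨hne, hc⟩, rfl⟩ := hS
      exact ⟨(frag_spec μ W S hne).1.trans hSE, hc⟩
    · intro D
      refine le_trans ?_ (hμ.spread D)
      rw [hμ', Finset.sum_sigma']
      calc _ = ∑ S ∈ ((E.powerset.filter (fun χ => D ⊆ χ)).sigma (fun χ => E.powerset.filter
                (fun S => ((μ S ≠ 0 ∧ #(frag μ W S) ≤ ℓ') ∧ frag μ W S = χ)))).image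
                (fun x => x.2), μ S := by
              rw [Finset.sum_image]
              rintro ⟨χ, S⟩ hx ⟨χ', S'⟩ hx' hxx
              simp only [coe_sigma, coe_filter, Set.mem_sigma_iff, Set.mem_ofPred_eq] at hx hx'
              simp only at hxx
              subst hxx
              obtain ⟨_, _, _, e1⟩ := hx
              obtain ⟨_, _, _, e2⟩ := hx'
              rw [← e1, ← e2]
        _ ≤ _ := by
          apply Finset.sum_le_sum_of_subset_of_nonneg
          · intro S hS
            simp only [mem_image, mem_sigma, mem_filter, mem_powerset] at hS
            obtain ⟨⟨χ, S'⟩, ⟨⟨h3, h4⟩, h5, ⟨h6, h7⟩, h8⟩, rfl⟩ := hS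
            simp only at h4 h5 h6 h7 h8 ⊢
            simp only [mem_filter, mem_powerset]
            refine ⟨h5, ?_⟩
            rw [← h8] at h4
            exact h4.trans (frag_spec μ W S' h6).1
          · intro S _ _; exact hμ.nonneg S
  have hmass : ∑ S ∈ E.powerset, μ S ≤ (∑ χ ∈ E.powerset, μ' χ) + bad W := by
    have e1 : ∑ χ ∈ E.powerset, μ' χ = ∑ S ∈ E.powerset with (μ S ≠ 0 ∧ #(frag μ W S) ≤ ℓ'), μ S := by
      rw [hμ']
      simp only [← Finset.filter_filter]
      apply Finset.sum_fiberwise_of_maps_to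
      intro S hS
      simp only [mem_filter, mem_powerset] at hS
      rw [mem_powerset]
      exact (frag_spec μ W S hS.1.2).1.trans hS.1.1
    have e2 : bad W = ∑ S ∈ E.powerset with (μ S ≠ 0 ∧ #(frag μ W S) ∈ Finset.Ioc ℓ' ℓ), μ S := by
      rw [hbad]
      dsimp only
      have : ∀ t ∈ Finset.Ioc ℓ' ℓ, ∑ S ∈ E.powerset with (μ S ≠ 0 ∧ #(frag μ W S) = t), μ S
         = ∑ S ∈ (E.powerset.filter (fun S => μ S ≠ 0 ∧ #(frag μ W S) ∈ Finset.Ioc ℓ' ℓ)) with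
            #(frag μ W S) = t, μ S := by
        intro t ht
        apply sum_congr _ fun _ _ => rfl
        ext S
        simp only [mem_filter]
        constructor
        · rintro ⟨a, b, rfl⟩; exact ⟨⟨a, b, ht⟩, rfl⟩
        · rintro ⟨⟨a, b, _⟩, c⟩; exact ⟨a, b, c⟩
      rw [sum_congr rfl this]
      apply Finset.sum_fiberwise_of_maps_to
      intro S hS
      exact (mem_filter.1 hS).2.2
    rw [e1, e2, sum_filter, sum_filter, ← sum_add_distrib]
    apply sum_le_sum
    intro S hS
    have hn := hμ.nonneg S
    by_cases h0 : μ S = 0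
    · simp [h0]
    · by_cases hc : #(frag μ W S) ≤ ℓ'
      · simp only [h0, hc, ne_eq, not_false_eq_true, and_self, if_true]
        split_ifs <;> linarith
      · have : #(frag μ W S) ∈ Finset.Ioc ℓ' ℓ := by
          rw [mem_Ioc]
          exact ⟨by omega, (card_le_card (frag_spec μ W S h0).1).trans (hμ.supp S h0).2⟩
        simp [h0, hc, this]
  have hbn : 0 ≤ bad W := sum_nonneg fun t _ => sum_nonneg fun S _ => hμ.nonneg S
  have hP0 := PB_nonneg (E := E) h2 h2' (fun W₂ => FragFail μ L (W ∪ W₂))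
  have hP1 := PB_le_one (E := E) h2 h2' (fun W₂ => FragFail μ L (W ∪ W₂))
  have hPP : PB E p₂ (fun W₂ => FragFail μ L (W ∪ W₂)) ≤ PB E p₂ (FragFail μ' L) := by
    apply PB_mono h2 h2'
    rintro W₂ - hf ⟨χ, hχ, hc⟩
    apply hf
    obtain ⟨S, hS, -⟩ := exists_ne_zero_of_sum_ne_zero hχ
    simp only [mem_filter, mem_powerset] at hS
    obtain ⟨hSE, ⟨hne, -⟩, rfl⟩ := hS
    obtain ⟨-, -, ⟨S', hS', hsub⟩, -⟩ := frag_spec μ W S hne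
    refine ⟨S', hS', le_trans (card_le_card ?_) hc⟩
    intro x hx
    simp only [mem_sdiff, mem_union, not_or] at hx ⊢
    refine ⟨?_, hx.2.2⟩
    rcases mem_union.1 (hsub hx.1) with h | h
    · exact absurd h hx.2.1
    · exact h
  have hfin := h μ' hμ's
  have hm' : 0 ≤ ∑ χ ∈ E.powerset, μ' χ := sum_nonneg fun S _ => hμ's.nonneg S
  change (∑ S ∈ E.powerset, μ S) * PB E p₂ (fun W₂ => FragFail μ L (W ∪ W₂)) ≤ ε + bad W
  calc _ ≤ ((∑ χ ∈ E.powerset, μ' χ) + bad W) * PB E p₂ (fun W₂ => FragFail μ L (W ∪ W₂)) :=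
        mul_le_mul_of_nonneg_right hmass hP0
    _ = (∑ χ ∈ E.powerset, μ' χ) * PB E p₂ (fun W₂ => FragFail μ L (W ∪ W₂))
        + bad W * PB E p₂ (fun W₂ => FragFail μ L (W ∪ W₂)) := by ring
    _ ≤ (∑ χ ∈ E.powerset, μ' χ) * PB E p₂ (FragFail μ' L) + bad W * 1 :=
        add_le_add (mul_le_mul_of_nonneg_left hPP hm') (mul_le_mul_of_nonneg_left hP1 hbn)
    _ ≤ _ := by linarith

theorem FragFail.anti (μ : Finset α → ℝ) (L : ℕ) (W W' : Finset α) (h : W ⊆ W')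
    (hf : FragFail μ L W') : FragFail μ L W := by
  rintro ⟨S, h1, h2⟩
  exact hf ⟨S, h1, (card_le_card (sdiff_subset_sdiff le_rfl h)).trans h2⟩

theorem FragGood.mono_p {E : Finset α} {q p p' : ℝ} {ℓ L : ℕ} {ε : ℝ}
    (h : FragGood E q p ℓ L ε) (h0 : 0 ≤ p) (hpp : p ≤ p') (h1 : p' ≤ 1) :
    FragGood E q p' ℓ L ε := by
  intro μ hμ
  refine le_trans ?_ (h μ hμ)
  exact mul_le_mul_of_nonneg_left (PB_anti_p h0 hpp h1 (FragFail.anti μ L))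
    (sum_nonneg fun S _ => hμ.nonneg S)

end BE


section Frag2
variable {α : Type*} [DecidableEq α]

theorem SubSpread.mono {E : Finset α} {q : ℝ} {ℓ ℓ' : ℕ} {μ : Finset α → ℝ}
    (h : SubSpread E q ℓ μ) (hl : ℓ ≤ ℓ') : SubSpread E q ℓ' μ :=
  ⟨h.nonneg, fun S hS => ⟨(h.supp S hS).1, (h.supp S hS).2.trans hl⟩, h.spread⟩

theorem halving_sum (m : ℕ) (x : ℝ) (hx0 : 0 ≤ x) (hx : x ≤ 1 / 16) :
    ∑ t ∈ Finset.Ioc m (2 * m), ((2 * m).choose t : ℝ) * x ^ t ≤ (1 / 4) ^ m := by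
  have h1 : ∀ t ∈ Finset.Ioc m (2 * m), ((2 * m).choose t : ℝ) * x ^ t
      ≤ ((2 * m).choose t : ℝ) * (1 / 16) ^ m := by
    intro t ht
    rw [mem_Ioc] at ht
    apply mul_le_mul_of_nonneg_left _ (by positivity)
    calc x ^ t ≤ x ^ m := pow_le_pow_of_le_one hx0 (by linarith) (by omega)
      _ ≤ _ := pow_le_pow_left₀ hx0 hx m
  refine (sum_le_sum h1).trans ?_
  rw [← sum_mul]
  have h2 : ∑ t ∈ Finset.Ioc m (2 * m), ((2 * m).choose t : ℝ) ≤ 2 ^ (2 * m) := by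
    have := Nat.sum_range_choose (2 * m)
    have h3 : ∑ t ∈ Finset.Ioc m (2 * m), (2 * m).choose t ≤
        ∑ t ∈ Finset.range (2 * m + 1), (2 * m).choose t := by
      apply sum_le_sum_of_subset
      intro t ht
      rw [mem_Ioc] at ht
      rw [mem_range]; omega
    rw [this] at h3
    exact_mod_cast h3
  calc _ ≤ (2:ℝ) ^ (2 * m) * (1 / 16) ^ m := mul_le_mul_of_nonneg_right h2 (by positivity)
    _ = (1 / 4) ^ m := by
      rw [pow_mul, ← mul_pow]; norm_num

theorem FragGood.iter {E : Finset α} {q p₀ : ℝ} {L₀ L : ℕ} {ε₀ : ℝ} (hq : 0 < q) (hp₀ : 0 ≤ p₀)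
    (h : FragGood E q p₀ L₀ L ε₀) (i : ℕ) :
    ∀ p, p₀ + 16 * i * q ≤ p → p ≤ 1 → FragGood E q p (2 ^ i * L₀) L (ε₀ + i * (1 / 2) ^ L₀) := by
  induction i with
  | zero =>
    intro p hp hp1
    simp only [Nat.cast_zero, mul_zero, zero_mul, add_zero] at hp
    simpa using h.mono_p hp₀ hp hp1
  | succ i ih =>
    intro p hp hp1
    have hi : (0:ℝ) ≤ 16 * i * q := by positivity
    push_cast at hp
    have h1 := ih (p₀ + 16 * i * q) le_rfl (by linarith)
    have h2 := FragGood.step (ε' := (1 / 2 : ℝ) ^ L₀) (ℓ := 2 ^ (i + 1) * L₀) (p₁ := 16 * q) hq.le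
      (by linarith) (by linarith) (by linarith) (by linarith) h1 (by
        have := halving_sum (2 ^ i * L₀) (q / (16 * q)) (by positivity)
          (by rw [div_mul_cancel_right₀ hq.ne']; norm_num)
        rw [show 2 ^ (i + 1) * L₀ = 2 * (2 ^ i * L₀) by ring]
        refine this.trans ?_
        calc ((1:ℝ) / 4) ^ (2 ^ i * L₀) ≤ (1 / 4) ^ L₀ := by
              apply pow_le_pow_of_le_one (by norm_num) (by norm_num)
              exact Nat.le_mul_of_pos_left _ (by positivity)
          _ ≤ _ := by gcongr; norm_num)
    have h3 := h2.mono_p (p' := p) (by nlinarith) (by nlinarith) hp1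
    convert h3 using 1
    push_cast; ring

theorem FragGood.final (E : Finset α) {q K : ℝ} {ℓ : ℕ} (hq : 0 < q) (hK : 0 < K)
    (hlK : (ℓ : ℝ) ≤ K) (hKq : K * q ≤ 1) : FragGood E q (K * q) ℓ 0 (2 * ℓ / K) := by
  have h := FragGood.step (ε' := 2 * ℓ / K) (ℓ := ℓ) (p₁ := K * q) (p₂ := 0) hq.le (by positivity) hKq
    le_rfl (by norm_num) (FragGood.base E q 0 0) (by
      have e : q / (K * q) = 1 / K := by field_simp
      rw [e]
      have hb := add_pow (1 / K : ℝ) 1 ℓ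
      have hs : ∑ t ∈ Finset.Ioc 0 ℓ, (ℓ.choose t : ℝ) * (1 / K) ^ t = (1 / K + 1) ^ ℓ - 1 := by
        rw [hb, Finset.sum_range_succ', ]
        simp only [one_pow, mul_one, pow_zero, Nat.choose_zero_right, Nat.cast_one]
        rw [add_sub_cancel_right]
        apply Finset.sum_bij' (fun t _ => t - 1) (fun t _ => t + 1)
        · intro t ht; simp only [mem_Ioc] at ht; omega
        · intro t ht; omega
        · intro t ht
          simp only [mem_Ioc] at ht
          rw [Nat.sub_add_cancel ht.1, mul_comm]
        · intro t ht; simp only [mem_Ioc] at ht; simp only [mem_range]; omega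
        · intro t ht; simp only [mem_range] at ht; simp only [mem_Ioc]; omega
      rw [hs]
      have h1 : (1 / K + 1) ^ ℓ ≤ Real.exp (ℓ / K) := by
        calc (1 / K + 1) ^ ℓ ≤ (Real.exp (1 / K)) ^ ℓ := by
              apply pow_le_pow_left₀ (by positivity) (Real.add_one_le_exp _)
          _ = _ := by rw [← Real.exp_nat_mul]; congr 1; ring
      have hx0 : (0:ℝ) ≤ ℓ / K := by positivity
      have hx1 : (ℓ:ℝ) / K ≤ 1 := by rw [div_le_one hK]; exact hlK
      have h2 := Real.abs_exp_sub_one_le (x := ℓ / K) (by rw [abs_of_nonneg hx0]; exact hx1)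
      rw [abs_of_nonneg hx0] at h2
      have h3 := le_abs_self (Real.exp (ℓ / K) - 1)
      have : 2 * (ℓ:ℝ) / K = 2 * (ℓ / K) := by ring
      rw [this]
      linarith)
  simpa using h

theorem frag_asymp (δ : ℝ) (hδ : 0 < δ) : ∃ n₀ : ℕ, ∀ n : ℕ, n₀ ≤ n → 4 ≤ Real.log n ∧
    (⌈Real.sqrt (Real.log n)⌉₊ : ℝ) ≤ Real.log n ∧
    2 * (⌈Real.sqrt (Real.log n)⌉₊ : ℝ) / Real.log n
      + ⌈3 * Real.log n⌉₊ * (1 / 2 : ℝ) ^ ⌈Real.sqrt (Real.log n)⌉₊ ≤ δ := by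
  have hlim : Filter.Tendsto (fun n : ℕ => Real.sqrt (Real.log n)) Filter.atTop Filter.atTop :=
    Real.tendsto_sqrt_atTop.comp (Real.tendsto_log_atTop.comp tendsto_natCast_atTop_atTop)
  have h1 : Filter.Tendsto (fun x : ℝ => 4 * (x ^ 2 * Real.exp (- Real.log 2 * x))) Filter.atTop
      (nhds 0) := by
    have := Real.tendsto_pow_mul_exp_neg_atTop_nhds_zero 2
    have hl2 : 0 < Real.log 2 := Real.log_pos (by norm_num)
    have h2 := (this.comp (Filter.tendsto_id.const_mul_atTop hl2)).const_mul (4 / (Real.log 2) ^ 2)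
    rw [mul_zero] at h2
    refine h2.congr fun x => ?_
    simp only [Function.comp, id]
    field_simp
  have h1' := (h1.comp hlim).eventually (gt_mem_nhds (show (0:ℝ) < δ / 2 by linarith))
  have h2 := hlim.eventually (Filter.eventually_ge_atTop (max 2 (8 / δ)))
  obtain ⟨n₀, hn₀⟩ := Filter.eventually_atTop.1 (h1'.and h2)
  refine ⟨n₀, fun n hn => ?_⟩
  obtain ⟨ha, hb⟩ := hn₀ n hn
  simp only [Function.comp] at ha
  set x := Real.sqrt (Real.log n) with hx
  have hx2 : 2 ≤ x := (le_max_left _ _).trans hb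
  have hxd : 8 / δ ≤ x := (le_max_right _ _).trans hb
  have hlog : Real.log n = x ^ 2 := by
    rw [hx, Real.sq_sqrt]
    by_contra hneg
    have : x = 0 := Real.sqrt_eq_zero_of_nonpos (by linarith)
    linarith
  rw [hlog]
  have hc := Nat.ceil_lt_add_one (show 0 ≤ x by linarith)
  have hc2 := Nat.le_ceil x
  have hi := Nat.ceil_lt_add_one (show 0 ≤ 3 * x ^ 2 by positivity)
  refine ⟨by nlinarith, by nlinarith, ?_⟩
  have e1 : 2 * (⌈x⌉₊ : ℝ) / x ^ 2 ≤ δ / 2 := by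
    rw [div_le_iff₀ (by positivity)]
    rw [div_le_iff₀ hδ] at hxd
    nlinarith
  have e2 : (1 / 2 : ℝ) ^ ⌈x⌉₊ ≤ Real.exp (- Real.log 2 * x) := by
    rw [show (1 / 2 : ℝ) = Real.exp (- Real.log 2) by
      rw [Real.exp_neg, Real.exp_log (by norm_num)]; norm_num, ← Real.exp_nat_mul]
    apply Real.exp_le_exp.2
    have hl2 : 0 < Real.log 2 := Real.log_pos (by norm_num)
    nlinarith
  have e3 : (⌈3 * x ^ 2⌉₊ : ℝ) * (1 / 2 : ℝ) ^ ⌈x⌉₊ ≤ 4 * (x ^ 2 * Real.exp (- Real.log 2 * x)) := by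
    calc _ ≤ (4 * x ^ 2) * Real.exp (- Real.log 2 * x) := by
          apply mul_le_mul (by nlinarith) e2 (by positivity) (by positivity)
      _ = _ := by ring
  linarith

/-- The spread theorem with a logarithmic factor. -/
theorem spread_threshold {δ : ℝ} (hδ : 0 < δ) : ∃ n₀ : ℕ, ∀ n : ℕ, n₀ ≤ n →
    ∀ {α : Type} [DecidableEq α] (E : Finset α) (q p : ℝ) (μ : Finset α → ℝ), 0 < q →
      SubSpread E q (n ^ 2) μ → ∑ S ∈ E.powerset, μ S = 1 → 100 * (q * Real.log n) ≤ p → p ≤ 1 →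
      1 - δ ≤ PB E p (fun W => ∃ S, μ S ≠ 0 ∧ S ⊆ W) := by
  obtain ⟨n₀, hn₀⟩ := frag_asymp δ hδ
  refine ⟨n₀, fun n hn α _ E q p μ hq hμ hm hp hp1 => ?_⟩
  obtain ⟨h4, hL, herr⟩ := hn₀ n hn
  set L₀ := ⌈Real.sqrt (Real.log n)⌉₊
  set i := ⌈3 * Real.log n⌉₊
  have hlq : 0 ≤ q * Real.log n := by positivity
  have h1 := FragGood.final E (ℓ := L₀) (K := Real.log n) hq (by linarith) hL (by nlinarith)
  have hi := Nat.ceil_lt_add_one (show 0 ≤ 3 * Real.log n by positivity)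
  have hi2 : (i : ℝ) ≤ 4 * Real.log n := by linarith
  have h2 := h1.iter hq (by positivity) i p (by nlinarith [mul_le_mul_of_nonneg_right hi2 hq.le]) hp1
  have hn0 : (0:ℝ) < n := by
    by_contra hh
    have : (n:ℝ) = 0 := le_antisymm (not_lt.1 hh) (Nat.cast_nonneg n)
    rw [this, Real.log_zero] at h4
    linarith
  have hsz : n ^ 2 ≤ 2 ^ i * L₀ := by
    have hL1 : 1 ≤ L₀ := Nat.one_le_iff_ne_zero.2 (Nat.ceil_pos.2 (Real.sqrt_pos.2 (by linarith))).ne'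
    have : (n:ℝ) ^ 2 ≤ 2 ^ i := by
      rw [← Real.log_le_log_iff (by positivity) (by positivity), Real.log_pow, Real.log_pow]
      have := Real.log_two_gt_d9
      have h5 := Nat.le_ceil (3 * Real.log n)
      have h6 : 3 * Real.log n ≤ i := h5
      push_cast
      nlinarith
    have h7 : n ^ 2 ≤ 2 ^ i := by exact_mod_cast this
    nlinarith
  have h3 := h2 μ (hμ.mono hsz)
  rw [hm, one_mul] at h3
  have hp0 : 0 ≤ p := by linarith
  have h4 : PB E p (fun W => ¬ ∃ S, μ S ≠ 0 ∧ S ⊆ W) ≤ PB E p (FragFail μ 0) := by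
    apply PB_mono hp0 hp1
    rintro W - hW ⟨S, hS, hc⟩
    apply hW
    refine ⟨S, hS, ?_⟩
    rwa [Nat.le_zero, card_eq_zero, sdiff_eq_empty_iff_subset] at hc
  rw [PB_compl] at h4
  linarith

/-- Iterated version giving many complete sets. -/
theorem spread_iter {E : Finset α} {q p : ℝ} {L i : ℕ} {μ : Finset α → ℝ} (hq : 0 < q)
    (hμ : SubSpread E q (2 ^ i * L) μ) (hm : ∑ S ∈ E.powerset, μ S = 1) (hp : 16 * i * q ≤ p)
    (hp1 : p ≤ 1) :
    1 - i * (1 / 2) ^ L ≤ PB E p (fun W => ∃ S, μ S ≠ 0 ∧ #(S \ W) ≤ L) := by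
  have h := (FragGood.base E q 0 L).iter hq le_rfl i p (by linarith) hp1 μ hμ
  rw [hm, one_mul, zero_add] at h
  have hp0 : 0 ≤ p := le_trans (by positivity) hp
  have := PB_compl E p (fun W => ∃ S, μ S ≠ 0 ∧ #(S \ W) ≤ L)
  change PB E p (FragFail μ L) = _ at this
  linarith

end Frag2

/-- potential edges -/
noncomputable def EE (n : ℕ) : Finset (Sym2 (Fin n)) := univ.filter (fun e => ¬ e.IsDiag)

theorem card_EE (n : ℕ) : #(EE n) = n.choose 2 := by
  have := Sym2.card_subtype_not_diag (α := Fin n)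
  rw [Fintype.card_fin] at this
  rw [← this, Fintype.card_subtype, EE]

theorem Pr_eq (n : ℕ) (p : ℝ) (P : SimpleGraph (Fin n) → Prop) :
    Pr n p P = PB (EE n) p (fun W => P (SimpleGraph.fromEdgeSet (W : Set (Sym2 (Fin n))))) := by
  unfold Pr PB BE
  symm
  refine Finset.sum_bij' (fun (W : Finset (Sym2 (Fin n))) _ => SimpleGraph.fromEdgeSet
    (W : Set (Sym2 (Fin n)))) (fun H _ => H.edgeSet.toFinset) ?_ ?_ ?_ ?_ ?_
  · intro W _; exact mem_univ _
  · intro H _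
    rw [mem_powerset]
    intro e he
    rw [Set.mem_toFinset] at he
    simp only [EE, mem_filter, mem_univ, true_and]
    exact H.not_isDiag_of_mem_edgeSet he
  · intro W hW
    ext e
    simp only [Set.mem_toFinset]
    rw [SimpleGraph.edgeSet_fromEdgeSet]
    constructor
    · intro h; exact h.1
    · intro h
      have := (mem_powerset.1 hW) h
      simp only [EE, mem_filter, mem_univ, true_and] at this
      exact ⟨h, this⟩
  · intro H _
    rw [Set.coe_toFinset, SimpleGraph.fromEdgeSet_edgeSet]
  · intro W hW
    have hc : edgeCount (SimpleGraph.fromEdgeSet (W : Set (Sym2 (Fin n)))) = #W := by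
      unfold edgeCount
      rw [SimpleGraph.edgeSet_fromEdgeSet]
      have : (W : Set (Sym2 (Fin n))) \ {e | e.IsDiag} = W := by
        ext e
        constructor
        · intro h; exact h.1
        · intro h
          have := (mem_powerset.1 hW) h
          simp only [EE, mem_filter, mem_univ, true_and] at this
          exact ⟨h, this⟩
      rw [show Sym2.diagSet = {e : Sym2 (Fin n) | e.IsDiag} by ext e; simp, this]
      rw [Nat.card_eq_fintype_card]
      simp
    rw [hc, card_EE]
    split_ifs with h <;> simp [h]


/-! ## Part 2 : spread random sets -/

/-- `x` if `p` holds and `0` otherwise -/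
noncomputable def ifp (p : Prop) (x : ℝ) : ℝ := @ite _ p (Classical.propDecidable p) x 0

theorem ifp_pos {p : Prop} {x : ℝ} (h : p) : ifp p x = x := by unfold ifp; rw [if_pos h]
theorem ifp_neg {p : Prop} {x : ℝ} (h : ¬ p) : ifp p x = 0 := by unfold ifp; rw [if_neg h]
theorem ifp_nonneg {p : Prop} {x : ℝ} (h : 0 ≤ x) : 0 ≤ ifp p x := by
  unfold ifp; split_ifs <;> simp [h]
theorem ifp_le {p : Prop} {x : ℝ} (h : 0 ≤ x) : ifp p x ≤ x := by
  unfold ifp; split_ifs <;> simp [h]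
theorem ifp_mono {p p' : Prop} {x : ℝ} (h : 0 ≤ x) (hp : p → p') : ifp p x ≤ ifp p' x := by
  by_cases h1 : p
  · rw [ifp_pos h1, ifp_pos (hp h1)]
  · rw [ifp_neg h1]; exact ifp_nonneg h

theorem sum_ifp {ι : Type*} (s : Finset ι) (p : ι → Prop) [DecidablePred p] (f : ι → ℝ) :
    ∑ i ∈ s, ifp (p i) (f i) = ∑ i ∈ s with p i, f i := by
  rw [sum_filter]
  apply sum_congr rfl
  intro i _
  by_cases h : p i
  · rw [ifp_pos h, if_pos h]
  · rw [ifp_neg h, if_neg h]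

/-- There is a random finite set, always satisfying `P`, with `ℙ(D ⊆ X) ≤ g D` for all `D`. -/
def Spr {α : Type} (P : Finset α → Prop) (g : Finset α → ℝ) : Prop :=
  ∃ (ι : Type) (_ : Fintype ι) (ν : ι → ℝ) (X : ι → Finset α), (∀ i, 0 ≤ ν i) ∧ ∑ i, ν i = 1 ∧
    (∀ i, P (X i)) ∧ ∀ D, ∑ i, (ifp (D ⊆ X i) (ν i)) ≤ g D

namespace Spr
variable {α β : Type} [DecidableEq α] {P Q : Finset α → Prop} {g g' : Finset α → ℝ}

theorem mono (h : Spr P g) (hP : ∀ O, P O → Q O) (hg : ∀ D, g D ≤ g' D) : Spr Q g' := by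
  obtain ⟨ι, _, ν, X, h0, h1, h2, h3⟩ := h
  exact ⟨ι, inferInstance, ν, X, h0, h1, fun i => hP _ (h2 i), fun D => (h3 D).trans (hg D)⟩

theorem nonneg (h : Spr P g) (D : Finset α) : 0 ≤ g D := by
  obtain ⟨ι, _, ν, X, h0, h1, h2, h3⟩ := h
  exact le_trans (sum_nonneg fun i _ => ifp_nonneg (h0 i)) (h3 D)

theorem exists_pos (h : Spr P g) : ∃ O, P O := by
  obtain ⟨ι, _, ν, X, h0, h1, h2, h3⟩ := h
  by_contra hne
  push Not at hne
  have : IsEmpty ι := ⟨fun i => hne _ (h2 i)⟩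
  simp at h1

theorem dirac (O : Finset α) (hP : P O) : Spr P (fun D => if D ⊆ O then 1 else 0) := by
  refine ⟨Unit, inferInstance, fun _ => 1, fun _ => O, by simp, by simp, by simp [hP], ?_⟩
  intro D
  by_cases h : D ⊆ O <;> simp [ifp, h]

/-- Two step composition. -/
theorem comp {Q : Finset α → Finset α → Prop} (h : Spr P g) (h' : ∀ O, P O → Spr (Q O) g') :
    Spr (fun S => ∃ O₁ O₂, P O₁ ∧ Q O₁ O₂ ∧ S = O₁ ∪ O₂)
      (fun D => ∑ D₁ ∈ D.powerset, g D₁ * g' (D \ D₁)) := by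
  have hg' : ∀ D, 0 ≤ g' D := by
    obtain ⟨O, hO⟩ := h.exists_pos
    exact (h' O hO).nonneg
  obtain ⟨ι, _, ν, X, h0, h1, h2, h3⟩ := h
  have h'' := fun i => h' (X i) (h2 i)
  choose κ hκ ν' X' k0 k1 k2 k3 using h''
  refine ⟨Σ i, κ i, inferInstance, fun x => ν x.1 * ν' x.1 x.2, fun x => X x.1 ∪ X' x.1 x.2,
    fun x => mul_nonneg (h0 _) (k0 _ _), ?_, fun x => ⟨_, _, h2 _, k2 _ _, rfl⟩, ?_⟩
  · rw [Fintype.sum_sigma]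
    simp only [← mul_sum, k1, mul_one, h1]
  · intro D
    rw [Fintype.sum_sigma]
    have : ∀ i, ∀ j : κ i, (ifp (D ⊆ X i ∪ X' i j) (ν i * ν' i j)) ≤
        ∑ D₁ ∈ D.powerset, (ifp (D₁ ⊆ X i) (ν i)) * (ifp (D \ D₁ ⊆ X' i j) (ν' i j)) := by
      intro i j
      have hnn : ∀ D₁ ∈ D.powerset,
          0 ≤ (ifp (D₁ ⊆ X i) (ν i)) * (ifp (D \ D₁ ⊆ X' i j) (ν' i j)) := by
        intro D₁ _
        exact mul_nonneg (ifp_nonneg (h0 i)) (ifp_nonneg (k0 i j))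
      by_cases hD : D ⊆ X i ∪ X' i j
      · rw [ifp_pos hD]
        refine le_trans (le_of_eq ?_) (single_le_sum hnn (mem_powerset.2 (inter_subset_left (s₂ := X i))))
        rw [ifp_pos inter_subset_right, ifp_pos]
        intro x hx
        simp only [mem_sdiff, mem_inter, not_and] at hx
        rcases mem_union.1 (hD hx.1) with h | h
        · exact absurd h (hx.2 hx.1)
        · exact h
      · rw [ifp_neg hD]
        exact sum_nonneg hnn
    calc _ ≤ ∑ i, ∑ j : κ i, ∑ D₁ ∈ D.powerset, (ifp (D₁ ⊆ X i) (ν i)) *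
            (ifp (D \ D₁ ⊆ X' i j) (ν' i j)) :=
          sum_le_sum fun i _ => sum_le_sum fun j _ => this i j
      _ = ∑ D₁ ∈ D.powerset, ∑ i, (ifp (D₁ ⊆ X i) (ν i)) *
            ∑ j : κ i, (ifp (D \ D₁ ⊆ X' i j) (ν' i j)) := by
          rw [Finset.sum_comm]
          apply sum_congr rfl; intro i _
          rw [Finset.sum_comm]
          apply sum_congr rfl; intro j _
          rw [mul_sum]
      _ ≤ _ := by
          apply sum_le_sum
          intro D₁ _
          calc _ ≤ ∑ i, (ifp (D₁ ⊆ X i) (ν i)) * g' (D \ D₁) := by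
                apply sum_le_sum
                intro i _
                exact mul_le_mul_of_nonneg_left (k3 i _) (ifp_nonneg (h0 i))
            _ = (∑ i, (ifp (D₁ ⊆ X i) (ν i))) * g' (D \ D₁) := by rw [sum_mul]
            _ ≤ _ := mul_le_mul_of_nonneg_right (h3 _) (hg' _)

theorem compW {Q : Finset α → Finset α → Prop} {w w' : α → ℝ} (h : Spr P (fun D => ∏ a ∈ D, w a))
    (h' : ∀ O, P O → Spr (Q O) (fun D => ∏ a ∈ D, w' a)) :
    Spr (fun S => ∃ O₁ O₂, P O₁ ∧ Q O₁ O₂ ∧ S = O₁ ∪ O₂) (fun D => ∏ a ∈ D, (w a + w' a)) := by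
  refine (h.comp h').mono (fun _ h => h) (fun D => ?_)
  rw [Finset.prod_add]

theorem diracW (O : Finset α) (hP : P O) :
    Spr P (fun D => ∏ a ∈ D, (if a ∈ O then (1:ℝ) else 0)) := by
  refine (dirac O hP).mono (fun _ h => h) fun D => ?_
  split_ifs with h
  · rw [prod_eq_one]; intro a ha; rw [if_pos (h ha)]
  · apply prod_nonneg; intro a _; split_ifs <;> norm_num

theorem monoW {w w' : α → ℝ} (h : Spr P (fun D => ∏ a ∈ D, w a)) (hw : ∀ a, 0 ≤ w a)
    (hww : ∀ a, w a ≤ w' a) (hP : ∀ O, P O → Q O) : Spr Q (fun D => ∏ a ∈ D, w' a) :=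
  h.mono hP fun _ => prod_le_prod (fun a _ => hw a) fun a _ => hww a

/-- Passing to subsets. -/
theorem subset (h : Spr P g) (hP : ∀ O, P O → ∃ O' ⊆ O, Q O') : Spr Q g := by
  obtain ⟨ι, _, ν, X, h0, h1, h2, h3⟩ := h
  choose f hf hQ using fun i => hP (X i) (h2 i)
  refine ⟨ι, inferInstance, ν, f, h0, h1, hQ, fun D => le_trans (sum_le_sum fun i _ => ?_) (h3 D)⟩
  exact ifp_mono (h0 i) fun hD => hD.trans (hf i)

/-- conditioning on an event. -/
theorem cond (h : Spr P g) (A : Finset α → Prop)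
    (hA : ∀ (ι : Type) [Fintype ι] (ν : ι → ℝ) (X : ι → Finset α), (∀ i, 0 ≤ ν i) → ∑ i, ν i = 1 →
      (∀ i, P (X i)) → (∀ D, ∑ i, (ifp (D ⊆ X i) (ν i)) ≤ g D) →
      ∑ i, (if A (X i) then 0 else ν i) ≤ 1 / 2) :
    Spr (fun O => P O ∧ A O) (fun D => if D = ∅ then 1 else 2 * g D) := by
  obtain ⟨ι, _, ν, X, h0, h1, h2, h3⟩ := h
  have hb := hA ι ν X h0 h1 h2 h3
  have hs : ∑ i : {i // A (X i)}, ν i = ∑ i, (if A (X i) then ν i else 0) := by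
    rw [← Finset.sum_filter]
    exact (Finset.sum_subtype _ (by simp) _).symm
  set m := ∑ i, (if A (X i) then ν i else 0) with hm
  have hm2 : 1 / 2 ≤ m := by
    have : m + ∑ i, (if A (X i) then 0 else ν i) = 1 := by
      rw [hm, ← sum_add_distrib, ← h1]
      apply sum_congr rfl; intro i _; split_ifs <;> simp
    linarith
  have hmpos : 0 < m := by linarith
  have htot : ∑ i : {i // A (X i)}, ν i / m = 1 := by rw [← sum_div, hs, div_self hmpos.ne']
  refine ⟨{i // A (X i)}, inferInstance, fun i => ν i / m, fun i => X i,
    fun i => div_nonneg (h0 _) hmpos.le, htot, fun i => ⟨h2 _, i.2⟩, fun D => ?_⟩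
  dsimp only
  by_cases hD : D = ∅
  · rw [if_pos hD, ← htot]
    exact sum_le_sum fun i _ => ifp_le (div_nonneg (h0 _) hmpos.le)
  · rw [if_neg hD]
    have e : ∑ i : {i // A (X i)}, (ifp (D ⊆ X i) (ν i / m)) ≤
        ∑ i, (ifp (D ⊆ X i) (ν i / m)) := by
      rw [← Finset.sum_subtype (Finset.univ.filter (fun i => A (X i))) (by simp)
        (fun i => ifp (D ⊆ X i) (ν i / m))]
      apply sum_le_sum_of_subset_of_nonneg (filter_subset _ _)
      intro i _ _
      exact ifp_nonneg (div_nonneg (h0 _) hmpos.le)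
    refine e.trans ?_
    have e2 : ∑ i, (ifp (D ⊆ X i) (ν i / m)) = (∑ i, (ifp (D ⊆ X i) (ν i))) / m := by
      rw [sum_div]; apply sum_congr rfl; intro i _; unfold ifp; split_ifs <;> simp
    have hn : 0 ≤ ∑ i, (ifp (D ⊆ X i) (ν i)) := sum_nonneg fun i _ => ifp_nonneg (h0 i)
    rw [e2, div_le_iff₀ hmpos]
    nlinarith [h3 D]

/-- image under a map whose containments are covered. -/
theorem map_cover (h : Spr P g) (f : Finset α → Finset β) (cov : Finset β → Finset (Finset α))
    (hc : ∀ O D, P O → D ⊆ f O → ∃ D' ∈ cov D, D' ⊆ O) :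
    Spr (fun S => ∃ O, P O ∧ S = f O) (fun D => ∑ D' ∈ cov D, g D') := by
  obtain ⟨ι, _, ν, X, h0, h1, h2, h3⟩ := h
  refine ⟨ι, inferInstance, ν, fun i => f (X i), h0, h1, fun i => ⟨_, h2 i, rfl⟩, fun D => ?_⟩
  calc _ ≤ ∑ i, ∑ D' ∈ cov D, (ifp (D' ⊆ X i) (ν i)) := by
        apply sum_le_sum
        intro i _
        have hn : ∀ D' ∈ cov D, 0 ≤ (ifp (D' ⊆ X i) (ν i)) := by
          intro D' _
          exact ifp_nonneg (h0 i)
        by_cases hD : D ⊆ f (X i)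
        · obtain ⟨D', hD', hs⟩ := hc _ _ (h2 i) hD
          rw [ifp_pos hD]
          have := single_le_sum hn hD'
          rwa [ifp_pos hs] at this
        · rw [ifp_neg hD]; exact sum_nonneg hn
    _ = ∑ D' ∈ cov D, ∑ i, (ifp (D' ⊆ X i) (ν i)) := Finset.sum_comm
    _ ≤ _ := sum_le_sum fun D' _ => h3 D'

theorem toSubSpread [Fintype α] {q : ℝ} {ℓ : ℕ} (E : Finset α)
    (h : Spr P (fun D => q ^ #D)) (hP : ∀ O, P O → O ⊆ E ∧ #O ≤ ℓ) :
    ∃ μ : Finset α → ℝ, SubSpread E q ℓ μ ∧ ∑ S ∈ E.powerset, μ S = 1 ∧ ∀ S, μ S ≠ 0 → P S := by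
  obtain ⟨ι, _, ν, X, h0, h1, h2, h3⟩ := h
  refine ⟨fun S => ∑ i with X i = S, ν i, ⟨fun S => sum_nonneg fun i _ => h0 i, ?_, ?_⟩, ?_, ?_⟩
  · intro S hS
    obtain ⟨i, hi, -⟩ := exists_ne_zero_of_sum_ne_zero hS
    rw [← (mem_filter.1 hi).2]
    exact hP _ (h2 i)
  · intro D
    refine le_trans (le_of_eq ?_) (h3 D)
    rw [sum_ifp, ← Finset.sum_fiberwise_of_maps_to (s := univ.filter (fun i => D ⊆ X i))
      (t := E.powerset.filter (fun S => D ⊆ S)) (g := X)]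
    · apply sum_congr rfl
      intro S hS
      apply sum_congr _ fun _ _ => rfl
      ext i
      simp only [mem_filter, mem_univ, true_and] at hS ⊢
      constructor
      · rintro rfl; exact ⟨hS.2, rfl⟩
      · exact fun h => h.2
    · intro i hi
      simp only [mem_filter, mem_univ, true_and, mem_powerset] at hi ⊢
      exact ⟨(hP _ (h2 i)).1, hi⟩
  · rw [← h1]
    apply Finset.sum_fiberwise_of_maps_to
    intro i _
    exact mem_powerset.2 (hP _ (h2 i)).1
  · intro S hS
    obtain ⟨i, hi, -⟩ := exists_ne_zero_of_sum_ne_zero hS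
    rw [← (mem_filter.1 hi).2]
    exact h2 i

end Spr

/-! ### tuples -/
section Tuple
variable {V L : Type} [Fintype V] [DecidableEq V] [DecidableEq L]

/-- the atoms of a tuple placed at label `t`. -/
noncomputable def put {κ : Type} [Fintype κ] (t : L) (τ : κ → V) : Finset (V × L) :=
  univ.image (fun j => (τ j, t))

theorem mem_put {κ : Type} [Fintype κ] {t : L} {τ : κ → V} {a : V × L} :
    a ∈ put t τ ↔ a.2 = t ∧ ∃ j, τ j = a.1 := by
  unfold put
  simp only [mem_image, mem_univ, true_and]
  constructor
  · rintro ⟨j, rfl⟩; exact ⟨rfl, j, rfl⟩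
  · rintro ⟨rfl, j, h⟩; exact ⟨j, by rw [h]⟩

theorem count_prescribed {κ : Type} [Fintype κ] (D : Finset V) (σ : D → κ) (hσ : Function.Injective σ) :
    (#(univ.filter (fun τ : κ → V => ∀ d : D, τ (σ d) = d)) : ℝ) * (Fintype.card V : ℝ) ^ #D
      ≤ (Fintype.card V : ℝ) ^ Fintype.card κ := by
  have h1 : #(univ.filter (fun τ : κ → V => ∀ d : D, τ (σ d) = d))
      ≤ Fintype.card V ^ (Fintype.card κ - #D) := by
    have : Fintype.card ({j : κ // j ∉ Set.range σ} → V) = Fintype.card V ^ (Fintype.card κ - #D) := by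
      rw [Fintype.card_fun]
      congr 1
      rw [Fintype.card_subtype_compl]
      congr 1
      have := Set.card_range_of_injective hσ
      rw [Fintype.card_coe] at this
      rw [← this]
    rw [← this, ← card_univ]
    apply Finset.card_le_card_of_injOn (fun τ j => τ j.1) (by intro _ _; simp)
    intro τ hτ τ' hτ' he
    simp only [coe_filter, mem_univ, true_and, Set.mem_ofPred_eq] at hτ hτ'
    funext j
    by_cases hj : j ∈ Set.range σ
    · obtain ⟨d, rfl⟩ := hj
      rw [hτ, hτ']
    · exact congrFun he ⟨j, hj⟩
  have h2 : #D ≤ Fintype.card κ := by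
    have := Fintype.card_le_of_injective σ hσ
    rwa [Fintype.card_coe] at this
  calc _ ≤ ((Fintype.card V : ℝ) ^ (Fintype.card κ - #D)) * (Fintype.card V : ℝ) ^ #D := by
        apply mul_le_mul_of_nonneg_right _ (by positivity)
        exact_mod_cast h1
    _ = _ := by rw [← pow_add, Nat.sub_add_cancel h2]

/-- number of tuples whose range contains `D`. -/
theorem count_tuples {κ : Type} [Fintype κ] (D : Finset V) (hV : 0 < Fintype.card V) :
    (#(univ.filter (fun τ : κ → V => ∀ d ∈ D, ∃ j, τ j = d)) : ℝ)
      ≤ (Fintype.card V : ℝ) ^ Fintype.card κ * ((Fintype.card κ : ℝ) / Fintype.card V) ^ #D := by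
  have hV' : (0:ℝ) < Fintype.card V := by exact_mod_cast hV
  have h1 : univ.filter (fun τ : κ → V => ∀ d ∈ D, ∃ j, τ j = d) ⊆
      (univ.filter (fun σ : D → κ => Function.Injective σ)).biUnion
        (fun σ => univ.filter (fun τ : κ → V => ∀ d : D, τ (σ d) = d)) := by
    intro τ hτ
    simp only [mem_filter, mem_univ, true_and] at hτ
    simp only [mem_biUnion, mem_filter, mem_univ, true_and]
    choose f hf using fun d : D => hτ d.1 d.2
    refine ⟨f, ?_, hf⟩
    intro a b hab
    apply Subtype.ext
    rw [← hf a, ← hf b, hab]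
  have h2 : (#(univ.filter (fun τ : κ → V => ∀ d ∈ D, ∃ j, τ j = d)) : ℝ) ≤
      ∑ σ ∈ univ.filter (fun σ : D → κ => Function.Injective σ),
        (#(univ.filter (fun τ : κ → V => ∀ d : D, τ (σ d) = d)) : ℝ) := by
    exact_mod_cast (card_le_card h1).trans card_biUnion_le
  have h3 : (#(univ.filter (fun σ : D → κ => Function.Injective σ)) : ℝ) ≤ (Fintype.card κ : ℝ) ^ #D := by
    have : #(univ.filter (fun σ : D → κ => Function.Injective σ)) ≤ Fintype.card κ ^ #D := by
      refine (card_filter_le _ _).trans ?_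
      rw [card_univ, Fintype.card_fun, Fintype.card_coe]
    exact_mod_cast this
  refine h2.trans ?_
  calc _ ≤ ∑ σ ∈ univ.filter (fun σ : D → κ => Function.Injective σ),
        (Fintype.card V : ℝ) ^ Fintype.card κ / (Fintype.card V : ℝ) ^ #D := by
        apply sum_le_sum
        intro σ hσ
        rw [le_div_iff₀ (by positivity)]
        exact count_prescribed D σ (mem_filter.1 hσ).2
    _ = #(univ.filter (fun σ : D → κ => Function.Injective σ)) *
        ((Fintype.card V : ℝ) ^ Fintype.card κ / (Fintype.card V : ℝ) ^ #D) := by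
        rw [sum_const, nsmul_eq_mul]
    _ ≤ (Fintype.card κ : ℝ) ^ #D * ((Fintype.card V : ℝ) ^ Fintype.card κ / (Fintype.card V : ℝ) ^ #D) :=
        mul_le_mul_of_nonneg_right h3 (by positivity)
    _ = _ := by rw [div_pow]; ring

/-- the labels of `D`. -/
noncomputable def labs (D : Finset (V × L)) : Finset L := D.image Prod.snd

theorem tuple_step {κ : Type} [Fintype κ] (T : Finset (κ → V)) (t : L) (M : ℝ) (hM : 0 < M)
    (hT : M ≤ #T) (hV : 0 < Fintype.card V) :
    Spr (fun O => ∃ τ ∈ T, O = put t τ) (fun D => if labs D ⊆ {t} then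
      ((Fintype.card V : ℝ) ^ Fintype.card κ / M) ^ #(labs D) *
        ((Fintype.card κ : ℝ) / Fintype.card V) ^ #D else 0) := by
  have hTpos : (0:ℝ) < #T := by linarith
  refine ⟨T, inferInstance, fun _ => 1 / #T, fun τ => put t τ.1, fun _ => by positivity, ?_,
    fun τ => ⟨τ.1, τ.2, rfl⟩, fun D => ?_⟩
  · rw [sum_const, card_univ, Fintype.card_coe, nsmul_eq_mul]
    field_simp
  · dsimp only
    by_cases hl : labs D ⊆ {t}
    · rw [if_pos hl]
      by_cases hD : D = ∅
      · subst hD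
        simp only [empty_subset, ifp, if_true, labs, image_empty, card_empty, pow_zero, mul_one]
        rw [sum_const, card_univ, Fintype.card_coe, nsmul_eq_mul]
        apply le_of_eq; field_simp
      · have hlc : labs D = {t} := by
          apply (subset_singleton_iff.1 hl).resolve_left
          intro h; exact hD (image_eq_empty.1 h)
        have hDt : ∀ a ∈ D, a.2 = t := by
          intro a ha
          have : a.2 ∈ labs D := mem_image_of_mem _ ha
          rw [hlc] at this
          exact mem_singleton.1 this
        have hcard : #(D.image Prod.fst) = #D := by
          apply card_image_of_injOn
          intro a ha b hb hab
          exact Prod.ext hab ((hDt a ha).trans (hDt b hb).symm)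
        have h1 := count_tuples (κ := κ) (D.image Prod.fst) hV
        rw [hcard] at h1
        rw [hlc, card_singleton, pow_one, sum_ifp, sum_const, nsmul_eq_mul]
        have h2 : (#(univ.filter (fun τ : T => D ⊆ put t τ.1)) : ℝ) ≤
          #(univ.filter (fun τ : κ → V => ∀ d ∈ D.image Prod.fst, ∃ j, τ j = d)) := by
          have : #(univ.filter (fun τ : T => D ⊆ put t τ.1)) ≤
            #(univ.filter (fun τ : κ → V => ∀ d ∈ D.image Prod.fst, ∃ j, τ j = d)) := by
            apply Finset.card_le_card_of_injOn (fun τ => τ.1)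
            · intro τ hτ
              simp only [coe_filter, mem_univ, true_and, Set.mem_ofPred_eq] at hτ ⊢
              intro d hd
              obtain ⟨a, ha, rfl⟩ := mem_image.1 hd
              exact (mem_put.1 (hτ ha)).2
            · intro a _ b _ h; exact Subtype.ext h
          exact_mod_cast this
        have h3 := h2.trans h1
        calc _ ≤ ((Fintype.card V : ℝ) ^ Fintype.card κ *
              ((Fintype.card κ : ℝ) / Fintype.card V) ^ #D) * (1 / #T) :=
              mul_le_mul_of_nonneg_right h3 (by positivity)
          _ ≤ ((Fintype.card V : ℝ) ^ Fintype.card κ *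
              ((Fintype.card κ : ℝ) / Fintype.card V) ^ #D) * (1 / M) := by
              apply mul_le_mul_of_nonneg_left _ (by positivity)
              exact one_div_le_one_div_of_le hM hT
          _ = _ := by ring
    · rw [if_neg hl]
      apply le_of_eq
      apply sum_eq_zero
      intro τ _
      rw [ifp_neg]
      intro h
      apply hl
      intro l hl'
      obtain ⟨a, ha, rfl⟩ := mem_image.1 hl'
      exact mem_singleton.2 (mem_put.1 (h ha)).1

/-- Greedy random choice of tuples, one per label. -/
theorem greedy {κ : Type} [Fintype κ] (Inv : Finset L → Finset (V × L) → Prop) (M : ℝ) (hM : 0 < M)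
    (hV : 0 < Fintype.card V) (h0 : Inv ∅ ∅) (T : Finset L)
    (hstep : ∀ A t O, A ⊆ T → t ∈ T → t ∉ A → Inv A O →
      M ≤ #(univ.filter (fun τ : κ → V => Inv (insert t A) (O ∪ put t τ)))) :
    Spr (Inv T) (fun D => if labs D ⊆ T then
      ((Fintype.card V : ℝ) ^ Fintype.card κ / M) ^ #(labs D) *
        ((Fintype.card κ : ℝ) / Fintype.card V) ^ #D else 0) := by
  induction T using Finset.induction_on with
  | empty =>
    refine (Spr.dirac (∅ : Finset (V × L)) h0).mono (fun _ h => h) fun D => ?_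
    by_cases hD : D = ∅
    · subst hD; simp [labs]
    · have h1 : ¬ D ⊆ ∅ := fun h => hD (subset_empty.1 h)
      have h2 : ¬ labs D ⊆ ∅ := fun h => hD (image_eq_empty.1 (subset_empty.1 h))
      rw [if_neg h1, if_neg h2]
  | insert t T ht ih =>
    have ih' := ih (fun A t' O hA ht' => hstep A t' O (hA.trans (subset_insert _ _))
      (mem_insert_of_mem ht'))
    have hs : ∀ O, Inv T O → _ := fun O hO =>
      tuple_step _ t M hM (hstep T t O (subset_insert _ _) (mem_insert_self _ _) ht hO) hV
    refine (ih'.comp hs).mono ?_ ?_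
    · rintro S ⟨O₁, O₂, h1, ⟨τ, hτ, rfl⟩, rfl⟩
      exact (mem_filter.1 hτ).2
    · intro D
      set D₁ := D.filter (fun a => a.2 ≠ t) with hD₁
      have hsub : D₁ ⊆ D := filter_subset _ _
      by_cases hl : labs D ⊆ insert t T
      · rw [if_pos hl, Finset.sum_eq_single D₁]
        · have e1 : labs D₁ ⊆ T := by
            intro l hl'
            obtain ⟨a, ha, rfl⟩ := mem_image.1 hl'
            rw [hD₁, mem_filter] at ha
            have := hl (mem_image_of_mem _ ha.1)
            exact (mem_insert.1 this).resolve_left ha.2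
          have e2 : labs (D \ D₁) ⊆ {t} := by
            intro l hl'
            obtain ⟨a, ha, rfl⟩ := mem_image.1 hl'
            rw [hD₁, mem_sdiff, mem_filter] at ha
            rw [mem_singleton]
            by_contra hne
            exact ha.2 ⟨ha.1, hne⟩
          rw [if_pos e1, if_pos e2]
          have e3 : #(labs D) = #(labs D₁) + #(labs (D \ D₁)) := by
            rw [← card_union_of_disjoint]
            · congr 1
              unfold labs
              rw [← image_union, union_sdiff_of_subset hsub]
            · rw [disjoint_left]
              intro l h1 h2
              have := mem_singleton.1 (e2 h2)
              subst this
              exact ht (e1 h1)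
          have e4 : #D = #D₁ + #(D \ D₁) := by
            rw [add_comm, card_sdiff_add_card_eq_card hsub]
          have e5 : ∀ y : ℝ, y ^ #D = y ^ #D₁ * y ^ #(D \ D₁) := by
            intro y; rw [← pow_add, ← e4]
          rw [e3, pow_add, e5]
          apply le_of_eq; ring
        · intro D₂ hD₂ hne
          rw [mem_powerset] at hD₂
          by_cases a1 : labs D₂ ⊆ T
          · by_cases a2 : labs (D \ D₂) ⊆ {t}
            · exfalso
              apply hne
              ext a
              rw [hD₁, mem_filter]
              constructor
              · intro ha
                refine ⟨hD₂ ha, ?_⟩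
                rintro rfl
                exact ht (a1 (mem_image_of_mem _ ha))
              · rintro ⟨h1, h2⟩
                by_contra h3
                exact h2 (mem_singleton.1 (a2 (mem_image_of_mem _ (mem_sdiff.2 ⟨h1, h3⟩))))
            · rw [if_neg a2, mul_zero]
          · rw [if_neg a1, zero_mul]
        · intro h; exact absurd (mem_powerset.2 hsub) h
      · rw [if_neg hl]
        apply le_of_eq
        apply sum_eq_zero
        intro D₂ hD₂
        rw [mem_powerset] at hD₂
        by_cases a1 : labs D₂ ⊆ T
        · by_cases a2 : labs (D \ D₂) ⊆ {t}
          · exfalso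
            apply hl
            intro l hl'
            obtain ⟨a, ha, rfl⟩ := mem_image.1 hl'
            by_cases h3 : a ∈ D₂
            · exact mem_insert_of_mem (a1 (mem_image_of_mem _ h3))
            · rw [mem_singleton.1 (a2 (mem_image_of_mem _ (mem_sdiff.2 ⟨ha, h3⟩)))]
              exact mem_insert_self _ _
          · rw [if_neg a2, mul_zero]
        · rw [if_neg a1, zero_mul]

/-- product weight version -/
theorem greedyW {κ : Type} [Fintype κ] (Inv : Finset L → Finset (V × L) → Prop) (c : ℝ) (hc : 0 < c)
    (hc1 : c ≤ 1)
    (hV : 0 < Fintype.card V) (h0 : Inv ∅ ∅) (T : Finset L)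
    (hstep : ∀ A t O, A ⊆ T → t ∈ T → t ∉ A → Inv A O →
      c * (Fintype.card V : ℝ) ^ Fintype.card κ
        ≤ #(univ.filter (fun τ : κ → V => Inv (insert t A) (O ∪ put t τ)))) :
    Spr (Inv T) (fun D => ∏ a ∈ D,
      (if a.2 ∈ T then (Fintype.card κ : ℝ) / c / Fintype.card V else 0)) := by
  have hV' : (0:ℝ) < Fintype.card V := by exact_mod_cast hV
  refine (greedy Inv _ (by positivity) hV h0 T hstep).mono (fun _ h => h) fun D => ?_
  have hx : (Fintype.card V : ℝ) ^ Fintype.card κ / (c * (Fintype.card V : ℝ) ^ Fintype.card κ) = 1 / c := by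
    field_simp
  rw [hx]
  split_ifs with h
  · rw [prod_congr rfl (g := fun _ => (Fintype.card κ : ℝ) / c / Fintype.card V), prod_const]
    · calc _ ≤ (1 / c) ^ #D * ((Fintype.card κ : ℝ) / Fintype.card V) ^ #D := by
            apply mul_le_mul_of_nonneg_right _ (by positivity)
            apply pow_le_pow_right₀
            · rw [le_div_iff₀ hc]; linarith
            · exact card_image_le
        _ = _ := by rw [← mul_pow]; congr 1; field_simp
    · intro a ha
      rw [if_pos (h (mem_image_of_mem _ ha))]
  · apply prod_nonneg
    intro a _
    split_ifs <;> positivity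

end Tuple


/-! ## Part 3 : spread perfect matchings -/

theorem prodP {κ Z : Type} [Fintype κ] [DecidableEq κ] [Fintype Z] (w : κ → Z → ℝ) (B : κ → Finset Z) :
    ∑ ω : κ → Z, ifp (∀ c, ω c ∈ B c) (∏ c, w c (ω c)) = ∏ c, ∑ z ∈ B c, w c z := by
  rw [Finset.prod_univ_sum, sum_ifp]
  apply sum_congr _ fun _ _ => rfl
  ext ω
  simp [Fintype.mem_piFinset]

theorem choose_le_exp (k i : ℕ) (hi : 1 ≤ i) : (k.choose i : ℝ) ≤ (Real.exp 1 * k / i) ^ i := by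
  have h1 := Nat.choose_le_pow_div (α := ℝ) i k
  have h2 := Real.pow_div_factorial_le_exp (i:ℝ) (by positivity) i
  have hi' : (0:ℝ) < i := by exact_mod_cast hi
  refine h1.trans ?_
  have h3 : Real.exp (i:ℝ) = Real.exp 1 ^ i := by rw [← Real.exp_nat_mul]; ring_nf
  rw [h3] at h2
  have : ((i:ℝ) ^ i / (i.factorial : ℝ)) * ((k:ℝ) / i) ^ i ≤ Real.exp 1 ^ i * ((k:ℝ)/i)^i :=
    mul_le_mul_of_nonneg_right h2 (by positivity)
  calc _ = ((i:ℝ) ^ i / (i.factorial : ℝ)) * ((k:ℝ) / i) ^ i := by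
        rw [div_pow]; field_simp
    _ ≤ _ := this
    _ = _ := by rw [← mul_pow]; ring_nf

section M
variable {X T : Type} [Fintype X] [Fintype T] [DecidableEq X] [DecidableEq T]

/-- neighbourhood of a set in a bipartite graph given as a set of pairs -/
def Expands (O : Finset (X × T)) (k : ℕ) : Prop :=
  ∀ (S : Finset X) (Z : Finset T), 2 * #S ≤ k + 1 → #Z < #S → ∃ a ∈ O, a.1 ∈ S ∧ a.2 ∉ Z

theorem numeric_hall (k i : ℕ) (hi : 1 ≤ i) (hik : 2 * (i + 1) ≤ k + 1) :
    (k.choose (i+1) : ℝ) * (k.choose i) * ((i:ℝ) / (9 / 10 * k)) ^ (10 * (i+1)) ≤ (1/2)^(i+1) := by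
  have hi' : (0:ℝ) < i := by exact_mod_cast hi
  have hk : (0:ℝ) < k := by
    have : 0 < k := by omega
    exact_mod_cast this
  have hik' : 2 * (i:ℝ) ≤ k := by
    have : 2 * i ≤ k := by omega
    exact_mod_cast this
  have he := Real.exp_one_lt_d9
  have he1 : (1:ℝ) ≤ Real.exp 1 := by
    have := Real.add_one_le_exp (1:ℝ); linarith
  set y := Real.exp 1 * k / i with hy
  have hy1 : 1 ≤ y := by
    rw [hy, le_div_iff₀ hi']; nlinarith
  have c1 : (k.choose (i+1) : ℝ) ≤ y ^ (i+1) := by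
    refine (choose_le_exp k (i+1) (by omega)).trans ?_
    apply pow_le_pow_left₀ (by positivity)
    rw [hy]
    apply div_le_div_of_nonneg_left (by positivity) hi'
    push_cast; linarith
  have c2 : (k.choose i : ℝ) ≤ y ^ (i+1) := by
    refine (choose_le_exp k i hi).trans ?_
    exact pow_le_pow_right₀ hy1 (by omega)
  set z := (i:ℝ) / (9 / 10 * k) with hz
  have hz0 : 0 ≤ z := by positivity
  have hz1 : z ≤ 5/9 := by
    rw [hz, div_le_iff₀ (by positivity)]; linarith
  have hyz : y * z ≤ 2.72 * (10/9) := by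
    have : y * z = Real.exp 1 * (10/9) := by rw [hy, hz]; field_simp
    rw [this]; nlinarith
  have hyz0 : 0 ≤ y * z := by positivity
  calc _ ≤ y ^ (i+1) * y ^ (i+1) * z ^ (10 * (i+1)) := by gcongr
    _ = ((y*z)^2 * z^8) ^ (i+1) := by
        rw [pow_mul, ← mul_pow, ← mul_pow]; congr 1; ring
    _ ≤ (1/2) ^ (i+1) := by
        apply pow_le_pow_left₀ (by positivity)
        calc _ ≤ (2.72 * (10/9))^2 * (5/9:ℝ)^8 := by gcongr
          _ ≤ 1/2 := by norm_num

theorem half_match (k : ℕ) (hk : 1 ≤ k) (hX : Fintype.card X = k) (hT : Fintype.card T = k)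
    (R : X → T → Prop) (hR : ∀ x, (9/10 : ℝ) * k ≤ #(univ.filter (fun y => R x y))) :
    Spr (fun O : Finset (X × T) => (∀ a ∈ O, R a.1 a.2) ∧ Expands O k)
      (fun D => ∏ _a ∈ D, (24 / k : ℝ)) := by
  have hk' : (0:ℝ) < k := by exact_mod_cast hk
  set Nb : X → Finset T := fun x => univ.filter (fun y => R x y) with hNb
  have hpos : ∀ x, (0:ℝ) < #(Nb x) := fun x => lt_of_lt_of_le (by positivity) (hR x)
  set w : X × Fin 10 → T → ℝ := fun c y => if y ∈ Nb c.1 then 1 / (#(Nb c.1) : ℝ) else 0 with hw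
  have hw0 : ∀ c y, 0 ≤ w c y := by
    intro c y; rw [hw]; dsimp only; split_ifs <;> positivity
  have hwB : ∀ c (B : Finset T), ∑ z ∈ B, w c z ≤ #B / (9/10 * k) := by
    intro c B
    calc _ ≤ ∑ z ∈ B, 1 / ((9/10 : ℝ) * k) := by
          apply sum_le_sum; intro z _
          rw [hw]; dsimp only; split_ifs
          · exact one_div_le_one_div_of_le (by positivity) (hR _)
          · positivity
      _ = _ := by rw [sum_const, nsmul_eq_mul]; ring
  have hw1 : ∀ c, ∑ z, w c z = 1 := by
    intro c
    rw [hw]; dsimp only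
    rw [← sum_filter, sum_const, nsmul_eq_mul, filter_mem_eq_inter, univ_inter]
    field_simp [(hpos c.1).ne']
  have hpr0 : ∀ ω : X × Fin 10 → T, 0 ≤ ∏ c, w c (ω c) := fun ω => prod_nonneg fun c _ => hw0 _ _
  have htot : ∑ ω : X × Fin 10 → T, ∏ c, w c (ω c) = 1 := by
    have := prodP w (fun _ => univ)
    simp only [mem_univ, implies_true, hw1, prod_const_one] at this
    rw [← this]
    exact sum_congr rfl fun ω _ => (ifp_pos trivial).symm
  -- the weighted family restricted to good tuples
  set ι := {ω : X × Fin 10 → T // (∀ c, ω c ∈ Nb c.1) ∧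
    Expands (univ.image (fun c : X × Fin 10 => (c.1, ω c))) k} with hι
  have hbad : ∑ ω : X × Fin 10 → T, ifp (¬ Expands (univ.image (fun c : X × Fin 10 => (c.1, ω c))) k)
      (∏ c, w c (ω c)) ≤ 1/2 := by
    calc _ ≤ ∑ ω : X × Fin 10 → T, ∑ i ∈ Ico 1 (k+1), ifp (2 * (i+1) ≤ k+1) (
          ∑ S ∈ powersetCard (i+1) (univ : Finset X), ∑ Z ∈ powersetCard i (univ : Finset T),
            ifp (∀ c, ω c ∈ (if c.1 ∈ S then Z else univ)) (∏ c, w c (ω c))) := by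
          apply sum_le_sum
          intro ω _
          have hnn : ∀ i ∈ Ico 1 (k+1), 0 ≤ ifp (2 * (i+1) ≤ k+1) (
          ∑ S ∈ powersetCard (i+1) (univ : Finset X), ∑ Z ∈ powersetCard i (univ : Finset T),
            ifp (∀ c, ω c ∈ (if c.1 ∈ S then Z else univ)) (∏ c, w c (ω c))) := fun i _ =>
            ifp_nonneg (sum_nonneg fun _ _ => sum_nonneg fun _ _ => ifp_nonneg (hpr0 _))
          by_cases hE : Expands (univ.image (fun c : X × Fin 10 => (c.1, ω c))) k
          · rw [ifp_neg (not_not.2 hE)]; exact sum_nonneg hnn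
          · rw [ifp_pos hE]
            unfold Expands at hE
            push Not at hE
            obtain ⟨S, Z, h1, h2, h3⟩ := hE
            have hin : ∀ x ∈ S, ∀ j, ω (x, j) ∈ Z := fun x hx j =>
              h3 (x, ω (x,j)) (mem_image.2 ⟨(x,j), mem_univ _, rfl⟩) hx
            obtain ⟨x, hx⟩ : S.Nonempty := card_pos.1 (by omega)
            have hZ : 0 < #Z := card_pos.2 ⟨_, hin x hx 0⟩
            obtain ⟨Z', hZZ', -, hZ'⟩ := exists_subsuperset_card_eq (n := #S - 1) (subset_univ Z)
              (by omega) (by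
                rw [card_univ, hT]
                have := card_le_univ S
                omega)
            have hi : #S - 1 ∈ Ico 1 (k+1) := mem_Ico.2 ⟨by omega, by omega⟩
            refine le_trans ?_ (single_le_sum hnn hi)
            rw [ifp_pos (by omega)]
            refine le_trans ?_ (single_le_sum (fun _ _ => sum_nonneg fun _ _ => ifp_nonneg (hpr0 _))
              (mem_powersetCard.2 ⟨subset_univ S, by omega⟩))
            refine le_trans ?_ (single_le_sum (fun _ _ => ifp_nonneg (hpr0 _))
              (mem_powersetCard.2 ⟨subset_univ Z', hZ'⟩))
            rw [ifp_pos]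
            intro c
            split_ifs with hc
            · exact hZZ' (hin c.1 hc c.2)
            · exact mem_univ _
      _ = ∑ i ∈ Ico 1 (k+1), ifp (2 * (i+1) ≤ k+1) (
          ∑ S ∈ powersetCard (i+1) (univ : Finset X), ∑ Z ∈ powersetCard i (univ : Finset T),
            ∏ c : X × Fin 10, ∑ z ∈ (if c.1 ∈ S then Z else univ), w c z) := by
          rw [sum_comm]
          apply sum_congr rfl; intro i _
          by_cases h : 2 * (i+1) ≤ k+1
          · simp only [ifp_pos h]
            rw [sum_comm]
            apply sum_congr rfl; intro S _
            rw [sum_comm]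
            apply sum_congr rfl; intro Z _
            rw [← prodP]
          · simp only [ifp_neg h, sum_const_zero]
      _ ≤ ∑ i ∈ Ico 1 (k+1), (1/2:ℝ)^(i+1) := by
          apply sum_le_sum
          intro i hi
          rw [mem_Ico] at hi
          by_cases h : 2 * (i+1) ≤ k+1
          · rw [ifp_pos h]
            refine le_trans ?_ (numeric_hall k i hi.1 h)
            calc _ ≤ ∑ S ∈ powersetCard (i+1) (univ : Finset X), ∑ Z ∈ powersetCard i (univ : Finset T),
                  ((i:ℝ) / (9 / 10 * k)) ^ (10 * (i+1)) := by
                  apply sum_le_sum; intro S hS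
                  apply sum_le_sum; intro Z hZ
                  rw [mem_powersetCard] at hS hZ
                  calc _ ≤ ∏ c : X × Fin 10, (if c.1 ∈ S then ((i:ℝ) / (9 / 10 * k)) else 1) := by
                        apply prod_le_prod (fun c _ => sum_nonneg fun _ _ => hw0 _ _)
                        intro c _
                        split_ifs
                        · have := hwB c Z; rwa [hZ.2] at this
                        · exact (hw1 c).le
                    _ = _ := by
                        have e0 : ∏ c : X × Fin 10, (if c.1 ∈ S then ((i:ℝ) / (9 / 10 * k)) else 1) =
                            ∏ x : X, ∏ _j : Fin 10, (if x ∈ S then ((i:ℝ) / (9 / 10 * k)) else 1) :=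
                          Fintype.prod_prod_type _
                        rw [e0]
                        simp only [prod_const, card_univ, Fintype.card_fin]
                        rw [prod_pow, prod_ite, prod_const_one, mul_one, prod_const, filter_mem_eq_inter,
                          univ_inter, hS.2, ← pow_mul, mul_comm 10]
              _ = _ := by
                  rw [sum_const, sum_const, card_powersetCard, card_powersetCard, card_univ, card_univ,
                    hX, hT, nsmul_eq_mul, nsmul_eq_mul]
                  ring
          · rw [ifp_neg h]; positivity
      _ ≤ 1/2 := by
          rw [sum_Ico_eq_sum_range]
          have h1 : ∀ m : ℕ, ∑ i ∈ range m, (1/2:ℝ)^(1+i+1) = 1/2 - (1/2)^(m+1) := by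
            intro m
            induction m with
            | zero => norm_num
            | succ m ih => rw [sum_range_succ, ih]; ring
          rw [h1]
          have : (0:ℝ) ≤ (1/2)^(k+1-1+1) := by positivity
          linarith
  set m := ∑ i : ι, ∏ c, w c (i.1 c) with hm
  have hmeq : m = ∑ ω : X × Fin 10 → T, ifp ((∀ c, ω c ∈ Nb c.1) ∧
    Expands (univ.image (fun c : X × Fin 10 => (c.1, ω c))) k) (∏ c, w c (ω c)) := by
    rw [sum_ifp, hm]
    exact (Finset.sum_subtype _ (by simp) (fun ω : X × Fin 10 → T => ∏ c, w c (ω c))).symm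
  have hm2 : 1/2 ≤ m := by
    have : 1 ≤ m + ∑ ω : X × Fin 10 → T, ifp (¬ Expands (univ.image (fun c : X × Fin 10 => (c.1, ω c))) k)
      (∏ c, w c (ω c)) := by
      rw [hmeq, ← sum_add_distrib, ← htot]
      apply sum_le_sum
      intro ω _
      by_cases hE : Expands (univ.image (fun c : X × Fin 10 => (c.1, ω c))) k
      · by_cases hN : ∀ c, ω c ∈ Nb c.1
        · rw [ifp_pos ⟨hN, hE⟩, ifp_neg (not_not.2 hE), add_zero]
        · have : ∏ c, w c (ω c) = 0 := by
            push Not at hN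
            obtain ⟨c, hc⟩ := hN
            apply prod_eq_zero (mem_univ c)
            rw [hw]; dsimp only; rw [if_neg hc]
          rw [this]
          exact add_nonneg (ifp_nonneg le_rfl) (ifp_nonneg le_rfl)
      · rw [ifp_neg (fun h => hE h.2), ifp_pos hE, zero_add]
    linarith
  have hmpos : 0 < m := by linarith
  refine ⟨ι, inferInstance, fun i => (∏ c, w c (i.1 c)) / m,
    fun i => univ.image (fun c : X × Fin 10 => (c.1, i.1 c)), fun i => div_nonneg (hpr0 _) hmpos.le, ?_,
    ?_, ?_⟩
  · rw [← sum_div, ← hm, div_self hmpos.ne']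
  · rintro ⟨ω, h1, h2⟩
    refine ⟨?_, h2⟩
    intro a ha
    obtain ⟨c, -, rfl⟩ := mem_image.1 ha
    exact (mem_filter.1 (h1 c)).2
  · intro D
    by_cases hD : D = ∅
    · subst hD
      simp only [empty_subset, prod_empty]
      calc _ ≤ ∑ i : ι, (∏ c, w c (i.1 c)) / m :=
            sum_le_sum fun i _ => ifp_le (div_nonneg (hpr0 _) hmpos.le)
        _ = 1 := by rw [← sum_div, ← hm, div_self hmpos.ne']
        _ ≤ 1 := le_rfl
    -- total bound
    have hall : ∑ ω : X × Fin 10 → T, ifp (D ⊆ univ.image (fun c : X × Fin 10 => (c.1, ω c)))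
        (∏ c, w c (ω c)) ≤ (100 / (9 * k) : ℝ)^#D := by
      calc _ ≤ ∑ ω : X × Fin 10 → T, ∑ f : D → Fin 10,
              ifp (∀ d : D, ω (d.1.1, f d) = d.1.2) (∏ c, w c (ω c)) := by
            apply sum_le_sum
            intro ω _
            by_cases h : D ⊆ univ.image (fun c : X × Fin 10 => (c.1, ω c))
            · rw [ifp_pos h]
              have : ∀ d : D, ∃ j, ω (d.1.1, j) = d.1.2 := by
                intro d
                obtain ⟨c, -, hc⟩ := mem_image.1 (h d.2)
                exact ⟨c.2, by rw [← hc]⟩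
              choose f hf using this
              refine le_trans ?_ (single_le_sum (fun _ _ => ifp_nonneg (hpr0 _)) (mem_univ f))
              rw [ifp_pos hf]
            · rw [ifp_neg h]; exact sum_nonneg fun _ _ => ifp_nonneg (hpr0 _)
        _ = ∑ f : D → Fin 10, ∑ ω : X × Fin 10 → T,
              ifp (∀ d : D, ω (d.1.1, f d) = d.1.2) (∏ c, w c (ω c)) := sum_comm
        _ ≤ ∑ f : D → Fin 10, (10 / (9 * k) : ℝ)^#D := by
            apply sum_le_sum
            intro f _
            by_cases hf : Function.Injective (fun d : D => (d.1.1, f d))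
            · set B : X × Fin 10 → Finset T := fun c =>
                univ.filter (fun y => ∀ d : D, (d.1.1, f d) = c → y = d.1.2) with hB
              have e1 : ∑ ω : X × Fin 10 → T, ifp (∀ d : D, ω (d.1.1, f d) = d.1.2) (∏ c, w c (ω c))
                  = ∑ ω : X × Fin 10 → T, ifp (∀ c, ω c ∈ B c) (∏ c, w c (ω c)) := by
                apply sum_congr rfl; intro ω _
                congr 1
                apply propext
                rw [hB]; simp only [mem_filter, mem_univ, true_and]
                constructor
                · rintro h c d rfl; exact h d
                · intro h d; exact h _ d rfl
              rw [e1, prodP]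
              calc _ ≤ ∏ c : X × Fin 10, (if c ∈ univ.image (fun d : D => (d.1.1, f d)) then
                      (10 / (9 * k) : ℝ) else 1) := by
                    apply prod_le_prod (fun c _ => sum_nonneg fun _ _ => hw0 _ _)
                    intro c _
                    split_ifs with hc
                    · obtain ⟨d, -, rfl⟩ := mem_image.1 hc
                      have hcard : #(B (d.1.1, f d)) ≤ 1 := by
                        rw [card_le_one]
                        intro a ha b hb
                        rw [(mem_filter.1 ha).2 d rfl, (mem_filter.1 hb).2 d rfl]
                      refine (hwB _ _).trans ?_
                      have : (#(B (d.1.1, f d)) : ℝ) ≤ 1 := by exact_mod_cast hcard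
                      calc _ ≤ 1 / ((9/10:ℝ) * k) := by gcongr
                        _ = _ := by field_simp
                    · rw [← hw1 c]
                      exact sum_le_sum_of_subset_of_nonneg (subset_univ _) fun _ _ _ => hw0 _ _
                _ = _ := by
                    rw [prod_ite, prod_const_one, mul_one, prod_const, filter_mem_eq_inter, univ_inter,
                      card_image_of_injective _ hf, card_univ, Fintype.card_coe]
            · rw [sum_eq_zero]
              · positivity
              · intro ω _
                rw [ifp_neg]
                intro h
                apply hf
                intro d d' hdd
                simp only [Prod.mk.injEq] at hdd
                apply Subtype.ext
                apply Prod.ext hdd.1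
                rw [← h d, ← h d', hdd.1, hdd.2]
        _ = _ := by
            rw [sum_const, card_univ, Fintype.card_fun, Fintype.card_coe, Fintype.card_fin, nsmul_eq_mul]
            push_cast
            rw [← mul_pow]; congr 1; ring
    have hDpos : 1 ≤ #D := card_pos.2 (nonempty_iff_ne_empty.2 hD)
    calc _ = ∑ i : ι, ifp (D ⊆ univ.image (fun c : X × Fin 10 => (c.1, i.1 c))) (∏ c, w c (i.1 c)) / m := by
          apply sum_congr rfl; intro i _; unfold ifp; split_ifs <;> simp
      _ = (∑ i : ι, ifp (D ⊆ univ.image (fun c : X × Fin 10 => (c.1, i.1 c))) (∏ c, w c (i.1 c))) / m := by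
          rw [sum_div]
      _ ≤ (100 / (9 * k) : ℝ)^#D / m := by
          apply div_le_div_of_nonneg_right _ hmpos.le
          refine le_trans ?_ hall
          have e : ∑ i : ι, ifp (D ⊆ univ.image (fun c : X × Fin 10 => (c.1, i.1 c))) (∏ c, w c (i.1 c))
              = ∑ ω : X × Fin 10 → T with ((∀ c, ω c ∈ Nb c.1) ∧
                Expands (univ.image (fun c : X × Fin 10 => (c.1, ω c))) k),
                ifp (D ⊆ univ.image (fun c : X × Fin 10 => (c.1, ω c))) (∏ c, w c (ω c)) :=
            (Finset.sum_subtype _ (by simp) (fun ω : X × Fin 10 → T =>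
              ifp (D ⊆ univ.image (fun c : X × Fin 10 => (c.1, ω c))) (∏ c, w c (ω c)))).symm
          rw [e]
          exact sum_le_sum_of_subset_of_nonneg (filter_subset _ _) fun _ _ _ => ifp_nonneg (hpr0 _)
      _ ≤ (100 / (9 * k) : ℝ)^#D * 2 := by
          rw [div_le_iff₀ hmpos, mul_assoc]
          have : (0:ℝ) ≤ (100 / (9 * k) : ℝ)^#D := by positivity
          nlinarith
      _ ≤ (100 / (9 * k) : ℝ)^#D * 2^#D := by
          apply mul_le_mul_of_nonneg_left _ (by positivity)
          calc (2:ℝ) = 2^1 := by norm_num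
            _ ≤ 2^#D := pow_le_pow_right₀ (by norm_num) hDpos
      _ ≤ _ := by
          dsimp only
          rw [prod_const, ← mul_pow]
          apply pow_le_pow_left₀ (by positivity)
          rw [div_mul_eq_mul_div, div_le_div_iff₀ (by positivity) hk']
          nlinarith

theorem Spr.map_inj {α β : Type} [DecidableEq α] [DecidableEq β] {P : Finset α → Prop} {w : α → ℝ}
    (h : Spr P (fun D => ∏ a ∈ D, w a)) (f : α → β) (hf : Function.Injective f) (w' : β → ℝ)
    (hw : ∀ a, w' (f a) = w a) (hw0 : ∀ b, 0 ≤ w' b) :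
    Spr (fun S => ∃ O, P O ∧ S = O.image f) (fun D => ∏ b ∈ D, w' b) := by
  refine (h.map_cover (fun O => O.image f)
    (fun D => if h : ∃ D' : Finset α, D = D'.image f then {h.choose} else ∅) ?_).mono (fun _ h => h) ?_
  · intro O D _ hD
    have : ∃ D' : Finset α, D = D'.image f := by
      obtain ⟨D', h1, h2⟩ := subset_image_iff.1 hD
      exact ⟨D', h2.symm⟩
    rw [dif_pos this]
    refine ⟨_, mem_singleton_self _, ?_⟩
    have h1 := this.choose_spec
    intro a ha
    have : f a ∈ D := by rw [h1]; exact mem_image_of_mem _ ha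
    obtain ⟨b, hb, hab⟩ := mem_image.1 (hD this)
    rwa [← hf hab]
  · intro D
    by_cases h : ∃ D' : Finset α, D = D'.image f
    · simp only [dif_pos h, sum_singleton]
      conv_rhs => rw [h.choose_spec, prod_image (fun a _ b _ hab => hf hab)]
      simp only [hw, le_refl]
    · simp only [dif_neg h, sum_empty]
      exact prod_nonneg fun b _ => hw0 b

theorem match_spr (k : ℕ) (hk : 1 ≤ k) (hX : Fintype.card X = k) (hT : Fintype.card T = k)
    (R : X → T → Prop) (hR : ∀ x, (9/10 : ℝ) * k ≤ #(univ.filter (fun y => R x y)))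
    (hR' : ∀ y, (9/10 : ℝ) * k ≤ #(univ.filter (fun x => R x y))) :
    Spr (fun O : Finset (X × T) => ∃ f : X → T, Function.Bijective f ∧ (∀ x, R x (f x)) ∧
        O = univ.image (fun x => (x, f x)))
      (fun D => ∏ _a ∈ D, (48 / k : ℝ)) := by
  have h1 := half_match k hk hX hT R hR
  have h2 := (half_match k hk hT hX (fun y x => R x y) hR').map_inj Prod.swap Prod.swap_injective
    (fun _ => 24 / (k:ℝ)) (fun _ => rfl) (fun _ => by positivity)
  have h3 := (h1.compW (fun _ _ => h2)).subset (Q := fun O : Finset (X × T) =>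
    ∃ f : X → T, Function.Bijective f ∧ (∀ x, R x (f x)) ∧ O = univ.image (fun x => (x, f x))) ?_
  · refine h3.mono (fun _ h => h) fun D => le_of_eq ?_
    apply prod_congr rfl; intro _ _; ring
  rintro O ⟨O₁, _, ⟨a1, a2⟩, ⟨O₂, ⟨b1, b2⟩, rfl⟩, rfl⟩
  set O := O₁ ∪ O₂.image Prod.swap with hO
  have hOR : ∀ a ∈ O, R a.1 a.2 := by
    intro a ha
    rcases mem_union.1 ha with h | h
    · exact a1 a h
    · obtain ⟨b, hb, rfl⟩ := mem_image.1 h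
      exact b1 b hb
  have hall : ∀ S : Finset X, #S ≤ #(S.biUnion (fun x => univ.filter (fun y => (x, y) ∈ O))) := by
    intro S
    by_contra hlt
    push Not at hlt
    set Nn := S.biUnion (fun x => univ.filter (fun y => (x, y) ∈ O)) with hNn
    have hmem : ∀ x ∈ S, ∀ y, (x, y) ∈ O → y ∈ Nn := by
      intro x hx y hxy
      exact mem_biUnion.2 ⟨x, hx, mem_filter.2 ⟨mem_univ _, hxy⟩⟩
    have hSk : #S ≤ k := by rw [← hX]; exact card_le_univ S
    by_cases hS : 2 * #S ≤ k + 1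
    · obtain ⟨a, ha, h1, h2⟩ := a2 S Nn hS hlt
      exact h2 (hmem a.1 h1 a.2 (mem_union_left _ ha))
    · have hc : #(univ \ Nn) = k - #Nn := by
        rw [card_sdiff_of_subset (subset_univ _), card_univ, hT]
      obtain ⟨S', hS', hS'c⟩ := exists_subset_card_eq (s := univ \ Nn) (n := k - #S + 1) (by omega)
      have hc2 : #(univ \ S) = k - #S := by
        rw [card_sdiff_of_subset (subset_univ _), card_univ, hX]
      obtain ⟨a, ha, h1, h2⟩ := b2 S' (univ \ S) (by omega) (by omega)
      have h3 : a.2 ∈ S := by simpa using h2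
      have h4 := hmem a.2 h3 a.1 (mem_union_right _ (mem_image.2 ⟨a, ha, rfl⟩))
      exact (mem_sdiff.1 (hS' h1)).2 h4
  obtain ⟨f, hf, hfm⟩ := (Finset.all_card_le_biUnion_card_iff_exists_injective _).1 hall
  have hbij : Function.Bijective f :=
    (Fintype.bijective_iff_injective_and_card f).2 ⟨hf, by rw [hX, hT]⟩
  have hm : ∀ x, (x, f x) ∈ O := fun x => (mem_filter.1 (hfm x)).2
  refine ⟨univ.image (fun x => (x, f x)), ?_, f, hbij, fun x => hOR _ (hm x), rfl⟩
  intro a ha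
  obtain ⟨x, -, rfl⟩ := mem_image.1 ha
  exact hm x

end M

/-- matching lemma between subsets of `V` and `L`. -/
theorem match_sub {V L : Type} [DecidableEq V] [DecidableEq L] (X : Finset V) (T : Finset L) (k : ℕ) (hk : 1 ≤ k)
    (hX : #X = k) (hT : #T = k) (R : V → L → Prop)
    (hR : ∀ x ∈ X, (9/10 : ℝ) * k ≤ #(T.filter (fun y => R x y)))
    (hR' : ∀ y ∈ T, (9/10 : ℝ) * k ≤ #(X.filter (fun x => R x y))) :
    Spr (fun O : Finset (V × L) => ∃ f : V → L, Set.BijOn f X T ∧ (∀ x ∈ X, R x (f x)) ∧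
        O = X.image (fun x => (x, f x)))
      (fun D => ∏ a ∈ D, if a.1 ∈ X ∧ a.2 ∈ T then (48 / k : ℝ) else 0) := by
  haveI : Nonempty T := by
    rw [← Fintype.card_pos_iff, Fintype.card_coe, hT]; exact hk
  have := match_spr (X := X) (T := T) k hk (by rw [Fintype.card_coe, hX]) (by rw [Fintype.card_coe, hT])
    (fun x y => R x y) ?_ ?_
  · have h2 := this.map_inj (fun a : X × T => ((a.1 : V), (a.2 : L))) ?_
      (fun a => if a.1 ∈ X ∧ a.2 ∈ T then (48 / k : ℝ) else 0) ?_ ?_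
    · refine h2.mono ?_ fun _ => le_rfl
      rintro _ ⟨_, ⟨f, hf, hR, rfl⟩, rfl⟩
      refine ⟨fun x => if h : x ∈ X then f ⟨x, h⟩ else (f (Classical.choice (by
        rw [← Fintype.card_pos_iff, Fintype.card_coe, hX]; exact hk))), ⟨?_, ?_, ?_⟩, ?_, ?_⟩
      · intro x hx
        rw [mem_coe] at hx
        simp only [dif_pos hx]; exact (f _).2
      · intro x hx y hy hxy
        rw [mem_coe] at hx hy
        simp only [dif_pos hx, dif_pos hy] at hxy
        have := hf.1 (Subtype.ext hxy)
        simpa using this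
      · intro y hy
        obtain ⟨x, hx⟩ := hf.2 ⟨y, hy⟩
        refine ⟨x, x.2, ?_⟩
        simp only [x.2, dif_pos, Subtype.coe_eta, hx]
      · intro x hx
        simp only [dif_pos hx]
        exact hR ⟨x, hx⟩
      · ext a
        simp only [mem_image, mem_univ, true_and, exists_exists_eq_and]
        constructor
        · rintro ⟨x, rfl⟩
          refine ⟨x, x.2, ?_⟩
          simp only [x.2, dif_pos, Subtype.coe_eta]
        · rintro ⟨x, hx, rfl⟩
          refine ⟨⟨x, hx⟩, ?_⟩
          simp only [dif_pos hx]
    · intro a b hab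
      simp only [Prod.mk.injEq] at hab
      exact Prod.ext (Subtype.ext hab.1) (Subtype.ext hab.2)
    · intro a
      exact if_pos ⟨a.1.2, a.2.2⟩
    · intro a; split_ifs <;> positivity
  · intro x
    refine (hR x x.2).trans (le_of_eq ?_)
    rw [← card_map (Function.Embedding.subtype _)]
    congr 2
    ext y
    simp [and_comm]
  · intro y
    refine (hR' y y.2).trans (le_of_eq ?_)
    rw [← card_map (Function.Embedding.subtype _)]
    congr 2
    ext y
    simp [and_comm]


/-! ## Part 4 : from labellings to missing edges -/

section Edge
variable {V L : Type} [Fintype V] [DecidableEq V] [Fintype L] [DecidableEq L]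

/-- missing edges inside the classes of a partial labelling -/
noncomputable def missO (G : SimpleGraph V) (O : Finset (V × L)) : Finset (Sym2 V) :=
  univ.filter (fun e => ¬ e.IsDiag ∧ e ∉ G.edgeSet ∧ ∃ t, ∀ v ∈ e, (v, t) ∈ O)

theorem mem_missO {G : SimpleGraph V} {O : Finset (V × L)} {e : Sym2 V} :
    e ∈ missO G O ↔ ¬ e.IsDiag ∧ e ∉ G.edgeSet ∧ ∃ t, ∀ v ∈ e, (v, t) ∈ O := by
  unfold missO
  rw [mem_filter]
  simp only [mem_univ, true_and]

/-- the labelling is functional -/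
def Func (O : Finset (V × L)) : Prop := ∀ v t t', (v, t) ∈ O → (v, t') ∈ O → t = t'

noncomputable def comps (D : Finset (Sym2 V)) : Finset (Finset V) :=
  (univ.filter (fun v => ∃ e ∈ D, v ∈ e)).image
    (fun v => univ.filter (fun u => (SimpleGraph.fromEdgeSet (D : Set (Sym2 V))).Reachable v u))

/-- placing components at labels -/
noncomputable def plc (D : Finset (Sym2 V)) (a : comps D → L) : Finset (V × L) :=
  univ.biUnion (fun c : comps D => c.1.image (fun v => (v, a c)))

theorem comps_disj (D : Finset (Sym2 V)) {c c' : Finset V} (hc : c ∈ comps D) (hc' : c' ∈ comps D)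
    {v : V} (hv : v ∈ c) (hv' : v ∈ c') : c = c' := by
  obtain ⟨x, -, rfl⟩ := mem_image.1 hc
  obtain ⟨y, -, rfl⟩ := mem_image.1 hc'
  simp only [mem_filter, mem_univ, true_and] at hv hv'
  ext u
  simp only [mem_filter, mem_univ, true_and]
  constructor
  · intro h; exact hv'.trans (hv.symm.trans h)
  · intro h; exact hv.trans (hv'.symm.trans h)

theorem comps_edge (D : Finset (Sym2 V)) {e : Sym2 V} (he : e ∈ D) : ∃ c ∈ comps D, ∀ v ∈ e, v ∈ c := by
  induction e with
  | h x y =>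
    refine ⟨_, mem_image_of_mem _ (mem_filter.2 ⟨mem_univ x, _, he, Sym2.mem_mk_left x y⟩), ?_⟩
    intro v hv
    rw [mem_filter]
    refine ⟨mem_univ _, ?_⟩
    rcases Sym2.mem_iff.1 hv with rfl | rfl
    · exact SimpleGraph.Reachable.refl _
    · by_cases hxy : x = v
      · subst hxy; exact SimpleGraph.Reachable.refl _
      · apply SimpleGraph.Adj.reachable
        rw [SimpleGraph.fromEdgeSet_adj]
        exact ⟨he, hxy⟩

theorem comps_card (D : Finset (Sym2 V)) (hD : ∀ e ∈ D, ¬ e.IsDiag) {c : Finset V} (hc : c ∈ comps D) :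
    2 ≤ #c := by
  obtain ⟨x, hx, rfl⟩ := mem_image.1 hc
  obtain ⟨-, e, he, hxe⟩ := mem_filter.1 hx
  obtain ⟨y, rfl⟩ := hxe
  have hxy : x ≠ y := fun h => hD _ he (Sym2.mk_isDiag_iff.2 h)
  have : 1 < #(univ.filter (fun u => (SimpleGraph.fromEdgeSet (D : Set (Sym2 V))).Reachable x u)) := by
    rw [one_lt_card]
    refine ⟨x, mem_filter.2 ⟨mem_univ _, SimpleGraph.Reachable.refl _⟩, y, mem_filter.2 ⟨mem_univ _, ?_⟩, hxy⟩
    apply SimpleGraph.Adj.reachable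
    rw [SimpleGraph.fromEdgeSet_adj]
    exact ⟨he, hxy⟩
  exact this

theorem comps_label (G : SimpleGraph V) (D : Finset (Sym2 V)) (O : Finset (V × L)) (hO : Func O)
    (hD : D ⊆ missO G O) {c : Finset V} (hc : c ∈ comps D) : ∃ t, ∀ v ∈ c, (v, t) ∈ O := by
  obtain ⟨x, hx, rfl⟩ := mem_image.1 hc
  obtain ⟨-, e, he, hxe⟩ := mem_filter.1 hx
  obtain ⟨-, -, t, ht⟩ := mem_missO.1 (hD he)
  refine ⟨t, fun v hv => ?_⟩
  rw [mem_filter] at hv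
  have h := hv.2
  rw [SimpleGraph.reachable_iff_reflTransGen] at h
  induction h with
  | refl => exact ht x hxe
  | @tail b d hb hbd ih =>
    have ih' := ih ⟨mem_univ _, (SimpleGraph.reachable_iff_reflTransGen _ _).2 hb⟩
    rw [SimpleGraph.fromEdgeSet_adj] at hbd
    obtain ⟨-, -, t', ht'⟩ := mem_missO.1 (hD hbd.1)
    have h1 := ht' b (Sym2.mem_mk_left _ _)
    rw [hO _ _ _ ih' h1]
    exact ht' d (Sym2.mem_mk_right _ _)

theorem edge_cover {P : Finset (V × L) → Prop} {g : Finset (V × L) → ℝ} (G : SimpleGraph V)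
    (h : Spr P g) (hF : ∀ O, P O → Func O) :
    Spr (fun S => ∃ O, P O ∧ S = missO G O) (fun D => ifp (∃ O, P O ∧ D ⊆ missO G O)
      (∑ a : comps D → L, g (plc D a))) := by
  have hg := h.nonneg
  refine (h.map_cover (missO G) (fun D => if (∃ O, P O ∧ D ⊆ missO G O) then
    univ.image (fun a : comps D → L => plc D a) else ∅) ?_).mono (fun _ h => h) ?_
  · intro O D hO hD
    rw [if_pos ⟨O, hO, hD⟩]
    choose a ha using fun c : comps D => comps_label G D O (hF O hO) hD c.2
    refine ⟨plc D a, mem_image_of_mem _ (mem_univ a), ?_⟩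
    intro x hx
    obtain ⟨c, -, hc⟩ := mem_biUnion.1 hx
    obtain ⟨v, hv, rfl⟩ := mem_image.1 hc
    exact ha c v hv
  · intro D
    by_cases hD : ∃ O, P O ∧ D ⊆ missO G O
    · rw [if_pos hD, ifp_pos hD]
      exact sum_image_le_of_nonneg (fun a _ => hg a) |>.trans (le_of_eq (by simp))
    · rw [if_neg hD, ifp_neg hD, sum_empty]

theorem plc_prod (D : Finset (Sym2 V)) (w : V × L → ℝ) :
    ∑ a : comps D → L, ∏ x ∈ plc D a, w x = ∏ c : comps D, ∑ t, ∏ v ∈ c.1, w (v, t) := by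
  rw [Finset.prod_univ_sum, Fintype.piFinset_univ]
  apply sum_congr rfl
  intro a _
  unfold plc
  rw [prod_biUnion]
  · apply prod_congr rfl
    intro c _
    rw [prod_image]
    intro x _ y _ hxy
    exact (Prod.mk.inj hxy).1
  · intro c _ c' _ hcc
    rw [Function.onFun, disjoint_left]
    intro x hx hx'
    obtain ⟨v, hv, rfl⟩ := mem_image.1 hx
    obtain ⟨v', hv', hvv⟩ := mem_image.1 hx'
    apply hcc
    apply Subtype.ext
    have : v' = v := (Prod.mk.inj hvv).1
    subst this
    exact comps_disj D c.2 c'.2 hv hv'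

noncomputable def edin (D : Finset (Sym2 V)) (c : Finset V) : Finset (Sym2 V) :=
  D.filter (fun e => ∀ v ∈ e, v ∈ c)

theorem card_le_sum_edin (D : Finset (Sym2 V)) : #D ≤ ∑ c : comps D, #(edin D c.1) := by
  have : D ⊆ univ.biUnion (fun c : comps D => edin D c.1) := by
    intro e he
    obtain ⟨c, hc, h⟩ := comps_edge D he
    exact mem_biUnion.2 ⟨⟨c, hc⟩, mem_univ _, mem_filter.2 ⟨he, h⟩⟩
  exact (card_le_card this).trans card_biUnion_le

/-- ordered missing pairs in `U` -/
noncomputable def mis (G : SimpleGraph V) (U : Finset V) : ℕ :=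
  #((U ×ˢ U).filter (fun p => p.1 ≠ p.2 ∧ ¬ G.Adj p.1 p.2))

theorem edin_mis (G : SimpleGraph V) (D : Finset (Sym2 V)) (c : Finset V)
    (hD : ∀ e ∈ D, ¬ e.IsDiag ∧ e ∉ G.edgeSet) : 2 * #(edin D c) ≤ mis G c := by
  set F := ((c ×ˢ c).filter (fun p => p.1 ≠ p.2 ∧ ¬ G.Adj p.1 p.2)) with hF
  have h1 : #(F.filter (fun p => s(p.1,p.2) ∈ edin D c)) = ∑ e ∈ edin D c,
      #((F.filter (fun p => s(p.1,p.2) ∈ edin D c)).filter (fun p => s(p.1,p.2) = e)) := by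
    apply card_eq_sum_card_fiberwise
    intro p hp
    exact (mem_filter.1 hp).2
  have h2 : ∑ e ∈ edin D c, 2 ≤ ∑ e ∈ edin D c,
      #((F.filter (fun p => s(p.1,p.2) ∈ edin D c)).filter (fun p => s(p.1,p.2) = e)) := by
    apply sum_le_sum
    intro e he
    induction e with
    | h x y =>
      have he' := mem_filter.1 he
      have hxy := hD _ he'.1
      have hne : x ≠ y := fun h => hxy.1 (Sym2.mk_isDiag_iff.2 h)
      have hx := he'.2 x (Sym2.mem_mk_left _ _)
      have hy := he'.2 y (Sym2.mem_mk_right _ _)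
      have hadj : ¬ G.Adj x y := hxy.2
      have : 1 < #((F.filter (fun p => s(p.1,p.2) ∈ edin D c)).filter (fun p => s(p.1,p.2) = s(x,y))) := by
        rw [one_lt_card]
        refine ⟨(x,y), ?_, (y,x), ?_, fun h => hne (Prod.mk.inj h).1⟩
        · simp only [hF, mem_filter, mem_product]
          exact ⟨⟨⟨⟨hx, hy⟩, hne, hadj⟩, he⟩, trivial⟩
        · simp only [hF, mem_filter, mem_product]
          exact ⟨⟨⟨⟨hy, hx⟩, hne.symm, fun h => hadj h.symm⟩, Sym2.eq_swap ▸ he⟩, Sym2.eq_swap⟩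
      exact this
  rw [sum_const, smul_eq_mul, mul_comm] at h2
  calc _ ≤ _ := h2
    _ = _ := h1.symm
    _ ≤ _ := card_le_card (filter_subset _ _)

/-- number of non-neighbours of `v` in `U`. -/
noncomputable def nn (G : SimpleGraph V) (U : Finset V) (v : V) : ℕ :=
  #(U.filter (fun u => v ≠ u ∧ ¬ G.Adj v u))

theorem mis_eq_sum (G : SimpleGraph V) (U : Finset V) : mis G U = ∑ v ∈ U, nn G U v := by
  unfold mis nn
  rw [card_filter, sum_product]
  apply sum_congr rfl
  intro v _
  rw [card_filter]

theorem nn_mono (G : SimpleGraph V) {U U' : Finset V} (h : U ⊆ U') (v : V) : nn G U v ≤ nn G U' v :=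
  card_le_card (filter_subset_filter _ h)

theorem nn_lt (G : SimpleGraph V) {U : Finset V} {v : V} (hv : v ∈ U) : nn G U v + 1 ≤ #U := by
  have : nn G U v ≤ #(U.erase v) := by
    apply card_le_card
    intro u hu
    rw [mem_filter] at hu
    exact mem_erase.2 ⟨hu.2.1.symm, hu.1⟩
  have h2 := card_erase_add_one hv
  omega

/-- good tiles -/
def GoodTile (G : SimpleGraph V) (s : ℕ) (T : Finset V) : Prop :=
  (∀ v ∈ T, nn G T v + 1 ≤ s) ∨ (∃ x ∈ T, ∀ v ∈ T.erase x, nn G (T.erase x) v + 2 ≤ s)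

theorem mis_one (G : SimpleGraph V) (s : ℕ) (U : Finset V) (h : ∀ v ∈ U, nn G U v + 1 ≤ s) :
    mis G U ≤ s * (#U - 1) := by
  rw [mis_eq_sum]
  rcases Nat.lt_or_ge #U s with hs | hs
  · calc _ ≤ ∑ v ∈ U, (#U - 1) := sum_le_sum fun v hv => by have := nn_lt G hv; omega
      _ = #U * (#U - 1) := by rw [sum_const, smul_eq_mul]
      _ ≤ _ := Nat.mul_le_mul_right _ hs.le
  · calc _ ≤ ∑ v ∈ U, (s - 1) := sum_le_sum fun v hv => by have := h v hv; omega
      _ = #U * (s - 1) := by rw [sum_const, smul_eq_mul]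
      _ ≤ _ := by
        rw [Nat.mul_sub, Nat.mul_sub, mul_comm s]; omega

theorem mis_good (G : SimpleGraph V) (s : ℕ) (T U : Finset V) (hT : GoodTile G s T) (hU : U ⊆ T) :
    mis G U ≤ s * (#U - 1) := by
  rcases hT with h | ⟨x, hx, h⟩
  · exact mis_one G s U fun v hv => by have := h v (hU hv); have := nn_mono G hU v; omega
  · by_cases hxU : x ∈ U
    · have hsub : U.erase x ⊆ T.erase x := erase_subset_erase _ hU
      rw [mis_eq_sum, ← add_sum_erase _ _ hxU]
      have h1 : nn G U x ≤ #U - 1 := by have := nn_lt G hxU; omega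
      have h2 : ∀ v ∈ U.erase x, nn G U v ≤ s - 1 := by
        intro v hv
        have h3 := h v (hsub hv)
        have h4 := nn_mono G hsub v
        have h5 : nn G U v ≤ nn G (U.erase x) v + 1 := by
          unfold nn
          calc _ ≤ #(insert x ((U.erase x).filter (fun u => v ≠ u ∧ ¬ G.Adj v u))) := by
                apply card_le_card
                intro u hu
                rw [mem_filter] at hu
                rw [mem_insert, mem_filter, mem_erase]
                tauto
            _ ≤ _ := card_insert_le _ _
        omega
      have h3 : ∑ v ∈ U.erase x, nn G U v ≤ ∑ v ∈ U.erase x, (s - 1) := sum_le_sum h2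
      rw [sum_const, smul_eq_mul, card_erase_of_mem hxU] at h3
      by_cases hs : 1 ≤ s
      · calc _ ≤ (#U - 1) + (#U - 1) * (s - 1) := by omega
          _ = s * (#U - 1) := by
            obtain ⟨s', rfl⟩ := Nat.exists_eq_add_of_le' hs
            simp; ring
      · have : #U - 1 = 0 := by
          by_contra hne
          obtain ⟨v, hv⟩ : (U.erase x).Nonempty := by
            rw [← card_pos, card_erase_of_mem hxU]; omega
          have := h v (hsub hv); omega
        rw [this] at h1 h3 ⊢
        omega
    · have hsub : U ⊆ T.erase x := fun u hu => mem_erase.2 ⟨fun h => hxU (h ▸ hu), hU hu⟩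
      exact mis_one G s U fun v hv => by
        have := h v (hsub hv); have := nn_mono G hsub v; omega

/-- class of label `t` -/
noncomputable def fib (O : Finset (V × L)) (t : L) : Finset V := univ.filter (fun v => (v, t) ∈ O)

/-- good total labellings relative to a root assignment -/
def GoodLab (G : SimpleGraph V) (r s : ℕ) (root : V → Option L) (O : Finset (V × L)) : Prop :=
  Func O ∧ (∀ v, ∃ t, (v, t) ∈ O) ∧ (∀ t, #(fib O t) = r) ∧ (∀ t, GoodTile G s (fib O t)) ∧
    (∀ t, ∀ u ∈ fib O t, ∀ v ∈ fib O t, u ≠ v → root u ≠ none → root v ≠ none →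
      (∀ x ∈ fib O t, u ≠ x → G.Adj u x) ∨ (∀ x ∈ fib O t, v ≠ x → G.Adj v x))

/-- the weight -/
noncomputable def rw8 (root : V → Option L) (κ : ℝ) (a : V × L) : ℝ :=
  κ + (if root a.1 = some a.2 then 1 else 0)

theorem rw8_sum (root : V → Option L) {κ : ℝ} (hκ : 0 ≤ κ) (c : Finset V) (hc : 2 ≤ #c)
    (hroot : ∀ u ∈ c, ∀ v ∈ c, u ≠ v → root u = none ∨ root v = none) :
    ∑ t : L, ∏ v ∈ c, rw8 root κ (v, t) ≤ κ ^ (#c - 1) * (κ * Fintype.card L + 1) := by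
  obtain ⟨v0, hv0, hr⟩ : ∃ v0 ∈ c, ∀ v ∈ c.erase v0, root v = none := by
    by_cases h : ∃ v0 ∈ c, root v0 ≠ none
    · obtain ⟨v0, hv0, h0⟩ := h
      refine ⟨v0, hv0, fun v hv => ?_⟩
      rw [mem_erase] at hv
      exact (hroot v hv.2 v0 hv0 hv.1).resolve_right h0
    · push Not at h
      obtain ⟨v0, hv0⟩ : c.Nonempty := card_pos.1 (by omega)
      exact ⟨v0, hv0, fun v hv => h v (mem_of_mem_erase hv)⟩
  have e : ∀ t : L, ∏ v ∈ c, rw8 root κ (v, t) = κ ^ (#c - 1) * rw8 root κ (v0, t) := by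
    intro t
    rw [← mul_prod_erase _ _ hv0, mul_comm]
    congr 1
    rw [prod_congr rfl (g := fun _ => κ), prod_const, card_erase_of_mem hv0]
    intro v hv
    unfold rw8
    rw [hr v hv]
    simp
  simp only [e]
  rw [← mul_sum]
  apply mul_le_mul_of_nonneg_left _ (by positivity)
  unfold rw8
  rw [sum_add_distrib, sum_const, card_univ, nsmul_eq_mul, mul_comm]
  gcongr
  dsimp only
  rw [← sum_filter, sum_const, nsmul_eq_mul, mul_one]
  have : #(univ.filter (fun t : L => root v0 = some t)) ≤ 1 := by
    rw [card_le_one]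
    intro a ha b hb
    rw [mem_filter] at ha hb
    exact Option.some_injective _ (ha.2.symm.trans hb.2)
  exact_mod_cast this

theorem edge_spread (G : SimpleGraph V) (r s : ℕ) (hs : 1 ≤ s) (root : V → Option L) (A : ℝ) (hA : 0 ≤ A) (n : ℕ)
    (hn : (A+1)^2 ≤ n) (hL : Fintype.card L ≤ n)
    (h : Spr (GoodLab G r s root) (fun D => ∏ a ∈ D, rw8 root (A / n) a)) :
    Spr (fun S => ∃ O, GoodLab G r s root O ∧ S = missO G O)
      (fun D => (((A+1)^2 / n : ℝ) ^ (2 / (s:ℝ))) ^ #D) := by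
  have hn0 : (0:ℝ) < n := lt_of_lt_of_le (by positivity) hn
  set x : ℝ := (A+1)^2 / n with hx
  have hx0 : 0 < x := by positivity
  have hx1 : x ≤ 1 := by rw [hx, div_le_one hn0]; exact hn
  have hq0 : 0 ≤ x ^ (2 / (s:ℝ)) := Real.rpow_nonneg hx0.le _
  have hq1 : x ^ (2 / (s:ℝ)) ≤ 1 := Real.rpow_le_one hx0.le hx1 (by positivity)
  refine (edge_cover G h fun O hO => hO.1).mono (fun _ h => h) fun D => ?_
  by_cases hD : ∃ O, GoodLab G r s root O ∧ D ⊆ missO G O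
  · rw [ifp_pos hD]
    obtain ⟨O, ⟨hF, -, hr, hgood, hroot⟩, hDO⟩ := hD
    have hDe : ∀ e ∈ D, ¬ e.IsDiag ∧ e ∉ G.edgeSet := fun e he =>
      ⟨(mem_missO.1 (hDO he)).1, (mem_missO.1 (hDO he)).2.1⟩
    rw [plc_prod]
    calc _ ≤ ∏ c : comps D, (x ^ (2 / (s:ℝ))) ^ #(edin D c.1) := by
          apply prod_le_prod
          · intro c _
            exact sum_nonneg fun t _ => prod_nonneg fun v _ => by
              unfold rw8; split_ifs <;> positivity
          · intro c _
            obtain ⟨t, ht⟩ := comps_label G D O hF hDO c.2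
            have hsub : c.1 ⊆ fib O t := fun v hv => mem_filter.2 ⟨mem_univ _, ht v hv⟩
            have hc2 := comps_card D (fun e he => (hDe e he).1) c.2
            have hm1 := edin_mis G D c.1 hDe
            have hm2 := mis_good G s _ c.1 (hgood t) hsub
            have hmiss : ∀ u ∈ c.1, ∃ x ∈ fib O t, u ≠ x ∧ ¬ G.Adj u x := by
              intro u hu
              obtain ⟨y, hy, hyc⟩ := mem_image.1 c.2
              -- u is incident to some edge of D
              have : ∃ z, (SimpleGraph.fromEdgeSet (D : Set (Sym2 V))).Adj u z := by
                obtain ⟨z, hz, hzu⟩ := exists_mem_ne (lt_of_lt_of_le one_lt_two hc2) u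
                have h1 : (SimpleGraph.fromEdgeSet (D : Set (Sym2 V))).Reachable u z := by
                  rw [← hyc, mem_filter] at hu hz
                  exact hu.2.symm.trans hz.2
                obtain ⟨p⟩ := h1
                cases p with
                | nil => exact absurd rfl hzu
                | cons hadj _ => exact ⟨_, hadj⟩
              obtain ⟨z, hz⟩ := this
              have hz' := SimpleGraph.fromEdgeSet_adj _ |>.1 hz
              have hzc : z ∈ c.1 := by
                rw [← hyc, mem_filter] at hu ⊢
                exact ⟨mem_univ _, hu.2.trans hz.reachable⟩
              exact ⟨z, hsub hzc, hz'.2, (hDe _ hz'.1).2⟩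
            have hsum := rw8_sum (L := L) root (κ := A / n) (by positivity) c.1 hc2 (by
              intro u hu v hv huv
              by_contra hcon
              push Not at hcon
              rcases hroot t u (hsub hu) v (hsub hv) huv hcon.1 hcon.2 with h | h
              · obtain ⟨x, hx, h1, h2⟩ := hmiss u hu
                exact h2 (h x hx h1)
              · obtain ⟨x, hx, h1, h2⟩ := hmiss v hv
                exact h2 (h x hx h1))
            refine hsum.trans ?_
            have hLn : A / n * Fintype.card L + 1 ≤ A + 1 := by
              have : (Fintype.card L : ℝ) ≤ n := by exact_mod_cast hL
              have : A / n * Fintype.card L ≤ A / n * n := by gcongr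
              rw [div_mul_cancel₀ _ hn0.ne'] at this
              linarith
            have h1 : (A / n) ^ (#c.1 - 1) * (A / n * Fintype.card L + 1) ≤ x ^ (#c.1 - 1) := by
              calc _ ≤ (A / n) ^ (#c.1 - 1) * (A + 1) ^ (#c.1 - 1) := by
                    apply mul_le_mul_of_nonneg_left _ (by positivity)
                    refine hLn.trans ?_
                    exact le_self_pow₀ (by linarith) (by omega)
                _ = (A / n * (A+1)) ^ (#c.1 - 1) := by rw [mul_pow]
                _ ≤ _ := by
                    apply pow_le_pow_left₀ (by positivity)
                    rw [hx, div_mul_eq_mul_div]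
                    apply div_le_div_of_nonneg_right _ hn0.le
                    nlinarith
            refine h1.trans ?_
            rw [← Real.rpow_natCast, ← Real.rpow_natCast, ← Real.rpow_mul hx0.le]
            apply Real.rpow_le_rpow_of_exponent_ge hx0 hx1
            have hs0 : (0:ℝ) < s := by exact_mod_cast hs
            rw [div_mul_eq_mul_div, div_le_iff₀ hs0]
            have : 2 * #(edin D c.1) ≤ (#c.1 - 1) * s := by rw [mul_comm (#c.1 - 1)]; omega
            exact_mod_cast this
      _ = (x ^ (2 / (s:ℝ))) ^ (∑ c : comps D, #(edin D c.1)) := by rw [prod_pow_eq_pow_sum]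
      _ ≤ _ := pow_le_pow_of_le_one hq0 hq1 (card_le_sum_edin D)
  · rw [ifp_neg hD]; positivity

end Edge

theorem factor_of_missO {n r : ℕ} {L : Type} [Fintype L] [DecidableEq L] (G : SimpleGraph (Fin n)) (s : ℕ)
    (root : Fin n → Option L) (O : Finset (Fin n × L)) (hO : GoodLab G r s root O) (W : Finset (Sym2 (Fin n)))
    (hW : missO G O ⊆ W) : HasCliqueFactor (G ⊔ SimpleGraph.fromEdgeSet (W : Set (Sym2 (Fin n)))) r := by
  obtain ⟨hF, hT, hr, -, -⟩ := hO
  choose ℓ hℓ using hT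
  refine ⟨Finpartition.ofSetoid (Setoid.ker ℓ), ?_⟩
  intro c hc
  have : ∃ v, c = fib O (ℓ v) := by
    have hne := (Finpartition.ofSetoid (Setoid.ker ℓ)).nonempty_of_mem_parts hc
    obtain ⟨v, hv⟩ := hne
    refine ⟨v, ?_⟩
    rw [← (Finpartition.ofSetoid (Setoid.ker ℓ)).part_eq_of_mem hc hv]
    ext u
    rw [Finpartition.mem_part_ofSetoid_iff_rel, fib, mem_filter]
    change ℓ v = ℓ u ↔ _
    constructor
    · intro h; rw [h]; exact ⟨mem_univ _, hℓ u⟩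
    · rintro ⟨-, h⟩; exact hF u _ _ h (hℓ u)
  obtain ⟨v, rfl⟩ := this
  refine SimpleGraph.isNClique_iff _ |>.2 ⟨?_, hr _⟩
  intro x hx y hy hxy
  rw [mem_coe, fib, mem_filter] at hx hy
  rw [SimpleGraph.sup_adj]
  by_cases h : G.Adj x y
  · exact Or.inl h
  · right
    rw [SimpleGraph.fromEdgeSet_adj]
    refine ⟨hW ?_, hxy⟩
    rw [mem_missO]
    refine ⟨fun h => hxy (Sym2.mk_isDiag_iff.1 h), h, ℓ v, ?_⟩
    intro z hz
    rcases Sym2.mem_iff.1 hz with rfl | rfl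
    · exact hx.2
    · exact hy.2

/-- The main random step. -/
theorem main_random {δ : ℝ} (hδ : 0 < δ) : ∃ n₀ : ℕ, ∀ n : ℕ, n₀ ≤ n → ∀ (L : Type) [Fintype L] [DecidableEq L]
    (G : SimpleGraph (Fin n)) (r s : ℕ) (root : Fin n → Option L) (A p : ℝ), 1 ≤ s → 0 ≤ A →
    (A+1)^2 ≤ n → Fintype.card L ≤ n →
    Spr (GoodLab G r s root) (fun D => ∏ a ∈ D, rw8 root (A / n) a) →
    100 * (((A+1)^2 / n : ℝ) ^ (2 / (s:ℝ)) * Real.log n) ≤ p → p ≤ 1 →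
    1 - δ ≤ PB (EE n) p (fun W => HasCliqueFactor (G ⊔ SimpleGraph.fromEdgeSet (W : Set (Sym2 (Fin n)))) r) := by
  obtain ⟨n₀, h₀⟩ := spread_threshold hδ
  refine ⟨n₀, fun n hn L _ _ G r s root A p hs hA hAn hL h hp hp1 => ?_⟩
  have hn0 : (0:ℝ) < n := lt_of_lt_of_le (by positivity) hAn
  have h1 := edge_spread G r s hs root A hA n hAn hL h
  have hsub : ∀ S, (∃ O, GoodLab G r s root O ∧ S = missO G O) → S ⊆ EE n ∧ #S ≤ n^2 := by
    rintro _ ⟨O, -, rfl⟩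
    have : missO G O ⊆ EE n := by
      intro e he
      exact mem_filter.2 ⟨mem_univ _, (mem_missO.1 he).1⟩
    refine ⟨this, (card_le_card this).trans ?_⟩
    rw [card_EE]
    exact Nat.choose_le_pow n 2
  obtain ⟨μ, hμ, hm, hP⟩ := h1.toSubSpread (EE n) hsub
  have hq : 0 < ((A+1)^2 / n : ℝ) ^ (2 / (s:ℝ)) := Real.rpow_pos_of_pos (by positivity) _
  have hp0 : 0 ≤ p := by
    refine le_trans ?_ hp
    have : 0 ≤ Real.log n := Real.log_natCast_nonneg n
    positivity
  refine (h₀ n hn (EE n) _ p μ hq hμ hm hp hp1).trans ?_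
  apply PB_mono hp0 hp1
  rintro W - ⟨S, hS, hSW⟩
  obtain ⟨O, hO, rfl⟩ := hP S hS
  exact factor_of_missO G s root O hO W hSW


/-! ## Part 5 : counting complete bipartite configurations, and the greedy job lemma -/

theorem pow_mean {ι : Type*} (S : Finset ι) (f : ι → ℝ) (hf : ∀ i ∈ S, 0 ≤ f i) (M : ℝ) (hM : 0 ≤ M)
    (h : M * #S ≤ ∑ i ∈ S, f i) (a : ℕ) : M ^ a * #S ≤ ∑ i ∈ S, f i ^ a := by
  rcases S.eq_empty_or_nonempty with rfl | hS
  · simp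
  have hS' : (0:ℝ) < #S := by exact_mod_cast card_pos.2 hS
  have h1 := Real.pow_arith_mean_le_arith_mean_pow S (fun _ => (1 / #S : ℝ)) f (fun _ _ => by positivity)
    (by rw [sum_const, nsmul_eq_mul]; field_simp) hf a
  rw [← mul_sum, ← mul_sum] at h1
  have h2 : M ≤ 1 / #S * ∑ i ∈ S, f i := by
    rw [div_mul_eq_mul_div, one_mul, le_div_iff₀ hS']; exact h
  have h3 := (pow_le_pow_left₀ hM h2 a).trans h1
  rwa [div_mul_eq_mul_div, one_mul, le_div_iff₀ hS'] at h3

section Count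
variable {V : Type} [Fintype V] [DecidableEq V]

theorem card_pow_filter {b : ℕ} (p : V → Prop) :
    #(univ.filter (fun y : Fin b → V => ∀ j, p (y j))) = #(univ.filter p) ^ b := by
  rw [← Fintype.card_piFinset_const]
  congr 1
  ext y
  simp [Fintype.mem_piFinset]

theorem kab_count0 (R : V → V → Prop) (c : ℝ) (hc : 0 ≤ c) (a b : ℕ)
    (h : c * (Fintype.card V : ℝ) ^ 2 ≤ #(univ.filter (fun p : V × V => R p.1 p.2))) :
    c ^ (a * b) * (Fintype.card V : ℝ) ^ (a + b) ≤
      #(univ.filter (fun p : (Fin a → V) × (Fin b → V) => ∀ i j, R (p.1 i) (p.2 j))) := by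
  set n : ℝ := (Fintype.card V : ℝ) with hn
  have hn0 : 0 ≤ n := by positivity
  have e1 : (#(univ.filter (fun p : V × V => R p.1 p.2)) : ℝ) = ∑ u : V, (#(univ.filter (fun v => R u v)) : ℝ) := by
    rw [← univ_product_univ, card_filter, sum_product]
    push_cast
    exact sum_congr rfl fun u _ => by rw [card_filter]; push_cast; rfl
  have s1 : (c * n) ^ b * (#(univ : Finset V) : ℝ) ≤ ∑ u : V, (#(univ.filter (fun v => R u v)) : ℝ) ^ b := by
    apply pow_mean _ _ (fun _ _ => by positivity) _ (by positivity)
    rw [← e1, card_univ, ← hn]; linarith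
  have e2 : ∑ u : V, (#(univ.filter (fun v => R u v)) : ℝ) ^ b =
      ∑ y : Fin b → V, (#(univ.filter (fun u => ∀ j, R u (y j))) : ℝ) := by
    have := Finset.sum_card_bipartiteAbove_eq_sum_card_bipartiteBelow (s := (univ : Finset V))
      (t := (univ : Finset (Fin b → V))) (fun u y => ∀ j, R u (y j))
    unfold Finset.bipartiteAbove Finset.bipartiteBelow at this
    have h2 : ∀ u : V, (#(univ.filter (fun v => R u v))) ^ b = #(univ.filter (fun y : Fin b → V => ∀ j, R u (y j))) :=
      fun u => (card_pow_filter (fun v => R u v)).symm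
    calc _ = ((∑ u : V, (#(univ.filter (fun v => R u v))) ^ b : ℕ) : ℝ) := by push_cast; rfl
      _ = _ := by rw [sum_congr rfl fun u _ => h2 u, this]; push_cast; rfl
  have s2 : (c ^ b * n) ^ a * (#(univ : Finset (Fin b → V)) : ℝ) ≤
      ∑ y : Fin b → V, (#(univ.filter (fun u => ∀ j, R u (y j))) : ℝ) ^ a := by
    apply pow_mean _ _ (fun _ _ => by positivity) _ (by positivity)
    rw [← e2]
    refine le_trans (le_of_eq ?_) s1
    rw [card_univ, card_univ, Fintype.card_fun, Fintype.card_fin, ← hn]; push_cast; rw [← hn]; ring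
  have e3 : (#(univ.filter (fun p : (Fin a → V) × (Fin b → V) => ∀ i j, R (p.1 i) (p.2 j))) : ℝ) =
      ∑ y : Fin b → V, (#(univ.filter (fun u => ∀ j, R u (y j))) : ℝ) ^ a := by
    rw [← univ_product_univ, card_filter, sum_product_right]
    push_cast
    refine sum_congr rfl fun y _ => ?_
    have h5 := card_pow_filter (b := a) (fun u => ∀ j, R u (y j))
    have h6 : ((#(univ.filter (fun x : Fin a → V => ∀ i j, R (x i) (y j))) : ℕ) : ℝ) =
        ((#(univ.filter (fun u => ∀ j, R u (y j))) ^ a : ℕ) : ℝ) := by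
      congr 1
      convert h5
    rw [Nat.cast_pow] at h6
    rw [← h6, card_filter]; push_cast; rfl
  rw [e3]
  refine le_trans (le_of_eq ?_) s2
  rw [card_univ, Fintype.card_fun, Fintype.card_fin]; push_cast; rw [← hn]; ring

theorem noninj_count {κ : Type} [Fintype κ] (hV : 0 < Fintype.card V) :
    Fintype.card V * #(univ.filter (fun τ : κ → V => ¬ Function.Injective τ)) ≤
      Fintype.card κ ^ 2 * Fintype.card V ^ Fintype.card κ := by
  have h1 : univ.filter (fun τ : κ → V => ¬ Function.Injective τ) ⊆
      (univ.filter (fun p : κ × κ => p.1 ≠ p.2)).biUnion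
        (fun p => univ.filter (fun τ : κ → V => τ p.1 = τ p.2)) := by
    intro τ hτ
    have hτ' := (mem_filter.1 hτ).2
    unfold Function.Injective at hτ'
    push Not at hτ'
    obtain ⟨i, j, h, hij⟩ := hτ'
    exact mem_biUnion.2 ⟨(i, j), mem_filter.2 ⟨mem_univ _, hij⟩, mem_filter.2 ⟨mem_univ _, h⟩⟩
  have h2 : ∀ p ∈ univ.filter (fun p : κ × κ => p.1 ≠ p.2),
      Fintype.card V * #(univ.filter (fun τ : κ → V => τ p.1 = τ p.2)) ≤ Fintype.card V ^ Fintype.card κ := by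
    intro p hp
    rw [← Fintype.card_fun, ← card_univ (α := V), ← card_product, ← card_univ]
    apply card_le_card_of_injOn (fun q => Function.update q.2 p.1 q.1) (fun _ _ => mem_univ _)
    rintro ⟨v, τ⟩ h ⟨v', τ'⟩ h' he
    simp only [coe_product, Set.mem_prod, mem_coe, mem_filter, mem_univ, true_and] at h h'
    simp only [mem_filter, mem_univ, true_and] at hp
    simp only at he
    have a1 : v = v' := by have := congrFun he p.1; simpa using this
    have a2 : ∀ j, j ≠ p.1 → τ j = τ' j := fun j hj => by
      have := congrFun he j; simpa [hj] using this
    have a3 : τ = τ' := by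
      ext j
      by_cases hj : j = p.1
      · rw [hj, h, h', a2 _ (Ne.symm hp)]
      · exact a2 j hj
    rw [a1, a3]
  calc _ ≤ Fintype.card V * ∑ p ∈ univ.filter (fun p : κ × κ => p.1 ≠ p.2),
        #(univ.filter (fun τ : κ → V => τ p.1 = τ p.2)) :=
        Nat.mul_le_mul_left _ ((card_le_card h1).trans card_biUnion_le)
    _ = ∑ p ∈ univ.filter (fun p : κ × κ => p.1 ≠ p.2),
        Fintype.card V * #(univ.filter (fun τ : κ → V => τ p.1 = τ p.2)) := mul_sum _ _ _
    _ ≤ ∑ p ∈ univ.filter (fun p : κ × κ => p.1 ≠ p.2), Fintype.card V ^ Fintype.card κ := sum_le_sum h2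
    _ = #(univ.filter (fun p : κ × κ => p.1 ≠ p.2)) * _ := by rw [sum_const, smul_eq_mul]
    _ ≤ _ := by
      apply Nat.mul_le_mul_right
      refine (card_filter_le _ _).trans ?_
      rw [card_univ, Fintype.card_prod, sq]

/-- if there are many tuples, then there are many injective ones -/
theorem inj_options {κ : Type} [Fintype κ] (c : ℝ) (hc : 0 < c) (P : (κ → V) → Prop)
    (hn : 2 * (Fintype.card κ : ℝ) ^ 2 / c ≤ Fintype.card V) (hV : 0 < Fintype.card V)
    (h : c * (Fintype.card V : ℝ) ^ Fintype.card κ ≤ #(univ.filter P)) :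
    c / 2 * (Fintype.card V : ℝ) ^ Fintype.card κ ≤ #(univ.filter (fun τ => Function.Injective τ ∧ P τ)) := by
  have h1 : (#(univ.filter P) : ℝ) ≤ #(univ.filter (fun τ => Function.Injective τ ∧ P τ)) +
      #(univ.filter (fun τ : κ → V => ¬ Function.Injective τ)) := by
    norm_cast
    refine le_trans (card_le_card ?_) (card_union_le _ _)
    intro τ
    simp only [mem_filter, mem_univ, true_and, mem_union]
    tauto
  have h2 := noninj_count (κ := κ) hV
  have h3 : (Fintype.card V : ℝ) * #(univ.filter (fun τ : κ → V => ¬ Function.Injective τ)) ≤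
      (Fintype.card κ : ℝ) ^ 2 * (Fintype.card V : ℝ) ^ Fintype.card κ := by exact_mod_cast h2
  have hV' : (0:ℝ) < Fintype.card V := by exact_mod_cast hV
  rw [div_le_iff₀ hc] at hn
  have h4 : (#(univ.filter (fun τ : κ → V => ¬ Function.Injective τ)) : ℝ) ≤
      c / 2 * (Fintype.card V : ℝ) ^ Fintype.card κ := by
    have : (Fintype.card V : ℝ) * #(univ.filter (fun τ : κ → V => ¬ Function.Injective τ)) ≤
        (Fintype.card V : ℝ) * (c / 2 * (Fintype.card V : ℝ) ^ Fintype.card κ) := by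
      refine h3.trans ?_
      have : 0 ≤ (Fintype.card V : ℝ) ^ Fintype.card κ := by positivity
      nlinarith
    exact le_of_mul_le_mul_left this hV'
  linarith

/-- copies of `K_{a,b}` between `X` and `Y`. -/
def Kab (X Y : Finset V) (R : V → V → Prop) {a b : ℕ} (τ : Fin a ⊕ Fin b → V) : Prop :=
  (∀ i, τ (Sum.inl i) ∈ X) ∧ (∀ j, τ (Sum.inr j) ∈ Y) ∧ ∀ i j, R (τ (Sum.inl i)) (τ (Sum.inr j))

theorem kab_count (X Y : Finset V) (R : V → V → Prop) (c : ℝ) (hc : 0 ≤ c) (a b : ℕ)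
    (hV : 0 < Fintype.card V)
    (h : c * (Fintype.card V : ℝ) ^ 2 ≤ #((X ×ˢ Y).filter (fun p => R p.1 p.2))) :
    c ^ ((a+1) * (b+1)) * (Fintype.card V : ℝ) ^ (a + b) ≤
      #(univ.filter (fun τ : Fin a ⊕ Fin b → V => Kab X Y R τ)) := by
  have hV' : (0:ℝ) < Fintype.card V := by exact_mod_cast hV
  have h1 := kab_count0 (fun u v => u ∈ X ∧ v ∈ Y ∧ R u v) c hc (a+1) (b+1) (by
    refine h.trans ?_
    norm_cast
    apply card_le_card
    intro p; simp only [mem_filter, mem_product, mem_univ, true_and]; tauto)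
  have h2 : #(univ.filter (fun p : (Fin (a+1) → V) × (Fin (b+1) → V) =>
      ∀ i j, p.1 i ∈ X ∧ p.2 j ∈ Y ∧ R (p.1 i) (p.2 j))) ≤
      #(univ.filter (fun τ : Fin a ⊕ Fin b → V => Kab X Y R τ)) * (Fintype.card V) ^ 2 := by
    rw [sq, ← Fintype.card_prod, ← card_univ (α := V × V), ← card_product]
    apply card_le_card_of_injOn (fun p => (Sum.elim (fun i => p.1 (Fin.succ i)) (fun j => p.2 (Fin.succ j)), (p.1 0, p.2 0)))
    · intro p hp
      simp only [coe_filter, mem_univ, true_and, Set.mem_setOf_eq] at hp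
      simp only [coe_product, Set.mem_prod, mem_coe, mem_filter, mem_univ, true_and, and_true]
      exact ⟨fun i => (hp _ 0).1, fun j => (hp 0 _).2.1, fun i j => (hp _ _).2.2⟩
    · rintro ⟨p1, p2⟩ - ⟨q1, q2⟩ - he
      simp only [Prod.mk.injEq] at he
      obtain ⟨e1, e2, e3⟩ := he
      congr 1
      · funext i
        refine Fin.cases e2 (fun i => ?_) i
        exact congrFun e1 (Sum.inl i)
      · funext i
        refine Fin.cases e3 (fun i => ?_) i
        exact congrFun e1 (Sum.inr i)
  have h3 : (#(univ.filter (fun p : (Fin (a+1) → V) × (Fin (b+1) → V) =>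
      ∀ i j, p.1 i ∈ X ∧ p.2 j ∈ Y ∧ R (p.1 i) (p.2 j))) : ℝ) ≤
      #(univ.filter (fun τ : Fin a ⊕ Fin b → V => Kab X Y R τ)) * (Fintype.card V : ℝ) ^ 2 := by exact_mod_cast h2
  have h4 := h1.trans (le_trans (le_of_eq (by congr!)) h3)
  rw [show a + 1 + (b+1) = a + b + 2 by ring, pow_add, ← mul_assoc] at h4
  exact le_of_mul_le_mul_right h4 (by positivity)

theorem kab_options (X Y : Finset V) (R : V → V → Prop) (c : ℝ) (hc : 0 < c) (a b : ℕ)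
    (hV : 0 < Fintype.card V)
    (hn : 2 * ((a + b : ℕ) : ℝ) ^ 2 / c ^ ((a+1)*(b+1)) ≤ Fintype.card V)
    (h : c * (Fintype.card V : ℝ) ^ 2 ≤ #((X ×ˢ Y).filter (fun p => R p.1 p.2))) :
    c ^ ((a+1) * (b+1)) / 2 * (Fintype.card V : ℝ) ^ Fintype.card (Fin a ⊕ Fin b) ≤
      #(univ.filter (fun τ : Fin a ⊕ Fin b → V => Function.Injective τ ∧ Kab X Y R τ)) := by
  have hk : Fintype.card (Fin a ⊕ Fin b) = a + b := by simp
  have h1 := kab_count X Y R c hc.le a b hV h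
  have h2 := inj_options (V := V) (κ := Fin a ⊕ Fin b) (c ^ ((a+1) * (b+1))) (by positivity)
    (fun τ => Kab X Y R τ) (by rw [hk]; exact hn) hV (by rw [hk]; convert h1)
  convert h2

end Count

section Jobs
variable {V L : Type} [Fintype V] [DecidableEq V] [DecidableEq L]

/-- a valid family of tuples on a set of labels -/
def Fam {κ : Type} (Ok : L → (κ → V) → Prop) (U : Finset V) (A : Finset L) (τ : L → κ → V) : Prop :=
  (∀ t ∈ A, Ok t (τ t)) ∧ (∀ t ∈ A, ∀ i, τ t i ∉ U) ∧ ∀ t ∈ A, ∀ t' ∈ A, t ≠ t' → ∀ i j, τ t i ≠ τ t' j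

/-- used vertices -/
noncomputable def usedV {κ : Type} [Fintype κ] (U : Finset V) (A : Finset L) (τ : L → κ → V) : Finset V :=
  U ∪ A.biUnion (fun t => univ.image (τ t))

theorem mem_usedV {κ : Type} [Fintype κ] {U : Finset V} {A : Finset L} {τ : L → κ → V} {v : V} :
    v ∈ usedV U A τ ↔ v ∈ U ∨ ∃ t ∈ A, ∃ i, τ t i = v := by
  unfold usedV; simp

theorem card_usedV {κ : Type} [Fintype κ] (U : Finset V) (A : Finset L) (τ : L → κ → V) :
    #(usedV U A τ) ≤ #U + #A * Fintype.card κ := by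
  refine (card_union_le _ _).trans (Nat.add_le_add_left ?_ _)
  refine card_biUnion_le_card_mul _ _ _ fun t _ => ?_
  exact card_image_le.trans (by rw [card_univ])

/-- the atoms of a family -/
noncomputable def atoms {κ : Type} [Fintype κ] (A : Finset L) (τ : L → κ → V) : Finset (V × L) :=
  A.biUnion (fun t => put t (τ t))

theorem mem_atoms {κ : Type} [Fintype κ] {A : Finset L} {τ : L → κ → V} {a : V × L} :
    a ∈ atoms A τ ↔ a.2 ∈ A ∧ ∃ i, τ a.2 i = a.1 := by
  unfold atoms
  simp only [mem_biUnion, mem_put]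
  constructor
  · rintro ⟨t, h, rfl, h'⟩; exact ⟨h, h'⟩
  · rintro ⟨h, h'⟩; exact ⟨_, h, rfl, h'⟩

theorem jobs {κ : Type} [Fintype κ] (Ok : L → (κ → V) → Prop) (U : Finset V) (T : Finset L) (c : ℝ)
    (hc : 0 < c) (hc1 : c ≤ 1) (hV : 0 < Fintype.card V)
    (hstep : ∀ A t τ, A ⊆ T → t ∈ T → t ∉ A → Fam Ok U A τ →
      c * (Fintype.card V : ℝ) ^ Fintype.card κ
        ≤ #(univ.filter (fun σ : κ → V => Ok t σ ∧ ∀ i, σ i ∉ usedV U A τ))) :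
    Spr (fun O => ∃ τ : L → κ → V, Fam Ok U T τ ∧ O = atoms T τ)
      (fun D => ∏ a ∈ D, (if a.2 ∈ T then (Fintype.card κ : ℝ) / c / Fintype.card V else 0)) := by
  haveI : Nonempty V := Fintype.card_pos_iff.1 hV
  refine greedyW (κ := κ) (fun A O => ∃ τ : L → κ → V, Fam Ok U A τ ∧ O = atoms A τ) c hc hc1 hV
    ⟨fun _ _ => Classical.arbitrary V, ⟨by simp, by simp, by simp⟩, by simp [atoms]⟩ T ?_
  rintro A t O hA ht htA ⟨τ, hτ, rfl⟩
  refine (hstep A t τ hA ht htA hτ).trans ?_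
  norm_cast
  apply card_le_card
  intro σ hσ
  simp only [mem_filter, mem_univ, true_and] at hσ ⊢
  obtain ⟨h1, h2⟩ := hσ
  simp only [mem_usedV, not_or, not_exists, not_and] at h2
  have hne : ∀ t' ∈ A, t' ≠ t := fun t' h e => htA (e ▸ h)
  refine ⟨Function.update τ t σ, ⟨?_, ?_, ?_⟩, ?_⟩
  · intro t' h
    rcases mem_insert.1 h with rfl | h
    · rwa [Function.update_self]
    · rw [Function.update_of_ne (hne _ h)]; exact hτ.1 _ h
  · intro t' h
    rcases mem_insert.1 h with rfl | h
    · rw [Function.update_self]; exact fun i => (h2 i).1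
    · rw [Function.update_of_ne (hne _ h)]; exact hτ.2.1 _ h
  · intro t1 h1' t2 h2' hn i j
    rcases mem_insert.1 h1' with e1 | h1a <;> rcases mem_insert.1 h2' with e2 | h2a
    · exact absurd (e1.trans e2.symm) hn
    · subst e1; rw [Function.update_self, Function.update_of_ne (hne _ h2a)]
      exact fun e => (h2 i).2 _ h2a _ e.symm
    · subst e2; rw [Function.update_self, Function.update_of_ne (hne _ h1a)]
      exact fun e => (h2 j).2 _ h1a _ e
    · rw [Function.update_of_ne (hne _ h1a), Function.update_of_ne (hne _ h2a)]
      exact hτ.2.2 _ h1a _ h2a hn i j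
  · unfold atoms
    rw [biUnion_insert, Function.update_self, union_comm]
    congr 1
    exact biUnion_congr rfl fun t' h => by rw [Function.update_of_ne (hne _ h)]

/-- jobs of type `K_{a,b}` -/
theorem jobsK (a b : ℕ) (X Y : L → Finset V) (R : V → V → Prop) (U : Finset V) (T : Finset L) (c : ℝ)
    (hc : 0 < c) (hc1 : c ≤ 1) (hV : 0 < Fintype.card V)
    (hn : 2 * ((a + b : ℕ) : ℝ) ^ 2 / c ^ ((a+1)*(b+1)) ≤ Fintype.card V)
    (hstep : ∀ A t τ, A ⊆ T → t ∈ T → t ∉ A →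
      Fam (fun t (σ : Fin a ⊕ Fin b → V) => Function.Injective σ ∧ Kab (X t) (Y t) R σ) U A τ →
      c * (Fintype.card V : ℝ) ^ 2
        ≤ #(((X t \ usedV U A τ) ×ˢ (Y t \ usedV U A τ)).filter (fun p => R p.1 p.2))) :
    Spr (fun O => ∃ τ : L → Fin a ⊕ Fin b → V,
        Fam (fun t (σ : Fin a ⊕ Fin b → V) => Function.Injective σ ∧ Kab (X t) (Y t) R σ) U T τ ∧ O = atoms T τ)
      (fun D => ∏ x ∈ D, (if x.2 ∈ T then ((a + b : ℕ) : ℝ) / (c ^ ((a+1) * (b+1)) / 2) / Fintype.card V else 0)) := by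
  have hk : Fintype.card (Fin a ⊕ Fin b) = a + b := by simp
  have h1 : c ^ ((a+1) * (b+1)) ≤ 1 := pow_le_one₀ hc.le hc1
  have := jobs (κ := Fin a ⊕ Fin b) (fun t (σ : Fin a ⊕ Fin b → V) => Function.Injective σ ∧ Kab (X t) (Y t) R σ)
    U T (c ^ ((a+1) * (b+1)) / 2) (by positivity) (by linarith) hV ?_
  · rwa [hk] at this
  · intro A t τ hA ht htA hF
    have h2 := kab_options _ _ R c hc a b hV hn (hstep A t τ hA ht htA hF)
    refine h2.trans ?_
    norm_cast
    refine le_trans (card_le_card (t := univ.filter (fun σ : Fin a ⊕ Fin b → V =>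
      (Function.Injective σ ∧ Kab (X t) (Y t) R σ) ∧ ∀ i, σ i ∉ usedV U A τ)) ?_) (le_of_eq (by congr!))
    intro σ hσ
    simp only [mem_filter, mem_univ, true_and] at hσ ⊢
    obtain ⟨hi, hx, hy, hr⟩ := hσ
    refine ⟨⟨hi, fun i => (mem_sdiff.1 (hx i)).1, fun i => (mem_sdiff.1 (hy i)).1, hr⟩, ?_⟩
    rintro (i | j)
    · exact (mem_sdiff.1 (hx i)).2
    · exact (mem_sdiff.1 (hy j)).2

end Jobs


/-! ## Part 6 : regularity, fractional tilings -/

theorem frac_dual {ι : Type} [Fintype ι] [DecidableEq ι] (R : ι → ι → Prop) (hRs : ∀ i j, R i j → R j i)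
    (a b : ℕ) (ha : 1 ≤ a) (hb : 1 ≤ b) (hba : b ≤ a)
    (hI : ∀ I : Finset ι, (∀ i ∈ I, ∀ j ∈ I, ¬ R i j) → b * #I ≤ a * #(univ.filter (fun j => ∃ i ∈ I, R i j)))
    (w : ι → ℝ) (hw : ∀ i j, R i j → 0 ≤ a * w i + b * w j) : 0 ≤ ∑ i, w i := by
  set I := univ.filter (fun i => w i < 0) with hIdef
  have ha' : (0:ℝ) < a := by exact_mod_cast ha
  have hb' : (0:ℝ) < b := by exact_mod_cast hb
  have hba' : (b:ℝ) ≤ a := by exact_mod_cast hba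
  have hind : ∀ S ⊆ I, ∀ i ∈ S, ∀ j ∈ S, ¬ R i j := by
    intro S hS i hi j hj h
    have h1 := (mem_filter.1 (hS hi)).2
    have h2 := (mem_filter.1 (hS hj)).2
    have := hw i j h
    nlinarith
  -- Hall
  have hall : ∃ f : (I × Fin b) → ι × Fin a, Function.Injective f ∧
      ∀ x, f x ∈ (univ.filter (fun j => R x.1.1 j)) ×ˢ (univ : Finset (Fin a)) := by
    rw [← Finset.all_card_le_biUnion_card_iff_exists_injective
      (fun x : I × Fin b => (univ.filter (fun j => R x.1.1 j)) ×ˢ (univ : Finset (Fin a)))]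
    intro S
    set S' : Finset ι := S.image (fun x => x.1.1) with hS'
    have h1 : #S ≤ #S' * b := by
      have : #S ≤ #(S' ×ˢ (univ : Finset (Fin b))) := by
        apply card_le_card_of_injOn (fun x => (x.1.1, x.2))
        · intro x hx
          simp only [coe_product, Set.mem_prod, mem_coe, mem_univ, and_true]
          exact mem_image_of_mem (fun x : I × Fin b => x.1.1) hx
        · rintro ⟨⟨x, hx⟩, k⟩ - ⟨⟨y, hy⟩, l⟩ - h
          simp only [Prod.mk.injEq] at h
          obtain ⟨rfl, rfl⟩ := h
          rfl
      rwa [card_product, card_univ, Fintype.card_fin] at this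
    have h2 := hI S' (hind S' (by
      intro i hi
      obtain ⟨x, _, rfl⟩ := mem_image.1 hi
      exact x.1.2))
    have h3 : (univ.filter (fun j => ∃ i ∈ S', R i j)) ×ˢ (univ : Finset (Fin a)) ⊆
        S.biUnion (fun x : I × Fin b => (univ.filter (fun j => R x.1.1 j)) ×ˢ (univ : Finset (Fin a))) := by
      rintro ⟨j, k⟩ h
      simp only [mem_product, mem_filter, mem_univ, true_and, and_true] at h
      obtain ⟨i, hi, hij⟩ := h
      obtain ⟨x, hx, rfl⟩ := mem_image.1 hi
      exact mem_biUnion.2 ⟨x, hx, by simpa using hij⟩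
    have h4 := card_le_card h3
    rw [card_product, card_univ, Fintype.card_fin] at h4
    calc #S ≤ #S' * b := h1
      _ = b * #S' := mul_comm _ _
      _ ≤ _ := h2
      _ = _ := mul_comm _ _
      _ ≤ _ := h4
  obtain ⟨f, hf, hfR⟩ := hall
  have hfR' : ∀ x, R x.1.1 (f x).1 := fun x => by
    have := hfR x
    simpa using this
  -- sum
  have hpos : ∀ x : I × Fin b, 0 ≤ w (f x).1 := by
    intro x
    have h1 := (mem_filter.1 x.1.2).2
    have h2 := hw _ _ (hfR' x)
    by_contra h
    push Not at h
    nlinarith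
  have hge : ∀ x : I × Fin b, a * (- w x.1.1) ≤ b * w (f x).1 := by
    intro x
    have h2 := hw _ _ (hfR' x)
    linarith
  have s1 : (a:ℝ) * (b * ∑ i ∈ I, (- w i)) ≤ b * (a * ∑ j ∈ univ.filter (fun i => ¬ w i < 0), w j) := by
    have e1 : ∑ x : I × Fin b, (a * (- w x.1.1) : ℝ) = a * (b * ∑ i ∈ I, (- w i)) := by
      rw [Fintype.sum_prod_type]
      simp only [sum_const, card_univ, Fintype.card_fin, nsmul_eq_mul]
      rw [mul_sum, mul_sum, ← sum_coe_sort I]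
      exact sum_congr rfl fun i _ => by ring
    have e2 : ∑ x : I × Fin b, (b * w (f x).1 : ℝ) ≤ b * (a * ∑ j ∈ univ.filter (fun i => ¬ w i < 0), w j) := by
      rw [← mul_sum]
      apply mul_le_mul_of_nonneg_left _ hb'.le
      have : ∑ x : I × Fin b, w (f x).1 = ∑ y ∈ univ.image f, w y.1 := by
        rw [sum_image (fun x _ y _ h => hf h)]
      rw [this]
      calc _ ≤ ∑ y ∈ (univ.filter (fun i => ¬ w i < 0)) ×ˢ (univ : Finset (Fin a)), w y.1 := by
            apply sum_le_sum_of_subset_of_nonneg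
            · intro y hy
              obtain ⟨x, _, rfl⟩ := mem_image.1 hy
              simp only [mem_product, mem_filter, mem_univ, true_and, and_true, not_lt]
              exact hpos x
            · intro y hy _
              simp only [mem_product, mem_filter, mem_univ, true_and, and_true, not_lt] at hy
              exact hy
        _ = _ := by
          rw [sum_product]
          simp only [sum_const, card_univ, Fintype.card_fin, nsmul_eq_mul]
          rw [mul_sum]
    rw [← e1]
    exact (sum_le_sum fun x _ => hge x).trans e2
  have s2 : ∑ i ∈ I, (- w i) ≤ ∑ j ∈ univ.filter (fun i => ¬ w i < 0), w j := by
    have : (0:ℝ) < a * b := by positivity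
    nlinarith
  rw [sum_neg_distrib] at s2
  rw [← sum_filter_add_sum_filter_not univ (fun i => w i < 0)]
  linarith

theorem frac_tiling {ι : Type} [Fintype ι] [DecidableEq ι] [Nonempty ι] (R : ι → ι → Prop) (hRs : ∀ i j, R i j → R j i)
    (a b : ℕ) (ha : 1 ≤ a) (hb : 1 ≤ b) (hba : b ≤ a)
    (hI : ∀ I : Finset ι, (∀ i ∈ I, ∀ j ∈ I, ¬ R i j) → b * #I ≤ a * #(univ.filter (fun j => ∃ i ∈ I, R i j))) :
    ∃ x : ι → ι → ℝ, (∀ i j, 0 ≤ x i j) ∧ (∀ i j, ¬ R i j → x i j = 0) ∧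
      ∀ i, ∑ j, (a * x i j + b * x j i) = 1 := by
  have ha' : (0:ℝ) < a := by exact_mod_cast ha
  have hb' : (0:ℝ) < b := by exact_mod_cast hb
  set k : ℝ := (Fintype.card ι : ℝ) with hk
  have hk0 : 0 < k := by rw [hk]; exact_mod_cast Fintype.card_pos
  set e : ι → (ι → ℝ) := fun i => Pi.single i 1 with he
  set pt : ι × ι → (ι → ℝ) := fun p => (a / (a + b) : ℝ) • e p.1 + (b / (a + b) : ℝ) • e p.2 with hpt
  set Sset : Set (ι → ℝ) := Set.image pt {p | R p.1 p.2} with hS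
  have hmem : (fun _ => 1 / k : ι → ℝ) ∈ convexHull ℝ Sset := by
    by_contra hcon
    have hcl : IsClosed (convexHull ℝ Sset) := Set.Finite.isClosed_convexHull ℝ ((Set.toFinite _).image _)
    obtain ⟨f, u, h1, h2⟩ := geometric_hahn_banach_point_closed (convex_convexHull ℝ Sset) hcl hcon
    set w : ι → ℝ := fun i => f (e i) - u with hw
    have hd := frac_dual R hRs a b ha hb hba hI w (by
      intro i j hij
      have h3 := h2 (pt (i, j)) (subset_convexHull ℝ _ ⟨(i, j), hij, rfl⟩)
      simp only [hpt, map_add, map_smul, smul_eq_mul] at h3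
      simp only [hw]
      rw [div_mul_eq_mul_div, div_mul_eq_mul_div, ← add_div, lt_div_iff₀ (by positivity)] at h3
      linarith)
    have h4 : f (fun _ => 1 / k : ι → ℝ) = (1/k) * ∑ i, f (e i) := by
      have : (fun _ => 1 / k : ι → ℝ) = (1/k) • ∑ i, e i := by
        ext j
        simp [he, Finset.sum_apply, Pi.single_apply]
      rw [this, map_smul, map_sum, smul_eq_mul]
    rw [h4] at h1
    simp only [hw, sum_sub_distrib, sum_const, card_univ, nsmul_eq_mul] at hd
    rw [← hk] at hd
    rw [div_mul_eq_mul_div, one_mul, div_lt_iff₀ hk0] at h1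
    linarith
  rw [_root_.convexHull_eq] at hmem
  obtain ⟨J, T, w, z, hw0, hw1, hz, hcm⟩ := hmem
  rw [Finset.centerMass_eq_of_sum_1 _ _ hw1] at hcm
  choose! q hq hqz using hz
  set x : ι → ι → ℝ := fun i j => k / (a + b) * ∑ t ∈ T, if q t = (i, j) then w t else 0 with hx
  refine ⟨x, ?_, ?_, ?_⟩
  · intro i j
    apply mul_nonneg (by positivity)
    apply sum_nonneg
    intro t ht
    split_ifs
    · exact hw0 t ht
    · exact le_rfl
  · intro i j hij
    simp only [hx]
    rw [sum_eq_zero, mul_zero]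
    intro t ht
    rw [if_neg]
    intro hqt
    have := hq t ht
    rw [hqt] at this
    exact hij this
  · intro i
    have h5 := congrFun hcm i
    simp only [Finset.sum_apply, Pi.smul_apply, smul_eq_mul] at h5
    have h6 : ∑ t ∈ T, w t * (z t i) = ∑ t ∈ T, (w t * (a / (a+b) * (if (q t).1 = i then 1 else 0) + b / (a+b) * (if (q t).2 = i then 1 else 0))) := by
      apply sum_congr rfl
      intro t ht
      rw [← hqz t ht]
      simp [hpt, he, Pi.single_apply, eq_comm]
    have h7 : ∑ j, x i j = k / (a+b) * ∑ t ∈ T, w t * (if (q t).1 = i then 1 else 0) := by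
      simp only [hx]
      rw [← mul_sum, sum_comm]
      congr 1
      apply sum_congr rfl
      intro t _
      by_cases h : (q t).1 = i
      · rw [if_pos h, mul_one, sum_eq_single (q t).2]
        · rw [if_pos (by rw [← h])]
        · intro j _ hj
          rw [if_neg (fun h' => hj (by rw [h']))]
        · simp
      · rw [if_neg h, mul_zero]
        apply sum_eq_zero
        intro j _
        rw [if_neg (fun h' => h (by rw [h']))]
    have h8 : ∑ j, x j i = k / (a+b) * ∑ t ∈ T, w t * (if (q t).2 = i then 1 else 0) := by
      simp only [hx]
      rw [← mul_sum, sum_comm]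
      congr 1
      apply sum_congr rfl
      intro t _
      by_cases h : (q t).2 = i
      · rw [if_pos h, mul_one, sum_eq_single (q t).1]
        · rw [if_pos (by rw [← h])]
        · intro j _ hj
          rw [if_neg (fun h' => hj (by rw [h']))]
        · simp
      · rw [if_neg h, mul_zero]
        apply sum_eq_zero
        intro j _
        rw [if_neg (fun h' => h (by rw [h']))]
    rw [sum_add_distrib, ← mul_sum (f := fun j => x i j), ← mul_sum (f := fun j => x j i), h7, h8]
    have h9 : ∑ t ∈ T, (w t * (a / (a+b) * (if (q t).1 = i then 1 else 0) + b / (a+b) * (if (q t).2 = i then 1 else 0))) =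
        a / (a+b) * ∑ t ∈ T, w t * (if (q t).1 = i then 1 else 0) + b / (a+b) * ∑ t ∈ T, w t * (if (q t).2 = i then 1 else 0) := by
      rw [mul_sum, mul_sum, ← sum_add_distrib]
      exact sum_congr rfl fun t _ => by ring
    rw [h6, h9] at h5
    have h10 : (a:ℝ) + b ≠ 0 := by positivity
    field_simp at h5 ⊢
    linarith


/-! ## Part 6b : clusters -/
section Clusters
variable {V : Type} [Fintype V] [DecidableEq V]

/-- ordered adjacent pairs between two sets -/
noncomputable def eG (G : SimpleGraph V) (X Y : Finset V) : ℕ := #((X ×ˢ Y).filter (fun p => G.Adj p.1 p.2))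

/-- degree into a set -/
noncomputable def dg (G : SimpleGraph V) (X : Finset V) (v : V) : ℕ := #(X.filter (fun u => G.Adj v u))

theorem eG_eq_sum (G : SimpleGraph V) (X Y : Finset V) : eG G X Y = ∑ x ∈ X, dg G Y x := by
  unfold eG dg
  rw [card_filter, sum_product]
  exact sum_congr rfl fun x _ => by rw [card_filter]

theorem eG_comm (G : SimpleGraph V) (X Y : Finset V) : eG G X Y = eG G Y X := by
  unfold eG
  apply card_bij (fun p _ => (p.2, p.1))
  · intro p hp
    simp only [mem_filter, mem_product] at hp ⊢
    exact ⟨⟨hp.1.2, hp.1.1⟩, hp.2.symm⟩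
  · rintro ⟨a, b⟩ _ ⟨c, d⟩ _ h
    simp only [Prod.mk.injEq] at h ⊢
    exact ⟨h.2, h.1⟩
  · rintro ⟨a, b⟩ h
    simp only [mem_filter, mem_product] at h
    exact ⟨(b, a), by simp only [mem_filter, mem_product]; exact ⟨⟨h.1.2, h.1.1⟩, h.2.symm⟩, rfl⟩

theorem dg_mono (G : SimpleGraph V) {X Y : Finset V} (h : X ⊆ Y) (v : V) : dg G X v ≤ dg G Y v :=
  card_le_card (filter_subset_filter _ h)

theorem dg_le (G : SimpleGraph V) (X : Finset V) (v : V) : dg G X v ≤ #X := card_filter_le _ _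

theorem eG_le (G : SimpleGraph V) (X Y : Finset V) : eG G X Y ≤ #X * #Y := by
  rw [← card_product]; exact card_filter_le _ _

theorem eG_mono (G : SimpleGraph V) {X X' Y Y' : Finset V} (h : X ⊆ X') (h' : Y ⊆ Y') : eG G X Y ≤ eG G X' Y' :=
  card_le_card (filter_subset_filter _ (product_subset_product h h'))

theorem eG_biUnion_right {ι : Type} (G : SimpleGraph V) (X : Finset V) (F : Finset ι) (f : ι → Finset V) :
    eG G X (F.biUnion f) ≤ ∑ i ∈ F, eG G X (f i) := by
  unfold eG
  refine le_trans (card_le_card ?_) card_biUnion_le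
  intro p
  simp only [mem_filter, mem_product, mem_biUnion]
  rintro ⟨⟨h1, i, hi, h2⟩, h3⟩
  exact ⟨i, hi, ⟨h1, h2⟩, h3⟩

theorem eG_biUnion_left {ι : Type} (G : SimpleGraph V) (Y : Finset V) (F : Finset ι) (f : ι → Finset V) :
    eG G (F.biUnion f) Y ≤ ∑ i ∈ F, eG G (f i) Y := by
  rw [eG_comm]
  refine (eG_biUnion_right G Y F f).trans (le_of_eq (sum_congr rfl fun i _ => eG_comm _ _ _))

theorem clusters_aux (G : SimpleGraph V) (η : ℝ) (hη : 0 < η) (hη1 : η ≤ 1/10) (P : Finpartition (univ : Finset V))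
    (hPe : P.IsEquipartition) (hPk : 1 / η ≤ #P.parts) (hPu : P.IsUniform G (η^2))
    (hn : (#P.parts : ℝ)^2 / η ≤ Fintype.card V) :
    ∃ GC ⊆ P.parts, (1 - η) * #P.parts ≤ #GC ∧
      ∀ A ∈ GC, ∀ F ⊆ P.parts, (eG G A (F.biUnion id) : ℝ) ≤
        #A * (#(F.filter (fun B => B ∈ GC ∧ A ≠ B ∧ G.IsUniform (η^2) A B ∧ 2 * η ≤ (G.edgeDensity A B : ℝ)))
           * ((Fintype.card V / #P.parts : ℕ) + 1)) + 8 * η * Fintype.card V * #A := by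
  set k := #P.parts with hk
  set n := Fintype.card V with hnn
  have hk0 : (0:ℝ) < k := lt_of_lt_of_le (by positivity) hPk
  have hk0' : 0 < k := by exact_mod_cast hk0
  have hk1 : (1:ℝ) ≤ k := by exact_mod_cast hk0'
  set bad : Finset V → Finset (Finset V) := fun A => P.parts.filter (fun B => A ≠ B ∧ ¬ G.IsUniform (η^2) A B) with hbad
  set GC := P.parts.filter (fun A => (#(bad A) : ℝ) ≤ η * k) with hGC
  have hnk : (k:ℝ) ≤ n := by
    refine le_trans ?_ hn
    rw [le_div_iff₀ hη]
    nlinarith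
  have hm1 : (((n / k : ℕ) : ℝ) + 1) ≤ 2 * n / k := by
    have : ((n / k : ℕ) : ℝ) ≤ n / k := Nat.cast_div_le
    have h2 : (1:ℝ) ≤ n / k := by rw [le_div_iff₀ hk0]; linarith
    have h3 : (2 * n / k : ℝ) = n / k + n / k := by ring
    linarith
  -- number of bad clusters
  have hB : (#(P.parts \ GC) : ℝ) ≤ η * k := by
    have h1 : ∑ A ∈ P.parts, #(bad A) = #(P.nonUniforms G (η^2)) := by
      rw [← card_sigma]
      apply card_bij (fun x _ => (x.1, x.2))
      · rintro ⟨A, B⟩ h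
        simp only [mem_sigma, hbad, mem_filter] at h
        rw [Finpartition.mk_mem_nonUniforms]
        exact ⟨h.1, h.2.1, h.2.2.1, h.2.2.2⟩
      · rintro ⟨A, B⟩ _ ⟨A', B'⟩ _ h
        simp only [Prod.mk.injEq] at h
        obtain ⟨rfl, rfl⟩ := h; rfl
      · rintro ⟨A, B⟩ h
        rw [Finpartition.mk_mem_nonUniforms] at h
        exact ⟨⟨A, B⟩, by simp only [mem_sigma, hbad, mem_filter]; exact ⟨h.1, h.2.1, h.2.2.1, h.2.2.2⟩, rfl⟩
    have h2 : (η * k) * #(P.parts \ GC) ≤ ∑ A ∈ P.parts, (#(bad A) : ℝ) := by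
      calc (η * k) * #(P.parts \ GC) = ∑ A ∈ P.parts \ GC, (η * k) := by rw [sum_const, nsmul_eq_mul]; ring
        _ ≤ ∑ A ∈ P.parts \ GC, (#(bad A) : ℝ) := by
          apply sum_le_sum
          intro A hA
          simp only [hGC, mem_sdiff, mem_filter, not_and, not_le] at hA
          exact (hA.2 hA.1).le
        _ ≤ _ := sum_le_sum_of_subset_of_nonneg sdiff_subset fun _ _ _ => by positivity
    have h3 : (∑ A ∈ P.parts, (#(bad A) : ℝ)) = #(P.nonUniforms G (η^2)) := by rw [← h1]; push_cast; rfl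
    have h4 : (#(P.nonUniforms G (η^2)) : ℝ) ≤ (k * (k - 1) : ℕ) * η^2 := hPu
    have h5 : ((k * (k - 1) : ℕ) : ℝ) ≤ k * k := by exact_mod_cast Nat.mul_le_mul_left _ (Nat.sub_le _ _)
    have h6 : (η * k) * #(P.parts \ GC) ≤ (η * k) * (η * k) := by nlinarith [sq_nonneg η]
    exact le_of_mul_le_mul_left h6 (by positivity)
  refine ⟨GC, filter_subset _ _, ?_, ?_⟩
  · have h1 := card_sdiff_add_card_eq_card (filter_subset (fun A => (#(bad A) : ℝ) ≤ η * k) P.parts)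
    have h2 : (#(P.parts \ GC) : ℝ) + #GC = k := by exact_mod_cast h1
    linarith
  · intro A hA F hF
    have hAP := (mem_filter.1 hA).1
    set RN := F.filter (fun B => B ∈ GC ∧ A ≠ B ∧ G.IsUniform (η^2) A B ∧ 2 * η ≤ (G.edgeDensity A B : ℝ)) with hRN
    set X : Finset (Finset V) := {A} ∪ bad A ∪ (P.parts \ GC) ∪ RN with hX
    have hXc : (#X : ℝ) ≤ #RN + 3 * η * k := by
      have h1 : #X ≤ 1 + #(bad A) + #(P.parts \ GC) + #RN := by
        refine (card_union_le _ _).trans (Nat.add_le_add_right ?_ _)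
        refine (card_union_le _ _).trans (Nat.add_le_add_right ?_ _)
        refine (card_union_le _ _).trans (Nat.add_le_add_right ?_ _)
        simp
      have h2 : (#X : ℝ) ≤ 1 + #(bad A) + #(P.parts \ GC) + #RN := by exact_mod_cast h1
      have h3 : (#(bad A) : ℝ) ≤ η * k := (mem_filter.1 hA).2
      have h4 : (1:ℝ) ≤ η * k := by rw [div_le_iff₀ hη] at hPk; linarith
      linarith
    have hpart : ∀ B ∈ P.parts, (#B : ℝ) ≤ ((n / k : ℕ) : ℝ) + 1 := by
      intro B hB
      have := hPe.card_part_le_average_add_one hB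
      rw [card_univ] at this
      exact_mod_cast this
    have hone : ∀ B ∈ F, (eG G A B : ℝ) ≤ (if B ∈ X then (#A : ℝ) * (((n / k : ℕ) : ℝ) + 1) else 0) + 2 * η * #A * #B := by
      intro B hB
      have hBP := hF hB
      split_ifs with h
      · have h1 : (eG G A B : ℝ) ≤ #A * #B := by exact_mod_cast eG_le G A B
        have h2 := mul_le_mul_of_nonneg_left (hpart B hBP) (Nat.cast_nonneg (α := ℝ) #A)
        have : (0:ℝ) ≤ 2 * η * #A * #B := by positivity
        linarith
      · simp only [hX, mem_union, mem_singleton, not_or, hbad, mem_filter, hRN, mem_sdiff] at h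
        obtain ⟨⟨⟨h1, h2⟩, h3⟩, h4⟩ := h
        have h5 : B ∈ GC := by by_contra h'; exact h3 ⟨hBP, h'⟩
        have h6 : G.IsUniform (η^2) A B := by by_contra h'; exact h2 ⟨hBP, Ne.symm h1, h'⟩
        have h7 : (G.edgeDensity A B : ℝ) < 2 * η := by
          by_contra h'
          exact h4 ⟨hB, h5, Ne.symm h1, h6, not_lt.1 h'⟩
        have h8 : (G.edgeDensity A B : ℝ) = (eG G A B : ℝ) / (#A * #B) := by
          rw [SimpleGraph.edgeDensity_def]; push_cast; rfl
        have hA0 : (0:ℝ) < #A := by exact_mod_cast card_pos.2 (P.nonempty_of_mem_parts hAP)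
        have hB0 : (0:ℝ) < #B := by exact_mod_cast card_pos.2 (P.nonempty_of_mem_parts hBP)
        rw [h8, div_lt_iff₀ (by positivity)] at h7
        linarith
    have hFn : ∑ B ∈ F, (#B : ℝ) ≤ n := by
      have : ∑ B ∈ P.parts, #B = n := by rw [P.sum_card_parts, card_univ]
      calc _ ≤ ∑ B ∈ P.parts, (#B : ℝ) := sum_le_sum_of_subset_of_nonneg hF fun _ _ _ => by positivity
        _ = n := by exact_mod_cast this
    have hsum : (eG G A (F.biUnion id) : ℝ) ≤ ∑ B ∈ F, (eG G A B : ℝ) := by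
      exact_mod_cast eG_biUnion_right G A F id
    have hXF : ∑ B ∈ F, (if B ∈ X then (#A : ℝ) * (((n / k : ℕ) : ℝ) + 1) else 0) ≤ #X * (#A * (((n / k : ℕ) : ℝ) + 1)) := by
      rw [← sum_filter, sum_const, nsmul_eq_mul]
      apply mul_le_mul_of_nonneg_right _ (by positivity)
      norm_cast
      apply card_le_card
      intro B hB
      exact (mem_filter.1 hB).2
    have hmk : η * k * (((n / k : ℕ) : ℝ) + 1) ≤ 2 * η * n := by
      calc _ ≤ η * k * (2 * n / k) := mul_le_mul_of_nonneg_left hm1 (by positivity)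
        _ = _ := by field_simp
    calc (eG G A (F.biUnion id) : ℝ) ≤ ∑ B ∈ F, (eG G A B : ℝ) := hsum
      _ ≤ ∑ B ∈ F, ((if B ∈ X then (#A : ℝ) * (((n / k : ℕ) : ℝ) + 1) else 0) + 2 * η * #A * #B) := sum_le_sum hone
      _ = ∑ B ∈ F, (if B ∈ X then (#A : ℝ) * (((n / k : ℕ) : ℝ) + 1) else 0) + 2 * η * #A * ∑ B ∈ F, (#B : ℝ) := by
          rw [sum_add_distrib, mul_sum]
      _ ≤ #X * (#A * (((n / k : ℕ) : ℝ) + 1)) + 2 * η * #A * n := by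
          apply add_le_add hXF
          exact mul_le_mul_of_nonneg_left hFn (by positivity)
      _ ≤ (#RN + 3 * η * k) * (#A * (((n / k : ℕ) : ℝ) + 1)) + 2 * η * #A * n := by
          gcongr
      _ = #A * (#RN * (((n / k : ℕ) : ℝ) + 1)) + 3 * #A * (η * k * (((n / k : ℕ) : ℝ) + 1)) + 2 * η * #A * n := by ring
      _ ≤ #A * (#RN * (((n / k : ℕ) : ℝ) + 1)) + 3 * #A * (2 * η * n) + 2 * η * #A * n := by
          gcongr
      _ = _ := by ring

end Clusters


/-! ## Part 6c : cluster structure -/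

set_option maxHeartbeats 2000000 in
theorem clusters (a b : ℕ) (ha : 1 ≤ a) (hb : 1 ≤ b) (γ ε : ℝ) (hγ : 0 < γ) (hε : 0 < ε) :
    ∃ c : ℝ, 0 < c ∧ c ≤ 1 ∧ ∃ K n₀ : ℕ, ∀ (V : Type) [Fintype V] [DecidableEq V] (G : SimpleGraph V),
      n₀ ≤ Fintype.card V →
      (∀ v, ((b:ℝ) / (a + b) - γ / (4 * a)) * Fintype.card V ≤ dg G univ v) →
      (∀ U : Finset V, ((a:ℝ) / (a + b) - γ) * Fintype.card V ≤ #U → γ * (Fintype.card V : ℝ)^2 ≤ eG G U U) →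
      ∃ (ι : Type) (_ : Fintype ι) (_ : DecidableEq ι) (_ : Nonempty ι) (cl : ι → Finset V) (R : ι → ι → Prop) (m : ℕ),
        (∀ i j, R i j → R j i) ∧ (∀ i j, i ≠ j → Disjoint (cl i) (cl j)) ∧ (∀ i, m ≤ #(cl i)) ∧
        (1 - ε) * Fintype.card V ≤ m * Fintype.card ι ∧ Fintype.card ι ≤ K ∧
        (∀ i j, R i j → i ≠ j ∧ ∀ X ⊆ cl i, ∀ Y ⊆ cl j, ε * m ≤ #X → ε * m ≤ #Y →
          c * (Fintype.card V : ℝ)^2 ≤ eG G X Y) ∧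
        (∀ I : Finset ι, (∀ i ∈ I, ∀ j ∈ I, ¬ R i j) → b * #I ≤ a * #(univ.filter (fun j => ∃ i ∈ I, R i j))) := by
  have ha' : (1:ℝ) ≤ a := by exact_mod_cast ha
  have hb' : (1:ℝ) ≤ b := by exact_mod_cast hb
  obtain ⟨η, hη, h1, h2, h3⟩ : ∃ η : ℝ, 0 < η ∧ η ≤ 1/10 ∧ η ≤ γ / (20 * a) ∧ η ≤ ε / 2 :=
    ⟨min (1/10) (min (γ / (20 * a)) (ε / 2)), by positivity, min_le_left _ _,
      (min_le_right _ _).trans (min_le_left _ _), (min_le_right _ _).trans (min_le_right _ _)⟩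
  set K := SzemerediRegularity.bound (η^2) (⌈1/η⌉₊) with hK
  have hK0 : 0 < K := SzemerediRegularity.bound_pos _ _
  have hK0' : (0:ℝ) < K := by exact_mod_cast hK0
  refine ⟨min 1 (η * (ε / (2 * K))^2), by positivity, min_le_left _ _, K,
    ⌈(K:ℝ)^2 / η⌉₊ + ⌈1/η⌉₊ + 2 * K, fun V _ _ G hn hdeg hne => ?_⟩
  set n := Fintype.card V with hnn
  have hnK : (K:ℝ)^2 / η ≤ n := (Nat.le_ceil _).trans (Nat.cast_le.2 (by omega))
  have hn2K : (2:ℝ) * K ≤ n := by exact_mod_cast (by omega : 2 * K ≤ n)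
  have hn0 : (0:ℝ) < n := by linarith
  obtain ⟨P, hPe, hPl, hPK, hPu⟩ := szemeredi_regularity G (ε := η^2) (l := ⌈1/η⌉₊) (by positivity) (by omega)
  set k := #P.parts with hk
  have hkη : 1 / η ≤ k := (Nat.le_ceil _).trans (by exact_mod_cast hPl)
  have hkK : (k:ℝ) ≤ K := by exact_mod_cast hPK
  have hk0 : (0:ℝ) < k := lt_of_lt_of_le (by positivity) hkη
  have hk0' : 0 < k := by exact_mod_cast hk0
  have hk1 : (1:ℝ) ≤ k := by exact_mod_cast hk0'
  have hnk : (k:ℝ)^2 / η ≤ n := le_trans (by gcongr) hnK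
  obtain ⟨GC, hGC, hGCc, hmain⟩ := clusters_aux G η hη h1 P hPe hkη hPu hnk
  set m := n / k with hm
  have hmk : (m:ℝ) ≤ n / k := Nat.cast_div_le
  have hmk2 : (n:ℝ) / k ≤ m + 1 := by
    rw [div_le_iff₀ hk0]
    have := Nat.lt_div_mul_add (a := n) hk0'
    have h : n ≤ (m + 1) * k := by rw [add_mul, one_mul, hm]; omega
    exact_mod_cast h
  have hm1 : (1:ℝ) ≤ m := by
    have : 1 ≤ m := (Nat.one_le_div_iff hk0').2 (by
      have : (k:ℝ) ≤ n := by linarith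
      exact_mod_cast this)
    exact_mod_cast this
  have hsz : ∀ A ∈ P.parts, m ≤ #A := fun A hA => by
    have := hPe.average_le_card_part hA
    rwa [card_univ] at this
  have hsz2 : ∀ A ∈ P.parts, #A ≤ m + 1 := fun A hA => by
    have := hPe.card_part_le_average_add_one hA
    rwa [card_univ] at this
  have hηk2 : (k:ℝ)^2 ≤ η * n := by rw [div_le_iff₀ hη] at hnk; linarith
  have hηk : (k:ℝ) ≤ η * n := by nlinarith
  -- numbers of neighbours
  set RR : Finset V → Finset V → Prop := fun A B => A ≠ B ∧ G.IsUniform (η^2) A B ∧ 2 * η ≤ (G.edgeDensity A B : ℝ) with hRR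
  have hdegR : ∀ A ∈ GC, ((b:ℝ) / (a + b) - γ / (4 * a) - 9 * η) * k ≤ #(GC.filter (fun B => RR A B)) := by
    intro A hA
    have hAP := hGC hA
    have e1 := hmain A hA P.parts (Subset.refl _)
    have e2 : P.parts.filter (fun B => B ∈ GC ∧ A ≠ B ∧ G.IsUniform (η^2) A B ∧ 2 * η ≤ (G.edgeDensity A B : ℝ)) =
        GC.filter (fun B => RR A B) := by
      ext B
      simp only [mem_filter, hRR]
      constructor
      · rintro ⟨_, h, h'⟩; exact ⟨h, h'⟩
      · rintro ⟨h, h'⟩; exact ⟨hGC h, h, h'⟩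
    rw [e2, P.biUnion_parts] at e1
    set d := #(GC.filter (fun B => RR A B)) with hd
    have e3 : (#A : ℝ) * (((b:ℝ) / (a + b) - γ / (4 * a)) * n) ≤ eG G A univ := by
      rw [eG_eq_sum]; push_cast
      rw [← nsmul_eq_mul, ← sum_const]
      exact sum_le_sum fun v _ => hdeg v
    have hA0 : (0:ℝ) < #A := by exact_mod_cast card_pos.2 (P.nonempty_of_mem_parts hAP)
    have e4 : ((b:ℝ) / (a + b) - γ / (4 * a)) * n ≤ d * ((m:ℝ) + 1) + 8 * η * n := by
      have : (#A : ℝ) * (((b:ℝ) / (a + b) - γ / (4 * a)) * n) ≤ #A * (d * ((m:ℝ) + 1) + 8 * η * n) := by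
        refine e3.trans (e1.trans (le_of_eq ?_)); ring
      exact le_of_mul_le_mul_left this hA0
    have e5 : (d:ℝ) ≤ k := by
      have : d ≤ k := (card_filter_le _ _).trans (card_le_card hGC)
      exact_mod_cast this
    have e6 : (d:ℝ) * ((m:ℝ) + 1) ≤ d * (n / k) + k := by nlinarith [Nat.cast_nonneg (α := ℝ) d]
    have e7 : ((b:ℝ) / (a + b) - γ / (4 * a) - 9 * η) * n ≤ d * (n / k) := by nlinarith
    rw [mul_div_assoc', le_div_iff₀ hk0] at e7
    have : (((b:ℝ) / (a + b) - γ / (4 * a) - 9 * η) * k) * n ≤ d * n := by linarith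
    exact le_of_mul_le_mul_right this hn0
  have hind : ∀ I ⊆ GC, (∀ A ∈ I, ∀ B ∈ I, ¬ RR A B) → (#I : ℝ) ≤ ((a:ℝ)/(a+b) - γ + η) * k := by
    intro I hI hR
    have hIP := hI.trans hGC
    have e1 : #(I.biUnion id) = ∑ A ∈ I, #A := by
      rw [card_biUnion]
      · rfl
      · intro A hA B hB hAB
        exact P.disjoint (hIP hA) (hIP hB) hAB
    have e2 : (eG G (I.biUnion id) (I.biUnion id) : ℝ) ≤ 8 * η * n * n := by
      have f1 : (eG G (I.biUnion id) (I.biUnion id) : ℝ) ≤ ∑ A ∈ I, (eG G A (I.biUnion id) : ℝ) := by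
        exact_mod_cast eG_biUnion_left G (I.biUnion id) I id
      have f2 : ∀ A ∈ I, (eG G A (I.biUnion id) : ℝ) ≤ 8 * η * n * #A := by
        intro A hA
        have g1 := hmain A (hI hA) I hIP
        rw [filter_false_of_mem] at g1
        · rw [card_empty, Nat.cast_zero, zero_mul, mul_zero, zero_add] at g1; exact g1
        · intro B hB h
          exact hR A hA B hB h.2
      refine f1.trans ((sum_le_sum f2).trans ?_)
      rw [← mul_sum]
      apply mul_le_mul_of_nonneg_left _ (by positivity)
      have : #(I.biUnion id) ≤ n := card_le_univ (I.biUnion id)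
      rw [e1] at this
      exact_mod_cast this
    have e3 : (#(I.biUnion id) : ℝ) < ((a:ℝ)/(a+b) - γ) * n := by
      by_contra h
      have h4 := (hne _ (not_lt.1 h)).trans e2
      have h5 : 20 * η ≤ γ := by
        rw [le_div_iff₀ (by positivity)] at h2
        nlinarith
      have h6 : γ * n^2 ≤ 8 * η * n^2 := by linarith
      have := le_of_mul_le_mul_right h6 (by positivity)
      linarith
    have e4 : (m:ℝ) * #I ≤ #(I.biUnion id) := by
      rw [e1]
      have : #I * m ≤ ∑ A ∈ I, #A := by
        rw [← smul_eq_mul, ← sum_const]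
        exact sum_le_sum fun A hA => hsz A (hIP hA)
      rw [mul_comm]
      exact_mod_cast this
    have e5 : (#I : ℝ) ≤ k := by exact_mod_cast card_le_card hIP
    have e6 : (n / k : ℝ) * #I ≤ ((a:ℝ)/(a+b) - γ + η) * n := by
      have u1 : (n / k : ℝ) * #I ≤ ((m:ℝ) + 1) * #I := mul_le_mul_of_nonneg_right hmk2 (Nat.cast_nonneg _)
      linarith
    rw [div_mul_eq_mul_div, div_le_iff₀ hk0] at e6
    have : (#I : ℝ) * n ≤ (((a:ℝ)/(a+b) - γ + η) * k) * n := by linarith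
    exact le_of_mul_le_mul_right this hn0
  have hGCne : GC.Nonempty := by
    rw [← card_pos]
    have : (0:ℝ) < #GC := lt_of_lt_of_le (by nlinarith) hGCc
    exact_mod_cast this
  have hRsymm : ∀ A B, RR A B → RR B A := by
    intro A B h
    exact ⟨h.1.symm, h.2.1.symm, by rw [SimpleGraph.edgeDensity_comm]; exact h.2.2⟩
  refine ⟨GC, inferInstance, inferInstance, hGCne.to_subtype, fun A => A.1, fun A B => RR A.1 B.1, m,
    fun i j h => hRsymm _ _ h, ?_, fun i => hsz _ (hGC i.2), ?_, ?_, ?_, ?_⟩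
  · intro i j hij
    exact P.disjoint (hGC i.2) (hGC j.2) fun h => hij (Subtype.ext h)
  · rw [Fintype.card_coe]
    have e1 : (m:ℝ) * ((1 - η) * k) ≤ m * #GC := mul_le_mul_of_nonneg_left hGCc (by positivity)
    have e2 : (n:ℝ) ≤ (m + 1) * k := by rwa [div_le_iff₀ hk0] at hmk2
    have e3 : (1 - η) * ((n:ℝ) - k) ≤ (1 - η) * (m * k) := mul_le_mul_of_nonneg_left (by linarith) (by linarith)
    nlinarith
  · rw [Fintype.card_coe]
    exact (card_le_card hGC).trans hPK
  · rintro ⟨A, hA⟩ ⟨B, hB⟩ ⟨hAB, hu, hd⟩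
    refine ⟨fun h => hAB (congrArg Subtype.val h), ?_⟩
    intro X hX Y hY hXm hYm
    simp only at hX hY
    have f1 : ∀ C ∈ GC, (#C : ℝ) * η^2 ≤ ε * m := by
      intro C hC
      have g1 : (#C : ℝ) ≤ m + 1 := by exact_mod_cast hsz2 C (hGC hC)
      have g2 : (#C : ℝ) ≤ 2 * m := by linarith
      have g3 : η^2 ≤ ε / 2 := by nlinarith
      calc (#C : ℝ) * η^2 ≤ (2 * m) * (ε / 2) := by gcongr
        _ = _ := by ring
    have f2 := hu hX hY ((f1 A hA).trans hXm) ((f1 B hB).trans hYm)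
    rw [abs_lt] at f2
    have f3 : η ≤ (G.edgeDensity X Y : ℝ) := by nlinarith
    have f4 : (G.edgeDensity X Y : ℝ) = (eG G X Y : ℝ) / (#X * #Y) := by
      rw [SimpleGraph.edgeDensity_def]; push_cast; rfl
    have hX0 : (0:ℝ) < #X := lt_of_lt_of_le (by positivity) hXm
    have hY0 : (0:ℝ) < #Y := lt_of_lt_of_le (by positivity) hYm
    rw [f4, le_div_iff₀ (by positivity)] at f3
    have f5 : (n:ℝ) / (2 * K) ≤ m := by
      rw [div_le_iff₀ (by positivity)]
      rw [div_le_iff₀ hk0] at hmk2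
      nlinarith
    calc min 1 (η * (ε / (2 * K))^2) * (n:ℝ)^2 ≤ (η * (ε / (2 * K))^2) * (n:ℝ)^2 := by
          gcongr; exact min_le_right _ _
      _ = η * ((ε * (n / (2*K))) * (ε * (n / (2 * K)))) := by ring
      _ ≤ η * ((ε * m) * (ε * m)) := by gcongr
      _ ≤ η * (#X * #Y) := by gcongr
      _ ≤ _ := f3
  · intro I hI
    rcases I.eq_empty_or_nonempty with rfl | ⟨i, hi⟩
    · simp
    have g1 := hind (I.map (Function.Embedding.subtype _)) (by
      intro A hA
      obtain ⟨B, _, rfl⟩ := mem_map.1 hA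
      exact B.2) (by
      intro A hA B hB
      obtain ⟨A', hA', rfl⟩ := mem_map.1 hA
      obtain ⟨B', hB', rfl⟩ := mem_map.1 hB
      exact hI A' hA' B' hB')
    rw [card_map] at g1
    have g2 := hdegR i.1 i.2
    have g3 : #(GC.filter (fun B => RR i.1 B)) ≤ #(univ.filter (fun j : GC => ∃ i ∈ I, RR i.1 j.1)) := by
      apply card_le_card_of_surjOn (fun j => j.1)
      intro B hB
      rw [mem_coe, mem_filter] at hB
      exact ⟨⟨B, hB.1⟩, by simp only [coe_filter, mem_univ, true_and, Set.mem_setOf_eq]; exact ⟨i, hi, hB.2⟩, rfl⟩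
    have g4 : (#(GC.filter (fun B => RR i.1 B)) : ℝ) ≤ #(univ.filter (fun j : GC => ∃ i ∈ I, RR i.1 j.1)) := by
      exact_mod_cast g3
    have key : (b:ℝ) * #I ≤ a * #(univ.filter (fun j : GC => ∃ i ∈ I, RR i.1 j.1)) := by
      have q1 : (b:ℝ) * (a / (a+b)) = a * (b / (a+b)) := by ring
      have q2 : (a:ℝ) * (γ / (4 * a)) = γ / 4 := by field_simp
      have q3 : 20 * (a * η) ≤ γ := by
        rw [le_div_iff₀ (by positivity)] at h2; linarith
      have q4 : (b:ℝ) * ((a:ℝ)/(a+b) - γ + η) ≤ a * ((b:ℝ) / (a + b) - γ / (4 * a) - 9 * η) := by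
        have : η ≤ a * η := by nlinarith
        have h5 : (b:ℝ) * (γ - η) ≥ γ - η := by nlinarith
        nlinarith
      calc (b:ℝ) * #I ≤ b * (((a:ℝ)/(a+b) - γ + η) * k) := by gcongr
        _ = (b * ((a:ℝ)/(a+b) - γ + η)) * k := by ring
        _ ≤ (a * ((b:ℝ) / (a + b) - γ / (4 * a) - 9 * η)) * k := by gcongr
        _ = a * (((b:ℝ) / (a + b) - γ / (4 * a) - 9 * η) * k) := by ring
        _ ≤ a * _ := by gcongr; exact g2.trans g4
    have key2 : b * #I ≤ a * #(univ.filter (fun j : GC => ∃ i ∈ I, RR i.1 j.1)) := by exact_mod_cast key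
    convert key2


/-! ## Part 6d : tiling most of the vertices -/

theorem eG_comap {V W : Type} [Fintype V] [DecidableEq V] [Fintype W] [DecidableEq W] (G : SimpleGraph V) (f : W ↪ V) (X Y : Finset W) :
    eG (G.comap f) X Y = eG G (X.map f) (Y.map f) := by
  unfold eG
  refine card_bij (fun p _ => (f p.1, f p.2)) ?_ ?_ ?_
  · intro p hp
    simp only [mem_filter, mem_product, mem_map', SimpleGraph.comap_adj] at hp ⊢
    exact hp
  · rintro ⟨p, p'⟩ _ ⟨q, q'⟩ _ h
    simp only [Prod.mk.injEq, f.injective.eq_iff] at h ⊢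
    exact h
  · rintro ⟨p, p'⟩ h
    simp only [mem_filter, mem_product, mem_map] at h
    obtain ⟨⟨⟨q, hq, rfl⟩, q', hq', rfl⟩, h⟩ := h
    exact ⟨(q, q'), by simp only [mem_filter, mem_product, SimpleGraph.comap_adj]; exact ⟨⟨hq, hq'⟩, h⟩, rfl⟩

theorem dg_comap {V W : Type} [Fintype V] [DecidableEq V] [Fintype W] [DecidableEq W] (G : SimpleGraph V) (f : W ↪ V) (X : Finset W) (v : W) :
    dg (G.comap f) X v = dg G (X.map f) (f v) := by
  unfold dg
  rw [← card_map f, filter_map]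
  rfl

theorem clustersX (a b : ℕ) (ha : 1 ≤ a) (hb : 1 ≤ b) (γ ε : ℝ) (hγ : 0 < γ) (hε : 0 < ε) :
    ∃ c : ℝ, 0 < c ∧ c ≤ 1 ∧ ∃ K n₀ : ℕ, ∀ (V : Type) [Fintype V] [DecidableEq V] (G : SimpleGraph V) (X : Finset V),
      n₀ ≤ #X →
      (∀ v ∈ X, ((b:ℝ) / (a + b) - γ / (4 * a)) * #X ≤ dg G X v) →
      (∀ U ⊆ X, ((a:ℝ) / (a + b) - γ) * #X ≤ #U → γ * (#X : ℝ)^2 ≤ eG G U U) →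
      ∃ (ι : Type) (_ : Fintype ι) (_ : DecidableEq ι) (_ : Nonempty ι) (cl : ι → Finset V) (R : ι → ι → Prop) (m : ℕ),
        (∀ i j, R i j → R j i) ∧ (∀ i j, i ≠ j → Disjoint (cl i) (cl j)) ∧ (∀ i, cl i ⊆ X) ∧ (∀ i, m ≤ #(cl i)) ∧
        (1 - ε) * #X ≤ m * Fintype.card ι ∧ Fintype.card ι ≤ K ∧
        (∀ i j, R i j → i ≠ j ∧ ∀ Y ⊆ cl i, ∀ Z ⊆ cl j, ε * m ≤ #Y → ε * m ≤ #Z →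
          c * (#X : ℝ)^2 ≤ eG G Y Z) ∧
        (∀ I : Finset ι, (∀ i ∈ I, ∀ j ∈ I, ¬ R i j) → b * #I ≤ a * #(univ.filter (fun j => ∃ i ∈ I, R i j))) := by
  obtain ⟨c, hc, hc1, K, n₀, h⟩ := clusters a b ha hb γ ε hγ hε
  refine ⟨c, hc, hc1, K, n₀, fun V _ _ G X hn hdeg hne => ?_⟩
  set f : X ↪ V := Function.Embedding.subtype _ with hf
  have hX : (univ : Finset X).map f = X := by ext v; simp [hf]
  obtain ⟨ι, i1, i2, i3, cl, R, m, h1, h2, h3, h4, h5, h6, h7⟩ := h X (G.comap f) (by rwa [Fintype.card_coe])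
    (by
      intro v
      rw [Fintype.card_coe, dg_comap, hX]
      exact hdeg _ v.2)
    (by
      intro U hU
      rw [Fintype.card_coe] at hU ⊢
      rw [eG_comap]
      refine hne _ ?_ (by rwa [card_map])
      intro v hv
      obtain ⟨u, _, rfl⟩ := mem_map.1 hv
      exact u.2)
  rw [Fintype.card_coe] at h4 h6
  refine ⟨ι, i1, i2, i3, fun i => (cl i).map f, R, m, h1, ?_, ?_, fun i => by rw [card_map]; exact h3 i, h4, h5, ?_, h7⟩
  · intro i j hij
    exact (disjoint_map f).2 (h2 i j hij)
  · intro i v hv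
    obtain ⟨u, _, rfl⟩ := mem_map.1 hv
    exact u.2
  · intro i j hR
    refine ⟨(h6 i j hR).1, fun Y hY Z hZ hYm hZm => ?_⟩
    obtain ⟨Y', hY', rfl⟩ := subset_map_iff.1 hY
    obtain ⟨Z', hZ', rfl⟩ := subset_map_iff.1 hZ
    rw [card_map] at hYm hZm
    rw [← eG_comap]
    exact (h6 i j hR).2 Y' hY' Z' hZ' hYm hZm

theorem exists_assign {L κ : Type} [DecidableEq L] [Fintype κ] [DecidableEq κ] [Nonempty κ] (T : Finset L) (w : κ → ℕ)
    (h : #T ≤ ∑ k, w k) : ∃ π : L → κ, ∀ k, #(T.filter (fun t => π t = k)) ≤ w k := by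
  have : Fintype.card T ≤ Fintype.card (Σ k, Fin (w k)) := by simpa using h
  obtain ⟨f⟩ := Function.Embedding.nonempty_of_card_le this
  refine ⟨fun t => if ht : t ∈ T then (f ⟨t, ht⟩).1 else Classical.arbitrary κ, fun k => ?_⟩
  have h2 : #(univ.filter (fun x : Σ k, Fin (w k) => x.1 = k)) = w k := by
    rw [← Fintype.card_fin (w k), ← card_univ, ← card_map (Function.Embedding.sigmaMk (β := fun k => Fin (w k)) k)]
    congr 1
    ext ⟨k', x⟩
    simp only [mem_filter, mem_univ, true_and, mem_map, Function.Embedding.sigmaMk_apply]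
    constructor
    · rintro rfl; exact ⟨x, rfl⟩
    · rintro ⟨y, hy⟩
      exact (congrArg Sigma.fst hy).symm
  rw [← h2, ← card_map (Function.Embedding.some (α := Σ k, Fin (w k)))]
  refine card_le_card_of_injOn (fun t => if ht : t ∈ T then some (f ⟨t, ht⟩) else none) ?_ ?_
  · intro t ht
    rw [mem_coe, mem_filter] at ht
    simp only [ht.1, dif_pos] at ht ⊢
    simp only [coe_map, Set.mem_image, mem_coe, mem_filter, mem_univ, true_and, Function.Embedding.some_apply]
    exact ⟨_, ht.2, rfl⟩
  · intro t ht t' ht' h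
    rw [mem_coe, mem_filter] at ht ht'
    simp only [ht.1, ht'.1, dif_pos, Option.some.injEq] at h
    exact congrArg Subtype.val (f.injective h)

theorem tileT (a b : ℕ) (ha : 1 ≤ a) (hb : 1 ≤ b) (hba : b ≤ a) (γ ε : ℝ) (hγ : 0 < γ) (hε : 0 < ε) (hε1 : ε ≤ 1) :
    ∃ C : ℝ, 0 < C ∧ ∃ n₀ : ℕ, ∀ (V L : Type) [Fintype V] [DecidableEq V] [DecidableEq L] (G : SimpleGraph V) (X : Finset V)
      (T : Finset L),
      n₀ ≤ Fintype.card V → Fintype.card V ≤ 2 * #X →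
      (∀ v ∈ X, ((b:ℝ) / (a + b) - γ / (4 * a)) * #X ≤ dg G X v) →
      (∀ U ⊆ X, ((a:ℝ) / (a + b) - γ) * #X ≤ #U → γ * (#X : ℝ)^2 ≤ eG G U U) →
      ((a + b : ℕ) : ℝ) * #T ≤ (1 - ε) * #X →
      Spr (fun O => ∃ τ : L → Fin a ⊕ Fin b → V,
          Fam (fun _ (σ : Fin a ⊕ Fin b → V) => Function.Injective σ ∧ Kab univ univ G.Adj σ) Xᶜ T τ ∧ O = atoms T τ)
        (fun D => ∏ x ∈ D, (if x.2 ∈ T then C / Fintype.card V else 0)) := by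
  set e : ℝ := ε / 3 with he
  have he0 : 0 < e := by positivity
  obtain ⟨c, hc, hc1, K, n₀, hcl⟩ := clustersX a b ha hb γ e hγ he0
  have ha' : (1:ℝ) ≤ a := by exact_mod_cast ha
  have hb' : (1:ℝ) ≤ b := by exact_mod_cast hb
  have hc4 : (c/4)^((a+1)*(b+1)) ≤ 1 := pow_le_one₀ (by positivity) (by linarith)
  refine ⟨((a + b : ℕ) : ℝ) / ((c/4) ^ ((a+1) * (b+1)) / 2), by positivity,
    2 * n₀ + ⌈2 * ((a + b : ℕ) : ℝ) ^ 2 / (c/4) ^ ((a+1)*(b+1))⌉₊ + 2 * ⌈(K:ℝ)^2 * (a + b) / e⌉₊ + 1,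
    fun V L _ _ _ G X T hn hX hdeg hne hT => ?_⟩
  have hn0 : 0 < Fintype.card V := by omega
  obtain ⟨ι, _, _, _, cl, R, m, hRs, hdisj, hclX, hm, hmk, hK, hedge, hHall⟩ := hcl V G X (by omega) hdeg hne
  obtain ⟨x, hx0, hxR, hx1⟩ := frac_tiling R hRs a b ha hb hba hHall
  have hXK : (K:ℝ)^2 * (a + b) ≤ e * #X := by
    have : (K:ℝ)^2 * (a + b) / e ≤ #X := (Nat.le_ceil _).trans (Nat.cast_le.2 (by omega))
    rwa [div_le_iff₀ he0, mul_comm (#X : ℝ)] at this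
  set w : ι × ι → ℕ := fun p => ⌊x p.1 p.2 * ((1 - e) * m)⌋₊ with hw
  have hem : 0 ≤ (1 - e) * m := mul_nonneg (by linarith) (Nat.cast_nonneg _)
  have hwle : ∀ p, (w p : ℝ) ≤ x p.1 p.2 * ((1 - e) * m) := fun p =>
    Nat.floor_le (mul_nonneg (hx0 _ _) hem)
  have hsumx : ((a:ℝ) + b) * ∑ p : ι × ι, x p.1 p.2 = Fintype.card ι := by
    have h1 : ∑ i, ∑ j, ((a:ℝ) * x i j + b * x j i) = Fintype.card ι := by
      rw [sum_congr rfl fun i _ => hx1 i]; simp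
    rw [← h1, Fintype.sum_prod_type]
    simp only [sum_add_distrib, ← mul_sum]
    rw [sum_comm (f := fun i j => x j i)]
    ring
  have hwT : #T ≤ ∑ p, w p := by
    have h1 : ∑ p : ι × ι, (x p.1 p.2 * ((1 - e) * m) - 1) ≤ ∑ p, (w p : ℝ) :=
      sum_le_sum fun p _ => (Nat.sub_one_lt_floor _).le
    rw [sum_sub_distrib, ← sum_mul] at h1
    simp only [sum_const, card_univ, Fintype.card_prod, nsmul_eq_mul, mul_one] at h1
    have h2 : ((Fintype.card ι * Fintype.card ι : ℕ) : ℝ) ≤ (K:ℝ)^2 := by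
      rw [pow_two]; exact_mod_cast Nat.mul_le_mul hK hK
    have h3 : ((a:ℝ) + b) * #T ≤ (a + b) * ∑ p, (w p : ℝ) := by
      have h4 : ((a:ℝ) + b) * ((∑ p : ι × ι, x p.1 p.2) * ((1 - e) * m) - (K:ℝ)^2) ≤ (a + b) * ∑ p, (w p : ℝ) := by
        gcongr; linarith
      refine le_trans ?_ h4
      have h5 : ((a:ℝ) + b) * ((∑ p : ι × ι, x p.1 p.2) * ((1 - e) * m) - (K:ℝ)^2) =
          (1 - e) * (m * Fintype.card ι) - (K:ℝ)^2 * (a+b) := by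
        rw [← hsumx]; ring
      rw [h5]
      have h6 : (1 - e) * ((1 - e) * #X) ≤ (1 - e) * (m * Fintype.card ι) := mul_le_mul_of_nonneg_left hmk (by linarith)
      push_cast at hT
      have : 0 ≤ e^2 * (#X : ℝ) := by positivity
      have h7 : ε = 3 * e := by rw [he]; ring
      rw [h7] at hT
      nlinarith
    have h4 := le_of_mul_le_mul_left h3 (by positivity)
    exact_mod_cast h4
  obtain ⟨π, hπ⟩ := exists_assign T w hwT
  have hcnt : ∀ i, (a:ℝ) * #(T.filter (fun t => (π t).1 = i)) + b * #(T.filter (fun t => (π t).2 = i)) ≤ (1 - e) * m := by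
    intro i
    have h1 : (#(T.filter (fun t => (π t).1 = i)) : ℝ) ≤ ∑ j, x i j * ((1 - e) * m) := by
      have : T.filter (fun t => (π t).1 = i) ⊆ univ.biUnion (fun j => T.filter (fun t => π t = (i, j))) := by
        intro t ht
        rw [mem_filter] at ht
        simp only [mem_biUnion, mem_univ, true_and, mem_filter]
        exact ⟨(π t).2, ht.1, by rw [← ht.2]⟩
      have h2 := (card_le_card this).trans card_biUnion_le
      have h3 : (#(T.filter (fun t => (π t).1 = i)) : ℝ) ≤ ∑ j, (#(T.filter (fun t => π t = (i, j))) : ℝ) := by exact_mod_cast h2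
      refine h3.trans (sum_le_sum fun j _ => le_trans ?_ (hwle (i, j)))
      exact_mod_cast hπ (i, j)
    have h1' : (#(T.filter (fun t => (π t).2 = i)) : ℝ) ≤ ∑ j, x j i * ((1 - e) * m) := by
      have : T.filter (fun t => (π t).2 = i) ⊆ univ.biUnion (fun j => T.filter (fun t => π t = (j, i))) := by
        intro t ht
        rw [mem_filter] at ht
        simp only [mem_biUnion, mem_univ, true_and, mem_filter]
        exact ⟨(π t).1, ht.1, by rw [← ht.2]⟩
      have h2 := (card_le_card this).trans card_biUnion_le
      have h3 : (#(T.filter (fun t => (π t).2 = i)) : ℝ) ≤ ∑ j, (#(T.filter (fun t => π t = (j, i))) : ℝ) := by exact_mod_cast h2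
      refine h3.trans (sum_le_sum fun j _ => le_trans ?_ (hwle (j, i)))
      exact_mod_cast hπ (j, i)
    calc _ ≤ (a:ℝ) * ∑ j, x i j * ((1 - e) * m) + b * ∑ j, x j i * ((1 - e) * m) := by gcongr
      _ = (∑ j, (a * x i j + b * x j i)) * ((1 - e) * m) := by
        rw [sum_add_distrib, ← mul_sum, ← mul_sum, ← sum_mul, ← sum_mul]; ring
      _ = _ := by rw [hx1, one_mul]
  have hRπ : ∀ t ∈ T, R (π t).1 (π t).2 := by
    intro t ht
    by_contra hR
    have h1 := hπ (π t)
    have h2 : w (π t) = 0 := by rw [hw]; simp only [hxR _ _ hR, zero_mul, Nat.floor_zero]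
    rw [h2, Nat.le_zero, card_eq_zero] at h1
    have : t ∈ T.filter (fun t' => π t' = π t) := mem_filter.2 ⟨ht, rfl⟩
    rw [h1] at this
    exact absurd this (notMem_empty _)
  have hXn : (Fintype.card V : ℝ) ≤ 2 * #X := by exact_mod_cast hX
  have key := jobsK a b (fun t => cl (π t).1) (fun t => cl (π t).2) G.Adj Xᶜ T (c/4) (by positivity) (by linarith) hn0
    ((Nat.le_ceil _).trans (Nat.cast_le.2 (by omega))) (by
      intro A t τ hA ht htA hF
      have hunused : ∀ i, e * m ≤ #(cl i \ usedV Xᶜ A τ) := by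
        intro i
        have h1 : cl i ∩ usedV Xᶜ A τ ⊆ (A.filter (fun t => (π t).1 = i)).biUnion (fun t => univ.image (fun k => τ t (Sum.inl k)))
            ∪ (A.filter (fun t => (π t).2 = i)).biUnion (fun t => univ.image (fun k => τ t (Sum.inr k))) := by
          intro v hv
          rw [mem_inter, mem_usedV] at hv
          obtain ⟨hv1, hv2 | ⟨t', ht', k, rfl⟩⟩ := hv
          · exact absurd (hclX i hv1) (mem_compl.1 hv2)
          · obtain ⟨-, hk1, hk2, -⟩ := hF.1 t' ht'
            simp only [mem_union, mem_biUnion, mem_filter, mem_image, mem_univ, true_and]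
            rcases k with k | k
            · left
              refine ⟨t', ⟨ht', ?_⟩, k, rfl⟩
              by_contra hne'
              exact (disjoint_left.1 (hdisj _ _ hne') (hk1 k)) hv1
            · right
              refine ⟨t', ⟨ht', ?_⟩, k, rfl⟩
              by_contra hne'
              exact (disjoint_left.1 (hdisj _ _ hne') (hk2 k)) hv1
        have h2 : #(cl i ∩ usedV Xᶜ A τ) ≤ #(T.filter (fun t => (π t).1 = i)) * a + #(T.filter (fun t => (π t).2 = i)) * b := by
          refine (card_le_card h1).trans ((card_union_le _ _).trans (Nat.add_le_add ?_ ?_))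
          · refine (card_biUnion_le_card_mul _ _ a fun t _ => card_image_le.trans (by simp)).trans ?_
            exact Nat.mul_le_mul_right _ (card_le_card (filter_subset_filter _ hA))
          · refine (card_biUnion_le_card_mul _ _ b fun t _ => card_image_le.trans (by simp)).trans ?_
            exact Nat.mul_le_mul_right _ (card_le_card (filter_subset_filter _ hA))
        have h3 : (#(cl i ∩ usedV Xᶜ A τ) : ℝ) ≤ #(T.filter (fun t => (π t).1 = i)) * a + #(T.filter (fun t => (π t).2 = i)) * b := by
          exact_mod_cast h2
        have h4 : (#(cl i \ usedV Xᶜ A τ) : ℝ) + #(cl i ∩ usedV Xᶜ A τ) = #(cl i) := by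
          exact_mod_cast card_sdiff_add_card_inter _ _
        have h5 : (m:ℝ) ≤ #(cl i) := by exact_mod_cast hm i
        have := hcnt i
        linarith
      have h1 := (hedge _ _ (hRπ t ht)).2 _ (sdiff_subset (t := usedV Xᶜ A τ)) _ (sdiff_subset (t := usedV Xᶜ A τ))
        (hunused _) (hunused _)
      refine le_trans ?_ h1
      have : (Fintype.card V : ℝ)^2 ≤ (2 * #X)^2 := by gcongr
      nlinarith)
  refine key.mono ?_ (fun D => le_refl _)
  rintro O ⟨τ, ⟨h1, h2, h3⟩, rfl⟩
  refine ⟨τ, ⟨fun t ht => ⟨(h1 t ht).1, by simp, by simp, (h1 t ht).2.2.2⟩, h2, h3⟩, rfl⟩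


/-! ## Part 7 : labelling utilities and the non-extremal case -/
section Lab
variable {V L : Type} [Fintype V] [DecidableEq V] [Fintype L] [DecidableEq L]

theorem Spr.bind {α : Type} [DecidableEq α] {P Q : Finset α → Prop} {w w' : α → ℝ} (h : Spr P (fun D => ∏ a ∈ D, w a))
    (h' : ∀ O, P O → Spr (fun O' => Q (O ∪ O')) (fun D => ∏ a ∈ D, w' a)) :
    Spr Q (fun D => ∏ a ∈ D, (w a + w' a)) := by
  refine (h.compW (Q := fun O O' => Q (O ∪ O')) h').mono ?_ (fun D => le_refl _)
  rintro S ⟨O₁, O₂, _, h, rfl⟩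
  exact h

/-- labelled vertices -/
def dom (O : Finset (V × L)) : Finset V := O.image Prod.fst

theorem mem_dom {O : Finset (V × L)} {v : V} : v ∈ dom O ↔ ∃ t, (v, t) ∈ O := by
  unfold dom; simp

theorem mem_fib {O : Finset (V × L)} {v : V} {t : L} : v ∈ fib O t ↔ (v, t) ∈ O := by
  unfold fib; simp

theorem dom_union (O O' : Finset (V × L)) : dom (O ∪ O') = dom O ∪ dom O' := image_union _ _

theorem fib_union (O O' : Finset (V × L)) (t : L) : fib (O ∪ O') t = fib O t ∪ fib O' t := by
  ext v; simp only [mem_fib, mem_union]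

theorem fib_subset_dom (O : Finset (V × L)) (t : L) : fib O t ⊆ dom O := fun v hv => mem_dom.2 ⟨t, mem_fib.1 hv⟩

theorem func_union {O O' : Finset (V × L)} (h : Func O) (h' : Func O') (hd : Disjoint (dom O) (dom O')) : Func (O ∪ O') := by
  intro v t t' h1 h2
  rw [mem_union] at h1 h2
  rcases h1 with h1 | h1 <;> rcases h2 with h2 | h2
  · exact h _ _ _ h1 h2
  · exact absurd (mem_dom.2 ⟨_, h2⟩) (disjoint_left.1 hd (mem_dom.2 ⟨_, h1⟩))
  · exact absurd (mem_dom.2 ⟨_, h1⟩) (disjoint_left.1 hd (mem_dom.2 ⟨_, h2⟩))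
  · exact h' _ _ _ h1 h2

theorem card_fib_union {O O' : Finset (V × L)} (hd : Disjoint (dom O) (dom O')) (t : L) :
    #(fib (O ∪ O') t) = #(fib O t) + #(fib O' t) := by
  rw [fib_union, card_union_of_disjoint]
  exact disjoint_of_subset_left (fib_subset_dom _ _) (disjoint_of_subset_right (fib_subset_dom _ _) hd)

theorem card_dom {O : Finset (V × L)} (h : Func O) : #(dom O) = ∑ t, #(fib O t) := by
  rw [← card_biUnion]
  · congr 1
    ext v
    simp only [mem_dom, mem_biUnion, mem_univ, true_and, mem_fib]
  · intro t _ t' _ htt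
    rw [Function.onFun, disjoint_left]
    intro v hv hv'
    exact htt (h v t t' (mem_fib.1 hv) (mem_fib.1 hv'))

theorem card_dom' {O : Finset (V × L)} (h : Func O) : #(dom O) = #O := by
  unfold dom
  apply card_image_of_injOn
  rintro ⟨v, t⟩ h1 ⟨v', t'⟩ h2 heq
  simp only at heq
  subst heq
  rw [h v t t' h1 h2]

theorem lab_total {O : Finset (V × L)} (h : Func O) (r : ℕ) (hr : ∀ t, #(fib O t) = r) (hc : Fintype.card V = r * Fintype.card L) :
    ∀ v, ∃ t, (v, t) ∈ O := by
  intro v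
  rw [← mem_dom]
  have : dom O = univ := by
    rw [← card_eq_iff_eq_univ, card_dom h, sum_congr rfl fun t _ => hr t, sum_const, card_univ, smul_eq_mul, hc, mul_comm]
  rw [this]; exact mem_univ _

theorem func_atoms {κ : Type} [Fintype κ] {Ok : L → (κ → V) → Prop} {U : Finset V} {T : Finset L} {τ : L → κ → V}
    (h : Fam Ok U T τ) : Func (atoms T τ) := by
  intro v t t' h1 h2
  rw [mem_atoms] at h1 h2
  obtain ⟨ht, i, hi⟩ := h1
  obtain ⟨ht', j, hj⟩ := h2
  by_contra hne
  exact h.2.2 t ht t' ht' hne i j (by rw [hi, hj])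

theorem dom_atoms_disj {κ : Type} [Fintype κ] {Ok : L → (κ → V) → Prop} {U : Finset V} {T : Finset L} {τ : L → κ → V}
    (h : Fam Ok U T τ) : Disjoint U (dom (atoms T τ)) := by
  rw [disjoint_right]
  intro v hv
  rw [mem_dom] at hv
  obtain ⟨t, hv⟩ := hv
  rw [mem_atoms] at hv
  obtain ⟨ht, i, hi⟩ := hv
  simp only at hi
  rw [← hi]; exact h.2.1 t ht i

theorem fib_atoms {κ : Type} [Fintype κ] {T : Finset L} {τ : L → κ → V} {t : L} (ht : t ∈ T) :
    fib (atoms T τ) t = univ.image (τ t) := by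
  ext v; rw [mem_fib, mem_atoms]; simp [ht]

theorem fib_atoms_not {κ : Type} [Fintype κ] {T : Finset L} {τ : L → κ → V} {t : L} (ht : t ∉ T) :
    fib (atoms T τ) t = ∅ := by
  ext v; rw [mem_fib, mem_atoms]; simp [ht]

theorem card_fib_atoms {κ : Type} [Fintype κ] {T : Finset L} {τ : L → κ → V} {t : L} (ht : t ∈ T) (hi : Function.Injective (τ t)) :
    #(fib (atoms T τ) t) = Fintype.card κ := by
  rw [fib_atoms ht, card_image_of_injective _ hi, card_univ]

/-- the atoms of a function on a set -/
noncomputable def gr (X : Finset V) (f : V → L) : Finset (V × L) := X.image (fun x => (x, f x))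

theorem mem_gr {X : Finset V} {f : V → L} {a : V × L} : a ∈ gr X f ↔ a.1 ∈ X ∧ f a.1 = a.2 := by
  unfold gr
  rw [mem_image]
  constructor
  · rintro ⟨x, hx, rfl⟩; exact ⟨hx, rfl⟩
  · rintro ⟨h1, h2⟩; exact ⟨a.1, h1, by rw [h2]⟩

theorem func_gr (X : Finset V) (f : V → L) : Func (gr X f) := by
  intro v t t' h1 h2
  rw [mem_gr] at h1 h2
  exact h1.2.symm.trans h2.2

theorem dom_gr (X : Finset V) (f : V → L) : dom (gr X f) = X := by
  ext v
  rw [mem_dom]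
  constructor
  · rintro ⟨t, h⟩; exact (mem_gr.1 h).1
  · intro h; exact ⟨f v, mem_gr.2 ⟨h, rfl⟩⟩

theorem fib_gr_not {X : Finset V} {f : V → L} {T : Finset L} (h : Set.BijOn f X T) {t : L} (ht : t ∉ T) : fib (gr X f) t = ∅ := by
  ext v
  rw [mem_fib, mem_gr]
  simp only [notMem_empty, iff_false]
  rintro ⟨h1, rfl⟩
  exact ht (h.mapsTo h1)

theorem fib_gr {X : Finset V} {f : V → L} {T : Finset L} (h : Set.BijOn f X T) {t : L} (ht : t ∈ T) :
    ∃ x ∈ X, f x = t ∧ fib (gr X f) t = {x} := by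
  obtain ⟨x, hx, hxt⟩ := h.surjOn ht
  refine ⟨x, hx, hxt, ?_⟩
  ext v
  rw [mem_fib, mem_gr, mem_singleton]
  constructor
  · rintro ⟨h1, h2⟩
    exact h.injOn h1 hx (by rw [hxt]; exact h2)
  · rintro rfl; exact ⟨hx, hxt⟩

theorem eG_sdiff (G : SimpleGraph V) (X Y U : Finset V) : eG G X Y ≤ eG G (X \ U) (Y \ U) + 2 * (#U * Fintype.card V) := by
  unfold eG
  have : (X ×ˢ Y).filter (fun p => G.Adj p.1 p.2) ⊆ ((X \ U) ×ˢ (Y \ U)).filter (fun p => G.Adj p.1 p.2) ∪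
      (U ×ˢ univ ∪ univ ×ˢ U) := by
    intro p
    simp only [mem_filter, mem_union, mem_product, mem_sdiff, mem_univ, and_true, true_and]
    tauto
  refine (card_le_card this).trans ((card_union_le _ _).trans ?_)
  refine Nat.add_le_add_left ((card_union_le _ _).trans ?_) _
  rw [card_product, card_product, card_univ]
  exact le_of_eq (by ring)

theorem dg_sdiff (G : SimpleGraph V) (X U : Finset V) (v : V) : dg G X v ≤ dg G (X \ U) v + #U := by
  unfold dg
  refine le_trans (card_le_card ?_) (card_union_le _ _)
  intro u
  simp only [mem_filter, mem_union, mem_sdiff]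
  tauto

end Lab


/-! ## Part 7b : universal sets -/
section Univ
variable {V L : Type} [Fintype V] [DecidableEq V] [DecidableEq L]

theorem nn_image_le {κ : Type} [Fintype κ] [DecidableEq κ] (G : SimpleGraph V) (σ : κ → V) (i : κ) (k : ℕ) (J : Finset κ)
    (hi : i ∈ J) (hJ : #J ≤ k) (h : ∀ j, j ∉ J → G.Adj (σ i) (σ j)) :
    nn G (univ.image σ) (σ i) + 1 ≤ k := by
  have h1 : (univ.image σ).filter (fun u => σ i ≠ u ∧ ¬ G.Adj (σ i) u) ⊆ (J.erase i).image σ := by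
    intro u hu
    simp only [mem_filter, mem_image, mem_univ, true_and] at hu
    obtain ⟨⟨j, rfl⟩, h2, h3⟩ := hu
    refine mem_image_of_mem _ (mem_erase.2 ⟨fun hh => h2 (by rw [hh]), ?_⟩)
    by_contra hh
    exact h3 (h j hh)
  have h2 := (card_le_card h1).trans card_image_le
  rw [card_erase_of_mem hi] at h2
  have h3 : 0 < #J := card_pos.2 ⟨i, hi⟩
  unfold nn
  omega

theorem nn_kab (G : SimpleGraph V) {a b : ℕ} {X Y : Finset V} (σ : Fin a ⊕ Fin b → V) (h : Kab X Y G.Adj σ) (k : ℕ)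
    (ha : a ≤ k) (hb : b ≤ k) : ∀ v ∈ univ.image σ, nn G (univ.image σ) v + 1 ≤ k := by
  intro v hv
  obtain ⟨i, -, rfl⟩ := mem_image.1 hv
  rcases i with i | i
  · refine nn_image_le G σ _ k (univ.image Sum.inl) (mem_image_of_mem _ (mem_univ _)) (card_image_le.trans (by simpa using ha)) ?_
    rintro (j | j) hj
    · exact absurd (mem_image_of_mem _ (mem_univ _)) hj
    · exact h.2.2 _ _
  · refine nn_image_le G σ _ k (univ.image Sum.inr) (mem_image_of_mem _ (mem_univ _)) (card_image_le.trans (by simpa using hb)) ?_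
    rintro (j | j) hj
    · exact (h.2.2 _ _).symm
    · exact absurd (mem_image_of_mem _ (mem_univ _)) hj

/-- universal tuples -/
def UOk {κ : Type} [Fintype κ] (G : SimpleGraph V) (s : ℕ) (σ : κ → V) : Prop :=
  Function.Injective σ ∧ ∀ v ∈ univ.image σ, nn G (univ.image σ) v + 2 ≤ s

theorem nn_apex (G : SimpleGraph V) {a : ℕ} (x : V) (σ : Fin a ⊕ Fin a → V)
    (h : Kab (univ.filter (fun u => G.Adj x u)) (univ.filter (fun u => G.Adj x u)) G.Adj σ) (ha : 1 ≤ a) (hi : Function.Injective σ) :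
    UOk G (a+1) (fun o : Option (Fin a ⊕ Fin a) => o.elim x σ) := by
  have hx : ∀ i, G.Adj x (σ i) := by
    rintro (i | i)
    · exact (mem_filter.1 (h.1 i)).2
    · exact (mem_filter.1 (h.2.1 i)).2
  refine ⟨?_, ?_⟩
  · rintro (_ | i) (_ | j) hij
    · rfl
    · exact absurd hij (hx j).ne
    · exact absurd hij (hx i).ne'
    · exact congrArg some (hi hij)
  · intro v hv
    obtain ⟨i, -, rfl⟩ := mem_image.1 hv
    have key : nn G (univ.image (fun o : Option (Fin a ⊕ Fin a) => o.elim x σ)) ((fun o : Option (Fin a ⊕ Fin a) => o.elim x σ) i) + 1 ≤ a := by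
      rcases i with _ | i
      · refine nn_image_le G _ none a {none} (mem_singleton_self _) (by simpa using ha) ?_
        rintro (_ | j) hj
        · exact absurd (mem_singleton_self _) hj
        · exact hx j
      · rcases i with i | i
        · refine nn_image_le G _ (some (Sum.inl i)) a (univ.image (fun j => some (Sum.inl j))) (mem_image_of_mem _ (mem_univ _)) (card_image_le.trans (by simp)) ?_
          rintro (_ | (j | j)) hj
          · exact (hx _).symm
          · exact absurd (mem_image.2 ⟨j, mem_univ _, rfl⟩) hj
          · exact h.2.2 _ _
        · refine nn_image_le G _ (some (Sum.inr i)) a (univ.image (fun j => some (Sum.inr j))) (mem_image_of_mem _ (mem_univ _)) (card_image_le.trans (by simp)) ?_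
          rintro (_ | (j | j)) hj
          · exact (hx _).symm
          · exact (h.2.2 _ _).symm
          · exact absurd (mem_image.2 ⟨j, mem_univ _, rfl⟩) hj
    exact Nat.succ_le_succ key

/-- universal sets, `r < 2 s` -/
theorem univ1 (r s : ℕ) (hs : 2 ≤ s) (hsr : s < r) (hr : r < 2 * s) :
    ∃ C : ℝ, 0 < C ∧ ∃ n₀ : ℕ, ∀ (V L : Type) [Fintype V] [DecidableEq V] [DecidableEq L] (G : SimpleGraph V) (T : Finset L),
      n₀ ≤ Fintype.card V → 8 * (r:ℝ)^2 * #T ≤ Fintype.card V →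
      (∀ v, (1 / r : ℝ) * Fintype.card V ≤ dg G univ v) →
      Spr (fun O => ∃ τ : L → Fin (r - s) ⊕ Fin (s - 1) → V, Fam (fun _ σ => UOk G s σ) ∅ T τ ∧ O = atoms T τ)
        (fun D => ∏ x ∈ D, (if x.2 ∈ T then C / Fintype.card V else 0)) := by
  have hr0 : (1:ℝ) ≤ r := by exact_mod_cast (by omega : 1 ≤ r)
  set c : ℝ := 1 / (2 * r) with hc
  have hc0 : 0 < c := by positivity
  have hc1 : c ≤ 1 := by rw [hc, div_le_one (by positivity)]; linarith
  set a := r - s with ha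
  set b := s - 1 with hb
  refine ⟨((a + b : ℕ) : ℝ) / (c ^ ((a+1) * (b+1)) / 2), ?_, ⌈2 * ((a + b : ℕ) : ℝ) ^ 2 / c ^ ((a+1)*(b+1))⌉₊ + 1,
    fun V L _ _ _ G T hn hT hdeg => ?_⟩
  · have : (0:ℝ) < (a + b : ℕ) := by exact_mod_cast (by omega : 0 < a + b)
    positivity
  have key := jobsK a b (fun _ : L => (univ : Finset V)) (fun _ => univ) G.Adj ∅ T c hc0 hc1 (by omega)
    ((Nat.le_ceil _).trans (Nat.cast_le.2 (by omega))) (by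
      intro A t τ hA ht htA hF
      have h1 : (Fintype.card V : ℝ) * ((1/r) * Fintype.card V) ≤ eG G univ univ := by
        rw [eG_eq_sum]; push_cast
        rw [← card_univ, ← nsmul_eq_mul, ← sum_const]
        exact sum_le_sum fun v _ => by rw [card_univ]; exact hdeg v
      have h2 := eG_sdiff G univ univ (usedV ∅ A τ)
      have h3 : #(usedV ∅ A τ) ≤ #T * r := by
        refine (card_usedV _ _ _).trans ?_
        rw [card_empty, zero_add]
        exact Nat.mul_le_mul (card_le_card hA) (by simp; omega)
      have h2' : (eG G univ univ : ℝ) ≤ eG G (univ \ usedV ∅ A τ) (univ \ usedV ∅ A τ) + 2 * (#(usedV ∅ A τ) * Fintype.card V) := by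
        exact_mod_cast h2
      have h3' : (#(usedV ∅ A τ) : ℝ) ≤ #T * r := by exact_mod_cast h3
      have h4 : 4 * r * (#T * r) ≤ (Fintype.card V : ℝ) := by nlinarith [Nat.cast_nonneg (α := ℝ) #T]
      have h5 : 2 * (#(usedV ∅ A τ) * Fintype.card V : ℝ) ≤ c * Fintype.card V ^ 2 := by
        have : 2 * (#(usedV ∅ A τ) : ℝ) ≤ c * Fintype.card V := by
          rw [hc, one_div_mul_eq_div, le_div_iff₀ (by positivity)]
          nlinarith
        nlinarith [Nat.cast_nonneg (α := ℝ) (Fintype.card V)]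
      have h6 : (Fintype.card V : ℝ) * ((1/r) * Fintype.card V) = 2 * (c * Fintype.card V ^ 2) := by
        rw [hc]; field_simp
      change _ ≤ (eG G (univ \ usedV ∅ A τ) (univ \ usedV ∅ A τ) : ℝ)
      linarith)
  refine key.mono ?_ (fun D => le_refl _)
  rintro O ⟨τ, ⟨h1, h2, h3⟩, rfl⟩
  refine ⟨τ, ⟨fun t ht => ⟨(h1 t ht).1, fun v hv => ?_⟩, h2, h3⟩, rfl⟩
  have := nn_kab G (τ t) (h1 t ht).2 (s - 1) (by omega) (by omega) v (by convert hv)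
  have e : (univ.image (τ t) : Finset V) = @Finset.image _ _ (fun a b => Classical.propDecidable _) (τ t) univ := by
    congr!
  convert (by omega : nn G (univ.image (τ t)) v + 2 ≤ s)

/-- universal sets, `r = 2 s` -/
theorem univ2 (r s : ℕ) (hs : 2 ≤ s) (hr : r = 2 * s) (γ : ℝ) (hγ : 0 < γ) (hγ1 : γ ≤ 1) :
    ∃ C : ℝ, 0 < C ∧ ∃ n₀ : ℕ, ∀ (V L : Type) [Fintype V] [DecidableEq V] [DecidableEq L] (G : SimpleGraph V) (T : Finset L),
      n₀ ≤ Fintype.card V → 8 * (r:ℝ) * #T ≤ γ * Fintype.card V →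
      (∀ v, γ * Fintype.card V ^ 2 ≤ eG G (univ.filter (fun u => G.Adj v u)) (univ.filter (fun u => G.Adj v u))) →
      Spr (fun O => ∃ τ : L → Option (Fin (s - 1) ⊕ Fin (s - 1)) → V, Fam (fun _ σ => UOk G s σ) ∅ T τ ∧ O = atoms T τ)
        (fun D => ∏ x ∈ D, (if x.2 ∈ T then C / Fintype.card V else 0)) := by
  have hr0 : (1:ℝ) ≤ r := by exact_mod_cast (by omega : 1 ≤ r)
  obtain ⟨a, rfl⟩ : ∃ a, s = a + 1 := ⟨s - 1, by omega⟩
  have ha1 : a + 1 - 1 = a := by omega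
  rw [ha1]
  set c : ℝ := γ / 2 with hc
  have hc0 : 0 < c := by positivity
  have hc1 : c ≤ 1 := by linarith
  set c' : ℝ := c ^ ((a+1)*(a+1)) / 2 with hc'
  have hc'0 : 0 < c' := by positivity
  have hc'1 : c' ≤ 1 := by have := pow_le_one₀ hc0.le hc1 (n := (a+1)*(a+1)); linarith
  have hκ : Fintype.card (Option (Fin a ⊕ Fin a)) = a + a + 1 := by simp
  refine ⟨((a + a + 1 : ℕ) : ℝ) / (c' / 2), by positivity, ⌈2 * ((a + a : ℕ) : ℝ) ^ 2 / c ^ ((a+1)*(a+1))⌉₊ + 1,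
    fun V L _ _ _ G T hn hT hdeg => ?_⟩
  have key := jobs (κ := Option (Fin a ⊕ Fin a)) (fun (_ : L) σ => UOk G (a+1) σ) ∅ T (c' / 2) (by positivity) (by linarith)
    (by omega : 0 < Fintype.card V) (by
      intro A t τ hA ht htA hF
      set U := usedV ∅ A τ with hU
      have h3 : #U ≤ #T * r := by
        refine (card_usedV _ _ _).trans ?_
        rw [card_empty, zero_add, hκ]
        exact Nat.mul_le_mul (card_le_card hA) (by omega)
      have h3' : (#U : ℝ) ≤ #T * r := by exact_mod_cast h3
      have h4 : 4 * (#U : ℝ) ≤ c * Fintype.card V := by rw [hc]; nlinarith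
      set Nb : V → Finset V := fun x => univ.filter (fun u => G.Adj x u) with hNb
      have hx : ∀ x, c' * (Fintype.card V : ℝ) ^ (a + a) ≤
          #(univ.filter (fun σ : Fin a ⊕ Fin a → V => Function.Injective σ ∧ Kab (Nb x \ U) (Nb x \ U) G.Adj σ)) := by
        intro x
        have h5 := kab_options (Nb x \ U) (Nb x \ U) G.Adj c hc0 a a (by omega : 0 < Fintype.card V)
          ((Nat.le_ceil _).trans (Nat.cast_le.2 (by omega))) (by
            have h6 : (eG G (Nb x) (Nb x) : ℝ) ≤ eG G (Nb x \ U) (Nb x \ U) + 2 * (#U * Fintype.card V) := by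
              exact_mod_cast eG_sdiff G (Nb x) (Nb x) U
            have h7 := hdeg x
            have h8 : 2 * (#U * Fintype.card V : ℝ) ≤ c * Fintype.card V ^ 2 := by
              nlinarith [Nat.cast_nonneg (α := ℝ) (Fintype.card V), Nat.cast_nonneg (α := ℝ) #U]
            change _ ≤ (eG G (Nb x \ U) (Nb x \ U) : ℝ)
            have h9 : γ = 2 * c := by rw [hc]; ring
            rw [h9] at h7
            linarith)
        rw [Fintype.card_sum, Fintype.card_fin] at h5
        exact h5
      have hcnt : #((univ \ U).sigma (fun x => univ.filter (fun σ : Fin a ⊕ Fin a → V => Function.Injective σ ∧ Kab (Nb x \ U) (Nb x \ U) G.Adj σ)))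
          ≤ #(univ.filter (fun σ : Option (Fin a ⊕ Fin a) → V => UOk G (a+1) σ ∧ ∀ i, σ i ∉ U)) := by
        refine card_le_card_of_injOn (fun p => fun o => o.elim p.1 p.2) ?_ ?_
        · rintro ⟨x, σ⟩ h
          simp only [coe_sigma, Set.mem_sigma_iff, mem_coe, mem_sdiff, mem_univ, true_and, mem_filter] at h
          obtain ⟨h1, h2, h3, h4, h5⟩ := h
          rw [mem_coe, mem_filter]
          refine ⟨mem_univ _, nn_apex G x σ ⟨fun i => (mem_sdiff.1 (h3 i)).1, fun i => (mem_sdiff.1 (h4 i)).1, h5⟩ (by omega) h2, ?_⟩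
          rintro (_ | (i | i))
          · exact h1
          · exact (mem_sdiff.1 (h3 i)).2
          · exact (mem_sdiff.1 (h4 i)).2
        · rintro ⟨x, σ⟩ _ ⟨y, ρ⟩ _ h
          have e1 : x = y := congrFun h none
          have e2 : σ = ρ := funext fun i => congrFun h (some i)
          rw [e1, e2]
      rw [card_sigma] at hcnt
      have hcnt' : ∑ x ∈ univ \ U, (#(univ.filter (fun σ : Fin a ⊕ Fin a → V => Function.Injective σ ∧ Kab (Nb x \ U) (Nb x \ U) G.Adj σ)) : ℝ)
          ≤ #(univ.filter (fun σ : Option (Fin a ⊕ Fin a) → V => UOk G (a+1) σ ∧ ∀ i, σ i ∉ U)) := by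
        exact_mod_cast hcnt
      have h10 : (#(univ \ U) : ℝ) * (c' * (Fintype.card V : ℝ) ^ (a + a)) ≤ ∑ x ∈ univ \ U, (#(univ.filter (fun σ : Fin a ⊕ Fin a → V => Function.Injective σ ∧ Kab (Nb x \ U) (Nb x \ U) G.Adj σ)) : ℝ) := by
        rw [← nsmul_eq_mul, ← sum_const]
        exact sum_le_sum fun x _ => hx x
      have h11 : (Fintype.card V : ℝ) / 2 ≤ #(univ \ U) := by
        have : #(univ \ U) + #U = Fintype.card V := by
          rw [card_sdiff_add_card, union_eq_left.2 (subset_univ _), card_univ]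
        have : (#(univ \ U) : ℝ) + #U = Fintype.card V := by exact_mod_cast this
        nlinarith [Nat.cast_nonneg (α := ℝ) (Fintype.card V)]
      have h12 : c' / 2 * (Fintype.card V : ℝ) ^ Fintype.card (Option (Fin a ⊕ Fin a)) ≤ (#(univ \ U) : ℝ) * (c' * (Fintype.card V : ℝ) ^ (a + a)) := by
        rw [hκ, pow_succ]
        calc _ = ((Fintype.card V : ℝ) / 2) * (c' * (Fintype.card V : ℝ) ^ (a + a)) := by ring
          _ ≤ _ := by gcongr
      refine (h12.trans (h10.trans hcnt')).trans (le_of_eq ?_)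
      congr!)
  rw [hκ] at key
  exact key

end Univ


/-! ## Part 7c : the non-extremal case -/

theorem nonext_asm {V L κ : Type} [Fintype V] [DecidableEq V] [Fintype L] [DecidableEq L] [Fintype κ] (r s : ℕ) (hs : 2 ≤ s)
    (hsr : s < r) (hrs : r ≤ 2 * s) (hκ : Fintype.card κ = r - 1) (G : SimpleGraph V) (hVL : Fintype.card V = r * Fintype.card L)
    (T : Finset L) (m : ℕ) (hm : #T = m) (hm1 : 1 ≤ m) (C1 C2 : ℝ) (hC1 : 0 ≤ C1) (hC2 : 0 ≤ C2)
    (h1 : Spr (fun O => ∃ τ : L → κ → V, Fam (fun _ σ => UOk G s σ) ∅ T τ ∧ O = atoms T τ)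
        (fun D => ∏ x ∈ D, (if x.2 ∈ T then C1 / Fintype.card V else 0)))
    (h2 : ∀ X : Finset V, #X + (r - 1) * m = Fintype.card V →
      Spr (fun O => ∃ τ : L → Fin s ⊕ Fin (r - s) → V,
          Fam (fun _ (σ : Fin s ⊕ Fin (r - s) → V) => Function.Injective σ ∧ Kab univ univ G.Adj σ) Xᶜ Tᶜ τ ∧ O = atoms Tᶜ τ)
        (fun D => ∏ x ∈ D, (if x.2 ∈ Tᶜ then C2 / Fintype.card V else 0))) :
    Spr (GoodLab G r s (fun _ => none)) (fun D => ∏ a ∈ D, rw8 (fun _ : V => (none : Option L)) (C1 / Fintype.card V + (C2 / Fintype.card V + 48 / m)) a) := by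
  have key : Spr (GoodLab G r s (fun _ => none)) (fun D => ∏ x ∈ D, ((if x.2 ∈ T then C1 / Fintype.card V else 0) +
      ((if x.2 ∈ Tᶜ then C2 / Fintype.card V else 0) + 48 / m))) := by
    refine Spr.bind h1 ?_
    rintro O1 ⟨τ1, hF1, rfl⟩
    set O1 := atoms T τ1 with hO1
    have hf1 : Func O1 := func_atoms hF1
    have hc1 : ∀ t ∈ T, #(fib O1 t) = r - 1 := fun t ht => by
      rw [card_fib_atoms ht (hF1.1 t ht).1, hκ]
    have hd1 : #(dom O1) = (r - 1) * m := by
      rw [card_dom hf1, ← sum_subset (subset_univ T), sum_congr rfl hc1, sum_const, hm, smul_eq_mul, mul_comm]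
      intro t _ ht
      rw [hO1, fib_atoms_not ht, card_empty]
    refine Spr.bind (h2 (dom O1)ᶜ ?_) ?_
    · rw [← hd1, card_compl_add_card]
    rintro O2 ⟨τ2, hF2, rfl⟩
    set O2 := atoms Tᶜ τ2 with hO2
    rw [compl_compl] at hF2
    have hf2 : Func O2 := func_atoms hF2
    have hc2 : ∀ t ∈ Tᶜ, #(fib O2 t) = r := fun t ht => by
      rw [card_fib_atoms ht (hF2.1 t ht).1, Fintype.card_sum, Fintype.card_fin, Fintype.card_fin]; omega
    have hd2 : #(dom O2) = r * #Tᶜ := by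
      rw [card_dom hf2, ← sum_subset (subset_univ Tᶜ), sum_congr rfl hc2, sum_const, smul_eq_mul, mul_comm]
      intro t _ ht
      rw [hO2, fib_atoms_not ht, card_empty]
    have hdis : Disjoint (dom O1) (dom O2) := dom_atoms_disj hF2
    set X := (dom O1 ∪ dom O2)ᶜ with hX
    have hXm : #X = m := by
      have e1 : #X + #(dom O1 ∪ dom O2) = Fintype.card V := card_compl_add_card _
      rw [card_union_of_disjoint hdis, hd1, hd2, hVL] at e1
      have e2 : #Tᶜ + #T = Fintype.card L := card_compl_add_card _
      rw [hm] at e2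
      rw [← e2] at e1
      obtain ⟨q, rfl⟩ : ∃ q, r = q + 1 := ⟨r - 1, by omega⟩
      rw [Nat.add_sub_cancel] at e1
      nlinarith
    have h3 := match_sub X T m hm1 hXm hm (fun _ _ => True) (by
      intro x _; rw [filter_true, hm]; nlinarith [Nat.cast_nonneg (α := ℝ) m])
      (by intro x _; rw [filter_true, hXm]; nlinarith [Nat.cast_nonneg (α := ℝ) m])
    refine h3.monoW ?_ ?_ ?_
    · intro a; split_ifs <;> positivity
    · intro a; split_ifs
      · exact le_refl _
      · positivity
    rintro O3 ⟨f, hf, -, hO3⟩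
    have hO3' : O3 = gr X f := hO3
    have hd3 : dom O3 = X := by rw [hO3', dom_gr]
    have hf3 : Func O3 := by rw [hO3']; exact func_gr _ _
    have hdis2 : Disjoint (dom O2) (dom O3) := by
      rw [hd3, hX]; exact disjoint_compl_right.mono_left subset_union_right
    have hdis3 : Disjoint (dom O1) (dom (O2 ∪ O3)) := by
      rw [dom_union, disjoint_union_right]
      refine ⟨hdis, ?_⟩
      rw [hd3, hX]; exact disjoint_compl_right.mono_left subset_union_left
    have hfun : Func (O1 ∪ (O2 ∪ O3)) := func_union hf1 (func_union hf2 hf3 hdis2) hdis3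
    have hcard : ∀ t, #(fib (O1 ∪ (O2 ∪ O3)) t) = r := by
      intro t
      rw [card_fib_union hdis3, card_fib_union hdis2]
      by_cases ht : t ∈ T
      · obtain ⟨x, _, _, hx⟩ := fib_gr hf ht
        rw [hc1 t ht, hO3', hx, hO2, fib_atoms_not (by rwa [mem_compl, not_not]), card_empty, card_singleton]; omega
      · rw [hc2 t (mem_compl.2 ht), hO1, fib_atoms_not ht, hO3', fib_gr_not hf ht, card_empty]; omega
    refine ⟨hfun, lab_total hfun r hcard hVL, hcard, ?_, by simp⟩
    intro t
    rw [fib_union, fib_union]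
    by_cases ht : t ∈ T
    · obtain ⟨x, hxX, _, hx⟩ := fib_gr hf ht
      have e2 : fib O2 t = ∅ := by rw [hO2]; exact fib_atoms_not (by rwa [mem_compl, not_not])
      have e1 : fib O1 t = univ.image (τ1 t) := by rw [hO1]; exact fib_atoms ht
      rw [e1, e2, hO3', hx, empty_union]
      right
      refine ⟨x, by simp, ?_⟩
      have hxn : x ∉ univ.image (τ1 t) := by
        rw [← fib_atoms ht, ← hO1]
        intro hh
        rw [hX, mem_compl, mem_union] at hxX
        exact hxX (Or.inl (fib_subset_dom _ _ hh))
      have : (univ.image (τ1 t) ∪ {x}).erase x = univ.image (τ1 t) := by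
        ext v
        simp only [mem_erase, mem_union, mem_singleton]
        constructor
        · rintro ⟨h1, h2 | h2⟩
          · exact h2
          · exact absurd h2 h1
        · intro h; exact ⟨fun hv => hxn (hv ▸ h), Or.inl h⟩
      rw [this]
      exact (hF1.1 t ht).2
    · rw [hO3', fib_gr_not hf ht, hO1, fib_atoms_not ht, hO2, fib_atoms (mem_compl.2 ht), empty_union, union_empty]
      left
      exact nn_kab G (τ2 t) (hF2.1 t (mem_compl.2 ht)).2 s le_rfl (by omega)
  refine key.monoW ?_ ?_ (fun _ h => h)
  · intro a; have : (0:ℝ) ≤ 48 / m := by positivity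
    split_ifs <;> positivity
  · intro a
    have : (0:ℝ) ≤ 48 / m := by positivity
    have e1 : 0 ≤ C1 / Fintype.card V := by positivity
    have e2 : 0 ≤ C2 / Fintype.card V := by positivity
    have e3 : rw8 (fun _ : V => (none : Option L)) (C1 / Fintype.card V + (C2 / Fintype.card V + 48 / m)) a = C1 / Fintype.card V + (C2 / Fintype.card V + 48 / m) := by
      simp [rw8]
    rw [e3]
    split_ifs <;> linarith

set_option maxHeartbeats 1000000 in
theorem nonext (r s : ℕ) (hs : 2 ≤ s) (hsr : s < r) (hrs : r ≤ 2 * s) (γ : ℝ) (hγ : 0 < γ) (hγ1 : γ ≤ 1) :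
    ∃ C : ℝ, 0 < C ∧ ∃ n₀ : ℕ, ∀ (V L : Type) [Fintype V] [DecidableEq V] [Fintype L] [DecidableEq L] (G : SimpleGraph V),
      n₀ ≤ Fintype.card V → Fintype.card V = r * Fintype.card L →
      (∀ v, (r - s) * Fintype.card L ≤ dg G univ v) →
      (∀ U : Finset V, ((s:ℝ) / r - γ) * Fintype.card V ≤ #U → γ * (Fintype.card V : ℝ)^2 ≤ eG G U U) →
      Spr (GoodLab G r s (fun _ => none)) (fun D => ∏ a ∈ D, rw8 (fun _ : V => (none : Option L)) (C / Fintype.card V) a) := by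
  have hs' : (2:ℝ) ≤ s := by exact_mod_cast hs
  have hr' : (2:ℝ) ≤ r := by exact_mod_cast (by omega : 2 ≤ r)
  obtain ⟨μ, hμ0, hμ1, hμ2⟩ : ∃ μ : ℝ, 0 < μ ∧ μ * (8 * r^2) ≤ 1 ∧ μ * (16 * r * s) ≤ γ :=
    ⟨min (1 / (8 * r^2)) (γ / (16 * r * s)), by positivity,
      by rw [← le_div_iff₀ (by positivity)]; exact min_le_left _ _, by rw [← le_div_iff₀ (by positivity)]; exact min_le_right _ _⟩
  have hμ3 : μ * r ≤ 1/16 := by nlinarith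
  have hμ4 : μ ≤ 1/16 := by nlinarith
  obtain ⟨C2, hC2, n2, hT⟩ := tileT s (r - s) (by omega) (by omega) (by omega) (γ/2) (μ/2) (by positivity) (by positivity) (by linarith)
  have hU : ∃ (κ : Type) (_ : Fintype κ), Fintype.card κ = r - 1 ∧ ∃ C : ℝ, 0 < C ∧ ∃ n₀ : ℕ, ∀ (V L : Type) [Fintype V] [DecidableEq V] [Fintype L] [DecidableEq L] (G : SimpleGraph V) (T : Finset L),
      n₀ ≤ Fintype.card V → Fintype.card V = r * Fintype.card L → (#T : ℝ) ≤ μ * Fintype.card V → 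
      (∀ v, (r - s) * Fintype.card L ≤ dg G univ v) →
      (∀ U : Finset V, ((s:ℝ) / r - γ) * Fintype.card V ≤ #U → γ * (Fintype.card V : ℝ)^2 ≤ eG G U U) →
      Spr (fun O => ∃ τ : L → κ → V, Fam (fun _ σ => UOk G s σ) ∅ T τ ∧ O = atoms T τ)
        (fun D => ∏ x ∈ D, (if x.2 ∈ T then C / Fintype.card V else 0)) := by
    rcases Nat.lt_or_ge r (2 * s) with h | h
    · obtain ⟨C, hC, n₀, h1⟩ := univ1 r s hs hsr h
      refine ⟨Fin (r - s) ⊕ Fin (s - 1), inferInstance, by simp; omega, C, hC, n₀, fun V L _ _ _ _ G T hn hVL hT hdeg _ => ?_⟩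
      refine h1 V L G T hn ?_ ?_
      · calc 8 * (r:ℝ)^2 * #T ≤ 8 * (r:ℝ)^2 * (μ * Fintype.card V) := by gcongr
          _ = (μ * (8 * r^2)) * Fintype.card V := by ring
          _ ≤ 1 * Fintype.card V := by gcongr
          _ = _ := one_mul _
      · intro v
        have h2 : Fintype.card L ≤ dg G univ v := le_trans (by nlinarith [(by omega : 1 ≤ r - s)]) (hdeg v)
        rw [hVL]; push_cast
        have : (1 / r : ℝ) * (r * Fintype.card L) = Fintype.card L := by field_simp
        rw [this]; exact_mod_cast h2
    · obtain ⟨C, hC, n₀, h1⟩ := univ2 r s hs (by omega) γ hγ hγ1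
      refine ⟨Option (Fin (s - 1) ⊕ Fin (s - 1)), inferInstance, by simp; omega, C, hC, n₀, fun V L _ _ _ _ G T hn hVL hT hdeg hne => ?_⟩
      refine h1 V L G T hn ?_ ?_
      · calc 8 * (r:ℝ) * #T ≤ 8 * (r:ℝ) * (μ * Fintype.card V) := by gcongr
          _ = (μ * (8 * r * 1)) * Fintype.card V := by ring
          _ ≤ (μ * (16 * r * s)) * Fintype.card V := by gcongr <;> linarith
          _ ≤ _ := by gcongr
      · intro v
        apply hne
        have h2 := hdeg v
        have h3 : (((r - s) * Fintype.card L : ℕ) : ℝ) ≤ #(univ.filter (fun u => G.Adj v u)) := by exact_mod_cast h2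
        refine le_trans ?_ h3
        have h4 : r - s = s := by omega
        have h5 : ((s:ℝ) / r) * Fintype.card V = s * Fintype.card L := by rw [hVL]; push_cast; field_simp
        rw [h4]; push_cast
        nlinarith [Nat.cast_nonneg (α := ℝ) (Fintype.card V)]
  obtain ⟨κ, _, hκ, C1, hC1, n1, hU⟩ := hU
  refine ⟨C1 + (C2 + 96 / μ), by positivity, n1 + n2 + ⌈2 / μ⌉₊ + 1, fun V L _ _ _ _ G hn hVL hdeg hne => ?_⟩
  set n := Fintype.card V with hnn
  have hn0 : (0:ℝ) < n := by exact_mod_cast (by omega : 0 < n)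
  have hnμ : 2 ≤ μ * n := by
    have : 2 / μ ≤ n := (Nat.le_ceil _).trans (Nat.cast_le.2 (by omega))
    rwa [div_le_iff₀ hμ0, mul_comm] at this
  set m := ⌊μ * n⌋₊ with hm
  have hm1 : (m:ℝ) ≤ μ * n := Nat.floor_le (by positivity)
  have hm2 : μ * n / 2 ≤ m := by have := Nat.lt_floor_add_one (μ * n); linarith
  have hm3 : 1 ≤ m := Nat.le_floor (by push_cast; linarith)
  have hmL : m ≤ Fintype.card L := by
    have : (m:ℝ) * r ≤ n := by nlinarith
    have : m * r ≤ n := by exact_mod_cast this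
    rw [hVL] at this
    nlinarith [(by omega : 0 < r)]
  obtain ⟨T, -, hTm⟩ := exists_subset_card_eq (s := (univ : Finset L)) (n := m) (by rwa [card_univ])
  have hasm := nonext_asm (κ := κ) r s hs hsr hrs hκ G hVL T m hTm hm3 C1 C2 hC1.le hC2.le
    (hU V L G T (by omega) hVL (by rw [hTm]; exact hm1) hdeg hne) ?_
  · refine hasm.monoW ?_ ?_ (fun _ h => h)
    · intro a; unfold rw8; rw [if_neg (by simp)]; positivity
    · intro a
      unfold rw8
      have h48 : (48:ℝ) / m ≤ 96 / μ / n := by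
        rw [div_div, div_le_div_iff₀ (by exact_mod_cast hm3) (by positivity)]
        linarith
      rw [add_div, add_div]
      linarith
  intro X hX
  have hrc : ((r - 1 : ℕ) : ℝ) = r - 1 := by rw [Nat.cast_sub (by omega)]; simp
  have hX' : (#X : ℝ) + (r - 1) * m = n := by rw [← hrc]; exact_mod_cast hX
  have hr0 : (0:ℝ) ≤ r := by linarith
  have hrm0 : (r:ℝ) * m ≤ r * (μ * n) := mul_le_mul_of_nonneg_left hm1 hr0
  have hrm : (r:ℝ) * m ≤ n / 16 := by
    have := mul_le_mul_of_nonneg_right hμ3 hn0.le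
    linarith
  have hrm2 : (r:ℝ) * m ≤ γ / (16 * s) * n := by
    rw [div_mul_eq_mul_div, le_div_iff₀ (by positivity)]
    have h1 := mul_le_mul_of_nonneg_right hμ2 hn0.le
    have h2 := mul_le_mul_of_nonneg_right hrm0 (by positivity : (0:ℝ) ≤ 16 * s)
    linarith
  have hm0 : (0:ℝ) ≤ m := Nat.cast_nonneg _
  have hrm1 : 0 ≤ ((r:ℝ) - 1) * m := mul_nonneg (by linarith) hm0
  have hXle : (#X : ℝ) ≤ n := by linarith
  have hXge : (n:ℝ) / 2 ≤ #X := by linarith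
  have hcX : Xᶜ.card = (r - 1) * m := by
    have := card_compl_add_card X
    omega
  have hcs : ((s:ℝ) + (r - s : ℕ)) = r := by rw [Nat.cast_sub (by omega)]; ring
  have hcs' : ((r - s : ℕ) : ℝ) = r - s := by rw [Nat.cast_sub (by omega)]
  have hLn : (n:ℝ) = r * Fintype.card L := by exact_mod_cast hVL
  refine hT V L G X Tᶜ (by omega) ?_ ?_ ?_ ?_
  · have : (n:ℝ) ≤ 2 * #X := by linarith
    exact_mod_cast this
  · intro v _
    rw [hcs, hcs']
    have e1 := dg_sdiff G univ Xᶜ v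
    have e0 : (univ : Finset V) \ Xᶜ = X := by ext; simp
    rw [e0, hcX] at e1
    have e2 : (((r - s) * Fintype.card L : ℕ) : ℝ) ≤ dg G X v + (((r - 1) * m : ℕ) : ℝ) := by exact_mod_cast (hdeg v).trans e1
    push_cast at e2
    rw [hrc, hcs'] at e2
    have e3 : ((r:ℝ) - s) * Fintype.card L = (r - s) / r * n := by rw [hLn]; field_simp
    have e4 : ((r:ℝ) - s) / r * #X ≤ (r - s) / r * n := by
      apply mul_le_mul_of_nonneg_left hXle
      apply div_nonneg _ (by linarith)
      rw [← hcs']; positivity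
    have e5 : γ / (16 * s) * n ≤ γ / 2 / (4 * s) * #X := by
      have : γ / 2 / (4 * s) = 2 * (γ / (16 * s)) := by field_simp; norm_num
      rw [this]
      have : 0 ≤ γ / (16 * s) := by positivity
      nlinarith
    linarith
  · intro U _ hU'
    rw [hcs] at hU'
    have e1 : γ * (n:ℝ)^2 ≤ eG G U U := by
      apply hne
      refine le_trans ?_ hU'
      have e2 : (s:ℝ) / r ≤ 1 := by rw [div_le_one (by positivity)]; exact_mod_cast hsr.le
      have e3 : γ / (16 * s) ≤ γ / 2 := by
        rw [div_le_div_iff₀ (by positivity) (by positivity)]; nlinarith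
      have e4 : (r:ℝ) * m ≤ γ / 2 * n := hrm2.trans (by gcongr)
      have e5 : 0 ≤ (s:ℝ) / r := by positivity
      have e6 : (s:ℝ)/r * (n - #X) ≤ n - #X := by nlinarith
      nlinarith
    refine le_trans ?_ e1
    have : (#X : ℝ)^2 ≤ n^2 := by gcongr
    nlinarith [sq_nonneg (n:ℝ)]
  · rw [show s + (r - s) = r by omega, card_compl, hTm, Nat.cast_sub hmL]
    nlinarith


/-! ## Part 8 : the extremal case, building blocks -/

section Ext
variable {V L : Type} [Fintype V] [DecidableEq V] [Fintype L] [DecidableEq L]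

theorem side_spr (G : SimpleGraph V) (M : Finset L) (m : ℕ) (hm1 : 1 ≤ m) (hM : #M = m) (O0 : Finset (V × L)) (hf0 : Func O0)
    (k0 : ℕ) (hk0 : ∀ t ∈ M, #(fib O0 t) ≤ k0) (h : ℝ) (hh : k0 * h ≤ m / 10) (hh' : h ≤ m / 10) :
    ∀ (k : ℕ) (X : Finset V), #X = k * m →
      (∀ x ∈ X, (#((dom O0).filter (fun y => ¬ G.Adj x y)) : ℝ) ≤ h) →
      (∀ y ∈ dom O0, (#(X.filter (fun x => ¬ G.Adj x y)) : ℝ) ≤ h) →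
      Spr (fun O => Func O ∧ dom O = X ∧ (∀ t, t ∉ M → fib O t = ∅) ∧ (∀ t ∈ M, #(fib O t) = k) ∧
          ∀ t ∈ M, ∀ x ∈ fib O t, ∀ y ∈ fib O0 t, G.Adj x y)
        (fun D => ∏ a ∈ D, ((k:ℝ) * (48 / m))) := by
  intro k
  induction k with
  | zero =>
    intro X hX _ _
    have hX' : X = ∅ := by rw [← card_eq_zero, hX, zero_mul]
    refine (Spr.diracW (P := fun O => Func O ∧ dom O = X ∧ (∀ t, t ∉ M → fib O t = ∅) ∧ (∀ t ∈ M, #(fib O t) = 0) ∧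
          ∀ t ∈ M, ∀ x ∈ fib O t, ∀ y ∈ fib O0 t, G.Adj x y) (∅ : Finset (V × L)) ?_).monoW (fun a => ?_) (fun a => ?_) (fun _ h => h)
    · have he : ∀ t : L, fib (∅ : Finset (V × L)) t = ∅ := fun t => by ext v; simp [mem_fib]
      refine ⟨fun v t t' h1 => absurd h1 (notMem_empty _), by rw [hX']; rfl, fun t _ => he t, fun t _ => by rw [he t]; rfl, ?_⟩
      intro t _ x hx
      rw [he t] at hx; exact absurd hx (notMem_empty _)
    · split_ifs <;> norm_num
    · simp
  | succ k ih =>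
    intro X hX h1 h2
    obtain ⟨P, hPX, hP⟩ := exists_subset_card_eq (s := X) (n := m) (by rw [hX]; nlinarith)
    have hX' : #(X \ P) = k * m := by
      rw [card_sdiff_of_subset hPX, hX, hP, Nat.add_mul, one_mul, Nat.add_sub_cancel]
    have ih' := ih (X \ P) hX' (fun x hx => h1 x (mem_sdiff.1 hx).1) (fun y hy => le_trans (by
      norm_cast; exact card_le_card (filter_subset_filter _ sdiff_subset)) (h2 y hy))
    set R : V → L → Prop := fun x t => ∀ y ∈ fib O0 t, G.Adj x y with hR
    have hmatch := match_sub P M m hm1 hP hM R (by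
      intro x hx
      have e1 : #(M.filter (fun t => ¬ R x t)) ≤ #((dom O0).filter (fun y => ¬ G.Adj x y)) := by
        have : ∀ t ∈ M.filter (fun t => ¬ R x t), ∃ y, y ∈ fib O0 t ∧ ¬ G.Adj x y := by
          intro t ht
          have := (mem_filter.1 ht).2
          simp only [hR] at this
          push Not at this
          exact this
        haveI hneV : Nonempty V := ⟨x⟩
        choose! f hf using this
        apply card_le_card_of_injOn f
        · intro t ht
          have := hf t ht
          simp only [coe_filter, Set.mem_setOf_eq]
          exact ⟨fib_subset_dom _ _ this.1, this.2⟩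
        · intro t ht t' ht' heq
          have a1 := mem_fib.1 (hf t ht).1
          have a2 := mem_fib.1 (hf t' ht').1
          rw [← heq] at a2
          exact hf0 _ _ _ a1 a2
      have e2 := card_filter_add_card_filter_not (s := M) (fun t => R x t)
      have e3 : (#(M.filter (fun t => R x t)) : ℝ) + #(M.filter (fun t => ¬ R x t)) = m := by rw [← hM]; exact_mod_cast e2
      have e4 : (#(M.filter (fun t => ¬ R x t)) : ℝ) ≤ h := le_trans (by exact_mod_cast e1) (h1 x (hPX hx))
      have e6 : (9/10 : ℝ) * m ≤ #(M.filter (fun t => R x t)) := by linarith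
      convert e6) (by
      intro t ht
      have e1 : #(P.filter (fun x => ¬ R x t)) ≤ ∑ y ∈ fib O0 t, #(X.filter (fun x => ¬ G.Adj x y)) := by
        refine le_trans (card_le_card ?_) card_biUnion_le
        intro x hx
        rw [mem_filter] at hx
        have := hx.2
        simp only [hR] at this
        push Not at this
        obtain ⟨y, hy, hxy⟩ := this
        exact mem_biUnion.2 ⟨y, hy, mem_filter.2 ⟨hPX hx.1, hxy⟩⟩
      have e2 := card_filter_add_card_filter_not (s := P) (fun x => R x t)
      have e3 : (#(P.filter (fun x => R x t)) : ℝ) + #(P.filter (fun x => ¬ R x t)) = m := by rw [← hP]; exact_mod_cast e2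
      have e4 : (#(P.filter (fun x => ¬ R x t)) : ℝ) ≤ m / 10 := by
        have : (#(P.filter (fun x => ¬ R x t)) : ℝ) ≤ ∑ y ∈ fib O0 t, (#(X.filter (fun x => ¬ G.Adj x y)) : ℝ) := by exact_mod_cast e1
        refine this.trans ?_
        have e5 : ∑ y ∈ fib O0 t, (#(X.filter (fun x => ¬ G.Adj x y)) : ℝ) ≤ #(fib O0 t) * h := by
          rw [← nsmul_eq_mul]
          exact sum_le_card_nsmul _ _ _ fun y hy => h2 y (fib_subset_dom _ _ hy)
        refine e5.trans ?_
        by_cases h0 : 0 ≤ h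
        · refine le_trans ?_ hh
          gcongr
          exact hk0 t ht
        · push Not at h0
          have : (#(fib O0 t):ℝ) * h ≤ 0 := mul_nonpos_of_nonneg_of_nonpos (by positivity) h0.le
          have : (0:ℝ) ≤ m / 10 := by positivity
          linarith
      have e6 : (9/10 : ℝ) * m ≤ #(P.filter (fun x => R x t)) := by linarith
      convert e6)
    have key := Spr.bind (Q := fun O => Func O ∧ dom O = X ∧ (∀ t, t ∉ M → fib O t = ∅) ∧ (∀ t ∈ M, #(fib O t) = k + 1) ∧
          ∀ t ∈ M, ∀ x ∈ fib O t, ∀ y ∈ fib O0 t, G.Adj x y) ih' (w' := fun a => if a.1 ∈ P ∧ a.2 ∈ M then (48 / m : ℝ) else 0) (by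
      rintro O ⟨c1, c2, c3, c4, c5⟩
      refine hmatch.mono ?_ (fun _ => le_refl _)
      rintro O' ⟨f, hf, hfR, hO'⟩
      have hO' : O' = gr P f := hO'
      have hd' : dom O' = P := by rw [hO', dom_gr]
      have hdis : Disjoint (dom O) (dom O') := by rw [c2, hd']; exact sdiff_disjoint
      refine ⟨func_union c1 (by rw [hO']; exact func_gr _ _) hdis, by rw [dom_union, c2, hd', sdiff_union_of_subset hPX], ?_, ?_, ?_⟩
      · intro t ht
        rw [fib_union, c3 t ht, hO', fib_gr_not hf ht, empty_union]
      · intro t ht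
        obtain ⟨x, hx, hxt, hfx⟩ := fib_gr hf ht
        rw [card_fib_union hdis, c4 t ht, hO', hfx, card_singleton]
      · intro t ht x hx y hy
        rw [fib_union, mem_union] at hx
        rcases hx with hx | hx
        · exact c5 t ht x hx y hy
        · rw [hO', mem_fib, mem_gr] at hx
          have := hfR x hx.1
          rw [hx.2] at this
          exact this y hy)
    refine key.monoW (fun a => ?_) (fun a => ?_) (fun _ h => h)
    · split_ifs <;> positivity
    · push_cast
      have : (0:ℝ) ≤ 48 / m := by positivity
      rw [add_mul, one_mul]
      split_ifs <;> linarith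

theorem job_spr (G : SimpleGraph V) (T : Finset L) (a b : ℕ) (α β : L → ℕ) (hα : ∀ t ∈ T, α t ≤ a) (hβ : ∀ t ∈ T, β t ≤ b)
    (U : Finset V) (X Y : L → Finset V) (c : ℝ) (hc : 0 < c) (hc1 : c ≤ 1)
    (hV : 0 < Fintype.card V) (hn : 2 * ((a + b : ℕ) : ℝ) ^ 2 / c ^ ((a+1)*(b+1)) ≤ Fintype.card V)
    (hU : (#U : ℝ) + #T * (a + b) ≤ c / 2 * Fintype.card V)
    (he : ∀ t ∈ T, 2 * c * (Fintype.card V : ℝ)^2 ≤ eG G (X t) (Y t)) :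
    Spr (fun O => Func O ∧ Disjoint U (dom O) ∧ (∀ t, t ∉ T → fib O t = ∅) ∧
        ∀ t ∈ T, ∃ A' B', A' ⊆ X t ∧ B' ⊆ Y t ∧ #A' = α t ∧ #B' = β t ∧ fib O t = A' ∪ B' ∧ ∀ x ∈ A', ∀ y ∈ B', G.Adj x y)
      (fun D => ∏ _x ∈ D, (((a + b : ℕ) : ℝ) / (c ^ ((a+1) * (b+1)) / 2) / Fintype.card V)) := by
  have hj := jobsK a b X Y G.Adj U T c hc hc1 hV hn (by
    intro A t τ hA ht htA hF
    have e1 := eG_sdiff G (X t) (Y t) (usedV U A τ)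
    have e2 := card_usedV U A τ
    rw [Fintype.card_sum, Fintype.card_fin, Fintype.card_fin] at e2
    have e3 : #A ≤ #T := card_le_card hA
    have e4 : (#(usedV U A τ) : ℝ) ≤ c / 2 * Fintype.card V := by
      refine le_trans ?_ hU
      have : (#(usedV U A τ) : ℝ) ≤ #U + #A * (a + b) := by exact_mod_cast e2
      refine this.trans ?_
      gcongr
    have e5 : (eG G (X t) (Y t) : ℝ) ≤ eG G (X t \ usedV U A τ) (Y t \ usedV U A τ) + 2 * (#(usedV U A τ) * Fintype.card V) := by
      exact_mod_cast e1
    have e6 := he t ht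
    have e7 : c * (Fintype.card V : ℝ)^2 ≤ eG G (X t \ usedV U A τ) (Y t \ usedV U A τ) := by
      have : (#(usedV U A τ) : ℝ) * Fintype.card V ≤ c / 2 * Fintype.card V * Fintype.card V := by gcongr
      nlinarith
    exact e7)
  refine (hj.subset (Q := fun O => Func O ∧ Disjoint U (dom O) ∧ (∀ t, t ∉ T → fib O t = ∅) ∧
        ∀ t ∈ T, ∃ A' B', A' ⊆ X t ∧ B' ⊆ Y t ∧ #A' = α t ∧ #B' = β t ∧ fib O t = A' ∪ B' ∧ ∀ x ∈ A', ∀ y ∈ B', G.Adj x y) ?_).monoW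
    (fun x => ?_) (fun x => ?_) (fun _ h => h)
  · rintro O ⟨τ, hF, rfl⟩
    set O' : Finset (V × L) := univ.filter (fun p => p.2 ∈ T ∧ ((∃ i : Fin a, i.1 < α p.2 ∧ τ p.2 (Sum.inl i) = p.1) ∨
      ∃ j : Fin b, j.1 < β p.2 ∧ τ p.2 (Sum.inr j) = p.1)) with hO'
    have hsub : O' ⊆ atoms T τ := by
      intro p hp
      rw [hO', mem_filter] at hp
      rw [mem_atoms]
      refine ⟨hp.2.1, ?_⟩
      rcases hp.2.2 with ⟨i, _, h⟩ | ⟨i, _, h⟩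
      · exact ⟨_, h⟩
      · exact ⟨_, h⟩
    refine ⟨O', hsub, ?_, ?_, ?_, ?_⟩
    · intro v t t' h1 h2
      exact func_atoms hF v t t' (hsub h1) (hsub h2)
    · exact (dom_atoms_disj hF).mono_right (image_subset_image hsub)
    · intro t ht
      ext v
      rw [mem_fib, hO', mem_filter]
      simp [ht]
    · intro t ht
      have hinj := (hF.1 t ht).1
      have hK := (hF.1 t ht).2
      refine ⟨(univ.filter (fun i : Fin a => i.1 < α t)).image (fun i => τ t (Sum.inl i)),
        (univ.filter (fun i : Fin b => i.1 < β t)).image (fun i => τ t (Sum.inr i)), ?_, ?_, ?_, ?_, ?_, ?_⟩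
      · intro v hv
        obtain ⟨i, _, rfl⟩ := mem_image.1 hv
        exact hK.1 i
      · intro v hv
        obtain ⟨i, _, rfl⟩ := mem_image.1 hv
        exact hK.2.1 i
      · rw [card_image_of_injective _ (fun i j h => Sum.inl_injective (hinj h)), Fin.card_filter_val_lt]
        exact min_eq_right (hα t ht)
      · rw [card_image_of_injective _ (fun i j h => Sum.inr_injective (hinj h)), Fin.card_filter_val_lt]
        exact min_eq_right (hβ t ht)
      · ext v
        rw [mem_fib, hO', mem_filter]
        simp [ht]
      · intro x hx y hy
        obtain ⟨i, _, rfl⟩ := mem_image.1 hx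
        obtain ⟨j, _, rfl⟩ := mem_image.1 hy
        exact hK.2.2 i j
  · split_ifs <;> positivity
  · split_ifs
    · exact le_refl _
    · positivity

end Ext


/-! ## Part 8b : the extremal case, assembly of the phases -/

section Ext
variable {V L : Type} [Fintype V] [DecidableEq V] [Fintype L] [DecidableEq L]

theorem card_dom_inter {O : Finset (V × L)} (h : Func O) (A : Finset V) : #(dom O ∩ A) = ∑ t, #(fib O t ∩ A) := by
  rw [← card_biUnion]
  · congr 1
    ext v
    simp only [mem_inter, mem_dom, mem_biUnion, mem_univ, true_and, mem_fib]
    exact exists_and_right.symm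
  · intro t _ t' _ htt
    rw [Function.onFun, disjoint_left]
    intro v hv hv'
    exact htt (h v t t' (mem_fib.1 (mem_inter.1 hv).1) (mem_fib.1 (mem_inter.1 hv').1))

theorem nn_bip (G : SimpleGraph V) (P Q : Finset V) (k : ℕ) (hP : #P ≤ k) (hQ : #Q ≤ k) (h : ∀ x ∈ P, ∀ y ∈ Q, G.Adj x y) :
    ∀ v ∈ P ∪ Q, nn G (P ∪ Q) v + 1 ≤ k := by
  have key : ∀ P Q : Finset V, #P ≤ k → (∀ x ∈ P, ∀ y ∈ Q, G.Adj x y) → ∀ v ∈ P, nn G (P ∪ Q) v + 1 ≤ k := by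
    intro P Q hP h v hv
    have : nn G (P ∪ Q) v < #P := by
      apply card_lt_card
      rw [ssubset_iff_of_subset]
      · exact ⟨v, hv, by simp⟩
      · intro u hu
        rw [mem_filter, mem_union] at hu
        rcases hu.1 with h1 | h1
        · exact h1
        · exact absurd (h v hv u h1) hu.2.2
    omega
  intro v hv
  rcases mem_union.1 hv with h1 | h1
  · exact key P Q hP h v h1
  · rw [union_comm]
    exact key Q P hQ (fun x hx y hy => (h y hy x hx).symm) v h1

set_option maxHeartbeats 1000000 in
theorem ext_asm (r s : ℕ) (hs : 1 ≤ s) (hsr : s < r) (hrs : r ≤ 2 * s) (G : SimpleGraph V) (hVL : Fintype.card V = r * Fintype.card L)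
    (A : Finset V) (T : Finset L) (m : ℕ) (hm : #Tᶜ = m) (hm1 : 1 ≤ m) (root : V → Option L) (hroot : ∀ v t, root v = some t → t ∈ T)
    (α β : L → ℕ) (hα : ∀ t ∈ T, α t ≤ s) (hβ : ∀ t ∈ T, β t ≤ r - s + 1) (RA RB : L → Finset V)
    (hRA : ∀ t, RA t = A.filter (fun v => root v = some t)) (hRB : ∀ t, RB t = Aᶜ.filter (fun v => root v = some t))
    (hsum : ∀ t ∈ T, #(RA t) + #(RB t) + (α t + β t) = r) (X Y : L → Finset V) (hX : ∀ t ∈ T, X t ⊆ A) (hY : ∀ t ∈ T, Y t ⊆ Aᶜ)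
    (hXR : ∀ t ∈ T, ∀ v ∈ RB t, ∀ x ∈ X t, G.Adj v x) (hYR : ∀ t ∈ T, ∀ v ∈ RA t, ∀ y ∈ Y t, G.Adj v y)
    (c : ℝ) (hc : 0 < c) (hc1 : c ≤ 1) (hV : 0 < Fintype.card V)
    (hn : 2 * ((s + (r - s + 1) : ℕ) : ℝ) ^ 2 / c ^ ((s+1)*(r - s + 1 + 1)) ≤ Fintype.card V)
    (hU : (#(univ.filter (fun v => root v ≠ none)) : ℝ) + #T * (r + 1) ≤ c / 2 * Fintype.card V)
    (he : ∀ t ∈ T, 2 * c * (Fintype.card V : ℝ)^2 ≤ eG G (X t) (Y t))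
    (hgood : ∀ t ∈ T, (#(RA t) + α t ≤ s ∧ #(RB t) + β t ≤ s ∧ #(RA t) + #(RB t) ≤ 1) ∨
      ((∀ u ∈ RA t, ∀ v ∈ RA t, u ≠ v → G.Adj u v) ∧ RB t = ∅ ∧ α t = 0 ∧ β t ≤ s))
    (hcount : #A = ∑ t ∈ T, (#(RA t) + α t) + s * m) (h : ℝ) (hh0 : 0 ≤ h) (hh : s * h ≤ m / 10)
    (htA : ∀ v ∈ A, root v = none → (#(Aᶜ.filter (fun y => ¬ G.Adj v y)) : ℝ) ≤ h)
    (htB : ∀ v ∈ Aᶜ, root v = none → (#(A.filter (fun y => ¬ G.Adj v y)) : ℝ) ≤ h) :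
    Spr (GoodLab G r s root) (fun D => ∏ a ∈ D, rw8 root
      (((s + (r - s + 1) : ℕ) : ℝ) / (c ^ ((s+1)*(r - s + 1 + 1)) / 2) / Fintype.card V + r * (48 / m)) a) := by
  set K : ℝ := ((s + (r - s + 1) : ℕ) : ℝ) / (c ^ ((s+1)*(r - s + 1 + 1)) / 2) / Fintype.card V with hK
  have hK0 : 0 ≤ K := by positivity
  have hm48 : (0:ℝ) ≤ 48 / m := by positivity
  set O0 : Finset (V × L) := univ.filter (fun a => root a.1 = some a.2) with hO0
  have mO0 : ∀ v t, (v, t) ∈ O0 ↔ root v = some t := by intro v t; rw [hO0]; simp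
  have hf0 : Func O0 := by
    intro v t t' h1 h2
    rw [mO0] at h1 h2
    exact Option.some_injective _ (h1.symm.trans h2)
  have hd0 : dom O0 = univ.filter (fun v => root v ≠ none) := by
    ext v
    simp only [mem_dom, mO0, mem_filter, mem_univ, true_and, ne_eq]
    exact Option.ne_none_iff_exists'.symm
  have hfib0 : ∀ t, fib O0 t = RA t ∪ RB t := by
    intro t
    ext v
    rw [mem_fib, mO0, hRA, hRB, mem_union, mem_filter, mem_filter, mem_compl]
    tauto
  have hRAA : ∀ t, RA t ⊆ A := fun t => by rw [hRA]; exact filter_subset _ _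
  have hRBB : ∀ t, RB t ⊆ Aᶜ := fun t => by rw [hRB]; exact filter_subset _ _
  have hdAB : ∀ P Q : Finset V, P ⊆ A → Q ⊆ Aᶜ → Disjoint P Q := fun P Q h1 h2 => disjoint_compl_right.mono h1 h2
  have hRdis : ∀ t, Disjoint (RA t) (RB t) := fun t => hdAB _ _ (hRAA t) (hRBB t)
  have hfib0' : ∀ t, t ∉ T → fib O0 t = ∅ := by
    intro t ht
    ext v
    rw [mem_fib, mO0]
    simp only [notMem_empty, iff_false]
    exact fun h => ht (hroot v t h)
  have key : Spr (GoodLab G r s root) (fun D => ∏ a ∈ D, ((if a ∈ O0 then (1:ℝ) else 0) + (K + ((s:ℝ) * (48 / m) + ((r - s : ℕ) : ℝ) * (48 / m))))) := by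
    refine Spr.bind (P := fun O => O = O0) (Spr.diracW O0 rfl) ?_
    rintro _ rfl
    refine Spr.bind (job_spr G T s (r - s + 1) α β hα hβ (dom O0) X Y c hc hc1 hV hn (by
      rw [hd0]
      refine le_trans ?_ hU
      have : ((s:ℝ) + ((r - s + 1 : ℕ) : ℝ)) = r + 1 := by
        rw [← Nat.cast_add, show s + (r - s + 1) = r + 1 by omega]; push_cast; ring
      rw [this]) he) ?_
    rintro O1 ⟨hf1, hdis1, hT1, h1⟩
    have hf01 : Func (O0 ∪ O1) := func_union hf0 hf1 hdis1
    have hfA : ∀ t ∈ T, #(fib (O0 ∪ O1) t ∩ A) = #(RA t) + α t := by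
      intro t ht
      obtain ⟨A', B', hA', hB', cA, cB, hfib, hadj⟩ := h1 t ht
      have e1 : fib (O0 ∪ O1) t ∩ A = RA t ∪ A' := by
        rw [fib_union, hfib0, hfib]
        ext v
        have q1 := @hRAA t v
        have q2 := @hRBB t v
        have q3 := fun hv => hX t ht (@hA' v hv)
        have q4 := fun hv => hY t ht (@hB' v hv)
        simp only [mem_compl] at q2 q4
        simp only [mem_inter, mem_union]
        tauto
      rw [e1, card_union_of_disjoint, cA]
      rw [disjoint_left]
      intro v hv hv'
      have p1 : v ∈ dom O0 := fib_subset_dom O0 t (by rw [hfib0]; exact mem_union_left _ hv)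
      have p2 : v ∈ dom O1 := fib_subset_dom O1 t (by rw [hfib]; exact mem_union_left _ hv')
      exact disjoint_left.1 hdis1 p1 p2
    have hc01 : ∀ t ∈ T, #(fib (O0 ∪ O1) t) = r := by
      intro t ht
      obtain ⟨A', B', hA', hB', cA, cB, hfib, hadj⟩ := h1 t ht
      rw [card_fib_union hdis1, hfib0, hfib, card_union_of_disjoint (hRdis t),
        card_union_of_disjoint (hdAB _ _ (hA'.trans (hX t ht)) (hB'.trans (hY t ht))), cA, cB]
      exact hsum t ht
    have hfn : ∀ t, t ∉ T → fib (O0 ∪ O1) t = ∅ := by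
      intro t ht
      rw [fib_union, hfib0' t ht, hT1 t ht, empty_union]
    set D := dom (O0 ∪ O1) with hD
    have hDA : #(D ∩ A) = ∑ t ∈ T, (#(RA t) + α t) := by
      rw [hD, card_dom_inter hf01, ← sum_subset (subset_univ T), sum_congr rfl hfA]
      intro t _ ht
      rw [hfn t ht, empty_inter, card_empty]
    have hDc : #D = r * #T := by
      rw [hD, card_dom hf01, ← sum_subset (subset_univ T), sum_congr rfl hc01, sum_const, smul_eq_mul, mul_comm]
      intro t _ ht
      rw [hfn t ht, card_empty]
    set A1 := A \ D with hA1
    set B1 := Aᶜ \ D with hB1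
    have hA1c : #A1 = s * m := by
      have := card_sdiff_add_card_inter A D
      rw [inter_comm, hDA] at this
      rw [hA1]; omega
    have hB1c : #B1 = (r - s) * m := by
      have e1 : #(A1 ∪ B1) = #A1 + #B1 := card_union_of_disjoint (hdAB _ _ sdiff_subset sdiff_subset)
      have e2 : A1 ∪ B1 = Dᶜ := by
        ext v; simp only [hA1, hB1, mem_union, mem_sdiff, mem_compl]; tauto
      have e3 : #Dᶜ + #D = Fintype.card V := card_compl_add_card D
      have e4 : #Tᶜ + #T = Fintype.card L := card_compl_add_card T
      rw [← e2, e1, hA1c, hDc, hVL, ← e4, hm] at e3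
      have : r * (m + #T) = r * #T + (s * m + (r - s) * m) := by
        rw [← Nat.add_mul, show s + (r - s) = r by omega]; ring
      omega
    have hrn : ∀ v, v ∉ D → root v = none := by
      intro v hv
      by_contra hne
      apply hv
      rw [hD, dom_union, mem_union, hd0, mem_filter]
      exact Or.inl ⟨mem_univ _, hne⟩
    have hemp : Func (∅ : Finset (V × L)) := fun v t t' h1 => absurd h1 (notMem_empty _)
    refine Spr.bind (side_spr G Tᶜ m hm1 hm ∅ hemp 0 (by intro t _; rw [show fib (∅ : Finset (V × L)) t = ∅ by ext v; simp [mem_fib]]; simp)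
      0 (by simp; positivity) (by positivity) s A1 hA1c (by intro x _; simp [dom]) (by intro y hy; simp [dom] at hy)) ?_
    rintro O2 ⟨hf2, hd2, hT2, hc2, -⟩
    refine (side_spr G Tᶜ m hm1 hm O2 hf2 s (fun t ht => (hc2 t ht).le) h hh
      (le_trans (by have : (1:ℝ) ≤ s := by exact_mod_cast hs
                    nlinarith) hh) (r - s) B1 hB1c (by
        intro x hx
        refine le_trans ?_ (htB x (mem_sdiff.1 hx).1 (hrn x (mem_sdiff.1 hx).2))
        norm_cast
        apply card_le_card
        rw [hd2]
        exact filter_subset_filter _ sdiff_subset) (by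
        intro y hy
        rw [hd2] at hy
        refine le_trans ?_ (htA y (mem_sdiff.1 hy).1 (hrn y (mem_sdiff.1 hy).2))
        norm_cast
        apply card_le_card
        intro x hx
        rw [mem_filter] at hx ⊢
        exact ⟨(mem_sdiff.1 hx.1).1, fun h => hx.2 h.symm⟩)).mono ?_ (fun _ => le_refl _)
    rintro O3 ⟨hf3, hd3, hT3, hc3, hadj3⟩
    have hD' : D = dom O0 ∪ dom O1 := by rw [hD, dom_union]
    have hdis23 : Disjoint (dom O2) (dom O3) := by
      rw [hd2, hd3]; exact hdAB _ _ sdiff_subset sdiff_subset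
    have hdisD : Disjoint D (dom (O2 ∪ O3)) := by
      rw [dom_union, hd2, hd3, disjoint_union_right]
      exact ⟨disjoint_sdiff, disjoint_sdiff⟩
    rw [← union_assoc]
    set O01 := O0 ∪ O1 with hO01
    have hfun : Func (O01 ∪ (O2 ∪ O3)) := func_union hf01 (func_union hf2 hf3 hdis23) hdisD
    have hfibT : ∀ t ∈ T, fib (O01 ∪ (O2 ∪ O3)) t = fib O01 t := by
      intro t ht
      rw [fib_union O01, fib_union O2, hT2 t (by simpa using ht), hT3 t (by simpa using ht), union_empty, union_empty]
    have hfibN : ∀ t, t ∉ T → fib (O01 ∪ (O2 ∪ O3)) t = fib O2 t ∪ fib O3 t := by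
      intro t ht
      rw [fib_union O01, fib_union O2, hfn t ht, empty_union]
    have hcard : ∀ t, #(fib (O01 ∪ (O2 ∪ O3)) t) = r := by
      intro t
      by_cases ht : t ∈ T
      · rw [hfibT t ht, hc01 t ht]
      · rw [hfibN t ht, ← fib_union, card_fib_union hdis23, hc2 t (mem_compl.2 ht), hc3 t (mem_compl.2 ht)]; omega
    have hrootfib : ∀ t, ∀ u ∈ fib (O01 ∪ (O2 ∪ O3)) t, root u ≠ none → u ∈ fib O0 t := by
      intro t u hu hne
      obtain ⟨t', ht'⟩ := Option.ne_none_iff_exists'.1 hne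
      have e1 : (u, t') ∈ O01 ∪ (O2 ∪ O3) := mem_union_left _ (mem_union_left _ ((mO0 u t').2 ht'))
      have e2 := hfun u t t' (mem_fib.1 hu) e1
      rw [mem_fib, mO0, e2]; exact ht'
    refine ⟨hfun, lab_total hfun r hcard hVL, hcard, ?_, ?_⟩
    · intro t
      left
      by_cases ht : t ∈ T
      · rw [hfibT t ht, hO01, fib_union, hfib0]
        obtain ⟨A', B', hA', hB', cA, cB, hfib, hadj⟩ := h1 t ht
        rw [hfib]
        rcases hgood t ht with ⟨g1, g2, g3⟩ | ⟨g1, g2, g3, g4⟩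
        · have e1 : (RA t ∪ RB t) ∪ (A' ∪ B') = (RA t ∪ A') ∪ (RB t ∪ B') := by
            ext v; simp only [mem_union]; tauto
          rw [e1]
          refine nn_bip G _ _ s ((card_union_le _ _).trans (by omega)) ((card_union_le _ _).trans (by omega)) ?_
          intro x hx y hy
          rcases mem_union.1 hx with hx | hx <;> rcases mem_union.1 hy with hy | hy
          · have := card_pos.2 ⟨x, hx⟩
            have := card_pos.2 ⟨y, hy⟩
            omega
          · exact hYR t ht x hx y (hB' hy)
          · exact (hXR t ht y hy x (hA' hx)).symm
          · exact hadj x hx y hy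
        · have e1 : A' = ∅ := by rw [← card_eq_zero, cA, g3]
          rw [g2, e1, union_empty, empty_union]
          intro v hv
          rcases mem_union.1 hv with hv | hv
          · have : nn G (RA t ∪ B') v = 0 := by
              unfold nn
              rw [card_eq_zero, filter_eq_empty_iff]
              intro u hu
              push Not
              intro hne
              rcases mem_union.1 hu with hu | hu
              · exact g1 v hv u hu hne
              · exact hYR t ht v hv u (hB' hu)
            omega
          · have : nn G (RA t ∪ B') v < #B' := by
              apply card_lt_card
              rw [ssubset_iff_of_subset]
              · exact ⟨v, hv, by simp⟩
              · intro u hu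
                rw [mem_filter, mem_union] at hu
                rcases hu.1 with q | q
                · exact absurd (hYR t ht u q v (hB' hv)).symm hu.2.2
                · exact q
            omega
      · rw [hfibN t ht, union_comm]
        refine nn_bip G _ _ s ?_ ?_ (hadj3 t (mem_compl.2 ht))
        · rw [hc3 t (mem_compl.2 ht)]; omega
        · rw [hc2 t (mem_compl.2 ht)]
    · intro t u hu v hv huv hru hrv
      have hu0 := hrootfib t u hu hru
      have hv0 := hrootfib t v hv hrv
      by_cases ht : t ∈ T
      · rw [hfibT t ht, hO01, fib_union, hfib0]
        obtain ⟨A', B', hA', hB', cA, cB, hfib, hadj⟩ := h1 t ht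
        rw [hfib]
        rcases hgood t ht with ⟨g1, g2, g3⟩ | ⟨g1, g2, g3, g4⟩
        · exfalso
          have e1 : #(fib O0 t) ≤ 1 := by rw [hfib0, card_union_of_disjoint (hRdis t)]; exact g3
          exact huv (card_le_one.1 e1 u hu0 v hv0)
        · have e1 : A' = ∅ := by rw [← card_eq_zero, cA, g3]
          rw [g2, e1, union_empty, empty_union]
          left
          intro x hx hne
          rw [hfib0, g2, union_empty] at hu0
          rcases mem_union.1 hx with q | q
          · exact g1 u hu0 x q hne
          · exact hYR t ht u hu0 x (hB' q)
      · rw [hfib0' t ht] at hu0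
        exact absurd hu0 (notMem_empty _)
  refine key.monoW ?_ ?_ (fun _ h => h)
  · intro a; split_ifs <;> positivity
  · rintro ⟨v, t⟩
    unfold rw8
    have e1 : (s:ℝ) * (48 / m) + ((r - s : ℕ) : ℝ) * (48 / m) = r * (48 / m) := by
      rw [← add_mul, ← Nat.cast_add, show s + (r - s) = r by omega]
    rw [e1]
    by_cases hh : root v = some t
    · rw [if_pos ((mO0 v t).2 hh), if_pos hh]; linarith
    · rw [if_neg (fun h => hh ((mO0 v t).1 h)), if_neg hh]; linarith

end Ext


/-! ## Part 8c : the extremal case from a nearly complete bipartite pair -/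

section Ext
variable {V L : Type} [Fintype V] [DecidableEq V] [Fintype L] [DecidableEq L]

theorem eG_low (G : SimpleGraph V) (P Q : Finset V) (q : ℝ) (h : ∀ x ∈ P, q ≤ dg G Q x) : #P * q ≤ eG G P Q := by
  rw [eG_eq_sum, ← nsmul_eq_mul]; push_cast
  exact card_nsmul_le_sum _ _ _ h

theorem dg_add_non (G : SimpleGraph V) (Q : Finset V) (x : V) : dg G Q x + #(Q.filter (fun y => ¬ G.Adj x y)) = #Q :=
  card_filter_add_card_filter_not _

lemma ext1_arith (s a d1 d2 z m N : ℕ) (hs : 2 ≤ s) (hA : a + d2 = s * N + d1) (hN : m + (z + d1 + d2) = N) :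
    a = z * s + (d1 * (s + 1) + d2 * (s - 1)) + s * m := by
  obtain ⟨s', rfl⟩ : ∃ s', s = s' + 1 := ⟨s - 1, by omega⟩
  rw [Nat.add_sub_cancel]
  subst hN
  have e : (s'+1)*(m+(z+d1+d2)) = (z*(s'+1) + d1*(s'+1) + d2*s' + (s'+1)*m) + d2 := by ring
  have e' : d1*(s'+1+1) = d1*(s'+1)+d1 := by ring
  omega

set_option maxHeartbeats 8000000 in
theorem ext1_aux (r s : ℕ) (hs : 2 ≤ s) (hsr : s < r) (hrs : r ≤ 2 * s) (lam : ℝ) (hlam : 0 < lam) (hlam1 : lam ≤ 1)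
    (G : SimpleGraph V) (hVL : Fintype.card V = r * Fintype.card L) (A Z : Finset V) (d1 d2 : ℕ) (K : Fin d1 → Finset V) (h : ℝ) (hh0 : 0 ≤ h)
    (hd2 : d2 ≠ 0 → r < 2 * s) (hA : #A + d2 = s * Fintype.card L + d1)
    (hk : ((#Z + d1 + d2 : ℕ) : ℝ) * (512 * r^3) ≤ lam * Fintype.card V) (hh : h * (40 * r^2) ≤ Fintype.card V)
    (htA : ∀ v ∈ A \ Z, (#(Aᶜ.filter (fun y => ¬ G.Adj v y)) : ℝ) ≤ h)
    (htB : ∀ v ∈ Aᶜ \ Z, (#(A.filter (fun y => ¬ G.Adj v y)) : ℝ) ≤ h)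
    (hZA : ∀ z ∈ Z, z ∈ A → lam * Fintype.card V ≤ dg G Aᶜ z) (hZB : ∀ z ∈ Z, z ∉ A → lam * Fintype.card V ≤ dg G A z)
    (hKA : ∀ i, K i ⊆ A \ Z) (hKc : ∀ i, #(K i) = s + 1) (hKd : ∀ i j, i ≠ j → Disjoint (K i) (K j))
    (hKq : ∀ i, ∀ u ∈ K i, ∀ v ∈ K i, u ≠ v → G.Adj u v) (c : ℝ) (hc : c = lam / (64 * r^2)) (hV : 0 < Fintype.card V)
    (hn : 2 * ((s + (r - s + 1) : ℕ) : ℝ) ^ 2 / c ^ ((s+1)*(r - s + 1 + 1)) ≤ Fintype.card V) :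
    ∃ root : V → Option L, Spr (GoodLab G r s root) (fun D => ∏ a ∈ D, rw8 root
      ((((s + (r - s + 1) : ℕ) : ℝ) / (c ^ ((s+1)*(r - s + 1 + 1)) / 2) + 96 * r^2) / Fintype.card V) a) := by
  set k := #Z + d1 + d2 with hkk
  set n := Fintype.card V with hnn
  set N := Fintype.card L with hN
  have hr2 : (3:ℝ) ≤ r := by exact_mod_cast (by omega : 3 ≤ r)
  have hn0 : (0:ℝ) < n := by exact_mod_cast hV
  have hnN : (n:ℝ) = r * N := by exact_mod_cast hVL
  have hln : lam * n ≤ n := by nlinarith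
  have hr3 : (27:ℝ) ≤ r^3 := by nlinarith [sq_nonneg ((r:ℝ) - 3)]
  have hr2' : (9:ℝ) ≤ r^2 := by nlinarith
  have hk0 : (0:ℝ) ≤ k := Nat.cast_nonneg _
  have hkN : (k:ℝ) * 512 ≤ N := by
    have h1 : (k:ℝ) * (512 * r^3) ≤ r * N := by rw [← hnN]; linarith
    have h2 : (k:ℝ) * 512 * r ≤ N * r := by nlinarith [mul_nonneg hk0 (by nlinarith : (0:ℝ) ≤ 512 * r^3 - 512 * r)]
    exact le_of_mul_le_mul_right h2 (by linarith)
  have hZk : (#Z : ℝ) ≤ k := by exact_mod_cast (by omega : #Z ≤ k)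
  have hd1k : (d1 : ℝ) ≤ k := by exact_mod_cast (by omega : d1 ≤ k)
  have hd2k : (d2 : ℝ) ≤ k := by exact_mod_cast (by omega : d2 ≤ k)
  have hkN' : k ≤ N := by
    have : (k:ℝ) ≤ N := by linarith
    exact_mod_cast this
  have hNpos : (0:ℝ) < N := by
    rcases (Nat.cast_nonneg (α := ℝ) N).lt_or_eq with h | h
    · exact h
    · rw [← h] at hnN; linarith
  have hhN : h * (40 * r) ≤ N := by
    have : h * (40 * r) * r ≤ N * r := by nlinarith
    exact le_of_mul_le_mul_right this (by linarith)
  have hhN1 : h * 120 ≤ N := by nlinarith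
  have hs' : (2:ℝ) ≤ s := by exact_mod_cast hs
  have hsr' : (s:ℝ) + 1 ≤ r := by exact_mod_cast hsr
  have hcA : (#A : ℝ) + d2 = s * N + d1 := by exact_mod_cast hA
  have hcB : (#Aᶜ : ℝ) + #A = r * N := by rw [← hnN]; exact_mod_cast card_compl_add_card A
  have hsN : 2 * (N:ℝ) ≤ s * N := by nlinarith
  have hsrN : (s:ℝ) * N + N ≤ r * N := by nlinarith
  have hA1 : (N:ℝ) / 2 ≤ #A - h := by linarith
  have hB1 : (N:ℝ) / 2 ≤ #Aᶜ - h := by linarith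
  have hdA : ∀ v ∈ A \ Z, (N:ℝ) / 2 ≤ dg G Aᶜ v := by
    intro v hv
    have e1 : (dg G Aᶜ v : ℝ) + #(Aᶜ.filter (fun y => ¬ G.Adj v y)) = #Aᶜ := by exact_mod_cast dg_add_non G Aᶜ v
    have := htA v hv
    linarith
  have hdB : ∀ v ∈ Aᶜ \ Z, (N:ℝ) / 2 ≤ dg G A v := by
    intro v hv
    have e1 : (dg G A v : ℝ) + #(A.filter (fun y => ¬ G.Adj v y)) = #A := by exact_mod_cast dg_add_non G A v
    have := htB v hv
    linarith
  have hlamZ : lam * n / 2 ≤ lam * n - k := by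
    have h1 : (k:ℝ) * 2 ≤ k * (512 * r^3) := by gcongr; linarith
    linarith
  have hlN : lam * N / 8 ≤ N / 8 := by nlinarith
  have hlN2 : lam * N / 8 ≤ lam * n / 2 := by rw [hnN]; nlinarith [mul_pos hlam hNpos]
  have hfin : ∀ p : ℝ, lam * N / 8 ≤ p → 2 * c * (n:ℝ)^2 ≤ p * (N / 2) := by
    intro p hp
    have : 2 * c * (n:ℝ)^2 = lam * N / 8 * (N / 4) := by rw [hc, hnN]; field_simp; norm_num
    rw [this]
    apply mul_le_mul hp (by linarith) (by positivity)
    refine le_trans (by positivity) hp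
  -- index type
  obtain ⟨e⟩ : Nonempty (Z ⊕ (Fin d1 ⊕ Fin d2) ↪ L) := by
    apply Function.Embedding.nonempty_of_card_le
    rw [Fintype.card_sum, Fintype.card_sum, Fintype.card_coe, Fintype.card_fin, Fintype.card_fin]; omega
  set root : V → Option L := fun v => if hz : v ∈ Z then some (e (Sum.inl ⟨v, hz⟩)) else
    if hk : ∃ i, v ∈ K i then some (e (Sum.inr (Sum.inl hk.choose))) else none with hroot
  have hKZ : ∀ i v, v ∈ K i → v ∉ Z := fun i v hv => (mem_sdiff.1 (hKA i hv)).2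
  have root1 : ∀ v z, root v = some (e (Sum.inl z)) ↔ v = z := by
    intro v z
    simp only [hroot]
    split_ifs with h1 h2
    · rw [Option.some_inj, e.injective.eq_iff, Sum.inl_injective.eq_iff, Subtype.ext_iff]
    · rw [Option.some_inj, e.injective.eq_iff]
      simp only [reduceCtorEq, false_iff]
      rintro rfl; exact h1 z.2
    · simp only [reduceCtorEq, false_iff]
      rintro rfl; exact h1 z.2
  have root2 : ∀ v i, root v = some (e (Sum.inr (Sum.inl i))) ↔ v ∈ K i := by
    intro v i
    simp only [hroot]
    split_ifs with h1 h2
    · rw [Option.some_inj, e.injective.eq_iff]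
      simp only [reduceCtorEq, false_iff]
      exact fun h => hKZ i v h h1
    · rw [Option.some_inj, e.injective.eq_iff, Sum.inr_injective.eq_iff, Sum.inl_injective.eq_iff]
      constructor
      · intro h; rw [← h]; exact h2.choose_spec
      · intro h
        by_contra hne
        exact disjoint_left.1 (hKd _ _ hne) h2.choose_spec h
    · simp only [reduceCtorEq, false_iff]
      exact fun h => h2 ⟨i, h⟩
  have root3 : ∀ v j, root v ≠ some (e (Sum.inr (Sum.inr j))) := by
    intro v j
    simp only [hroot]
    split_ifs with h1 h2
    · rw [ne_eq, Option.some_inj, e.injective.eq_iff]; simp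
    · rw [ne_eq, Option.some_inj, e.injective.eq_iff]; simp
    · simp
  have root4 : ∀ v, root v = none → v ∉ Z := by
    intro v hv hz
    simp only [hroot] at hv
    rw [dif_pos hz] at hv
    exact Option.some_ne_none _ hv
  have root5 : ∀ v, root v ≠ none → v ∈ Z ∪ univ.biUnion K := by
    intro v hv
    simp only [hroot] at hv
    split_ifs at hv with h1 h2
    · exact mem_union_left _ h1
    · obtain ⟨i, hi⟩ := h2
      exact mem_union_right _ (mem_biUnion.2 ⟨i, mem_univ _, hi⟩)
    · exact absurd rfl hv
  set T : Finset L := univ.map e with hT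
  have memT : ∀ i, e i ∈ T := fun i => mem_map_of_mem e (mem_univ i)
  set αi : Z ⊕ (Fin d1 ⊕ Fin d2) → ℕ := Sum.elim (fun z => if z.1 ∈ A then s - 1 else s) (Sum.elim (fun _ => 0) (fun _ => s - 1)) with hαi
  set βi : Z ⊕ (Fin d1 ⊕ Fin d2) → ℕ := Sum.elim (fun z => if z.1 ∈ A then r - s else r - s - 1)
    (Sum.elim (fun _ => r - s - 1) (fun _ => r - s + 1)) with hβi
  set Xi : Z ⊕ (Fin d1 ⊕ Fin d2) → Finset V := Sum.elim (fun z => if z.1 ∈ A then A else (A \ Z).filter (fun x => G.Adj z x))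
    (Sum.elim (fun _ => A) (fun _ => A)) with hXi
  set Yi : Z ⊕ (Fin d1 ⊕ Fin d2) → Finset V := Sum.elim (fun z => if z.1 ∈ A then (Aᶜ \ Z).filter (fun x => G.Adj z x) else Aᶜ)
    (Sum.elim (fun i => (Aᶜ \ Z).filter (fun y => ∀ v ∈ K i, G.Adj v y)) (fun _ => Aᶜ \ Z)) with hYi
  set RA : L → Finset V := fun t => A.filter (fun v => root v = some t) with hRA
  set RB : L → Finset V := fun t => Aᶜ.filter (fun v => root v = some t) with hRB
  have RA1 : ∀ z : Z, RA (e (Sum.inl z)) = if z.1 ∈ A then {z.1} else ∅ := by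
    intro z; ext v; simp only [hRA, mem_filter, root1]
    split_ifs with h1
    · rw [mem_singleton]; exact ⟨fun h => h.2, fun h => ⟨h ▸ h1, h⟩⟩
    · simp only [notMem_empty, iff_false]; rintro ⟨h2, rfl⟩; exact h1 h2
  have RB1 : ∀ z : Z, RB (e (Sum.inl z)) = if z.1 ∈ A then ∅ else {z.1} := by
    intro z; ext v; simp only [hRB, mem_filter, root1, mem_compl]
    split_ifs with h1
    · simp only [notMem_empty, iff_false]; rintro ⟨h2, rfl⟩; exact h2 h1
    · rw [mem_singleton]; exact ⟨fun h => h.2, fun h => ⟨h ▸ h1, h⟩⟩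
  have RA2 : ∀ i, RA (e (Sum.inr (Sum.inl i))) = K i := by
    intro i; ext v; simp only [hRA, mem_filter, root2]
    exact ⟨fun h => h.2, fun h => ⟨(mem_sdiff.1 (hKA i h)).1, h⟩⟩
  have RB2 : ∀ i, RB (e (Sum.inr (Sum.inl i))) = ∅ := by
    intro i; ext v; simp only [hRB, mem_filter, root2, mem_compl, notMem_empty, iff_false]
    exact fun h => h.1 (mem_sdiff.1 (hKA i h.2)).1
  have RA3 : ∀ i, RA (e (Sum.inr (Sum.inr i))) = ∅ := by
    intro i; ext v; simp only [hRA, mem_filter, notMem_empty, iff_false]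
    exact fun h => root3 _ _ h.2
  have RB3 : ∀ i, RB (e (Sum.inr (Sum.inr i))) = ∅ := by
    intro i; ext v; simp only [hRB, mem_filter, notMem_empty, iff_false]
    exact fun h => root3 _ _ h.2
  have hTk : #T = k := by
    rw [hT, card_map, card_univ, Fintype.card_sum, Fintype.card_sum, Fintype.card_coe, Fintype.card_fin, Fintype.card_fin]; omega
  set m := #Tᶜ with hm
  have hmk : m + k = N := by rw [hm, ← hTk]; exact card_compl_add_card T
  have hmk' : (m:ℝ) + k = N := by exact_mod_cast hmk
  have hm2 : (N:ℝ) / 2 ≤ m := by linarith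
  have hm1 : 1 ≤ m := by
    have : (0:ℝ) < m := by linarith
    exact_mod_cast this
  have hc0 : 0 < c := by rw [hc]; positivity
  have hc1 : c ≤ 1 := by rw [hc, div_le_one (by positivity)]; linarith
  have hd2i : ∀ _ : Fin d2, r < 2 * s := fun i => hd2 (by have := i.2; omega)
  refine ⟨root, ?_⟩
  have main := ext_asm r s (by omega) hsr hrs G hVL A T m rfl hm1 root ?_ (Function.extend e αi 0) (Function.extend e βi 0) ?_ ?_ RA RB
    (fun _ => rfl) (fun _ => rfl) ?_ (Function.extend e Xi (fun _ => ∅)) (Function.extend e Yi (fun _ => ∅)) ?_ ?_ ?_ ?_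
    c hc0 hc1 hV hn ?_ ?_ ?_ ?_ h hh0 ?_ ?_ ?_
  · refine main.monoW ?_ ?_ (fun _ h => h)
    · intro a; unfold rw8; split_ifs <;> positivity
    · intro a
      unfold rw8
      have h48 : (r:ℝ) * (48 / m) ≤ 96 * r^2 / n := by
        rw [hnN, mul_div_assoc', div_le_div_iff₀ (by linarith) (by positivity)]
        have : 0 ≤ (r:ℝ)^2 := by positivity
        nlinarith
      rw [add_div]
      linarith
  · intro v t hv
    by_contra hne
    have hv' := hv
    simp only [hroot] at hv
    split_ifs at hv with h1 h2
    · rw [← Option.some_injective _ hv] at hne; exact hne (memT _)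
    · rw [← Option.some_injective _ hv] at hne; exact hne (memT _)
  all_goals (try (intro t ht; obtain ⟨i, -, rfl⟩ := mem_map.1 ht; simp only [e.injective.extend_apply]))
  · rcases i with z | i | i <;> simp only [hαi, Sum.elim_inl, Sum.elim_inr] <;> [split_ifs; skip; skip] <;> omega
  · rcases i with z | i | i <;> simp only [hβi, Sum.elim_inl, Sum.elim_inr] <;> [split_ifs; skip; skip] <;> omega
  · rcases i with z | i | i <;> simp only [hαi, hβi, Sum.elim_inl, Sum.elim_inr]
    · rw [RA1, RB1]; split_ifs <;> simp <;> omega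
    · rw [RA2, RB2, hKc, card_empty]; omega
    · rw [RA3, RB3, card_empty]; omega
  · rcases i with z | i | i <;> simp only [hXi, Sum.elim_inl, Sum.elim_inr]
    · split_ifs
      · exact subset_refl _
      · exact (filter_subset _ _).trans sdiff_subset
    · exact subset_refl _
    · exact subset_refl _
  · rcases i with z | i | i <;> simp only [hYi, Sum.elim_inl, Sum.elim_inr]
    · split_ifs
      · exact (filter_subset _ _).trans sdiff_subset
      · exact subset_refl _
    · exact (filter_subset _ _).trans sdiff_subset
    · exact sdiff_subset
  · rcases i with z | i | i <;> simp only [hXi, Sum.elim_inl, Sum.elim_inr]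
    · rw [RB1]
      split_ifs
      · simp
      · intro v hv x hx
        rw [mem_singleton] at hv
        rw [hv]; exact (mem_filter.1 hx).2
    · rw [RB2]; simp
    · rw [RB3]; simp
  · rcases i with z | i | i <;> simp only [hYi, Sum.elim_inl, Sum.elim_inr]
    · rw [RA1]
      split_ifs
      · intro v hv x hx
        rw [mem_singleton] at hv
        rw [hv]; exact (mem_filter.1 hx).2
      · simp
    · rw [RA2]; intro v hv y hy; exact (mem_filter.1 hy).2 v hv
    · rw [RA3]; simp
  · have e1 : #(univ.filter (fun v => root v ≠ none)) ≤ #Z + d1 * (s + 1) := by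
      refine (card_le_card (fun v hv => root5 v (mem_filter.1 hv).2)).trans ((card_union_le _ _).trans ?_)
      refine Nat.add_le_add_left ?_ _
      refine (card_biUnion_le_card_mul _ _ (s+1) (fun i _ => (hKc i).le)).trans ?_
      rw [card_univ, Fintype.card_fin]
    have e2 : (#(univ.filter (fun v => root v ≠ none)) : ℝ) ≤ #Z + d1 * (s + 1) := by exact_mod_cast e1
    rw [hTk]
    have e3 : (#Z : ℝ) + d1 * (s + 1) ≤ k * r := by
      have : (k:ℝ) = #Z + d1 + d2 := by rw [hkk]; push_cast; ring
      rw [this]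
      have : (0:ℝ) ≤ #Z := by positivity
      have : (0:ℝ) ≤ d1 := by positivity
      have : (0:ℝ) ≤ d2 := by positivity
      nlinarith
    have e4 : (k:ℝ) * r + k * (r + 1) ≤ k * (4 * r) := by nlinarith
    have e5 : (k:ℝ) * (4 * r) ≤ c / 2 * n := by
      rw [hc, div_div, div_mul_eq_mul_div, le_div_iff₀ (by positivity)]
      calc (k:ℝ) * (4 * r) * (64 * r^2 * 2) = k * (512 * r^3) := by ring
        _ ≤ _ := hk
    exact (add_le_add_left (e2.trans e3) _).trans (e4.trans e5)
  · rcases i with z | i | i <;> simp only [hXi, hYi, Sum.elim_inl, Sum.elim_inr]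
    · split_ifs with hz
      · rw [eG_comm]
        refine le_trans (hfin _ ?_) (eG_low G _ _ ((N:ℝ)/2) (fun x hx => hdB x (mem_filter.1 hx).1))
        have e1 := hZA z.1 z.2 hz
        have e2 : (dg G Aᶜ z : ℝ) ≤ dg G (Aᶜ \ Z) z + #Z := by exact_mod_cast dg_sdiff G Aᶜ Z z
        have e3 : (dg G (Aᶜ \ Z) z : ℝ) = #((Aᶜ \ Z).filter (fun x => G.Adj z x)) := rfl
        rw [← e3]; linarith
      · refine le_trans (hfin _ ?_) (eG_low G _ _ ((N:ℝ)/2) (fun x hx => hdA x (mem_filter.1 hx).1))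
        have e1 := hZB z.1 z.2 hz
        have e2 : (dg G A z : ℝ) ≤ dg G (A \ Z) z + #Z := by exact_mod_cast dg_sdiff G A Z z
        have e3 : (dg G (A \ Z) z : ℝ) = #((A \ Z).filter (fun x => G.Adj z x)) := rfl
        rw [← e3]; linarith
    · rw [eG_comm]
      refine le_trans (hfin _ ?_) (eG_low G _ _ ((N:ℝ)/2) (fun x hx => hdB x (mem_filter.1 hx).1))
      have e1 : #Aᶜ ≤ #((Aᶜ \ Z).filter (fun y => ∀ v ∈ K i, G.Adj v y)) + (#Z + ∑ v ∈ K i, #(Aᶜ.filter (fun y => ¬ G.Adj v y))) := by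
        have : Aᶜ ⊆ ((Aᶜ \ Z).filter (fun y => ∀ v ∈ K i, G.Adj v y)) ∪ (Z ∪ (K i).biUnion (fun v => Aᶜ.filter (fun y => ¬ G.Adj v y))) := by
          intro y hy
          by_cases h1 : y ∈ Z
          · exact mem_union_right _ (mem_union_left _ h1)
          by_cases h2 : ∀ v ∈ K i, G.Adj v y
          · exact mem_union_left _ (mem_filter.2 ⟨mem_sdiff.2 ⟨hy, h1⟩, h2⟩)
          · push Not at h2
            obtain ⟨v, hv, hvy⟩ := h2
            exact mem_union_right _ (mem_union_right _ (mem_biUnion.2 ⟨v, hv, mem_filter.2 ⟨hy, hvy⟩⟩))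
        refine (card_le_card this).trans ((card_union_le _ _).trans (Nat.add_le_add_left ((card_union_le _ _).trans ?_) _))
        exact Nat.add_le_add_left card_biUnion_le _
      have e2 : ∑ v ∈ K i, (#(Aᶜ.filter (fun y => ¬ G.Adj v y)) : ℝ) ≤ (s + 1 : ℕ) * h := by
        rw [← hKc i, ← nsmul_eq_mul]
        exact sum_le_card_nsmul _ _ _ fun v hv => htA v (hKA i hv)
      have e3 : (#Aᶜ : ℝ) ≤ #((Aᶜ \ Z).filter (fun y => ∀ v ∈ K i, G.Adj v y)) + (#Z + ∑ v ∈ K i, (#(Aᶜ.filter (fun y => ¬ G.Adj v y)) : ℝ)) := by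
        exact_mod_cast e1
      have e4 : ((s + 1 : ℕ) : ℝ) * h ≤ N / 40 := by
        push_cast
        have : ((s:ℝ) + 1) * h ≤ r * h := by gcongr
        linarith
      linarith
    · rw [eG_comm]
      refine le_trans (hfin _ ?_) (eG_low G _ _ ((N:ℝ)/2) (fun x hx => hdB x hx))
      have e1 : (#Aᶜ : ℝ) ≤ #(Aᶜ \ Z) + #Z := by exact_mod_cast (card_le_card_sdiff_add_card)
      linarith
  · rcases i with z | i | i <;> simp only [hαi, hβi, Sum.elim_inl, Sum.elim_inr]
    · left
      rw [RA1, RB1]; split_ifs <;> simp <;> omega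
    · right
      rw [RA2, RB2]
      exact ⟨hKq i, rfl, trivial, by omega⟩
    · left
      have := hd2i i
      rw [RA3, RB3]; simp; omega
  · rw [hT, sum_map]
    simp only [e.injective.extend_apply]
    rw [Fintype.sum_sum_type, Fintype.sum_sum_type]
    have e1 : ∑ z : Z, (#(RA (e (Sum.inl z))) + αi (Sum.inl z)) = #Z * s := by
      rw [sum_congr rfl (g := fun _ => s), sum_const, card_univ, Fintype.card_coe, smul_eq_mul]
      intro z _
      rw [RA1]; simp only [hαi, Sum.elim_inl]
      split_ifs <;> simp; omega
    have e2 : ∑ i, (#(RA (e (Sum.inr (Sum.inl i)))) + αi (Sum.inr (Sum.inl i))) = d1 * (s + 1) := by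
      rw [sum_congr rfl (g := fun _ => s + 1), sum_const, card_univ, Fintype.card_fin, smul_eq_mul]
      intro i _
      rw [RA2, hKc]; simp only [hαi, Sum.elim_inl, Sum.elim_inr, add_zero]
    have e3 : ∑ i, (#(RA (e (Sum.inr (Sum.inr i)))) + αi (Sum.inr (Sum.inr i))) = d2 * (s - 1) := by
      rw [sum_congr rfl (g := fun _ => s - 1), sum_const, card_univ, Fintype.card_fin, smul_eq_mul]
      intro i _
      rw [RA3]; simp only [hαi, Sum.elim_inr, card_empty, zero_add]
    rw [e1, e2, e3]
    exact ext1_arith s (#A) d1 d2 (#Z) m N (by omega) hA (by omega)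
  · have : (s:ℝ) * h ≤ r * h := by gcongr
    linarith
  · intro v hv hr; exact htA v (mem_sdiff.2 ⟨hv, root4 v hr⟩)
  · intro v hv hr; exact htB v (mem_sdiff.2 ⟨hv, root4 v hr⟩)

end Ext


/-! ## Part 8d : extracting the extremal structure -/

section Extract
variable {V : Type} [Fintype V] [DecidableEq V]

theorem dg_compl_add (G : SimpleGraph V) (X : Finset V) (v : V) : dg G X v + dg G Xᶜ v = dg G univ v := by
  unfold dg
  rw [← card_union_of_disjoint, ← filter_union, union_compl]
  exact disjoint_filter_filter disjoint_compl_right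

theorem non_sum (G : SimpleGraph V) (X : Finset V) (k : ℕ) (hk : ∀ v, k ≤ dg G univ v) :
    (#Xᶜ : ℝ) * #X - eG G Xᶜ X ≤ #X * ((Fintype.card V : ℝ) - k - #X) + eG G X X := by
  have h1 : #X * k ≤ eG G X X + eG G X Xᶜ := by
    rw [eG_eq_sum, eG_eq_sum, ← sum_add_distrib, ← smul_eq_mul]
    exact card_nsmul_le_sum _ _ _ fun v _ => by rw [dg_compl_add]; exact hk v
  have h2 : (#X : ℝ) * k ≤ eG G X X + eG G X Xᶜ := by exact_mod_cast h1
  have h3 : (#Xᶜ : ℝ) = Fintype.card V - #X := by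
    have : (#Xᶜ : ℝ) + #X = Fintype.card V := by exact_mod_cast card_compl_add_card X
    linarith
  rw [eG_comm G Xᶜ X, h3]
  linarith

theorem non_markov (G : SimpleGraph V) (X T : Finset V) (hT : T ⊆ Xᶜ) (t : ℝ) (ht : ∀ b ∈ T, t ≤ #X - dg G X b) :
    #T * t ≤ (#Xᶜ : ℝ) * #X - eG G Xᶜ X := by
  rw [eG_eq_sum, ← nsmul_eq_mul, ← nsmul_eq_mul, ← sum_const, ← sum_const]; push_cast
  rw [← sum_sub_distrib]
  refine (sum_le_sum ht).trans (sum_le_sum_of_subset_of_nonneg hT fun b _ _ => ?_)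
  have : (dg G X b : ℝ) ≤ #X := by exact_mod_cast dg_le G X b
  linarith

theorem ext_A (G : SimpleGraph V) (k : ℕ) (hk : ∀ v, k ≤ dg G univ v) (n σ g ω γ : ℝ) (hn : n = Fintype.card V) (hn0 : 0 < n)
    (hσ : σ = n - k) (hσ2 : n / 2 ≤ σ) (hg : 0 < g) (hg1 : g ≤ 1/16) (hω : 0 < ω) (hω1 : ω ≤ g / 2) (hγ : γ = g * ω / 40)
    (A0 : Finset V) (hA1 : #A0 ≤ σ) (hA2 : σ - γ * n ≤ #A0) (hA3 : eG G A0 A0 ≤ γ * n^2) :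
    ∃ A : Finset V, (∀ v ∈ A, dg G A v ≤ 2 * g * n) ∧ (∀ v ∉ A, g * n / 2 ≤ dg G A v) ∧ |#A - σ| ≤ ω * n ∧
      (#Aᶜ : ℝ) * #A - eG G Aᶜ A ≤ ω * n^2 := by
  set A : Finset V := univ.filter (fun v => (dg G A0 v : ℝ) < g * n) with hA
  have hle : ∀ X : Finset V, (#X : ℝ) ≤ n := fun X => by rw [hn]; exact_mod_cast card_le_univ X
  have hγ0 : 0 < γ := by rw [hγ]; positivity
  have hγω : γ ≤ ω / 640 := by rw [hγ]; nlinarith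
  have hγn : γ * n ≤ ω * n / 640 := by nlinarith
  have hgn : g * n ≤ n / 16 := by nlinarith
  have hωn : ω * n ≤ g * n / 2 := by nlinarith
  have hωn0 : 0 < ω * n := by positivity
  have h1 : (#(A0 \ A) : ℝ) ≤ ω / 40 * n := by
    have : (#(A0 \ A) : ℝ) * (g * n) ≤ eG G (A0 \ A) A0 := by
      apply eG_low
      intro x hx
      by_contra hc
      push Not at hc
      exact (mem_sdiff.1 hx).2 (mem_filter.2 ⟨mem_univ _, hc⟩)
    have h2 : (eG G (A0 \ A) A0 : ℝ) ≤ eG G A0 A0 := by exact_mod_cast eG_mono G sdiff_subset (Subset.refl _)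
    have h3 : (#(A0 \ A) : ℝ) * (g * n) ≤ (ω / 40 * n) * (g * n) := by
      refine (this.trans (h2.trans hA3)).trans (le_of_eq ?_)
      rw [hγ]; ring
    exact le_of_mul_le_mul_right h3 (by positivity)
  have h2 : (#(A \ A0) : ℝ) ≤ ω / 40 * n := by
    have m := non_markov G A0 (A \ A0) (fun x hx => mem_compl.2 (mem_sdiff.1 hx).2) (n / 4) (fun b hb => by
      have := (mem_filter.1 (mem_sdiff.1 hb).1).2
      linarith)
    have m2 := non_sum G A0 k hk
    rw [← hn, ← hσ] at m2
    have m3 : (#A0 : ℝ) * (σ - #A0) ≤ n * (γ * n) := mul_le_mul (hle _) (by linarith) (by linarith) hn0.le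
    have m4 : (#(A \ A0) : ℝ) * (n/4) ≤ (8 * γ * n) * (n / 4) := by nlinarith
    have m5 := le_of_mul_le_mul_right m4 (by linarith)
    nlinarith
  have c1 : (#A : ℝ) ≤ #A0 + #(A \ A0) := by
    have : #A ≤ #(A \ A0) + #A0 := card_le_card_sdiff_add_card
    have : (#A : ℝ) ≤ #(A \ A0) + #A0 := by exact_mod_cast this
    linarith
  have c2 : (#A0 : ℝ) ≤ #A + #(A0 \ A) := by
    have : #A0 ≤ #(A0 \ A) + #A := card_le_card_sdiff_add_card
    have : (#A0 : ℝ) ≤ #(A0 \ A) + #A := by exact_mod_cast this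
    linarith
  have d1 : ∀ v, (dg G A v : ℝ) ≤ dg G A0 v + #(A \ A0) := by
    intro v
    have e1 := dg_sdiff G A (A \ A0) v
    have e2 : dg G (A \ (A \ A0)) v ≤ dg G A0 v := dg_mono G (by rw [sdiff_sdiff_right_self]; exact inter_subset_right) v
    exact_mod_cast e1.trans (Nat.add_le_add_right e2 _)
  have d2 : ∀ v, (dg G A0 v : ℝ) ≤ dg G A v + #(A0 \ A) := by
    intro v
    have e1 := dg_sdiff G A0 (A0 \ A) v
    have e2 : dg G (A0 \ (A0 \ A)) v ≤ dg G A v := dg_mono G (by rw [sdiff_sdiff_right_self]; exact inter_subset_right) v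
    exact_mod_cast e1.trans (Nat.add_le_add_right e2 _)
  refine ⟨A, ?_, ?_, ?_, ?_⟩
  · intro v hv
    have := (mem_filter.1 hv).2
    have := d1 v
    linarith
  · intro v hv
    have : g * n ≤ dg G A0 v := by
      by_contra hc
      push Not at hc
      exact hv (mem_filter.2 ⟨mem_univ _, hc⟩)
    have := d2 v
    linarith
  · rw [abs_le]; constructor <;> linarith
  · have m2 := non_sum G A k hk
    rw [← hn, ← hσ] at m2
    have m3 : (#A : ℝ) * (σ - #A) ≤ n * (ω / 4 * n) := by
      have : (#A : ℝ) * (σ - #A) ≤ #A * (ω / 4 * n) := by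
        apply mul_le_mul_of_nonneg_left _ (Nat.cast_nonneg _); linarith
      exact this.trans (mul_le_mul_of_nonneg_right (hle _) (by positivity))
    have m4 : (eG G A A : ℝ) ≤ eG G A0 A0 + 2 * (#(A \ A0) * n) := by
      have e1 := eG_sdiff G A A (A \ A0)
      have e2 : eG G (A \ (A \ A0)) (A \ (A \ A0)) ≤ eG G A0 A0 :=
        eG_mono G (by rw [sdiff_sdiff_right_self]; exact inter_subset_right) (by rw [sdiff_sdiff_right_self]; exact inter_subset_right)
      rw [hn]
      exact_mod_cast e1.trans (Nat.add_le_add_right e2 _)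
    have m5 : (#(A \ A0) : ℝ) * n ≤ ω / 40 * n * n := mul_le_mul_of_nonneg_right h2 hn0.le
    have m6 : γ * n^2 ≤ ω / 640 * n^2 := mul_le_mul_of_nonneg_right hγω (by positivity)
    have m7 : 0 < ω * n^2 := by positivity
    linarith

end Extract


/-! ## Part 8e : the extremal structure, case analysis -/

section Extract2
variable {V : Type} [Fintype V] [DecidableEq V]

/-- the structure obtained in the extremal case -/
def ExtOK (G : SimpleGraph V) (r s N : ℕ) (n g ω h : ℝ) (A Z : Finset V) (d1 d2 : ℕ) : Prop :=
  (d2 ≠ 0 → r < 2 * s) ∧ #A + d2 = s * N + d1 ∧ ((#Z + d1 + d2 : ℕ) : ℝ) * (512 * r^3) ≤ g / 4 * n ∧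
  (∀ v ∈ A \ Z, (#(Aᶜ.filter (fun y => ¬ G.Adj v y)) : ℝ) ≤ h) ∧
  (∀ v ∈ Aᶜ \ Z, (#(A.filter (fun y => ¬ G.Adj v y)) : ℝ) ≤ h) ∧
  (∀ z ∈ Z, z ∈ A → g / 4 * n ≤ dg G Aᶜ z) ∧ (∀ z ∈ Z, z ∉ A → g / 4 * n ≤ dg G A z) ∧
  (d1 ≠ 0 → (∀ v ∈ A, v ∉ Z) ∧ n / 3 ≤ #A ∧ (d1:ℝ) ≤ ω * n ∧ ∀ v ∈ A, d1 ≤ dg G A v ∧ dg G A v ≤ 2 * g * n)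

set_option maxHeartbeats 4000000 in
theorem ext_struct (r s : ℕ) (hs : 2 ≤ s) (hsr : s < r) (hrs : r ≤ 2 * s) (G : SimpleGraph V) (N : ℕ) (hVN : Fintype.card V = r * N)
    (hk : ∀ v, (r - s) * N ≤ dg G univ v) (n g ω γ h : ℝ) (hn : n = Fintype.card V) (hn0 : 0 < n)
    (hg : 0 < g) (hg1 : g * (160 * r^2) ≤ 1) (hω : 0 < ω) (hω1 : ω * (200000 * r^5) ≤ g) (hγ : γ = g * ω / 40) (hh : h = n / (40 * r^2))
    (U : Finset V) (hU1 : ((s:ℝ) / r - γ) * n ≤ #U) (hU2 : eG G U U ≤ γ * n^2) :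
    ∃ A Z d1 d2, ExtOK G r s N n g ω h A Z d1 d2 := by
  have hr3 : (3:ℝ) ≤ r := by exact_mod_cast (by omega : 3 ≤ r)
  have hr9 : (9:ℝ) ≤ (r:ℝ)^2 := by nlinarith
  have hr5 : (1:ℝ) ≤ (r:ℝ)^5 := one_le_pow₀ (by linarith)
  have hnN : n = r * N := by rw [hn]; exact_mod_cast hVN
  have hsN : ((s:ℝ) / r) * n = s * N := by rw [hnN]; field_simp
  have hg16 : g ≤ 1/16 := by nlinarith
  have hωg : ω ≤ g / 2 := by nlinarith
  have hkr : (((r - s) * N : ℕ) : ℝ) = r * N - s * N := by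
    push_cast [Nat.cast_sub hsr.le]; ring
  have hσ2 : n / 2 ≤ s * N := by
    have : (r:ℝ) ≤ 2 * s := by exact_mod_cast hrs
    rw [hnN]; nlinarith [Nat.cast_nonneg (α := ℝ) N]
  have hγ0 : 0 < γ := by rw [hγ]; positivity
  obtain ⟨A0, hA0U, hA0c⟩ := exists_subset_card_eq (min_le_left (#U) (s * N))
  obtain ⟨A, hA1, hA2, hA3, hA4⟩ := ext_A G ((r - s) * N) hk n (s * N) g ω γ hn hn0 (by rw [hkr, hnN]; ring) hσ2 hg hg16 hω hωg hγ A0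
    (by exact_mod_cast hA0c.le.trans (min_le_right _ _))
    (by
      rw [hA0c]; push_cast
      rw [le_min_iff]
      constructor
      · rw [← hsN]; linarith
      · nlinarith)
    (le_trans (by exact_mod_cast eG_mono G hA0U hA0U) hU2)
  have hgn : 0 < g * n := by positivity
  have hgn16 : g * n ≤ n / 16 := by nlinarith
  have hωn0 : 0 < ω * n := by positivity
  have hωn : ω * n * (200000 * r^5) ≤ g * n := by nlinarith
  have hωn' : ω * n * 200000 ≤ g * n := by nlinarith
  have hgh : g * n * 4 ≤ h := by
    rw [hh, le_div_iff₀ (by positivity)]; nlinarith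
  have hh0 : 0 < h := by rw [hh]; positivity
  rw [abs_le] at hA3
  have hAc : #Aᶜ + #A = r * N := by rw [← hVN]; exact card_compl_add_card A
  have hAc' : (#Aᶜ : ℝ) + #A = r * N := by exact_mod_cast hAc
  -- typical vertices of A
  have tA : ∀ v ∈ A, (#(Aᶜ.filter (fun y => ¬ G.Adj v y)) : ℝ) ≤ 3 * (g * n) := by
    intro v hv
    have e1 : (dg G Aᶜ v : ℝ) + #(Aᶜ.filter (fun y => ¬ G.Adj v y)) = #Aᶜ := by exact_mod_cast dg_add_non G Aᶜ v
    have e2 : (dg G A v : ℝ) + dg G Aᶜ v = dg G univ v := by exact_mod_cast dg_compl_add G A v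
    have e3 : (((r - s) * N : ℕ) : ℝ) ≤ dg G univ v := by exact_mod_cast hk v
    rw [hkr] at e3
    have := hA1 v hv
    linarith
  set Z0 : Finset V := Aᶜ.filter (fun b => h / 2 < #(A.filter (fun y => ¬ G.Adj b y))) with hZ0
  have tB : ∀ v ∈ Aᶜ \ Z0, (#(A.filter (fun y => ¬ G.Adj v y)) : ℝ) ≤ h / 2 := by
    intro v hv
    by_contra hc
    push Not at hc
    exact (mem_sdiff.1 hv).2 (mem_filter.2 ⟨(mem_sdiff.1 hv).1, hc⟩)
  have cZ : (#Z0 : ℝ) ≤ 80 * r^2 * (ω * n) := by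
    have m := non_markov G A Z0 (filter_subset _ _) (h / 2) (fun b hb => by
      have e1 : (dg G A b : ℝ) + #(A.filter (fun y => ¬ G.Adj b y)) = #A := by exact_mod_cast dg_add_non G A b
      have := (mem_filter.1 hb).2
      linarith)
    have m2 : (#Z0 : ℝ) * (h / 2) ≤ (80 * r^2 * (ω * n)) * (h / 2) := by
      refine (m.trans hA4).trans (le_of_eq ?_)
      rw [hh]; field_simp; norm_num
    exact le_of_mul_le_mul_right m2 (by linarith)
  have cTot : ∀ x : ℝ, x ≤ 80 * r^2 * (ω * n) + ω * n → x * (512 * r^3) ≤ g / 4 * n := by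
    intro x hx
    have e1 : x ≤ 81 * r^2 * (ω * n) := by
      have := mul_nonneg hωn0.le (by linarith : (0:ℝ) ≤ r^2 - 1)
      linarith
    have e2 : x * (512 * r^3) ≤ 81 * r^2 * (ω * n) * (512 * r^3) := mul_le_mul_of_nonneg_right e1 (by positivity)
    have e3 : 81 * r^2 * (ω * n) * (512 * r^3) = (41472:ℝ) * (ω * n * r^5) := by ring
    have e4 : 0 ≤ ω * n * r^5 := by positivity
    linarith
  have zB : ∀ z ∈ Z0, z ∉ A := fun z hz => mem_compl.1 (mem_filter.1 hz).1
  by_cases hc1 : s * N ≤ #A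
  · refine ⟨A, Z0, #A - s * N, 0, fun h => absurd rfl h, by omega, cTot _ ?_, ?_, ?_, ?_, ?_, ?_⟩
    · push_cast [Nat.cast_sub hc1]; linarith
    · intro v hv; linarith [tA v (mem_sdiff.1 hv).1]
    · intro v hv; linarith [tB v hv]
    · intro z hz hzA; exact absurd hzA (zB z hz)
    · intro z _ hzA; linarith [hA2 z hzA]
    · intro _
      refine ⟨fun v hv hz => zB v hz hv, by linarith, by push_cast [Nat.cast_sub hc1]; linarith, fun v hv => ⟨?_, by linarith [hA1 v hv]⟩⟩
      have e1 := dg_compl_add G A v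
      have e2 := hk v
      have e3 := dg_le G Aᶜ v
      have e4 : (r - s) * N + s * N = r * N := by rw [← add_mul, Nat.sub_add_cancel hsr.le]
      omega
  push Not at hc1
  have hd : ((s * N - #A : ℕ) : ℝ) = s * N - #A := by push_cast [Nat.cast_sub hc1.le]; ring
  by_cases hc2 : r < 2 * s
  · refine ⟨A, Z0, 0, s * N - #A, fun _ => hc2, by omega, cTot _ ?_, ?_, ?_, ?_, ?_, fun h => absurd rfl h⟩
    · push_cast [hd]; linarith
    · intro v hv; linarith [tA v (mem_sdiff.1 hv).1]
    · intro v hv; linarith [tB v hv]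
    · intro z hz hzA; exact absurd hzA (zB z hz)
    · intro z _ hzA; linarith [hA2 z hzA]
  have hr2s : r = 2 * s := by omega
  have hrN : r * N = s * N + s * N := by rw [hr2s]; ring
  have hrsN : (r - s) * N = s * N := by rw [hr2s]; congr 1; omega
  have hrN' : (r:ℝ) * N = s * N + s * N := by exact_mod_cast hrN
  set W : Finset V := Aᶜ.filter (fun b => g * n ≤ dg G Aᶜ b) with hW
  have hWA : ∀ w ∈ W, w ∉ A := fun z hz => mem_compl.1 (mem_filter.1 hz).1
  by_cases hc3 : s * N - #A ≤ #W
  · obtain ⟨D, hDW, hDc⟩ := exists_subset_card_eq hc3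
    have hDc' : (#D : ℝ) ≤ ω * n := by rw [hDc, hd]; linarith
    have hDA : Disjoint A D := disjoint_left.2 fun x hx hx' => hWA x (hDW hx') hx
    have hAD : (A ∪ D)ᶜ ⊆ Aᶜ := compl_subset_compl.2 subset_union_left
    refine ⟨A ∪ D, Z0 ∪ D, 0, 0, fun h => absurd rfl h, ?_, cTot _ ?_, ?_, ?_, ?_, ?_, fun h => absurd rfl h⟩
    · rw [card_union_of_disjoint hDA]; omega
    · have : (#(Z0 ∪ D) : ℝ) ≤ #Z0 + #D := by exact_mod_cast card_union_le _ _
      push_cast; linarith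
    · intro v hv
      have hvA : v ∈ A := by
        rcases mem_union.1 (mem_sdiff.1 hv).1 with h | h
        · exact h
        · exact absurd (mem_union_right _ h) (mem_sdiff.1 hv).2
      have e1 : (#((A ∪ D)ᶜ.filter (fun y => ¬ G.Adj v y)) : ℝ) ≤ #(Aᶜ.filter (fun y => ¬ G.Adj v y)) := by
        exact_mod_cast card_le_card (filter_subset_filter _ hAD)
      linarith [tA v hvA]
    · intro v hv
      have hvB : v ∈ Aᶜ \ Z0 := mem_sdiff.2 ⟨hAD (mem_sdiff.1 hv).1, fun h => (mem_sdiff.1 hv).2 (mem_union_left _ h)⟩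
      have e1 : (#((A ∪ D).filter (fun y => ¬ G.Adj v y)) : ℝ) ≤ #(A.filter (fun y => ¬ G.Adj v y)) + #D := by
        rw [filter_union]
        exact_mod_cast (card_union_le _ _).trans (Nat.add_le_add_left (card_filter_le _ _) _)
      linarith [tB v hvB]
    · intro z hz hzA
      have hzD : z ∈ D := by
        rcases mem_union.1 hzA with h | h
        · rcases mem_union.1 hz with h' | h'
          · exact absurd h (zB z h')
          · exact h'
        · exact h
      have e1 := (mem_filter.1 (hDW hzD)).2
      have e2 := dg_sdiff G Aᶜ D z
      have e3 : Aᶜ \ D = (A ∪ D)ᶜ := by ext x; simp [not_or]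
      rw [e3] at e2
      have e4 : (dg G Aᶜ z : ℝ) ≤ dg G (A ∪ D)ᶜ z + #D := by exact_mod_cast e2
      linarith
    · intro z _ hzA
      have e1 : (dg G A z : ℝ) ≤ dg G (A ∪ D) z := by exact_mod_cast dg_mono G subset_union_left z
      linarith [hA2 z (fun h => hzA (mem_union_left _ h))]
  · push Not at hc3
    have hWd : (#W : ℝ) ≤ ω * n := by
      have : (#W : ℝ) ≤ ((s * N - #A : ℕ) : ℝ) := by exact_mod_cast hc3.le
      rw [hd] at this; linarith
    have hWs : W ⊆ Aᶜ := filter_subset _ _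
    have hBc : #(Aᶜ \ W) + #W = #Aᶜ := card_sdiff_add_card_eq_card hWs
    have hBc' : (#(Aᶜ \ W) : ℝ) + #W = #Aᶜ := by exact_mod_cast hBc
    have hcomp : (Aᶜ \ W)ᶜ = A ∪ W := by ext x; simp; tauto
    have hd1 : ((#Aᶜ - #W - s * N : ℕ) : ℝ) ≤ ω * n := by
      have : #Aᶜ - #W - s * N ≤ s * N - #A := by omega
      have : ((#Aᶜ - #W - s * N : ℕ) : ℝ) ≤ ((s * N - #A : ℕ) : ℝ) := by exact_mod_cast this
      rw [hd] at this; linarith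
    have hnW : ∀ v ∈ Aᶜ \ W, (dg G Aᶜ v : ℝ) < g * n := by
      intro v hv
      by_contra hc
      push Not at hc
      exact (mem_sdiff.1 hv).2 (mem_filter.2 ⟨(mem_sdiff.1 hv).1, hc⟩)
    have hcompc : #(A ∪ W) + #(Aᶜ \ W) = r * N := by
      rw [← hcomp, ← hVN]; exact card_compl_add_card _
    have hin : ∀ v, (#Aᶜ - #W - s * N) ≤ dg G (Aᶜ \ W) v := by
      intro v
      have e1 := dg_compl_add G (Aᶜ \ W) v
      have e2 := hk v
      have e3 := dg_le G (Aᶜ \ W)ᶜ v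
      rw [hcomp] at e1 e3
      omega
    refine ⟨Aᶜ \ W, W, #Aᶜ - #W - s * N, 0, fun h => absurd rfl h, ?_, cTot _ ?_, ?_, ?_, ?_, ?_, ?_⟩
    · omega
    · have : 0 ≤ 80 * r^2 * (ω * n) - ω * n := by nlinarith
      push_cast
      linarith
    · intro v hv
      have hv' := (mem_sdiff.1 hv).1
      have e1 : (dg G (Aᶜ \ W)ᶜ v : ℝ) + #((Aᶜ \ W)ᶜ.filter (fun y => ¬ G.Adj v y)) = #(Aᶜ \ W)ᶜ := by exact_mod_cast dg_add_non G _ v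
      have e2 : (dg G (Aᶜ \ W) v : ℝ) + dg G (Aᶜ \ W)ᶜ v = dg G univ v := by exact_mod_cast dg_compl_add G _ v
      have e3 : (((r - s) * N : ℕ) : ℝ) ≤ dg G univ v := by exact_mod_cast hk v
      have e4 : (dg G (Aᶜ \ W) v : ℝ) ≤ dg G Aᶜ v := by exact_mod_cast dg_mono G sdiff_subset v
      have e5 := hnW v hv'
      have e6 : (#(A ∪ W) : ℝ) ≤ #A + #W := by exact_mod_cast card_union_le _ _
      have e7 : (#A : ℝ) < s * N := by exact_mod_cast hc1
      rw [hkr, hrN'] at e3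
      rw [hcomp] at e1 e2 ⊢
      linarith
    · intro v hv
      rw [hcomp] at hv
      have hvA : v ∈ A := by
        rcases mem_union.1 (mem_sdiff.1 hv).1 with h | h
        · exact h
        · exact absurd h (mem_sdiff.1 hv).2
      have e1 : (#((Aᶜ \ W).filter (fun y => ¬ G.Adj v y)) : ℝ) ≤ #(Aᶜ.filter (fun y => ¬ G.Adj v y)) := by
        exact_mod_cast card_le_card (filter_subset_filter _ sdiff_subset)
      linarith [tA v hvA]
    · intro z hz hzA; exact absurd hz (mem_sdiff.1 hzA).2
    · intro z hz _
      have e1 := (mem_filter.1 hz).2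
      have e2 : (dg G Aᶜ z : ℝ) ≤ dg G (Aᶜ \ W) z + #W := by exact_mod_cast dg_sdiff G Aᶜ W z
      linarith
    · intro _
      refine ⟨fun v hv => (mem_sdiff.1 hv).2, ?_, hd1, fun v hv => ⟨hin v, ?_⟩⟩
      · have e7 : (#A : ℝ) < s * N := by exact_mod_cast hc1
        have : s * N ≤ #(Aᶜ \ W) := by omega
        have : (s:ℝ) * N ≤ #(Aᶜ \ W) := by exact_mod_cast this
        linarith
      · have e4 : (dg G (Aᶜ \ W) v : ℝ) ≤ dg G Aᶜ v := by exact_mod_cast dg_mono G sdiff_subset v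
        have := hnW v hv
        linarith

end Extract2


/-! ## Part 9 : disjoint cliques in the sparse side -/

section Cliques
variable {V L : Type} [Fintype V] [DecidableEq V] [Fintype L] [DecidableEq L]

theorem jobsM {κ : Type} [Fintype κ] (Ok : L → (κ → V) → Prop) (U : Finset V) (T : Finset L) (M : ℝ)
    (hM : 0 < M) (hV : 0 < Fintype.card V)
    (hstep : ∀ A t τ, A ⊆ T → t ∈ T → t ∉ A → Fam Ok U A τ →
      M ≤ #(univ.filter (fun σ : κ → V => Ok t σ ∧ ∀ i, σ i ∉ usedV U A τ))) :
    Spr (fun O => ∃ τ : L → κ → V, Fam Ok U T τ ∧ O = atoms T τ)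
      (fun D => if labs D ⊆ T then ((Fintype.card V : ℝ) ^ Fintype.card κ / M) ^ #(labs D) *
        ((Fintype.card κ : ℝ) / Fintype.card V) ^ #D else 0) := by
  haveI : Nonempty V := Fintype.card_pos_iff.1 hV
  refine greedy (κ := κ) (fun A O => ∃ τ : L → κ → V, Fam Ok U A τ ∧ O = atoms A τ) M hM hV
    ⟨fun _ _ => Classical.arbitrary V, ⟨by simp, by simp, by simp⟩, by simp [atoms]⟩ T ?_
  rintro A t O hA ht htA ⟨τ, hτ, rfl⟩
  refine (hstep A t τ hA ht htA hτ).trans ?_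
  norm_cast
  apply card_le_card
  intro σ hσ
  simp only [mem_filter, mem_univ, true_and] at hσ ⊢
  obtain ⟨h1, h2⟩ := hσ
  simp only [mem_usedV, not_or, not_exists, not_and] at h2
  have hne : ∀ t' ∈ A, t' ≠ t := fun t' h e => htA (e ▸ h)
  refine ⟨Function.update τ t σ, ⟨?_, ?_, ?_⟩, ?_⟩
  · intro t' h
    rcases mem_insert.1 h with rfl | h
    · rwa [Function.update_self]
    · rw [Function.update_of_ne (hne _ h)]; exact hτ.1 _ h
  · intro t' h
    rcases mem_insert.1 h with rfl | h
    · rw [Function.update_self]; exact fun i => (h2 i).1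
    · rw [Function.update_of_ne (hne _ h)]; exact hτ.2.1 _ h
  · intro t1 h1' t2 h2' hn i j
    rcases mem_insert.1 h1' with e1 | h1a <;> rcases mem_insert.1 h2' with e2 | h2a
    · exact absurd (e1.trans e2.symm) hn
    · subst e1; rw [Function.update_self, Function.update_of_ne (hne _ h2a)]
      exact fun e => (h2 i).2 _ h2a _ e.symm
    · subst e2; rw [Function.update_self, Function.update_of_ne (hne _ h1a)]
      exact fun e => (h2 j).2 _ h1a _ e
    · rw [Function.update_of_ne (hne _ h1a), Function.update_of_ne (hne _ h2a)]
      exact hτ.2.2 _ h1a _ h2a hn i j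
  · unfold atoms
    rw [biUnion_insert, Function.update_self, union_comm]
    congr 1
    exact biUnion_congr rfl fun t' h => by rw [Function.update_of_ne (hne _ h)]

theorem plc_card (D : Finset (Sym2 V)) (a : comps D → L) : #(plc D a) = ∑ c : comps D, #c.1 := by
  unfold plc
  rw [card_biUnion]
  · refine sum_congr rfl fun c _ => card_image_of_injective _ fun x y h => (Prod.mk.inj h).1
  · intro c _ c' _ hcc
    rw [Function.onFun, disjoint_left]
    intro x hx hx'
    obtain ⟨v, hv, rfl⟩ := mem_image.1 hx
    obtain ⟨v', hv', hvv⟩ := mem_image.1 hx'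
    apply hcc
    apply Subtype.ext
    have : v' = v := (Prod.mk.inj hvv).1
    subst this
    exact comps_disj D c.2 c'.2 hv hv'

theorem plc_labs (D : Finset (Sym2 V)) (a : comps D → L) : #(labs (plc D a)) ≤ Fintype.card (comps D) := by
  have : labs (plc D a) ⊆ univ.image a := by
    intro t ht
    obtain ⟨x, hx, rfl⟩ := mem_image.1 ht
    obtain ⟨c, -, hc⟩ := mem_biUnion.1 hx
    obtain ⟨v, hv, rfl⟩ := mem_image.1 hc
    exact mem_image_of_mem _ (mem_univ _)
  exact (card_le_card this).trans (card_image_le.trans (by rw [card_univ]))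

theorem fam_func {κ : Type} [Fintype κ] {Ok : L → (κ → V) → Prop} {U : Finset V} {T : Finset L} {τ : L → κ → V}
    (h : Fam Ok U T τ) : Func (atoms T τ) := by
  intro v t t' h1 h2
  by_contra hne
  obtain ⟨ht, i, hi⟩ := mem_atoms.1 h1
  obtain ⟨ht', j, hj⟩ := mem_atoms.1 h2
  exact h.2.2 t ht t' ht' hne i j (hi.trans hj.symm)

theorem S_spr (k : ℕ) (G : SimpleGraph V) (Ok : (Fin k → V) → Prop) (M q : ℝ) (b : ℕ → ℕ)
    (hb : ∀ σ, Ok σ → ∀ c ⊆ univ.image σ, mis G c ≤ 2 * b (#c)) (hM : 0 < M) (hM1 : M ≤ (Fintype.card V : ℝ)^k)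
    (hq0 : 0 < q) (hq1 : q ≤ 1) (hV : 0 < Fintype.card V)
    (hnum : ∀ v, 2 ≤ v → v ≤ k → Fintype.card L * ((Fintype.card V : ℝ)^k / M) * ((k:ℝ) / Fintype.card V) ^ v ≤ q ^ b v)
    (hstep : ∀ U : Finset V, #U ≤ Fintype.card L * k → M ≤ #(univ.filter (fun σ : Fin k → V => Ok σ ∧ ∀ i, σ i ∉ U))) :
    Spr (fun S => ∃ τ : L → Fin k → V, Fam (fun _ => Ok) ∅ univ τ ∧ S = missO G (atoms univ τ)) (fun D => q ^ #D) := by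
  have hst : ∀ (A : Finset L) (t : L) (τ : L → Fin k → V), A ⊆ univ → t ∈ (univ : Finset L) → t ∉ A →
      Fam (fun _ => Ok) ∅ A τ →
      M ≤ #(univ.filter (fun σ : Fin k → V => (fun _ => Ok) t σ ∧ ∀ i, σ i ∉ usedV ∅ A τ)) := by
    intro A t τ _ _ _ _
    have h1 : #(usedV ∅ A τ) ≤ Fintype.card L * k := by
      refine (card_usedV ∅ A τ).trans ?_
      rw [card_empty, zero_add, Fintype.card_fin]
      exact Nat.mul_le_mul_right _ (card_le_univ A)
    have h2 := hstep _ h1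
    convert h2
  have h := jobsM (L := L) (κ := Fin k) (fun _ => Ok) ∅ univ M hM hV (by
    intro A t τ h1 h2 h3 h4
    convert hst A t τ h1 h2 h3 h4)
  rw [Fintype.card_fin] at h
  set x : ℝ := (Fintype.card V : ℝ)^k / M with hx
  set y : ℝ := (k:ℝ) / Fintype.card V with hy
  have hx1 : 1 ≤ x := by rw [hx, one_le_div hM]; exact hM1
  have hy0 : 0 ≤ y := by positivity
  refine (edge_cover G h ?_).mono ?_ fun D => ?_
  · rintro O ⟨τ, hτ, rfl⟩; exact fam_func hτ
  · rintro S ⟨O, ⟨τ, hτ, rfl⟩, rfl⟩; exact ⟨τ, hτ, rfl⟩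
  by_cases hD : ∃ O, (∃ τ : L → Fin k → V, Fam (fun _ => Ok) ∅ univ τ ∧ O = atoms univ τ) ∧ D ⊆ missO G O
  · rw [ifp_pos hD]
    obtain ⟨O, ⟨τ, hτ, rfl⟩, hDO⟩ := hD
    have hDe : ∀ e ∈ D, ¬ e.IsDiag ∧ e ∉ G.edgeSet := fun e he =>
      ⟨(mem_missO.1 (hDO he)).1, (mem_missO.1 (hDO he)).2.1⟩
    calc _ ≤ ∑ a : comps D → L, x ^ Fintype.card (comps D) * y ^ (∑ c : comps D, #c.1) := by
          refine sum_le_sum fun a _ => ?_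
          rw [if_pos (subset_univ _), plc_card]
          exact mul_le_mul_of_nonneg_right (pow_le_pow_right₀ hx1 (plc_labs D a)) (by positivity)
      _ = ∏ c : comps D, (Fintype.card L * x * y ^ #c.1) := by
          rw [sum_const, card_univ, Fintype.card_fun, prod_mul_distrib, prod_pow_eq_pow_sum, prod_const, card_univ, nsmul_eq_mul, mul_pow]
          push_cast; ring
      _ ≤ ∏ c : comps D, q ^ #(edin D c.1) := by
          refine prod_le_prod (fun c _ => by positivity) fun c _ => ?_
          obtain ⟨t, ht⟩ := comps_label G D _ (fam_func hτ) hDO c.2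
          have hsub : c.1 ⊆ univ.image (τ t) := by
            intro v hv
            obtain ⟨-, i, hi⟩ := mem_atoms.1 (ht v hv)
            exact mem_image.2 ⟨i, mem_univ _, hi⟩
          have hc2 := comps_card D (fun e he => (hDe e he).1) c.2
          have hm1 := edin_mis G D c.1 hDe
          have hm2 := hb _ (hτ.1 t (mem_univ _)) c.1 hsub
          have hck : #c.1 ≤ k := (card_le_card hsub).trans (card_image_le.trans (by rw [card_univ, Fintype.card_fin]))
          exact (hnum _ hc2 hck).trans (pow_le_pow_of_le_one hq0.le hq1 (by omega))
      _ = q ^ (∑ c : comps D, #(edin D c.1)) := by rw [prod_pow_eq_pow_sum]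
      _ ≤ _ := pow_le_pow_of_le_one hq0.le hq1 (card_le_sum_edin D)
  · rw [ifp_neg hD]; positivity

theorem missO_card (k : ℕ) (G : SimpleGraph V) (τ : L → Fin k → V) : #(missO G (atoms univ τ)) ≤ Fintype.card L * k^2 := by
  have : missO G (atoms univ τ) ⊆ (univ : Finset (L × (Fin k × Fin k))).image (fun x => s(τ x.1 x.2.1, τ x.1 x.2.2)) := by
    intro e he
    obtain ⟨-, -, t, ht⟩ := mem_missO.1 he
    induction e with
    | h x y =>
      obtain ⟨-, i, hi⟩ := mem_atoms.1 (ht x (Sym2.mem_mk_left _ _))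
      obtain ⟨-, j, hj⟩ := mem_atoms.1 (ht y (Sym2.mem_mk_right _ _))
      refine mem_image.2 ⟨(t, i, j), mem_univ _, ?_⟩
      simp only at hi hj
      rw [hi, hj]
  refine (card_le_card this).trans (card_image_le.trans (le_of_eq ?_))
  rw [card_univ, Fintype.card_prod, Fintype.card_prod, Fintype.card_fin]; ring

theorem S_cliques (k d ℓ : ℕ) (G : SimpleGraph V) (Ok : (Fin k → V) → Prop) (A : Finset V) (hinj : ∀ σ, Ok σ → Function.Injective σ)
    (hA : ∀ σ, Ok σ → ∀ i, σ i ∈ A) (τ : L → Fin k → V) (hτ : Fam (fun _ => Ok) ∅ univ τ) (W : Finset (Sym2 V))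
    (hW : #(missO G (atoms univ τ) \ W) ≤ ℓ) (hd : d + ℓ ≤ Fintype.card L) :
    ∃ K : Fin d → Finset V, (∀ i, K i ⊆ A) ∧ (∀ i, #(K i) = k) ∧ (∀ i j, i ≠ j → Disjoint (K i) (K j)) ∧
      ∀ i, ∀ u ∈ K i, ∀ v ∈ K i, u ≠ v → (G ⊔ SimpleGraph.fromEdgeSet (W : Set (Sym2 V))).Adj u v := by
  set O := atoms univ τ with hO
  set bad : Finset L := univ.filter (fun t => ∃ e ∈ missO G O \ W, ∀ v ∈ e, (v, t) ∈ O) with hbad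
  have hF : Func O := fam_func hτ
  have hbc : #bad ≤ ℓ := by
    refine le_trans ?_ hW
    have hch : ∀ t : bad, ∃ e, e ∈ missO G O \ W ∧ ∀ v ∈ e, (v, t.1) ∈ O := fun t => (mem_filter.1 t.2).2
    choose f hf using hch
    rw [← card_attach]
    refine card_le_card_of_injOn f (fun t _ => (hf t).1) ?_
    intro t _ t' _ hff
    have h1 := (hf t).2
    have h2 := (hf t').2
    rw [← hff] at h2
    exact Subtype.ext <| hF _ t.1 t'.1 (h1 _ (Sym2.out_fst_mem _)) (h2 _ (Sym2.out_fst_mem _))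
  obtain ⟨f⟩ : Nonempty (Fin d ↪ (badᶜ : Finset L)) := by
    apply Function.Embedding.nonempty_of_card_le
    rw [Fintype.card_fin, Fintype.card_coe]
    have := card_compl_add_card bad
    omega
  refine ⟨fun i => univ.image (τ (f i)), ?_, ?_, ?_, ?_⟩
  · intro i v hv
    obtain ⟨j, -, rfl⟩ := mem_image.1 hv
    exact hA _ (hτ.1 _ (mem_univ _)) j
  · intro i
    rw [card_image_of_injective _ (hinj _ (hτ.1 _ (mem_univ _))), card_univ, Fintype.card_fin]
  · intro i j hij
    rw [disjoint_left]
    intro v hv hv'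
    obtain ⟨a, -, rfl⟩ := mem_image.1 hv
    obtain ⟨b, -, hb⟩ := mem_image.1 hv'
    refine hτ.2.2 _ (mem_univ (f i : L)) _ (mem_univ (f j : L)) (fun h => hij (f.injective (Subtype.ext h))) a b hb.symm
  · intro i u hu v hv huv
    rw [SimpleGraph.sup_adj]
    by_cases h : G.Adj u v
    · exact Or.inl h
    right
    rw [SimpleGraph.fromEdgeSet_adj]
    refine ⟨?_, huv⟩
    by_contra hc
    have hmem : ∀ z ∈ s(u, v), (z, (f i : L)) ∈ O := by
      have key : ∀ z ∈ univ.image (τ (f i)), (z, (f i : L)) ∈ O := by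
        intro z hz
        obtain ⟨j, -, rfl⟩ := mem_image.1 hz
        exact mem_atoms.2 ⟨mem_univ _, j, rfl⟩
      intro z hz
      rcases Sym2.mem_iff.1 hz with rfl | rfl
      · exact key _ hu
      · exact key _ hv
    refine mem_compl.1 (f i).2 (mem_filter.2 ⟨mem_univ _, s(u, v), mem_sdiff.2 ⟨mem_missO.2 ⟨?_, h, _, hmem⟩, hc⟩, hmem⟩)
    exact fun h => huv (Sym2.mk_isDiag_iff.1 h)

end Cliques


section Tuples
variable {V : Type} [Fintype V] [DecidableEq V]

/-- tuples in `X` with first two entries adjacent -/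
def OkT (G : SimpleGraph V) (X : Finset V) (m : ℕ) (σ : Fin (m+2) → V) : Prop :=
  Function.Injective σ ∧ (∀ i, σ i ∈ X) ∧ G.Adj (σ 0) (σ 1)

theorem tuple_ext (G : SimpleGraph V) (X : Finset V) (m : ℕ) :
    eG G X X * (#X - (m+1))^m ≤ #(univ.filter (fun σ : Fin (m+2) → V => OkT G X m σ)) := by
  induction m with
  | zero =>
    rw [pow_zero, mul_one]
    unfold eG
    refine card_le_card_of_injOn (fun p => ![p.1, p.2]) ?_ ?_
    · intro p hp
      simp only [coe_filter, mem_product, Set.mem_setOf_eq] at hp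
      simp only [coe_filter, mem_univ, true_and, Set.mem_setOf_eq]
      refine ⟨?_, ?_, ?_⟩
      · intro i j hij
        have := hp.2.ne
        fin_cases i <;> fin_cases j <;> simp_all
      · intro i; fin_cases i <;> simp [hp]
      · simpa using hp.2
    · intro p _ p' _ h
      have h0 := congrFun h 0
      have h1 := congrFun h 1
      simp at h0 h1
      exact Prod.ext h0 h1
  | succ m ih =>
    have h1 : eG G X X * (#X - (m+1+1))^(m+1) ≤
        #(univ.filter (fun σ : Fin (m+2) → V => OkT G X m σ)) * (#X - (m+2)) := by
      rw [pow_succ, ← mul_assoc]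
      refine Nat.mul_le_mul_right _ (le_trans ?_ ih)
      exact Nat.mul_le_mul_left _ (Nat.pow_le_pow_left (by omega) _)
    refine h1.trans ?_
    have h2 : #(univ.filter (fun σ : Fin (m+2) → V => OkT G X m σ)) * (#X - (m+2)) ≤
        #((univ.filter (fun σ : Fin (m+2) → V => OkT G X m σ)).sigma (fun σ => X \ univ.image σ)) := by
      rw [card_sigma, ← smul_eq_mul]
      apply card_nsmul_le_sum
      intro σ hσ
      have h3 := le_card_sdiff (univ.image σ) X
      have h4 : #(univ.image σ) ≤ m+2 := card_image_le.trans (by simp)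
      omega
    refine h2.trans ?_
    refine card_le_card_of_injOn (fun p => Fin.snoc (α := fun _ => V) p.1 p.2) ?_ ?_
    · rintro ⟨σ, x⟩ hp
      simp only [mem_coe, mem_sigma, mem_filter, mem_univ, true_and, mem_sdiff, mem_image, not_exists] at hp
      obtain ⟨⟨ha, hb, hc⟩, hx, hxn⟩ := hp
      simp only [coe_filter, mem_univ, true_and, Set.mem_setOf_eq]
      refine ⟨?_, ?_, ?_⟩
      · rw [Fin.snoc_injective_iff]
        exact ⟨ha, fun ⟨i, hi⟩ => hxn i hi⟩
      · intro i
        induction i using Fin.lastCases with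
        | last => rw [Fin.snoc_last]; exact hx
        | cast i => rw [Fin.snoc_castSucc]; exact hb i
      · have e0 : (0 : Fin (m+1+2)) = Fin.castSucc (0 : Fin (m+2)) := rfl
        have e1 : (1 : Fin (m+1+2)) = Fin.castSucc (1 : Fin (m+2)) := rfl
        rw [e0, e1, Fin.snoc_castSucc, Fin.snoc_castSucc]; exact hc
    · rintro ⟨σ, x⟩ _ ⟨σ', x'⟩ _ h
      have := Fin.snoc_injective2 (α := fun _ => V) h
      obtain ⟨rfl, rfl⟩ := this
      rfl

theorem mis_le (G : SimpleGraph V) (c : Finset V) : mis G c ≤ 2 * (#c).choose 2 := by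
  have h : mis G c ≤ #c.offDiag := by
    unfold mis
    apply card_le_card
    intro p hp
    simp only [mem_filter, mem_product] at hp
    rw [mem_offDiag]; exact ⟨hp.1.1, hp.1.2, hp.2.1⟩
  rw [offDiag_card] at h
  have h2 := Nat.triangle_succ (#c)
  rw [Nat.choose_two_right, Nat.mul_div_cancel' (Nat.even_mul_pred_self _).two_dvd]
  rw [Nat.mul_sub, mul_one]; exact h

theorem mis_le_edge (G : SimpleGraph V) (c : Finset V) (x y : V) (hx : x ∈ c) (hy : y ∈ c) (h : G.Adj x y) :
    mis G c ≤ 2 * ((#c).choose 2 - 1) := by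
  have h1 : mis G c ≤ #(c.offDiag \ {(x,y),(y,x)}) := by
    unfold mis
    apply card_le_card
    intro p hp
    simp only [mem_filter, mem_product] at hp
    simp only [mem_sdiff, mem_offDiag, mem_insert, mem_singleton, not_or]
    refine ⟨⟨hp.1.1, hp.1.2, hp.2.1⟩, ?_, ?_⟩
    · rintro rfl; exact hp.2.2 h
    · rintro rfl; exact hp.2.2 h.symm
  have hsub : ({(x,y),(y,x)} : Finset (V × V)) ⊆ c.offDiag := by
    intro p hp
    simp only [mem_insert, mem_singleton] at hp
    rcases hp with rfl | rfl
    · exact mem_offDiag.2 ⟨hx, hy, h.ne⟩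
    · exact mem_offDiag.2 ⟨hy, hx, h.ne'⟩
  have hc2 : #({(x,y),(y,x)} : Finset (V × V)) = 2 := by
    rw [card_pair]; intro e; exact h.ne (Prod.mk.inj e).1
  rw [card_sdiff_of_subset hsub, hc2, offDiag_card] at h1
  have h3 : 2 * (#c).choose 2 = #c * #c - #c := by
    rw [Nat.choose_two_right, Nat.mul_div_cancel' (Nat.even_mul_pred_self _).two_dvd, Nat.mul_sub, mul_one]
  omega

/-- spreadness of the missing edges of a random family of tuples -/
theorem T_spr {L : Type} [Fintype L] [DecidableEq L] (m : ℕ) (G G' : SimpleGraph V) (A : Finset V) (q e n : ℝ) (b : ℕ → ℕ)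
    (hn : n = Fintype.card V) (hn0 : 0 < n)
    (hb : ∀ σ, OkT G' A m σ → ∀ c ⊆ univ.image σ, mis G c ≤ 2 * b (#c)) (he : 0 < e) (hq0 : 0 < q) (hq1 : q ≤ 1)
    (hnum : ∀ v, 2 ≤ v → v ≤ m+2 → Fintype.card L * (n^2 * 6^m / e) * (((m+2 : ℕ):ℝ) / n) ^ v ≤ q ^ b v)
    (hX : ∀ U : Finset V, #U ≤ Fintype.card L * (m+2) → n/6 ≤ ((#(A \ U) - (m+1) : ℕ) : ℝ))
    (hE : ∀ U : Finset V, #U ≤ Fintype.card L * (m+2) → e ≤ eG G' (A \ U) (A \ U)) :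
    Spr (fun S => ∃ τ : L → Fin (m+2) → V, Fam (fun _ => OkT G' A m) ∅ univ τ ∧ S = missO G (atoms univ τ)) (fun D => q ^ #D) := by
  have hM : 0 < e * (n/6)^m := by positivity
  have hen : e ≤ n^2 := by
    refine (hE ∅ (by simp)).trans ?_
    have h1 := eG_le G' (A \ ∅) (A \ ∅)
    have h2 : #(A \ ∅) ≤ Fintype.card V := card_le_univ _
    have h3 := h1.trans (Nat.mul_le_mul h2 h2)
    have h4 : ((eG G' (A \ ∅) (A \ ∅) : ℕ):ℝ) ≤ ((Fintype.card V * Fintype.card V : ℕ):ℝ) := by exact_mod_cast h3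
    rw [hn, sq]; push_cast at h4; exact h4
  refine S_spr (m+2) G (OkT G' A m) (e * (n/6)^m) q b hb hM ?_ hq0 hq1 ?_ ?_ ?_
  · rw [← hn, pow_add, mul_comm]
    refine mul_le_mul ?_ hen he.le (by positivity)
    exact pow_le_pow_left₀ (by positivity) (by linarith) _
  · have : (0:ℝ) < Fintype.card V := by rw [← hn]; exact hn0
    exact_mod_cast this
  · intro v h1 h2
    rw [← hn]
    have := hnum v h1 h2
    have e1 : n^(m+2) / (e * (n/6)^m) = n^2 * 6^m / e := by
      rw [div_pow]; field_simp; ring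
    rw [e1]; exact this
  · intro U hU
    have h1 := tuple_ext G' (A \ U) m
    have h2 : ((eG G' (A \ U) (A \ U) * (#(A \ U) - (m+1))^m : ℕ) : ℝ) ≤ (#(univ.filter (fun σ : Fin (m+2) → V => OkT G' (A \ U) m σ)) : ℝ) := by
      exact_mod_cast h1
    rw [Nat.cast_mul, Nat.cast_pow] at h2
    refine (mul_le_mul (hE U hU) (pow_le_pow_left₀ (by positivity) (hX U hU) m) (by positivity) (by positivity)).trans (h2.trans ?_)
    norm_cast
    apply card_le_card
    intro σ hσ
    simp only [mem_filter, mem_univ, true_and] at hσ ⊢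
    obtain ⟨ha, hb', hc⟩ := hσ
    exact ⟨⟨ha, fun i => (mem_sdiff.1 (hb' i)).1, hc⟩, fun i => (mem_sdiff.1 (hb' i)).2⟩

end Tuples

/-- the exponent -/
noncomputable def phi (s : ℕ) : ℝ := 2 * (s:ℝ) / (((s:ℝ) - 1) * ((s:ℝ) + 2))

theorem phi_pos (m : ℕ) (hm : 1 ≤ m) : 0 < phi (m+1) := by
  unfold phi; push_cast
  have : (1:ℝ) ≤ m := by exact_mod_cast hm
  have h1 : (0:ℝ) < (m:ℝ) + 1 - 1 := by linarith
  positivity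

theorem choose2_real (v : ℕ) : ((v.choose 2 : ℕ) : ℝ) = v * (v - 1) / 2 := Nat.cast_choose_two ℝ v

theorem phi_small (m : ℕ) (hm : 1 ≤ m) (v : ℕ) (h2 : 2 ≤ v) (hv : v ≤ m+1) :
    phi (m+1) * (v.choose 2 : ℕ) ≤ v - 1 := by
  rw [choose2_real]
  unfold phi; push_cast
  have hm' : (1:ℝ) ≤ m := by exact_mod_cast hm
  have hv' : (v:ℝ) ≤ m + 1 := by exact_mod_cast hv
  have h2' : (2:ℝ) ≤ v := by exact_mod_cast h2
  have h1 : (0:ℝ) < (m:ℝ) + 1 - 1 := by linarith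
  rw [div_mul_eq_mul_div, div_le_iff₀ (by positivity)]
  have : (m+1:ℝ) * v ≤ (m + 1 - 1) * (m+1+2) := by nlinarith
  nlinarith

theorem phi_top (m : ℕ) (hm : 1 ≤ m) : phi (m+1) * (((m+2).choose 2 : ℕ) - 1 : ℝ) = m + 1 := by
  rw [choose2_real]
  unfold phi; push_cast
  have hm' : (1:ℝ) ≤ m := by exact_mod_cast hm
  have h1 : (0:ℝ) < (m:ℝ) + 1 - 1 := by linarith
  field_simp
  ring

theorem num_core (C2 n φ κ x : ℝ) (b v : ℕ) (hn : 1 ≤ n) (hC : 1 ≤ C2) (hb : 1 ≤ b) (hx : κ ≤ C2)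
    (hxv : φ * b ≤ x) : κ * n ^ (-x) ≤ (C2 * n ^ (-φ)) ^ b := by
  have hn0 : 0 < n := by linarith
  rw [mul_pow, ← Real.rpow_natCast (n ^ (-φ)) b, ← Real.rpow_mul hn0.le]
  refine mul_le_mul (hx.trans (le_self_pow₀ hC (by omega))) (Real.rpow_le_rpow_of_exponent_le hn (by linarith)) (by positivity) (by positivity)


noncomputable def C2 (m : ℕ) : ℝ := 4 * 6^(m+2) * ((m+2 : ℕ):ℝ)^(m+2)

theorem C2_ge (m : ℕ) : 1 ≤ C2 m := by
  unfold C2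
  have h1 : (1:ℝ) ≤ 6^(m+2) := one_le_pow₀ (by norm_num)
  have h2 : (1:ℝ) ≤ ((m+2 : ℕ):ℝ)^(m+2) := one_le_pow₀ (by push_cast; have : (0:ℝ) ≤ m := Nat.cast_nonneg m; linarith)
  nlinarith

theorem num_mode (m : ℕ) (J n a κ y φ : ℝ) (b v : ℕ) (hn : 1 ≤ n) (hJ : J * y ≤ κ * n ^ a) (hκ0 : 0 ≤ κ) (hv : v ≤ m+2)
    (hκ : κ * ((m+2 : ℕ):ℝ)^(m+2) ≤ C2 m) (hb : 1 ≤ b) (h : φ * b ≤ v - a) :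
    J * y * (((m+2 : ℕ):ℝ) / n) ^ v ≤ (C2 m * n ^ (-φ)) ^ b := by
  have hn0 : 0 < n := by linarith
  have hm1 : (1:ℝ) ≤ ((m+2 : ℕ):ℝ) := by push_cast; have : (0:ℝ) ≤ m := Nat.cast_nonneg m; linarith
  calc _ ≤ κ * n ^ a * (((m+2 : ℕ):ℝ) / n) ^ v := mul_le_mul_of_nonneg_right hJ (by positivity)
    _ = (κ * ((m+2 : ℕ):ℝ)^v) * n ^ (-(v - a)) := by
        rw [neg_sub, Real.rpow_sub_natCast hn0.ne', div_pow]; ring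
    _ ≤ _ := num_core (C2 m) n φ _ _ b v hn (C2_ge m) hb (le_trans (mul_le_mul_of_nonneg_left (pow_le_pow_right₀ hm1 hv) hκ0) hκ) h

section Modes
variable {V L : Type} [Fintype V] [DecidableEq V] [Fintype L] [DecidableEq L]

theorem hX_aux (m : ℕ) (A : Finset V) (n : ℝ) (J : ℕ) (hA : n/3 ≤ #A) (hJ : (J:ℝ) * (m+2) * 12 ≤ n) (hm : ((m:ℝ)+1) * 12 ≤ n)
    (U : Finset V) (hU : #U ≤ J * (m+2)) : n/6 ≤ ((#(A \ U) - (m+1) : ℕ) : ℝ) := by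
  have h1 := le_card_sdiff U A
  have h2 : #A ≤ (#(A \ U) - (m+1)) + (J * (m+2) + (m+1)) := by omega
  have h3 : (#A:ℝ) ≤ ((#(A \ U) - (m+1) : ℕ):ℝ) + (J * (m+2) + (m+1)) := by exact_mod_cast h2
  linarith

theorem edge_spr (m : ℕ) (hm : 1 ≤ m) (G : SimpleGraph V) (A : Finset V) (n g : ℝ) (d : ℕ)
    (hn : n = Fintype.card V) (hn1 : 1 ≤ n) (hA : n/3 ≤ #A) (hd : 1 ≤ d) (hdn : (d:ℝ) * (m+2) * 24 ≤ n) (hmn : ((m:ℝ)+1) * 12 ≤ n)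
    (hg : 48 * (m+2) * g ≤ 1) (hdeg : ∀ v ∈ A, d ≤ dg G A v ∧ (dg G A v : ℝ) ≤ 2 * g * n)
    (hJ : Fintype.card L ≤ 2 * d) (hq : C2 m * n ^ (-phi (m+1)) ≤ 1) :
    Spr (fun S => ∃ τ : L → Fin (m+2) → V, Fam (fun _ => OkT G A m) ∅ univ τ ∧ S = missO G (atoms univ τ))
      (fun D => (C2 m * n ^ (-phi (m+1))) ^ #D) := by
  have hn0 : 0 < n := by linarith
  have hd0 : (1:ℝ) ≤ d := by exact_mod_cast hd
  have hJr : (Fintype.card L : ℝ) ≤ 2 * d := by exact_mod_cast hJ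
  have hm0 : (0:ℝ) ≤ m := Nat.cast_nonneg m
  have hC := C2_ge m
  refine T_spr m G G A _ (d * n / 6) n (fun v => if v ≤ m+1 then v.choose 2 else v.choose 2 - 1) hn hn0 ?_ (by positivity)
    (by positivity) hq ?_ ?_ ?_
  · rintro σ ⟨hinj, -, hadj⟩ c hc
    split_ifs with h
    · exact mis_le G c
    · have hci : #(univ.image σ) = m+2 := by rw [card_image_of_injective _ hinj, card_univ, Fintype.card_fin]
      have : c = univ.image σ := eq_of_subset_of_card_le hc (by omega)
      exact mis_le_edge G c (σ 0) (σ 1) (by rw [this]; exact mem_image_of_mem _ (mem_univ _)) (by rw [this]; exact mem_image_of_mem _ (mem_univ _)) hadj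
  · intro v h2 hv
    have hcv : v ≤ v.choose 2 + 1 := by
      rcases v with _ | _ | v
      · omega
      · omega
      · rw [Nat.choose_two_right]
        have : (v+1+1) * (v+1+1-1) = (v+1) * v + 2 * (v+1) := by simp; ring
        rw [this]; omega
    apply num_mode m _ n 1 (2 * 6^(m+1)) _ _ _ v hn1 _ (by positivity) hv
    · unfold C2
      rw [show (4:ℝ) * 6^(m+2) = 12 * (2 * 6^(m+1)) by ring]
      have : (0:ℝ) ≤ 2 * 6^(m+1) * ((m+2 : ℕ):ℝ)^(m+2) := by positivity
      linarith
    · split_ifs with h <;> omega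
    · split_ifs with h
      · exact phi_small m hm v h2 h
      · have hv' : v = m+2 := by omega
        subst hv'
        rw [Nat.cast_sub (by omega), Nat.cast_one, phi_top m hm]; push_cast; linarith
    · rw [Real.rpow_one]
      have : n^2 * 6^m / (d * n / 6) = 6^(m+1) * n / d := by field_simp; ring
      rw [this]
      calc _ ≤ (2 * d : ℝ) * (6^(m+1) * n / d) := mul_le_mul_of_nonneg_right hJr (by positivity)
        _ = _ := by field_simp
  · intro U hU
    refine hX_aux m A n (Fintype.card L) hA ?_ hmn U hU
    nlinarith
  · intro U hU
    have h1 : eG G A A ≤ eG G (A \ U) (A \ U) + 2 * eG G (A ∩ U) A := by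
      have : eG G A A ≤ eG G (A \ U) (A \ U) + (eG G (A ∩ U) A + eG G A (A ∩ U)) := by
        unfold eG
        refine le_trans (card_le_card ?_) ((card_union_le _ _).trans (Nat.add_le_add_left (card_union_le _ _) _))
        intro p
        simp only [mem_filter, mem_product, mem_union, mem_sdiff, mem_inter]
        tauto
      rw [eG_comm G A (A ∩ U)] at this
      omega
    have h2 : (eG G (A ∩ U) A : ℝ) ≤ #U * (2 * g * n) := by
      rw [eG_eq_sum, Nat.cast_sum]
      have h0 : (0:ℝ) ≤ 2 * g * n := by
        obtain ⟨v, hv⟩ : A.Nonempty := by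
          rw [← card_pos]; have : (0:ℝ) < #A := by linarith
          exact_mod_cast this
        have := (hdeg v hv).2
        exact le_trans (Nat.cast_nonneg _) this
      refine (sum_le_card_nsmul _ _ (2 * g * n) fun v hv => (hdeg v (mem_inter.1 hv).1).2).trans ?_
      rw [nsmul_eq_mul]
      refine mul_le_mul_of_nonneg_right ?_ h0
      exact_mod_cast card_le_card inter_subset_right
    have h3 : (d:ℝ) * #A ≤ eG G A A := by
      rw [eG_eq_sum]
      have : #A • d ≤ ∑ x ∈ A, dg G A x := card_nsmul_le_sum _ _ _ fun v hv => (hdeg v hv).1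
      rw [smul_eq_mul, mul_comm] at this
      exact_mod_cast this
    have h4 : (eG G A A : ℝ) ≤ eG G (A \ U) (A \ U) + 2 * eG G (A ∩ U) A := by exact_mod_cast h1
    have h5 : (#U : ℝ) ≤ 2 * d * (m+2) := by
      have : (#U:ℝ) ≤ Fintype.card L * (m+2) := by exact_mod_cast hU
      nlinarith
    have h0 : (0:ℝ) ≤ g := by
      by_contra hneg
      push Not at hneg
      obtain ⟨v, hv⟩ : A.Nonempty := by
        rw [← card_pos]; have : (0:ℝ) < #A := by linarith
        exact_mod_cast this
      have := (hdeg v hv).2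
      have h6 : (0:ℝ) ≤ dg G A v := Nat.cast_nonneg _
      nlinarith
    have h6 : (#U:ℝ) * (2 * g * n) ≤ d * n / 12 := by
      calc (#U:ℝ) * (2 * g * n) ≤ 2 * d * (m+2) * (2 * g * n) := mul_le_mul_of_nonneg_right h5 (by positivity)
        _ = (d * n / 12) * (48 * (m+2) * g) := by ring
        _ ≤ (d * n / 12) * 1 := mul_le_mul_of_nonneg_left hg (by positivity)
        _ = _ := by ring
    have h7 : (d:ℝ) * (n/3) ≤ d * #A := mul_le_mul_of_nonneg_left hA (by positivity)
    linarith

theorem pure_spr (m : ℕ) (hm : 1 ≤ m) (G : SimpleGraph V) (A : Finset V) (n : ℝ)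
    (hn : n = Fintype.card V) (hn1 : 1 ≤ n) (hA : n/3 ≤ #A) (hJn : (Fintype.card L:ℝ) * (m+2) * 12 ≤ n) (hmn : ((m:ℝ)+1) * 12 ≤ n)
    (hJ : (Fintype.card L:ℝ) ≤ 4 * n ^ (1 - phi (m+1))) (hq : C2 m * n ^ (-phi (m+1)) ≤ 1) :
    Spr (fun S => ∃ τ : L → Fin (m+2) → V, Fam (fun _ => OkT ⊤ A m) ∅ univ τ ∧ S = missO G (atoms univ τ))
      (fun D => (C2 m * n ^ (-phi (m+1))) ^ #D) := by
  have hn0 : 0 < n := by linarith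
  have hm0 : (0:ℝ) ≤ m := Nat.cast_nonneg m
  have hC := C2_ge m
  refine T_spr m G ⊤ A _ ((n/6)^2) n (fun v => v.choose 2) hn hn0 ?_ (by positivity)
    (by positivity) hq ?_ ?_ ?_
  · exact fun σ _ c _ => mis_le G c
  · intro v h2 hv
    apply num_mode m _ n (1 - phi (m+1)) (4 * 6^(m+2)) _ _ _ v hn1 _ (by positivity) hv
    · exact le_refl _
    · exact Nat.choose_pos h2
    · have hp := phi_pos m hm
      rcases Nat.lt_or_ge v (m+2) with h | h
      · have := phi_small m hm v h2 (by omega)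
        linarith
      · have hv' : v = m+2 := by omega
        subst hv'
        have := phi_top m hm
        push_cast at this ⊢
        linarith
    · have : n^2 * 6^m / ((n/6)^2) = 6^(m+2) := by field_simp; ring
      rw [this]
      calc _ ≤ (4 * n ^ (1 - phi (m+1))) * 6^(m+2) := mul_le_mul_of_nonneg_right hJ (by positivity)
        _ = _ := by ring
  · exact fun U hU => hX_aux m A n (Fintype.card L) hA hJn hmn U hU
  · intro U hU
    have h1 := hX_aux m A n (Fintype.card L) hA hJn hmn U hU
    set X := A \ U
    have h2 : eG (⊤ : SimpleGraph V) X X = #X.offDiag := by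
      unfold eG
      congr 1
      ext p
      simp only [mem_filter, mem_product, mem_offDiag, SimpleGraph.top_adj]
      tauto
    have h3 : (#X - (m+1)) * (#X - (m+1)) ≤ #X.offDiag := by
      rw [offDiag_card, ← Nat.mul_pred, Nat.pred_eq_sub_one]
      exact Nat.mul_le_mul (by omega) (by omega)
    rw [h2, sq]
    refine (mul_le_mul h1 h1 (by positivity) (by positivity)).trans ?_
    exact_mod_cast h3
end Modes


/-- there are `d` disjoint `k`-cliques inside `A` -/
def HasCl {n : ℕ} (G : SimpleGraph (Fin n)) (A : Finset (Fin n)) (k d : ℕ) : Prop :=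
  ∃ K : Fin d → Finset (Fin n), (∀ i, K i ⊆ A) ∧ (∀ i, #(K i) = k) ∧ (∀ i j, i ≠ j → Disjoint (K i) (K j)) ∧
      ∀ i, ∀ u ∈ K i, ∀ v ∈ K i, u ≠ v → G.Adj u v

theorem S_fin {n J : ℕ} (m : ℕ) (G G' : SimpleGraph (Fin n)) (A : Finset (Fin n)) (q : ℝ)
    (h : Spr (fun S => ∃ τ : Fin J → Fin (m+2) → Fin n, Fam (fun _ => OkT G' A m) ∅ univ τ ∧ S = missO G (atoms univ τ))
      (fun D => q ^ #D)) :
    ∃ μ : Finset (Sym2 (Fin n)) → ℝ, SubSpread (EE n) q (J * (m+2)^2) μ ∧ ∑ S ∈ (EE n).powerset, μ S = 1 ∧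
      ∀ d ℓ, d + ℓ ≤ J → ∀ W, (∃ S, μ S ≠ 0 ∧ #(S \ W) ≤ ℓ) → HasCl (G ⊔ SimpleGraph.fromEdgeSet (W : Set (Sym2 (Fin n)))) A (m+2) d := by
  obtain ⟨μ, h1, h2, h3⟩ := h.toSubSpread (EE n) (ℓ := J * (m+2)^2) (by
    rintro O ⟨τ, -, rfl⟩
    refine ⟨fun e he => ?_, ?_⟩
    · unfold EE; exact mem_filter.2 ⟨mem_univ _, (mem_missO.1 he).1⟩
    · have := missO_card (m+2) G τ
      rwa [Fintype.card_fin] at this)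
  refine ⟨μ, h1, h2, ?_⟩
  rintro d ℓ hd W ⟨S, hS, hSW⟩
  obtain ⟨τ, hτ, rfl⟩ := h3 S hS
  refine S_cliques (m+2) d ℓ G (OkT G' A m) A (fun σ h => h.1) (fun σ h => h.2.1) τ hτ W ?_ (by rwa [Fintype.card_fin])
  convert hSW

theorem ev_phi (m : ℕ) (hm : 1 ≤ m) : ∀ᶠ n : ℕ in Filter.atTop, C2 m * (n:ℝ) ^ (-phi (m+1)) ≤ 1 ∧ ((m:ℝ)+1) * 12 ≤ n ∧ (1:ℝ) ≤ n := by
  have h1 : Filter.Tendsto (fun n : ℕ => C2 m * (n:ℝ) ^ (-phi (m+1))) Filter.atTop (nhds 0) := by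
    have := ((tendsto_rpow_neg_atTop (phi_pos m hm)).comp (tendsto_natCast_atTop_atTop (R := ℝ))).const_mul (C2 m)
    simpa using this
  have h2 : Filter.Tendsto (fun n : ℕ => (n:ℝ)) Filter.atTop Filter.atTop := tendsto_natCast_atTop_atTop
  filter_upwards [h1.eventually_le_const (by norm_num : (0:ℝ) < 1), h2.eventually_ge_atTop (((m:ℝ)+1) * 12), h2.eventually_ge_atTop 1] with n a b c
  exact ⟨a, b, c⟩

theorem lemS2 {δ : ℝ} (hδ : 0 < δ) : ∃ n₀ : ℕ, ∀ n : ℕ, n₀ ≤ n → ∀ (G : SimpleGraph (Fin n)) (A : Finset (Fin n)) (g p : ℝ) (d : ℕ),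
    (n:ℝ)/3 ≤ #A → 1 ≤ d → (d:ℝ) * 72 ≤ n → 144 * g ≤ 1 →
    (∀ v ∈ A, d ≤ dg G A v ∧ (dg G A v : ℝ) ≤ 2 * g * n) → 100 * (C2 1 * (n:ℝ)^(-phi 2) * Real.log n) ≤ p → p ≤ 1 →
    1 - δ ≤ PB (EE n) p (fun W => HasCl (G ⊔ SimpleGraph.fromEdgeSet (W : Set (Sym2 (Fin n)))) A 3 d) := by
  obtain ⟨n₁, h₁⟩ := spread_threshold hδ
  obtain ⟨n₂, h₂⟩ := Filter.eventually_atTop.1 (ev_phi 1 le_rfl)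
  refine ⟨max n₁ n₂, fun n hn G A g p d hA hd hdn hg hdeg hp hp1 => ?_⟩
  obtain ⟨hq, hmn, hn1⟩ := h₂ n (le_trans (le_max_right _ _) hn)
  have hsp := edge_spr (L := Fin d) 1 le_rfl G A n g d (by simp) hn1 hA hd (by push_cast; linarith) hmn (by push_cast; linarith) hdeg
    (by simp; omega) hq
  obtain ⟨μ, hμ, hs, hc⟩ := S_fin 1 G G A _ hsp
  have hq0 : 0 < C2 1 * (n:ℝ) ^ (-phi (1+1)) := by have := C2_ge 1; have : (0:ℝ) < n := by linarith
                                                   positivity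
  have hdn' : d * (1+2)^2 ≤ n^2 := by
    have : d * 72 ≤ n := by exact_mod_cast hdn
    nlinarith
  have h := h₁ n (le_trans (le_max_left _ _) hn) (EE n) _ p μ hq0 (hμ.mono hdn') hs hp hp1
  have hp0 : 0 ≤ p := le_trans (by have := Real.log_nonneg hn1; positivity) hp
  refine h.trans (PB_mono hp0 hp1 fun W _ => ?_)
  rintro ⟨S, hS, hSW⟩
  exact hc d 0 (by omega) W ⟨S, hS, by rw [sdiff_eq_empty_iff_subset.2 hSW]; simp⟩

theorem lemS3 (m : ℕ) (hm : 2 ≤ m) {δ : ℝ} (hδ : 0 < δ) : ∃ n₀ : ℕ, ∀ n : ℕ, n₀ ≤ n → ∀ (G : SimpleGraph (Fin n)) (A : Finset (Fin n)) (g p : ℝ) (d : ℕ),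
    (n:ℝ)/3 ≤ #A → 1 ≤ d → (d:ℝ) * (m+2) * 24 ≤ n → 48 * (m+2) * g ≤ 1 →
    (∀ v ∈ A, d ≤ dg G A v ∧ (dg G A v : ℝ) ≤ 2 * g * n) →
    16 * ((2 * (m+2) + 1 : ℕ):ℝ) * (C2 m * (n:ℝ)^(-phi (m+1))) ≤ p → p ≤ 1 →
    1 - δ ≤ PB (EE n) p (fun W => HasCl (G ⊔ SimpleGraph.fromEdgeSet (W : Set (Sym2 (Fin n)))) A (m+2) d) := by
  have hφ1 : 0 < 1 - phi (m+1) := by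
    have hm' : (2:ℝ) ≤ m := by exact_mod_cast hm
    unfold phi; push_cast
    have h1 : (0:ℝ) < (m:ℝ) + 1 - 1 := by linarith
    rw [sub_pos, div_lt_one (by positivity)]
    nlinarith
  have hm1 : 1 ≤ m := by omega
  set i := 2 * (m+2) + 1 with hi
  have ht : Filter.Tendsto (fun D : ℕ => (i:ℝ) * (1/2)^D) Filter.atTop (nhds 0) := by
    have := (tendsto_pow_atTop_nhds_zero_of_lt_one (by norm_num : (0:ℝ) ≤ 1/2) (by norm_num)).const_mul (i:ℝ)
    simpa using this
  obtain ⟨N0, hN0⟩ := Filter.eventually_atTop.1 (ht.eventually_le_const hδ)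
  have h3 : ∀ᶠ n : ℕ in Filter.atTop, ((N0+1 : ℕ):ℝ) ≤ (n:ℝ) ^ (1 - phi (m+1)) :=
    ((tendsto_rpow_atTop hφ1).comp tendsto_natCast_atTop_atTop).eventually_ge_atTop _
  obtain ⟨n₂, h₂⟩ := Filter.eventually_atTop.1 ((ev_phi m hm1).and h3)
  refine ⟨n₂, fun n hn G A g p d hA hd hdn hg hdeg hp hp1 => ?_⟩
  obtain ⟨⟨hq, hmn, hn1⟩, hN⟩ := h₂ n hn
  have hn0 : (0:ℝ) < n := by linarith
  have hq0 : 0 < C2 m * (n:ℝ) ^ (-phi (m+1)) := by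
    have := C2_ge m
    positivity
  have hp0 : 0 ≤ p := le_trans (by positivity) hp
  have h2i : 2 * (m+2)^2 ≤ 2^i := by
    have h1 : m+2 ≤ 2^(m+2) := Nat.lt_two_pow_self.le
    have h2 : 2^i = 2 * (2^(m+2))^2 := by rw [hi]; ring
    rw [h2]
    exact Nat.mul_le_mul_left _ (Nat.pow_le_pow_left h1 2)
  -- reduce to spreads
  suffices hmain : ∃ (D : ℕ) (G' : SimpleGraph (Fin n)), d ≤ D ∧ (n:ℝ) ^ (1 - phi (m+1)) ≤ D ∧
      Spr (fun S => ∃ τ : Fin (2*D) → Fin (m+2) → Fin n, Fam (fun _ => OkT G' A m) ∅ univ τ ∧ S = missO G (atoms univ τ))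
      (fun D => (C2 m * (n:ℝ) ^ (-phi (m+1))) ^ #D) by
    obtain ⟨D, G', hdD, hD, hsp⟩ := hmain
    obtain ⟨μ, hμ, hs, hc⟩ := S_fin m G G' A _ hsp
    have hl : 2 * D * (m+2)^2 ≤ 2^i * D := by
      calc 2 * D * (m+2)^2 = 2 * (m+2)^2 * D := by ring
        _ ≤ _ := Nat.mul_le_mul_right _ h2i
    have h := spread_iter (L := D) (i := i) hq0 (hμ.mono hl) hs hp hp1
    have hDN : N0 ≤ D := by
      have : ((N0+1:ℕ):ℝ) ≤ D := hN.trans hD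
      have : N0 + 1 ≤ D := by exact_mod_cast this
      omega
    have herr := hN0 D hDN
    refine le_trans (by linarith) (h.trans (PB_mono hp0 hp1 fun W _ hW => hc d D (by omega) W hW))
  by_cases hcase : (n:ℝ) ^ (1 - phi (m+1)) ≤ d
  · exact ⟨d, G, le_rfl, hcase, edge_spr (L := Fin (2*d)) m hm1 G A n g d (by simp) hn1 hA hd hdn hmn hg hdeg (by simp) hq⟩
  · push Not at hcase
    have h1 : (1:ℝ) ≤ (n:ℝ) ^ (1 - phi (m+1)) := le_trans (by push_cast; have : (0:ℝ) ≤ N0 := Nat.cast_nonneg _; linarith) hN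
    have hc1 := Nat.le_ceil ((n:ℝ) ^ (1 - phi (m+1)))
    have hc2 := (Nat.ceil_lt_add_one (by positivity : 0 ≤ (n:ℝ) ^ (1 - phi (m+1)))).le
    refine ⟨⌈(n:ℝ) ^ (1 - phi (m+1))⌉₊, ⊤, ?_, hc1, pure_spr m hm1 G A n (by simp) hn1 hA ?_ hmn ?_ hq⟩
    · have : (d:ℝ) ≤ (⌈(n:ℝ) ^ (1 - phi (m+1))⌉₊ : ℝ) := hcase.le.trans hc1
      exact_mod_cast this
    · rw [Fintype.card_fin]
      push_cast
      have hm0 : (0:ℝ) ≤ m := Nat.cast_nonneg m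
      have hC : 48 * ((m:ℝ)+2) ≤ C2 m := by
        unfold C2
        have h6 : (12:ℝ) ≤ 6^(m+2) := by
          calc (12:ℝ) ≤ 6^2 := by norm_num
            _ ≤ 6^(m+2) := pow_le_pow_right₀ (by norm_num) (by omega)
        have h7 : ((m:ℝ)+2) ≤ ((m+2:ℕ):ℝ)^(m+2) := by
          have : (1:ℝ) ≤ ((m+2:ℕ):ℝ) := by push_cast; linarith
          have := le_self_pow₀ this (n := m+2) (by omega)
          push_cast at this ⊢; exact this
        have : (12:ℝ) * (m+2) ≤ 6^(m+2) * ((m+2:ℕ):ℝ)^(m+2) := mul_le_mul h6 h7 (by positivity) (by positivity)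
        linarith
      have e : (n:ℝ) ^ (1 - phi (m+1)) = n * (n:ℝ) ^ (-phi (m+1)) := by
        rw [sub_eq_add_neg, Real.rpow_add hn0, Real.rpow_one]
      have hy : 0 ≤ (n:ℝ) ^ (-phi (m+1)) := by positivity
      have h8 : 48 * ((m:ℝ)+2) * (n:ℝ) ^ (-phi (m+1)) ≤ 1 := (mul_le_mul_of_nonneg_right hC hy).trans hq
      have h9 : 48 * ((m:ℝ)+2) * (n:ℝ) ^ (1 - phi (m+1)) ≤ n := by
        rw [e]; nlinarith
      have h10 : (⌈(n:ℝ) ^ (1 - phi (m+1))⌉₊:ℝ) ≤ 2 * (n:ℝ) ^ (1 - phi (m+1)) := by linarith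
      have h11 : ((m:ℝ)+2) * ⌈(n:ℝ) ^ (1 - phi (m+1))⌉₊ ≤ (m+2) * (2 * (n:ℝ) ^ (1 - phi (m+1))) := mul_le_mul_of_nonneg_left h10 (by positivity)
      linarith
    · rw [Fintype.card_fin]
      push_cast
      linarith


theorem factor_mono {n r : ℕ} {G G' : SimpleGraph (Fin n)} (h : G ≤ G') (hG : HasCliqueFactor G r) : HasCliqueFactor G' r := by
  obtain ⟨P, hP⟩ := hG
  exact ⟨P, fun c hc => (hP c hc).mono h⟩

theorem PB_mono_p {α : Type} [DecidableEq α] {E : Finset α} {p p' : ℝ} (h0 : 0 ≤ p) (hpp : p ≤ p') (h1 : p' ≤ 1)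
    {A : Finset α → Prop} (hA : ∀ W W', W ⊆ W' → A W → A W') : PB E p A ≤ PB E p' A := by
  have := PB_anti_p (E := E) (A := fun W => ¬ A W) h0 hpp h1 (fun W W' h hn h' => hn (hA W W' h h'))
  rw [PB_compl, PB_compl] at this
  linarith

theorem two_round {α : Type} [DecidableEq α] {E : Finset α} {p δ₁ δ₂ : ℝ} (h0 : 0 ≤ p) (h1 : p ≤ 1) (hδ : 0 ≤ δ₁) (hδ₂ : 0 ≤ δ₂) (hδ1 : δ₂ ≤ 1)
    (P Q : Finset α → Prop) (hQ : ∀ W W', W ⊆ W' → Q W → Q W') (hP : 1 - δ₁ ≤ PB E (p/2) P)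
    (hPQ : ∀ W ⊆ E, P W → 1 - δ₂ ≤ PB E (p/2) (fun W' => Q (W ∪ W'))) : 1 - δ₁ - δ₂ ≤ PB E p Q := by
  have hp0 : 0 ≤ p/2 := by linarith
  have hp1 : p/2 ≤ 1 := by linarith
  have h2 := BE_union E (p/2) (p/2) (fun W => if Q W then 1 else 0)
  have h3 : BE E (p/2) (fun W => (1 - δ₂) * (if P W then 1 else 0)) ≤
      BE E (p/2) (fun W₁ => BE E (p/2) (fun W₂ => if Q (W₁ ∪ W₂) then 1 else 0)) := by
    apply BE_mono hp0 hp1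
    intro W hW
    by_cases h : P W
    · rw [if_pos h, mul_one]; exact hPQ W hW h
    · rw [if_neg h, mul_zero]; exact PB_nonneg hp0 hp1 (fun W' => Q (W ∪ W'))
  rw [h2, BE_smul] at h3
  have h4 : PB E (p/2 + p/2 - p/2 * (p/2)) Q ≤ PB E p Q :=
    PB_mono_p (by nlinarith) (by nlinarith) h1 hQ
  have h5 : (1 - δ₂) * PB E (p/2) P ≤ PB E p Q := h3.trans h4
  have h6 : (1 - δ₂) * (1 - δ₁) ≤ (1 - δ₂) * PB E (p/2) P := mul_le_mul_of_nonneg_left hP (by linarith)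
  nlinarith

theorem pThr_eq (s n : ℕ) (hs : s ≠ 2) : pThr s n = (n:ℝ) ^ (-phi s) := by
  unfold pThr phi
  rw [if_neg hs, neg_div]

theorem pThr_two (n : ℕ) : pThr 2 n = Real.log n / n := by
  unfold pThr; rw [if_pos rfl]

theorem phi_two : phi 2 = 1 := by unfold phi; norm_num

theorem pThr_nonneg (s n : ℕ) : 0 ≤ pThr s n := by
  by_cases hs : s = 2
  · subst hs; rw [pThr_two]; exact div_nonneg (Real.log_natCast_nonneg n) (Nat.cast_nonneg n)
  · rw [pThr_eq s n hs]; positivity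

theorem pThr_ev (s : ℕ) (hs : 2 ≤ s) (C : ℝ) : ∀ᶠ n : ℕ in Filter.atTop, C * pThr s n ≤ 1 := by
  have hc : Filter.Tendsto (fun n : ℕ => (n:ℝ)) Filter.atTop Filter.atTop := tendsto_natCast_atTop_atTop
  have h : Filter.Tendsto (fun n : ℕ => C * pThr s n) Filter.atTop (nhds (C * 0)) := by
    apply Filter.Tendsto.const_mul
    by_cases h2 : s = 2
    · subst h2
      rw [show pThr 2 = fun n : ℕ => Real.log n / n from funext pThr_two]
      have h1 : Filter.Tendsto (fun x : ℝ => Real.log x / x) Filter.atTop (nhds 0) := Real.isLittleO_log_id_atTop.tendsto_div_nhds_zero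
      exact h1.comp hc
    · have e : pThr s = fun n : ℕ => (n:ℝ) ^ (-phi s) := by
        funext n; exact pThr_eq s n h2
      rw [e]
      obtain ⟨m, rfl⟩ : ∃ m, s = m + 1 := ⟨s - 1, by omega⟩
      exact (tendsto_rpow_neg_atTop (phi_pos m (by omega))).comp hc
  rw [mul_zero] at h
  exact h.eventually_le_const (by norm_num)

/-- the second round probability -/
theorem main_p (s : ℕ) (hs : 2 ≤ s) (A : ℝ) (hA : 0 ≤ A) : ∃ C : ℝ, 0 < C ∧ ∀ᶠ n : ℕ in Filter.atTop,
    100 * (((A+1)^2 / n : ℝ) ^ (2 / (s:ℝ)) * Real.log n) ≤ C * pThr s n := by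
  by_cases h2 : s = 2
  · subst h2
    refine ⟨100 * (A+1)^2, by positivity, Filter.Eventually.of_forall fun n => ?_⟩
    rw [pThr_two]
    have : (2:ℝ) / ((2:ℕ):ℝ) = 1 := by norm_num
    rw [this, Real.rpow_one]
    apply le_of_eq; ring
  · have hs3 : (3:ℝ) ≤ s := by exact_mod_cast (by omega : 3 ≤ s)
    have hgap : 0 < 2 / (s:ℝ) - phi s := by
      unfold phi
      have h1 : (0:ℝ) < (s:ℝ) - 1 := by linarith
      rw [sub_pos, div_lt_div_iff₀ (by positivity) (by positivity)]
      nlinarith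
    set K : ℝ := ((A+1)^2) ^ (2 / (s:ℝ)) with hK
    have hK0 : 0 < K := by positivity
    refine ⟨100 * K, by positivity, ?_⟩
    have hl := (isLittleO_log_rpow_atTop hgap).bound (by norm_num : (0:ℝ) < 1)
    have hl' := (tendsto_natCast_atTop_atTop (R := ℝ)).eventually hl
    filter_upwards [hl', Filter.eventually_ge_atTop 1] with n hn hn1
    have hn0 : (0:ℝ) < n := by exact_mod_cast hn1
    rw [pThr_eq s n h2, Real.div_rpow (by positivity) hn0.le, ← hK]
    have h3 : Real.log n ≤ (n:ℝ) ^ (2 / (s:ℝ) - phi s) := by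
      have h4 := le_trans (le_abs_self _) hn
      rw [one_mul, Real.norm_of_nonneg (by positivity)] at h4
      exact h4
    have h5 : (n:ℝ) ^ (-phi s) = (n:ℝ) ^ (2 / (s:ℝ) - phi s) / (n:ℝ) ^ (2 / (s:ℝ)) := by
      rw [← Real.rpow_sub hn0]; congr 1; ring
    rw [h5]
    have hx : (0:ℝ) < (n:ℝ) ^ (2 / (s:ℝ)) := by positivity
    calc 100 * (K / (n:ℝ) ^ (2 / (s:ℝ)) * Real.log n) = 100 * K * (Real.log n / (n:ℝ) ^ (2 / (s:ℝ))) := by ring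
      _ ≤ _ := mul_le_mul_of_nonneg_left (div_le_div_of_nonneg_right h3 hx.le) (by positivity)

theorem lemS (s : ℕ) (hs : 2 ≤ s) : ∃ C : ℝ, 0 < C ∧ ∀ δ : ℝ, 0 < δ → ∃ n₀ : ℕ, ∀ n : ℕ, n₀ ≤ n →
    ∀ (G : SimpleGraph (Fin n)) (A : Finset (Fin n)) (g p : ℝ) (d : ℕ),
    (n:ℝ)/3 ≤ #A → 1 ≤ d → (d:ℝ) * (s+1) * 24 ≤ n → 48 * (s+1) * g ≤ 1 →
    (∀ v ∈ A, d ≤ dg G A v ∧ (dg G A v : ℝ) ≤ 2 * g * n) →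
    C * pThr s n ≤ p → p ≤ 1 →
    1 - δ ≤ PB (EE n) p (fun W => HasCl (G ⊔ SimpleGraph.fromEdgeSet (W : Set (Sym2 (Fin n)))) A (s+1) d) := by
  by_cases h2 : s = 2
  · subst h2
    have hC := C2_ge 1
    refine ⟨100 * C2 1, by positivity, fun δ hδ => ?_⟩
    obtain ⟨n₀, h⟩ := lemS2 hδ
    refine ⟨n₀, fun n hn G A g p d hA hd hdn hg hdeg hp hp1 => ?_⟩
    refine h n hn G A g p d hA hd (by push_cast at hdn; linarith) (by push_cast at hg; linarith) hdeg ?_ hp1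
    refine le_trans (le_of_eq ?_) hp
    rw [pThr_two, phi_two, Real.rpow_neg_one]; ring
  · obtain ⟨m, rfl⟩ : ∃ m, s = m + 1 := ⟨s - 1, by omega⟩
    have hC := C2_ge m
    refine ⟨16 * ((2 * (m+2) + 1 : ℕ):ℝ) * C2 m, by positivity, fun δ hδ => ?_⟩
    obtain ⟨n₀, h⟩ := lemS3 m (by omega) hδ
    refine ⟨n₀, fun n hn G A g p d hA hd hdn hg hdeg hp hp1 => ?_⟩
    refine h n hn G A g p d hA hd (by push_cast at hdn; linarith) (by push_cast at hg; linarith) hdeg ?_ hp1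
    refine le_trans (le_of_eq ?_) hp
    rw [pThr_eq _ _ h2]; ring

theorem degR_eq {n : ℕ} (G : SimpleGraph (Fin n)) (v : Fin n) : degR G v = dg G univ v := by
  unfold degR dg
  rw [Nat.card_eq_fintype_card, ← Set.toFinset_card]
  congr 1
  ext u
  simp

theorem case_one {n : ℕ} (hn : 2 ∣ n) (G : SimpleGraph (Fin n)) (hG : ∀ u v, u ≠ v → G.Adj u v) : HasCliqueFactor G 2 := by
  obtain ⟨k, rfl⟩ := hn
  set ℓ : Fin (2*k) → ℕ := fun v => v.1 / 2 with hℓ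
  refine ⟨Finpartition.ofSetoid (Setoid.ker ℓ), ?_⟩
  intro c hc
  refine (SimpleGraph.isNClique_iff _).2 ⟨fun x _ y _ hxy => hG x y hxy, ?_⟩
  obtain ⟨v, hv⟩ := (Finpartition.ofSetoid (Setoid.ker ℓ)).nonempty_of_mem_parts hc
  have hv2 := v.2
  have : c = {(⟨2 * (v.1/2), by omega⟩ : Fin (2*k)), ⟨2 * (v.1/2) + 1, by omega⟩} := by
    rw [← (Finpartition.ofSetoid (Setoid.ker ℓ)).part_eq_of_mem hc hv]
    ext u
    rw [Finpartition.mem_part_ofSetoid_iff_rel]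
    change v.1 / 2 = u.1 / 2 ↔ _
    simp only [mem_insert, mem_singleton, Fin.ext_iff]
    omega
  rw [this, card_pair]
  simp [Fin.ext_iff]

theorem PB_one {α : Type} [DecidableEq α] (E : Finset α) (Q : Finset α → Prop) (hQ : Q E) : 1 ≤ PB E 1 Q := by
  unfold PB BE
  have h := single_le_sum (f := fun W => (1:ℝ) ^ (#W) * (1 - 1) ^ (#E - #W) * (if Q W then 1 else 0)) (s := E.powerset)
    (fun W _ => by split_ifs <;> simp) (mem_powerset_self E)
  simp only [if_pos hQ] at h
  simpa using h


theorem nonadj_mono {V : Type} [Fintype V] [DecidableEq V] {G G' : SimpleGraph V} (h : G ≤ G') (X : Finset V) (v : V) :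
    #(X.filter (fun y => ¬ G'.Adj v y)) ≤ #(X.filter (fun y => ¬ G.Adj v y)) := by
  apply card_le_card
  intro y hy
  simp only [mem_filter] at hy ⊢
  exact ⟨hy.1, fun h' => hy.2 (h h')⟩

theorem dg_mono_G {V : Type} [Fintype V] [DecidableEq V] {G G' : SimpleGraph V} (h : G ≤ G') (X : Finset V) (v : V) :
    dg G X v ≤ dg G' X v := by
  apply card_le_card
  intro y hy
  simp only [mem_filter] at hy ⊢
  exact ⟨hy.1, h hy.2⟩

theorem hasCl_zero {n : ℕ} (G : SimpleGraph (Fin n)) (A : Finset (Fin n)) (k : ℕ) : HasCl G A k 0 :=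
  ⟨fun i => i.elim0, fun i => i.elim0, fun i => i.elim0, fun i => i.elim0, fun i => i.elim0⟩

set_option maxHeartbeats 4000000 in
theorem main_two (r s : ℕ) (hs : 2 ≤ s) (hrs : r ≤ 2 * s) (hsr : s < r) :
    ∃ C : ℝ, 0 < C ∧
      ∀ δ : ℝ, 0 < δ → ∃ n₀ : ℕ, ∀ n : ℕ, n₀ ≤ n → r ∣ n →
        ∀ G : SimpleGraph (Fin n),
          (∀ v, (1 - (s : ℝ) / (r : ℝ)) * n ≤ (degR G v : ℝ)) →
          1 - δ ≤ Pr n (C * pThr s n) (fun H => HasCliqueFactor (G ⊔ H) r) := by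
  have hr3 : (3:ℝ) ≤ r := by exact_mod_cast (by omega : 3 ≤ r)
  have hsr' : (s:ℝ) + 1 ≤ r := by exact_mod_cast hsr
  have hs' : (2:ℝ) ≤ s := by exact_mod_cast hs
  have hr2 : (9:ℝ) ≤ (r:ℝ)^2 := by nlinarith
  have hr5 : (r:ℝ) ≤ (r:ℝ)^5 := le_self_pow₀ (by linarith) (by norm_num)
  obtain ⟨g, hg⟩ : ∃ g : ℝ, g = 1 / (160 * r^2) := ⟨_, rfl⟩
  have hg0 : 0 < g := by rw [hg]; positivity
  have hg1 : g * (160 * r^2) ≤ 1 := by rw [hg]; apply le_of_eq; field_simp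
  have hgle : g ≤ 1 := by nlinarith
  obtain ⟨ω, hω⟩ : ∃ ω : ℝ, ω = g / (200000 * r^5) := ⟨_, rfl⟩
  have hω0 : 0 < ω := by rw [hω]; positivity
  have hω1 : ω * (200000 * r^5) ≤ g := by rw [hω]; apply le_of_eq; field_simp
  have hωle : ω ≤ 1 := by nlinarith
  obtain ⟨γ, hγ⟩ : ∃ γ : ℝ, γ = g * ω / 40 := ⟨_, rfl⟩
  have hγ0 : 0 < γ := by rw [hγ]; positivity
  have hγ1 : γ ≤ 1 := by rw [hγ]; nlinarith
  obtain ⟨Ca, hCa, na, hna⟩ := nonext r s hs hsr hrs γ hγ0 hγ1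
  obtain ⟨c, hc⟩ : ∃ c : ℝ, c = (g/4) / (64 * r^2) := ⟨_, rfl⟩
  have hc0 : 0 < c := by rw [hc]; positivity
  obtain ⟨Cb, hCb⟩ : ∃ Cb : ℝ, Cb = ((s + (r - s + 1) : ℕ) : ℝ) / (c ^ ((s+1)*(r - s + 1 + 1)) / 2) + 96 * r^2 := ⟨_, rfl⟩
  have hCb0 : 0 ≤ Cb := by rw [hCb]; positivity
  obtain ⟨Da, hDa, hDa'⟩ := main_p s hs Ca hCa.le
  obtain ⟨Db, hDb, hDb'⟩ := main_p s hs Cb hCb0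
  obtain ⟨Ds, hDs, hDs'⟩ := lemS s hs
  refine ⟨2 * (Da + Db + Ds), by positivity, fun δ hδ => ?_⟩
  obtain ⟨δ', hδ', hδ1, hδ2⟩ : ∃ δ' : ℝ, 0 < δ' ∧ δ' ≤ 1 ∧ 2 * δ' ≤ δ := ⟨min 1 (δ/2), by positivity, min_le_left _ _, by
    have := min_le_right 1 (δ/2); linarith⟩
  obtain ⟨n1, hn1⟩ := main_random hδ'
  obtain ⟨n2, hn2⟩ := hDs' δ' hδ'
  have hcast : Filter.Tendsto (fun n : ℕ => (n:ℝ)) Filter.atTop Filter.atTop := tendsto_natCast_atTop_atTop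
  have hev := (((hDa'.and hDb').and ((pThr_ev s hs (2 * (Da + Db + Ds))).and (Filter.eventually_ge_atTop (max (max n1 n2) (na + 1))))).and
    ((hcast.eventually_ge_atTop ((Ca+1)^2)).and ((hcast.eventually_ge_atTop ((Cb+1)^2)).and
      (hcast.eventually_ge_atTop (2 * ((s + (r - s + 1) : ℕ) : ℝ) ^ 2 / c ^ ((s+1)*(r - s + 1 + 1)))))))
  obtain ⟨n₀, hn₀⟩ := Filter.eventually_atTop.1 hev
  refine ⟨n₀, fun n hn hrn G hG => ?_⟩
  obtain ⟨⟨⟨hpa, hpb⟩, hp1, hnmax⟩, hna1, hnb1, hnc⟩ := hn₀ n hn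
  have hnn1 : n1 ≤ n := le_trans (le_trans (le_max_left _ _) (le_max_left _ _)) hnmax
  have hnn2 : n2 ≤ n := le_trans (le_trans (le_max_right _ _) (le_max_left _ _)) hnmax
  have hnna : na + 1 ≤ n := le_trans (le_max_right _ _) hnmax
  have hn0 : (0:ℝ) < n := by exact_mod_cast (by omega : 0 < n)
  have hpt := pThr_nonneg s n
  set p := 2 * (Da + Db + Ds) * pThr s n with hp
  have hp0 : 0 ≤ p := by positivity
  have hpA : Da * pThr s n ≤ p / 2 := by rw [hp]; nlinarith [mul_nonneg hDb.le hpt, mul_nonneg hDs.le hpt]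
  have hpB : Db * pThr s n ≤ p / 2 := by rw [hp]; nlinarith [mul_nonneg hDa.le hpt, mul_nonneg hDs.le hpt]
  have hpS : Ds * pThr s n ≤ p / 2 := by rw [hp]; nlinarith [mul_nonneg hDb.le hpt, mul_nonneg hDa.le hpt]
  rw [Pr_eq]
  obtain ⟨N, hN⟩ := hrn
  have hnN : (n:ℝ) = r * N := by exact_mod_cast hN
  have hcV : Fintype.card (Fin n) = r * Fintype.card (Fin N) := by simp only [Fintype.card_fin]; exact hN
  have hk : ∀ v, (r - s) * N ≤ dg G univ v := by
    intro v
    have h1 := hG v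
    rw [degR_eq] at h1
    have h2 : (((r - s) * N : ℕ):ℝ) = (1 - (s : ℝ) / (r : ℝ)) * n := by
      rw [hnN]; push_cast [Nat.cast_sub hsr.le]; field_simp
    rw [← h2] at h1
    exact_mod_cast h1
  have hNn : N ≤ n := by rw [hN]; exact Nat.le_mul_of_pos_left N (by omega)
  by_cases hcase : ∀ U : Finset (Fin n), ((s:ℝ) / r - γ) * Fintype.card (Fin n) ≤ #U → γ * (Fintype.card (Fin n) : ℝ)^2 ≤ eG G U U
  · have hsp := hna (Fin n) (Fin N) G (by rw [Fintype.card_fin]; omega) hcV (by rw [Fintype.card_fin]; exact hk) hcase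
    rw [Fintype.card_fin] at hsp
    have h := hn1 n hnn1 (Fin N) G r s _ Ca p (by omega) hCa.le hna1 (by rw [Fintype.card_fin]; exact hNn) hsp
      (by linarith) hp1
    linarith
  · push Not at hcase
    obtain ⟨U, hU1, hU2⟩ := hcase
    rw [Fintype.card_fin] at hU1 hU2
    obtain ⟨A, Z, d1, d2, ho1, ho2, ho3, ho4, ho5, ho6, ho7, ho8⟩ := ext_struct r s hs hsr hrs G N (by rw [Fintype.card_fin]; exact hN) hk n g ω γ (n / (40 * r^2))
      (by rw [Fintype.card_fin]) hn0 hg0 hg1 hω0 hω1 hγ rfl U hU1 hU2.le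
    have hrd : 1 - δ' - δ' ≤ PB (EE n) p (fun W => HasCliqueFactor (G ⊔ SimpleGraph.fromEdgeSet (W : Set (Sym2 (Fin n)))) r) := by
      refine two_round hp0 hp1 hδ'.le hδ'.le hδ1
        (fun W => HasCl (G ⊔ SimpleGraph.fromEdgeSet (W : Set (Sym2 (Fin n)))) A (s+1) d1) _ ?_ ?_ ?_
      · intro W W' hW
        exact factor_mono (sup_le_sup_left (SimpleGraph.fromEdgeSet_mono (by exact_mod_cast hW)) G)
      · by_cases hd1 : d1 = 0
        · subst hd1
          have : PB (EE n) (p/2) (fun _ => True) = 1 := by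
            unfold PB; simp only [if_true]; exact BE_const _ _ _
          have h2 := PB_mono (E := EE n) (p := p/2) (by linarith) (by linarith) (A := fun _ => True)
            (B := fun W => HasCl (G ⊔ SimpleGraph.fromEdgeSet (W : Set (Sym2 (Fin n)))) A (s+1) 0)
            (fun W _ _ => hasCl_zero _ _ _)
          linarith
        · obtain ⟨-, hA3, hdω, hdeg⟩ := ho8 hd1
          refine hn2 n hnn2 G A g (p/2) d1 hA3 (by omega) ?_ ?_ hdeg hpS (by linarith)
          · have h1 : (d1:ℝ) * (s+1) * 24 ≤ (ω * n) * r * 24 := by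
              have : (d1:ℝ) * (s+1) ≤ (ω * n) * r := mul_le_mul hdω hsr' (by positivity) (by positivity)
              linarith
            have h2 : ω * (r * 24) ≤ 1 := by
              have : ω * (r * 24) ≤ ω * (200000 * r^5) := mul_le_mul_of_nonneg_left (by linarith) hω0.le
              linarith
            nlinarith
          · have : 48 * ((s:ℝ)+1) * g ≤ g * (160 * r^2) := by
              have : 48 * ((s:ℝ)+1) ≤ 160 * r^2 := by nlinarith
              nlinarith
            linarith
      · rintro W hW ⟨K, hK1, hK2, hK3, hK4⟩
        set G' := G ⊔ SimpleGraph.fromEdgeSet (W : Set (Sym2 (Fin n))) with hG'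
        have hGG : G ≤ G' := le_sup_left
        have hKA : ∀ i, K i ⊆ A \ Z := by
          intro i v hv
          have hd1 : d1 ≠ 0 := by rintro rfl; exact i.elim0
          have := hK1 i hv
          exact mem_sdiff.2 ⟨this, (ho8 hd1).1 v this⟩
        obtain ⟨root, hroot⟩ := ext1_aux (L := Fin N) r s hs hsr hrs (g/4) (by linarith) (by linarith) G' hcV A Z d1 d2 K (n / (40 * r^2))
          (by positivity) ho1 (by rw [Fintype.card_fin]; exact ho2) (by rw [Fintype.card_fin]; exact ho3)
          (by rw [Fintype.card_fin]; apply le_of_eq; field_simp)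
          (fun v hv => le_trans (by exact_mod_cast nonadj_mono hGG _ v) (ho4 v hv))
          (fun v hv => le_trans (by exact_mod_cast nonadj_mono hGG _ v) (ho5 v hv))
          (fun z h1 h2 => by rw [Fintype.card_fin]; exact le_trans (ho6 z h1 h2) (by exact_mod_cast dg_mono_G hGG _ z))
          (fun z h1 h2 => by rw [Fintype.card_fin]; exact le_trans (ho7 z h1 h2) (by exact_mod_cast dg_mono_G hGG _ z))
          hKA hK2 hK3 hK4 c hc (by rw [Fintype.card_fin]; omega) (by rw [Fintype.card_fin]; exact hnc)
        rw [← hCb, Fintype.card_fin] at hroot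
        have h := hn1 n hnn1 (Fin N) G' r s root Cb (p/2) (by omega) hCb0 hnb1 (by rw [Fintype.card_fin]; exact hNn) hroot
          (by linarith) (by linarith)
        refine h.trans (PB_mono (by linarith) (by linarith) fun W' _ => ?_)
        refine factor_mono ?_
        rw [hG', sup_assoc, ← SimpleGraph.fromEdgeSet_union]
        refine sup_le_sup_left (SimpleGraph.fromEdgeSet_mono ?_) G
        push_cast; exact le_rfl
    linarith

theorem statement0 (r s : ℕ) (hrs : r ≤ 2 * s) (hsr : s < r) :
    ∃ C : ℝ, 0 < C ∧
      ∀ δ : ℝ, 0 < δ → ∃ n₀ : ℕ, ∀ n : ℕ, n₀ ≤ n → r ∣ n →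
        ∀ G : SimpleGraph (Fin n),
          (∀ v, (1 - (s : ℝ) / (r : ℝ)) * n ≤ (degR G v : ℝ)) →
          1 - δ ≤ Pr n (C * pThr s n) (fun H => HasCliqueFactor (G ⊔ H) r) := by
  by_cases hs : 2 ≤ s
  · exact main_two r s hs hrs hsr
  · have hs1 : s = 1 := by omega
    have hr2 : r = 2 := by omega
    subst hs1 hr2
    refine ⟨1, one_pos, fun δ hδ => ⟨0, fun n _ hn G _ => ?_⟩⟩
    have hp : (1:ℝ) * pThr 1 n = 1 := by
      rw [pThr_eq 1 n (by norm_num)]; unfold phi; norm_num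
    rw [hp, Pr_eq]
    have := PB_one (EE n) (fun W => HasCliqueFactor (G ⊔ SimpleGraph.fromEdgeSet (W : Set (Sym2 (Fin n)))) 2) (by
      refine case_one hn _ fun u v huv => ?_
      rw [SimpleGraph.sup_adj, SimpleGraph.fromEdgeSet_adj]
      right
      refine ⟨?_, huv⟩
      unfold EE
      simpa using huv)
    linarith
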